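/- There is a universal constant M such that sup_{0≤t≤T} σ(t)∫_{ℝ²}|∇u(x,t)|²dx + ∫₀ᵀ∫_{ℝ²}σ(t)|u̇|²dxdt ≤ M(ε₀ + ∫₀ᵀ∫_{ℝ²}σ(t)²|∇u|⁴dxdt). -/

import Mathlib

open MeasureTheory Filter

noncomputable section

/-- Points/vectors in the plane, with Lebesgue measure. -/
abbrev V : Type := Fin 2 → ℝ

/-- 2×2 real matrices realized as nested functions. -/
abbrev M2 : Type := Fin 2 → Fin 2 → ℝ

/-- Partial derivative in the `i`-th coordinate direction. -/
def pd (i : Fin 2) (f : V → ℝ) (x : V) : ℝ :=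
  fderiv ℝ f x (Pi.single i 1)

/-- Laplacian of a scalar field. -/
def lap (f : V → ℝ) (x : V) : ℝ := ∑ i, pd i (pd i f) x

/-- Spatial gradient of a vector field: `(∇u)_{ij} = ∂_j u_i`. -/
def gradU (u : V → V) (x : V) : M2 := fun i j => pd j (fun y => u y i) x

/-- Divergence of a vector field. -/
def divV (u : V → V) (x : V) : ℝ := ∑ i, pd i (fun y => u y i) x

/-- Squared Frobenius norm of a 2×2 matrix. -/
def nsq (A : M2) : ℝ := ∑ i, ∑ j, (A i j) ^ 2

/-- Squared Euclidean norm of a vector in the plane. -/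
def vnsq (v : V) : ℝ := ∑ i, (v i) ^ 2

/-- The identity matrix. -/
def idM : M2 := fun i j => if i = j then 1 else 0

/-- The weight `σ(t) = min{1,t}`. -/
def sg (t : ℝ) : ℝ := min 1 t

/-- The material derivative `u̇ = ∂ₜ u + (u·∇)u`. -/
def mdot (u : ℝ → V → V) (t : ℝ) (x : V) : V :=
  fun i => deriv (fun s => u s x i) t + ∑ j, u t x j * pd j (fun y => u t y i) x

/-- `ε₀ = ‖F₀ − I‖²_{L^∞} + ∫ (|F₀ − I|² + |u₀|²)(1+|x|²) dx`. -/
def eps0 (u0 : V → V) (F0 : V → M2) : ℝ :=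
  (⨆ x : V, nsq (F0 x - idM)) +
    ∫ x : V, (nsq (F0 x - idM) + vnsq (u0 x)) * (1 + vnsq x)

/-- The incompressible viscoelastic system on the time interval `[0,T]`:
momentum equation, deformation-gradient transport equation, and `div u = 0`. -/
def IsSolution (u : ℝ → V → V) (F : ℝ → V → M2) (P : ℝ → V → ℝ) (T : ℝ) : Prop :=
  (∀ t ∈ Set.Icc (0:ℝ) T, ∀ (x : V) (i : Fin 2),
      deriv (fun s => u s x i) t + (∑ j, u t x j * pd j (fun y => u t y i) x)
        - lap (fun y => u t y i) x + pd i (P t) x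
        = ∑ j, pd j (fun y => ∑ k, F t y i k * F t y j k) x) ∧
  (∀ t ∈ Set.Icc (0:ℝ) T, ∀ (x : V) (i j : Fin 2),
      deriv (fun s => F s x i j) t + (∑ k, u t x k * pd k (fun y => F t y i j) x)
        = ∑ k, pd k (fun y => u t y i) x * F t x k j) ∧
  (∀ t ∈ Set.Icc (0:ℝ) T, ∀ x : V, divV (u t) x = 0)

/-- The quantity `A(T)` (with `w = 𝒫u̇` the Leray projection of the material
derivative, given as a separate argument). -/
def Afun (u : ℝ → V → V) (F : ℝ → V → M2) (w : ℝ → V → V) (T : ℝ) : ℝ :=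
  (⨆ t ∈ Set.Icc (0:ℝ) T, ∫ x : V,
      (vnsq (u t x) + nsq (F t x - idM) + sg t * nsq (gradU (u t) x)
        + (sg t) ^ 2 * vnsq (w t x))) +
  ∫ t in Set.Ioc (0:ℝ) T, ∫ x : V,
      (nsq (gradU (u t) x) + sg t * vnsq (mdot u t x)
        + (sg t) ^ 2 * nsq (gradU (w t) x))

/-- The quantity `B(T) = ‖F − I‖²_{L^∞(ℝ²×[0,T])}`. -/
def Bfun (F : ℝ → V → M2) (T : ℝ) : ℝ :=
  ⨆ t ∈ Set.Icc (0:ℝ) T, ⨆ x : V, nsq (F t x - idM)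


abbrev Sm (f : V → ℝ) : Prop := ContDiff ℝ (⊤ : ℕ∞) f

theorem Sm.diff {f : V → ℝ} (hf : Sm f) : Differentiable ℝ f :=
  ContDiff.differentiable hf (by simp)

theorem Sm.pd {f : V → ℝ} (hf : Sm f) (i : Fin 2) : Sm (pd i f) := by
  have : ContDiff ℝ (⊤ : ℕ∞) (fderiv ℝ f) := hf.fderiv_right (by simp)
  exact this.clm_apply contDiff_const

section PdRules
variable {f g : V → ℝ} (i j : Fin 2)

theorem pd_add (hf : Differentiable ℝ f) (hg : Differentiable ℝ g) :
    pd i (fun x => f x + g x) = fun x => pd i f x + pd i g x := by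
  funext x
  simp only [pd]
  rw [fderiv_fun_add (hf x) (hg x)]; simp

theorem pd_sub (hf : Differentiable ℝ f) (hg : Differentiable ℝ g) :
    pd i (fun x => f x - g x) = fun x => pd i f x - pd i g x := by
  funext x
  simp only [pd]
  rw [fderiv_fun_sub (hf x) (hg x)]; simp

theorem pd_mul (hf : Differentiable ℝ f) (hg : Differentiable ℝ g) :
    pd i (fun x => f x * g x) = fun x => pd i f x * g x + f x * pd i g x := by
  funext x
  simp only [pd]
  rw [fderiv_fun_mul (hf x) (hg x)]; simp; ring

theorem pd_neg : pd i (fun x => - f x) = fun x => - pd i f x := by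
  funext x
  simp only [pd]
  rw [fderiv_fun_neg]; simp

theorem pd_const (c : ℝ) : pd i (fun _ => c) = fun _ => 0 := by
  funext x; simp [pd]

theorem pd_const_mul (c : ℝ) (hf : Differentiable ℝ f) :
    pd i (fun x => c * f x) = fun x => c * pd i f x := by
  rw [pd_mul i (differentiable_const c) hf, pd_const]; simp

theorem pd_sq (hf : Differentiable ℝ f) :
    pd i (fun x => f x ^ 2) = fun x => 2 * f x * pd i f x := by
  simp only [pow_two]
  rw [pd_mul i hf hf]; funext x; ring

theorem pd_sum {ι : Type*} (s : Finset ι) {F : ι → V → ℝ} (h : ∀ k ∈ s, Differentiable ℝ (F k)) :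
    pd i (fun x => ∑ k ∈ s, F k x) = fun x => ∑ k ∈ s, pd i (F k) x := by
  funext x
  simp only [pd]
  rw [fderiv_fun_sum (fun k hk => h k hk x)]; simp

theorem pd_comm (hf : Sm f) : pd i (pd j f) = pd j (pd i f) := by
  funext x
  have hd : DifferentiableAt ℝ (fderiv ℝ f) x :=
    (hf.fderiv_right (m := (⊤ : ℕ∞)) (by simp)).differentiable (by simp) x
  have key : ∀ k l : Fin 2, pd k (pd l f) x
      = fderiv ℝ (fderiv ℝ f) x (Pi.single k 1) (Pi.single l 1) := by
    intro k l
    have : pd l f = fun y => fderiv ℝ f y (Pi.single l 1) := rfl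
    rw [this]
    simp only [pd]
    rw [fderiv_clm_apply hd (differentiableAt_const _)]
    simp
  rw [key, key]
  have hs : IsSymmSndFDerivAt ℝ f x :=
    (hf.contDiffAt).isSymmSndFDerivAt (by simp only [minSmoothness_of_isRCLikeNormedField]; exact WithTop.coe_le_coe.2 (le_top (a := (2 : ℕ∞))))
  exact hs _ _

theorem pd_affine (hf : Differentiable ℝ f) (x : V) (l : ℝ) :
    pd i (fun z => f (x + l • z)) = fun z => l * pd i f (x + l • z) := by
  funext z
  simp only [pd]
  have h1 : HasFDerivAt (fun z : V => x + l • z) (l • ContinuousLinearMap.id ℝ V) z := by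
    have := ((hasFDerivAt_id (𝕜 := ℝ) z).const_smul l).const_add x
    exact this
  have h2 := ((hf (x + l • z)).hasFDerivAt).comp z h1
  have h3 := h2.fderiv
  simp only [Function.comp_def] at h3
  rw [h3]; simp

theorem fderiv_apply_eq_sum (f : V → ℝ) (x v : V) :
    fderiv ℝ f x v = ∑ k, v k * pd k f x := by
  conv_lhs => rw [← Finset.univ_sum_single v]
  rw [map_sum]
  refine Finset.sum_congr rfl fun k _ => ?_
  have : (Pi.single k (v k) : V) = v k • Pi.single k (1:ℝ) := by
    rw [← Pi.single_smul]; simp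
  rw [this, map_smul]; rfl

end PdRules

theorem integral_pd_eq_zero {f : V → ℝ} (i : Fin 2) (hf : Differentiable ℝ f)
    (h : Integrable f) (h' : Integrable (pd i f)) : ∫ x, pd i f x = 0 := by
  have := integral_mul_fderiv_eq_neg_fderiv_mul_of_integrable (𝕜 := ℝ) (μ := (volume : Measure V))
    (f := fun _ : V => (1:ℝ)) (g := f) (v := Pi.single i 1)
    (by simp) (by simp only [one_mul]; exact h') (by simpa using h)
    (fun x _ => differentiableAt_const _) (fun x _ => hf x)
  simpa [pd] using this

theorem integral_mul_pd {f g : V → ℝ} (i : Fin 2) (hf : Differentiable ℝ f)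
    (hg : Differentiable ℝ g) (h : Integrable fun x => f x * g x)
    (h1 : Integrable fun x => pd i f x * g x) (h2 : Integrable fun x => f x * pd i g x) :
    ∫ x, f x * pd i g x = - ∫ x, pd i f x * g x := by
  have h0 := integral_pd_eq_zero i (hf.mul hg) h (by
    have := pd_mul i hf hg
    rw [show (f * g) = fun x => f x * g x from rfl, this]; exact h1.add h2)
  rw [show (f * g) = fun x => f x * g x from rfl, pd_mul i hf hg, integral_add h1 h2] at h0
  linarith

/-- Cauchy–Schwarz for square-integrable real functions. -/
theorem integral_mul_le_sqrt {α : Type*} [MeasurableSpace α] {μ : Measure α} {f g : α → ℝ}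
    (hf : AEStronglyMeasurable f μ) (hg : AEStronglyMeasurable g μ)
    (hf2 : Integrable (fun x => f x ^ 2) μ) (hg2 : Integrable (fun x => g x ^ 2) μ) :
    Integrable (fun x => f x * g x) μ ∧
      ∫ x, |f x * g x| ∂μ ≤ √(∫ x, f x ^ 2 ∂μ) * √(∫ x, g x ^ 2 ∂μ) := by
  have hF : MemLp f 2 μ := (memLp_two_iff_integrable_sq hf).2 hf2
  have hG : MemLp g 2 μ := (memLp_two_iff_integrable_sq hg).2 hg2
  refine ⟨hF.integrable_mul hG, ?_⟩
  have := integral_mul_norm_le_Lp_mul_Lq (μ := μ) (f := f) (g := g) Real.HolderConjugate.two_two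
    (by simpa using hF) (by simpa using hG)
  simp only [Real.norm_eq_abs] at this
  simp only [abs_mul, Real.sqrt_eq_rpow]
  convert this using 4 <;> · ext x; simp

theorem abs_integral_mul_le_sqrt {α : Type*} [MeasurableSpace α] {μ : Measure α} {f g : α → ℝ}
    (hf : AEStronglyMeasurable f μ) (hg : AEStronglyMeasurable g μ)
    (hf2 : Integrable (fun x => f x ^ 2) μ) (hg2 : Integrable (fun x => g x ^ 2) μ) :
    |∫ x, f x * g x ∂μ| ≤ √(∫ x, f x ^ 2 ∂μ) * √(∫ x, g x ^ 2 ∂μ) :=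
  (abs_integral_le_integral_abs).trans (integral_mul_le_sqrt hf hg hf2 hg2).2

/-- Bounded and integrable functions. -/
def BI (f : V → ℝ) : Prop := (∃ C, ∀ x, |f x| ≤ C) ∧ Integrable f

/-- All partial derivatives up to order `n` are bounded and integrable. -/
def BIder : ℕ → (V → ℝ) → Prop
  | 0, f => BI f
  | n + 1, f => BI f ∧ ∀ i, BIder n (pd i f)

/-- Smooth functions all of whose partial derivatives are bounded and integrable. -/
structure Nice (f : V → ℝ) : Prop where
  sm : Sm f
  der : ∀ n, BIder n f

theorem BI.add {f g : V → ℝ} (hf : BI f) (hg : BI g) : BI (fun x => f x + g x) := by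
  obtain ⟨⟨C, hC⟩, hi⟩ := hf
  obtain ⟨⟨D, hD⟩, hj⟩ := hg
  exact ⟨⟨C + D, fun x => (abs_add_le _ _).trans (add_le_add (hC x) (hD x))⟩, hi.add hj⟩

theorem BI.mul {f g : V → ℝ} (hf : BI f) (hg : BI g) : BI (fun x => f x * g x) := by
  obtain ⟨⟨C, hC⟩, hi⟩ := hf
  obtain ⟨⟨D, hD⟩, hj⟩ := hg
  refine ⟨⟨C * D, fun x => ?_⟩, hj.bdd_mul (c := C) hi.aestronglyMeasurable (ae_of_all _ hC)⟩
  rw [abs_mul]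
  exact mul_le_mul (hC x) (hD x) (abs_nonneg _) ((abs_nonneg _).trans (hC x))

theorem BIder.pred {n : ℕ} : ∀ {f : V → ℝ}, BIder (n + 1) f → BIder n f := by
  induction n with
  | zero => intro f h; exact h.1
  | succ n ih => intro f h; exact ⟨h.1, fun i => ih (h.2 i)⟩

theorem BIder.add {n : ℕ} : ∀ {f g : V → ℝ}, Sm f → Sm g → BIder n f → BIder n g →
    BIder n (fun x => f x + g x) := by
  induction n with
  | zero => intro f g _ _ h h'; exact BI.add h h'
  | succ n ih =>
    intro f g hf hg h h'
    refine ⟨BI.add h.1 h'.1, fun i => ?_⟩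
    rw [pd_add i hf.diff hg.diff]
    exact ih (hf.pd i) (hg.pd i) (h.2 i) (h'.2 i)

theorem BIder.mul {n : ℕ} : ∀ {f g : V → ℝ}, Sm f → Sm g → BIder n f → BIder n g →
    BIder n (fun x => f x * g x) := by
  induction n with
  | zero => intro f g _ _ h h'; exact BI.mul h h'
  | succ n ih =>
    intro f g hf hg h h'
    refine ⟨BI.mul h.1 h'.1, fun i => ?_⟩
    rw [pd_mul i hf.diff hg.diff]
    exact BIder.add ((hf.pd i).mul hg) (hf.mul (hg.pd i))
      (ih (hf.pd i) hg (h.2 i) h'.pred) (ih hf (hg.pd i) h.pred (h'.2 i))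

theorem BIder.const_mul {n : ℕ} (c : ℝ) : ∀ {f : V → ℝ}, Sm f → BIder n f →
    BIder n (fun x => c * f x) := by
  have hb : ∀ {f : V → ℝ}, BI f → BI (fun x => c * f x) := by
    rintro f ⟨⟨C, hC⟩, hi⟩
    exact ⟨⟨|c| * C, fun x => by rw [abs_mul]; gcongr; exact hC x⟩, hi.const_mul c⟩
  induction n with
  | zero => intro f _ h; exact hb h
  | succ n ih =>
    intro f hf h
    refine ⟨hb h.1, fun i => ?_⟩
    rw [pd_const_mul i c hf.diff]
    exact ih (hf.pd i) (h.2 i)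

namespace Nice
variable {f g : V → ℝ}

theorem bi (h : Nice f) : BI f := h.der 0
theorem int (h : Nice f) : Integrable f := h.bi.2
theorem bdd (h : Nice f) : ∃ C, ∀ x, |f x| ≤ C := h.bi.1
theorem diff (h : Nice f) : Differentiable ℝ f := h.sm.diff
theorem cont (h : Nice f) : Continuous f := h.diff.continuous
protected theorem pd (h : Nice f) (i : Fin 2) : Nice (pd i f) :=
  ⟨h.sm.pd i, fun n => (h.der (n + 1)).2 i⟩
protected theorem add (h : Nice f) (h' : Nice g) : Nice (fun x => f x + g x) :=
  ⟨h.sm.add h'.sm, fun n => BIder.add h.sm h'.sm (h.der n) (h'.der n)⟩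
protected theorem mul (h : Nice f) (h' : Nice g) : Nice (fun x => f x * g x) :=
  ⟨h.sm.mul h'.sm, fun n => BIder.mul h.sm h'.sm (h.der n) (h'.der n)⟩
protected theorem const_mul (h : Nice f) (c : ℝ) : Nice (fun x => c * f x) :=
  ⟨contDiff_const.mul h.sm, fun n => BIder.const_mul c h.sm (h.der n)⟩
protected theorem neg (h : Nice f) : Nice (fun x => - f x) := by
  simpa using h.const_mul (-1)
protected theorem sub (h : Nice f) (h' : Nice g) : Nice (fun x => f x - g x) := by
  simpa [sub_eq_add_neg] using h.add h'.neg
protected theorem lap (h : Nice f) : Nice (lap f) := by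
  have : lap f = fun x => pd 0 (pd 0 f) x + pd 1 (pd 1 f) x := by
    funext x; simp [_root_.lap, Fin.sum_univ_two]
  rw [this]
  exact ((h.pd 0).pd 0).add ((h.pd 1).pd 1)

theorem sq_int (h : Nice f) : Integrable (fun x => f x ^ 2) := by
  simpa [pow_two] using (h.mul h).int

theorem integral_mul_pd (h : Nice f) (h' : Nice g) (i : Fin 2) :
    ∫ x, f x * _root_.pd i g x = - ∫ x, _root_.pd i f x * g x :=
  _root_.integral_mul_pd i h.diff h'.diff (h.mul h').int ((h.pd i).mul h').int (h.mul (h'.pd i)).int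

end Nice

theorem hasCompactSupport_pd {f : V → ℝ} (hf : HasCompactSupport f) (i : Fin 2) :
    HasCompactSupport (pd i f) := hf.fderiv_apply (𝕜 := ℝ) (v := (Pi.single i 1 : V))

theorem Nice.of_compact {f : V → ℝ} (hs : Sm f) (hc : HasCompactSupport f) : Nice f := by
  have hb : ∀ f : V → ℝ, Sm f → HasCompactSupport f → BI f := fun f hs hc =>
    ⟨by simpa using hc.exists_bound_of_continuous hs.diff.continuous,
      hs.diff.continuous.integrable_of_hasCompactSupport hc⟩
  refine ⟨hs, fun n => ?_⟩
  induction n generalizing f with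
  | zero => exact hb f hs hc
  | succ n ih => exact ⟨hb f hs hc, fun i => ih (hs.pd i) (hasCompactSupport_pd hc i)⟩

/-- Averaging a function against the translates of a measure. -/
def cv (μ : Measure V) (f : V → ℝ) (x : V) : ℝ := ∫ y, f (x + y) ∂μ

theorem cv_const_mul (μ : Measure V) {f : V → ℝ} (c : ℝ) : cv μ (fun x => c * f x) = fun x => c * cv μ f x := by
  funext x
  exact integral_const_mul _ _

section cv
variable (μ : Measure V) [IsFiniteMeasure μ] {f g : V → ℝ}

theorem integrable_shift (hc : Continuous f) (hb : ∃ C, ∀ x, |f x| ≤ C) (x : V) :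
    Integrable (fun y => f (x + y)) μ := by
  obtain ⟨C, hC⟩ := hb
  exact Integrable.of_bound (by fun_prop) C (ae_of_all _ fun y => hC _)

theorem abs_cv_le {C : ℝ} (hC : ∀ x, |f x| ≤ C) (x : V) : |cv μ f x| ≤ C * μ.real Set.univ := by
  exact norm_integral_le_of_norm_le_const (f := fun y => f (x + y)) (ae_of_all _ fun y => hC _)

theorem cv_add (hf : Nice f) (hg : Nice g) :
    cv μ (fun x => f x + g x) = fun x => cv μ f x + cv μ g x := by
  funext x
  exact integral_add (integrable_shift μ hf.cont hf.bdd x) (integrable_shift μ hg.cont hg.bdd x)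

theorem cv_sub (hf : Nice f) (hg : Nice g) :
    cv μ (fun x => f x - g x) = fun x => cv μ f x - cv μ g x := by
  funext x
  exact integral_sub (integrable_shift μ hf.cont hf.bdd x) (integrable_shift μ hg.cont hg.bdd x)

theorem integrable_prod_shift (hc : Continuous f) (hf : Integrable f) :
    Integrable (fun p : V × V => f (p.1 + p.2)) ((volume : Measure V).prod μ) := by
  rw [integrable_prod_iff' (by fun_prop)]
  refine ⟨ae_of_all _ fun y => hf.comp_add_right y, ?_⟩
  have : (fun y : V => ∫ x : V, ‖f (x + y)‖) = fun _ => ∫ x, ‖f x‖ := by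
    funext y
    exact integral_add_right_eq_self (fun x => ‖f x‖) y
  simp only [this]
  exact integrable_const _

theorem integrable_cv (hc : Continuous f) (hf : Integrable f) : Integrable (cv μ f) :=
  (integrable_prod_shift μ hc hf).integral_prod_left

theorem integral_abs_cv_le (hc : Continuous f) (hf : Integrable f) :
    ∫ x, |cv μ f x| ≤ μ.real Set.univ * ∫ x, |f x| := by
  have h := integrable_prod_shift μ hc hf
  calc ∫ x, |cv μ f x| ≤ ∫ x, ∫ y, |f (x + y)| ∂μ := by
        refine integral_mono (integrable_cv μ hc hf).abs h.norm.integral_prod_left fun x => ?_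
        exact abs_integral_le_integral_abs
    _ = ∫ y, (∫ x, |f (x + y)|) ∂μ := integral_integral_swap h.norm
    _ = μ.real Set.univ * ∫ x, |f x| := by
        have : (fun y : V => ∫ x : V, |f (x + y)|) = fun _ => ∫ x, |f x| := by
          funext y
          exact integral_add_right_eq_self (fun x => |f x|) y
        rw [this]; simp

theorem hasFDerivAt_cv (hf : Nice f) (x : V) :
    HasFDerivAt (cv μ f) (∫ y, fderiv ℝ f (x + y) ∂μ) x := by
  obtain ⟨C0, hC0⟩ := (hf.pd 0).bdd
  obtain ⟨C1, hC1⟩ := (hf.pd 1).bdd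
  have hcd : Continuous (fderiv ℝ f) := hf.sm.continuous_fderiv (by simp)
  refine hasFDerivAt_integral_of_dominated_of_fderiv_le (bound := fun _ => C0 + C1) (s := Set.univ)
    (F' := fun x y => fderiv ℝ f (x + y)) Filter.univ_mem
    (Eventually.of_forall fun x => ?_) (integrable_shift μ hf.cont hf.bdd x) ?_ ?_
    (integrable_const _) ?_
  · exact (integrable_shift μ hf.cont hf.bdd x).aestronglyMeasurable
  · exact Continuous.aestronglyMeasurable (by fun_prop)
  · refine ae_of_all _ fun y z _ => ?_
    have hp : 0 ≤ C0 + C1 := add_nonneg ((abs_nonneg _).trans (hC0 0)) ((abs_nonneg _).trans (hC1 0))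
    refine ContinuousLinearMap.opNorm_le_bound _ hp fun v => ?_
    rw [fderiv_apply_eq_sum, Fin.sum_univ_two]
    have h0 : |v 0| ≤ ‖v‖ := norm_le_pi_norm v 0
    have h1 : |v 1| ≤ ‖v‖ := norm_le_pi_norm v 1
    calc ‖v 0 * pd 0 f (z + y) + v 1 * pd 1 f (z + y)‖
        ≤ |v 0| * |pd 0 f (z + y)| + |v 1| * |pd 1 f (z + y)| := by
          rw [← abs_mul, ← abs_mul]; exact abs_add_le _ _
      _ ≤ ‖v‖ * C0 + ‖v‖ * C1 := by gcongr <;> [exact hC0 _; exact hC1 _]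
      _ = _ := by ring
  · refine ae_of_all _ fun y z _ => ?_
    have h1 : HasFDerivAt (fun z : V => z + y) (ContinuousLinearMap.id ℝ V) z :=
      (hasFDerivAt_id z).add_const y
    have := ((hf.diff (z + y)).hasFDerivAt).comp z h1
    simpa [Function.comp_def] using this

theorem pd_cv (hf : Nice f) (i : Fin 2) : pd i (cv μ f) = cv μ (pd i f) := by
  funext x
  have h := (hasFDerivAt_cv μ hf x).fderiv
  have h_int : Integrable (fun y => fderiv ℝ f (x + y)) μ := by
    obtain ⟨C0, hC0⟩ := (hf.pd 0).bdd
    obtain ⟨C1, hC1⟩ := (hf.pd 1).bdd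
    have hcd : Continuous (fderiv ℝ f) := hf.sm.continuous_fderiv (by simp)
    have hp : 0 ≤ C0 + C1 := add_nonneg ((abs_nonneg _).trans (hC0 0)) ((abs_nonneg _).trans (hC1 0))
    refine Integrable.of_bound (Continuous.aestronglyMeasurable (by fun_prop)) (C0 + C1)
      (ae_of_all _ fun y => ?_)
    refine ContinuousLinearMap.opNorm_le_bound _ hp fun v => ?_
    rw [fderiv_apply_eq_sum, Fin.sum_univ_two]
    have h0 : |v 0| ≤ ‖v‖ := norm_le_pi_norm v 0
    have h1 : |v 1| ≤ ‖v‖ := norm_le_pi_norm v 1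
    calc ‖v 0 * pd 0 f (x + y) + v 1 * pd 1 f (x + y)‖
        ≤ |v 0| * |pd 0 f (x + y)| + |v 1| * |pd 1 f (x + y)| := by
          rw [← abs_mul, ← abs_mul]; exact abs_add_le _ _
      _ ≤ ‖v‖ * C0 + ‖v‖ * C1 := by gcongr <;> [exact hC0 _; exact hC1 _]
      _ = _ := by ring
  simp only [pd, cv]
  change fderiv ℝ (cv μ f) x _ = _
  rw [h, ContinuousLinearMap.integral_apply h_int]

theorem Nice.cv (hf : Nice f) : Nice (cv μ f) := by
  have hb : ∀ f, Nice f → BI (_root_.cv μ f) := fun f hf => by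
    obtain ⟨C, hC⟩ := hf.bdd
    exact ⟨⟨_, abs_cv_le μ hC⟩, integrable_cv μ hf.cont hf.int⟩
  constructor
  · refine contDiff_infty.2 fun n => ?_
    induction n generalizing f with
    | zero =>
      exact contDiff_zero.2
        (Differentiable.continuous fun x => (hasFDerivAt_cv μ hf x).differentiableAt)
    | succ n ih =>
      have hs := contDiff_succ_iff_fderiv (𝕜 := ℝ) (n := (n : WithTop ℕ∞)) (f := _root_.cv μ f)
      suffices h : ContDiff ℝ n (fderiv ℝ (_root_.cv μ f)) from
        hs.2 ⟨fun x => (hasFDerivAt_cv μ hf x).differentiableAt, fun h => absurd h (by simp), h⟩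
      have : fderiv ℝ (_root_.cv μ f) = fun x => ∑ i : Fin 2,
          _root_.cv μ (_root_.pd i f) x • ContinuousLinearMap.proj (R := ℝ) (φ := fun _ : Fin 2 => ℝ) i := by
        funext x
        ext1 v
        rw [fderiv_apply_eq_sum]
        simp only [_root_.sum_apply, _root_.smul_apply,
          ContinuousLinearMap.proj_apply, smul_eq_mul]
        refine Finset.sum_congr rfl fun k _ => ?_
        rw [pd_cv μ hf k, mul_comm]
      rw [this]
      exact ContDiff.sum fun i _ => (ih (hf.pd i)).smul contDiff_const
  · intro n
    induction n generalizing f with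
    | zero => exact hb f hf
    | succ n ih =>
      refine ⟨hb f hf, fun i => ?_⟩
      rw [pd_cv μ hf]
      exact ih (hf.pd i)

theorem integral_mul_cv [μ.IsNegInvariant] (hf : Nice f) (hg : Nice g) :
    ∫ x, f x * cv μ g x = ∫ x, cv μ f x * g x := by
  obtain ⟨C, hC⟩ := hf.bdd
  obtain ⟨D, hD⟩ := hg.bdd
  have hfc := hf.cont
  have hgc := hg.cont
  have h1 : Integrable (fun p : V × V => f p.1 * g (p.1 + p.2)) ((volume : Measure V).prod μ) :=
    (integrable_prod_shift μ hg.cont hg.int).bdd_mul (c := C)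
      (Continuous.aestronglyMeasurable (by fun_prop)) (ae_of_all _ fun p => hC _)
  have h2 : Integrable (fun p : V × V => f (p.1 + p.2) * g p.1) ((volume : Measure V).prod μ) :=
    (integrable_prod_shift μ hf.cont hf.int).mul_bdd (c := D)
      (Continuous.aestronglyMeasurable (by fun_prop)) (ae_of_all _ fun p => hD _)
  calc ∫ x, f x * cv μ g x = ∫ x, ∫ y, f x * g (x + y) ∂μ := by
        simp only [cv, integral_const_mul]
    _ = ∫ y, (∫ x, f x * g (x + y)) ∂μ := integral_integral_swap h1
    _ = ∫ y, (∫ x, f (x + -y) * g x) ∂μ := by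
        congr 1; funext y
        rw [← integral_add_right_eq_self (fun x => f (x + -y) * g x) y]
        simp
    _ = ∫ y, (∫ x, f (x + y) * g x) ∂μ := by
        exact integral_neg_eq_self (fun y => ∫ x, f (x + y) * g x) μ
    _ = ∫ x, ∫ y, f (x + y) * g x ∂μ := (integral_integral_swap h2).symm
    _ = ∫ x, cv μ f x * g x := by
        simp only [cv, integral_mul_const]

theorem integral_cv_sq_le (hf : Nice f) :
    ∫ x, cv μ f x ^ 2 ≤ μ.real Set.univ ^ 2 * ∫ x, f x ^ 2 := by
  have hc := hf.cont
  have hp : ∀ x, cv μ f x ^ 2 ≤ μ.real Set.univ * cv μ (fun y => f y ^ 2) x := by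
    intro x
    have h2 : Integrable (fun y => f (x + y) ^ 2) μ := by
      have := integrable_shift μ (hf.mul hf).cont (hf.mul hf).bdd x
      simpa [pow_two] using this
    have := abs_integral_mul_le_sqrt (μ := μ) (f := fun _ => (1:ℝ)) (g := fun y => f (x + y))
      (by fun_prop) (by fun_prop) (by simp) h2
    simp only [one_mul, one_pow, integral_const, smul_eq_mul, mul_one] at this
    have h3 := pow_le_pow_left₀ (abs_nonneg _) this 2
    rw [mul_pow, Real.sq_sqrt (by positivity), Real.sq_sqrt (integral_nonneg fun y => by positivity),
      sq_abs] at h3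
    exact h3
  have hff : Nice (fun y => f y ^ 2) := by simpa [pow_two] using hf.mul hf
  have hm := integral_mono (hf.cv μ).sq_int
    ((integrable_cv μ hff.cont hff.int).const_mul (μ.real Set.univ)) hp
  refine hm.trans ?_
  rw [integral_const_mul, pow_two, mul_assoc]
  gcongr
  have := integral_abs_cv_le μ hff.cont hff.int
  simp only [abs_pow, sq_abs] at this
  refine le_trans (integral_mono (integrable_cv μ hff.cont hff.int)
    (integrable_cv μ hff.cont hff.int).abs fun x => le_abs_self _) this

end cv

/-- One-dimensional standard Gaussian density. -/
def gs (t : ℝ) : ℝ := (√(2 * Real.pi))⁻¹ * Real.exp (-(1 / 2) * t ^ 2)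

/-- Monomials times the standard Gaussian density on the plane. -/
def gmono (a : Fin 2 → ℕ) (z : V) : ℝ := ∏ i, (z i ^ a i * gs (z i))

/-- The standard Gaussian density on the plane. -/
def rho (z : V) : ℝ := ∏ i, gs (z i)

theorem gs_pos (t : ℝ) : 0 < gs t := by unfold gs; positivity

theorem integral_gs : ∫ t, gs t = 1 := by
  simp only [gs]
  rw [integral_const_mul, integral_gaussian, inv_mul_eq_one₀ (by positivity)]
  congr 1; ring

theorem integrable_pow_gs (n : ℕ) : Integrable (fun t : ℝ => t ^ n * gs t) := by
  have h := integrable_rpow_mul_exp_neg_mul_sq (b := 1 / 2) (by norm_num) (s := n)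
    (lt_of_lt_of_le (by norm_num) (Nat.cast_nonneg n))
  simp only [Real.rpow_natCast] at h
  refine (h.const_mul (√(2 * Real.pi))⁻¹).congr (ae_of_all _ fun t => ?_)
  simp only [gs]; ring

theorem bdd_pow_gs (n : ℕ) : ∃ C, ∀ t : ℝ, |t ^ n * gs t| ≤ C := by
  refine ⟨(√(2 * Real.pi))⁻¹ * ((n.factorial : ℝ) * Real.exp (1 / 2)), fun t => ?_⟩
  rw [abs_mul, abs_of_pos (gs_pos t), abs_pow, gs, mul_left_comm]
  refine mul_le_mul_of_nonneg_left ?_ (by positivity)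
  have h1 : |t| ^ n ≤ n.factorial * Real.exp |t| := by
    have := Real.pow_div_factorial_le_exp |t| (abs_nonneg t) n
    rwa [div_le_iff₀ (by positivity), mul_comm] at this
  calc |t| ^ n * Real.exp (-(1 / 2) * t ^ 2)
      ≤ (n.factorial * Real.exp |t|) * Real.exp (-(1 / 2) * t ^ 2) := by gcongr
    _ = n.factorial * Real.exp (|t| + -(1 / 2) * t ^ 2) := by rw [Real.exp_add]; ring
    _ ≤ n.factorial * Real.exp (1 / 2) := by
        gcongr
        nlinarith [sq_nonneg (|t| - 1), sq_abs t]

theorem hasDerivAt_pow_gs (n : ℕ) (t : ℝ) :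
    HasDerivAt (fun t : ℝ => t ^ n * gs t) (n * (t ^ (n - 1) * gs t) - t ^ (n + 1) * gs t) t := by
  have h1 : HasDerivAt gs (-t * gs t) t := by
    have := (((hasDerivAt_pow 2 t).const_mul (-(1 / 2 : ℝ))).exp).const_mul (√(2 * Real.pi))⁻¹
    exact this.congr_deriv (by simp only [gs]; ring)
  exact ((hasDerivAt_pow n t).mul h1).congr_deriv (by ring)

theorem contDiff_gs : ContDiff ℝ (⊤ : ℕ∞) gs := by unfold gs; fun_prop

theorem sm_gmono (a : Fin 2 → ℕ) : Sm (gmono a) := by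
  unfold gmono
  refine contDiff_prod fun i _ => ?_
  have : ContDiff ℝ (⊤ : ℕ∞) (fun z : V => z i) := contDiff_apply ℝ ℝ i
  exact (this.pow _).mul (contDiff_gs.comp this)

theorem gmono_eq (a : Fin 2 → ℕ) (z : V) :
    gmono a z = (z 0 ^ a 0 * gs (z 0)) * (z 1 ^ a 1 * gs (z 1)) := by
  simp [gmono, Fin.prod_univ_two]

theorem bi_gmono (a : Fin 2 → ℕ) : BI (gmono a) := by
  constructor
  · obtain ⟨C, hC⟩ := bdd_pow_gs (a 0)
    obtain ⟨D, hD⟩ := bdd_pow_gs (a 1)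
    refine ⟨C * D, fun z => ?_⟩
    rw [gmono_eq, abs_mul]
    exact mul_le_mul (hC _) (hD _) (abs_nonneg _) ((abs_nonneg _).trans (hC 0))
  · exact Integrable.fintype_prod (f := fun i t => t ^ a i * gs t) fun i => integrable_pow_gs (a i)

theorem pd_coord (i k : Fin 2) (f : ℝ → ℝ) (z : V) (c : ℝ) (hf : HasDerivAt f c (z k)) :
    pd i (fun z => f (z k)) z = if i = k then c else 0 := by
  have h1 : HasFDerivAt (fun z : V => z k)
      (ContinuousLinearMap.proj (R := ℝ) (φ := fun _ : Fin 2 => ℝ) k) z := hasFDerivAt_apply k z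
  have h2 := (hf.hasFDerivAt.comp z h1).fderiv
  simp only [Function.comp_def] at h2
  simp only [pd]
  rw [h2]
  by_cases h : i = k
  · subst h; simp
  · simp [h, Ne.symm h]

theorem pd_gmono (a : Fin 2 → ℕ) (i : Fin 2) : pd i (gmono a) = fun z =>
    a i * gmono (Function.update a i (a i - 1)) z - gmono (Function.update a i (a i + 1)) z := by
  have hs : ∀ k : Fin 2, Differentiable ℝ (fun z : V => z k ^ a k * gs (z k)) := fun k z =>
    (hasDerivAt_pow_gs (a k) (z k)).differentiableAt.comp (f := fun z : V => z k) z
      (differentiableAt_apply k z)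
  have : gmono a = fun z => (z 0 ^ a 0 * gs (z 0)) * (z 1 ^ a 1 * gs (z 1)) := by
    funext z; exact gmono_eq a z
  rw [this, pd_mul i (hs 0) (hs 1)]
  funext z
  rw [pd_coord i 0 (fun t => t ^ a 0 * gs t) z _ (hasDerivAt_pow_gs _ _),
    pd_coord i 1 (fun t => t ^ a 1 * gs t) z _ (hasDerivAt_pow_gs _ _)]
  fin_cases i
  · simp [gmono_eq, Function.update]; ring
  · simp [gmono_eq, Function.update]; ring

theorem BIder.sub {n : ℕ} {f g : V → ℝ} (hf : Sm f) (hg : Sm g) (h : BIder n f) (h' : BIder n g) :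
    BIder n (fun x => f x - g x) := by
  have := BIder.add hf (contDiff_const.mul hg) h (BIder.const_mul (-1) hg h')
  simpa [sub_eq_add_neg] using this

theorem nice_gmono (a : Fin 2 → ℕ) : Nice (gmono a) := by
  refine ⟨sm_gmono a, fun n => ?_⟩
  induction n generalizing a with
  | zero => exact bi_gmono a
  | succ n ih =>
    refine ⟨bi_gmono a, fun i => ?_⟩
    rw [pd_gmono]
    exact BIder.sub (contDiff_const.mul (sm_gmono _)) (sm_gmono _)
      (BIder.const_mul _ (sm_gmono _) (ih _)) (ih _)

theorem rho_eq : rho = gmono 0 := by funext z; simp [rho, gmono]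

theorem nice_rho : Nice rho := rho_eq ▸ nice_gmono 0

theorem rho_pos (z : V) : 0 < rho z := Finset.prod_pos fun _ _ => gs_pos _

theorem integral_rho : ∫ z, rho z = 1 := by
  have := integral_fintype_prod_volume_eq_prod (ι := Fin 2) (fun _ => gs)
  simp only [rho]
  rw [this]; simp [integral_gs]

theorem rho_neg (z : V) : rho (-z) = rho z := by simp [rho, gs]

theorem pd_rho (i : Fin 2) (z : V) : pd i rho z = - (z i * rho z) := by
  rw [rho_eq, pd_gmono]
  fin_cases i <;> simp [gmono_eq, Function.update] <;> ring

/-- Weighted average of `f` at scale `l` around `x`. -/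
def wav (w : V → ℝ) (l : ℝ) (f : V → ℝ) (x : V) : ℝ := ∫ z, f (x + l • z) * w z

/-- The heat evolution at time `l ^ 2 / 2`. -/
abbrev heat (l : ℝ) (f : V → ℝ) (x : V) : ℝ := wav rho l f x

section wav
variable {f w : V → ℝ}

theorem integrable_wav (hf : Nice f) (hw : Integrable w) (l : ℝ) (x : V) :
    Integrable (fun z => f (x + l • z) * w z) := by
  obtain ⟨C, hC⟩ := hf.bdd
  have := hf.cont
  exact hw.bdd_mul (c := C) (Continuous.aestronglyMeasurable (by fun_prop)) (ae_of_all _ fun z => hC _)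

theorem abs_wav_le (hw : Integrable w) {C : ℝ} (hC : ∀ x, |f x| ≤ C) (l : ℝ) (x : V) :
    |wav w l f x| ≤ C * ∫ z, |w z| := by
  rw [← integral_const_mul]
  refine norm_integral_le_of_norm_le (f := fun z => f (x + l • z) * w z) (hw.abs.const_mul C) (ae_of_all _ fun z => ?_)
  rw [Real.norm_eq_abs, abs_mul]
  gcongr
  exact hC _

theorem wav_pd (hf : Nice f) (hw : Nice w) (i : Fin 2) (l : ℝ) (x : V) :
    l * wav w l (pd i f) x = - wav (pd i w) l f x := by
  have hd : Differentiable ℝ (fun z : V => f (x + l • z)) := by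
    have := hf.diff
    fun_prop
  have h := integral_mul_pd (f := w) (g := fun z => f (x + l • z)) i hw.diff hd
    (by simpa only [mul_comm] using integrable_wav hf hw.int l x)
    (by simpa only [mul_comm] using integrable_wav hf (hw.pd i).int l x)
    (by
      rw [pd_affine i hf.diff]
      simpa only [mul_comm, mul_left_comm] using (integrable_wav (hf.pd i) hw.int l x).const_mul l)
  rw [pd_affine i hf.diff] at h
  simp only [wav]
  rw [← integral_const_mul]
  calc _ = ∫ z, w z * (l * pd i f (x + l • z)) := by congr 1; funext z; ring
    _ = _ := h
    _ = _ := by congr 2; funext z; ring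

theorem continuous_wav (hf : Nice f) (hw : Nice w) :
    Continuous (fun p : ℝ × V => wav w p.1 f p.2) := by
  obtain ⟨C, hC⟩ := hf.bdd
  have hfc := hf.cont
  have hwc := hw.cont
  refine continuous_of_dominated (bound := fun z => C * |w z|)
    (fun p => Continuous.aestronglyMeasurable (by fun_prop)) (fun p => ae_of_all _ fun z => ?_)
    (hw.int.abs.const_mul C) (ae_of_all _ fun z => by fun_prop)
  rw [Real.norm_eq_abs, abs_mul]
  gcongr
  exact hC _

theorem hasDerivAt_heat (hf : Nice f) (l : ℝ) (x : V) :
    HasDerivAt (fun l => heat l f x) (l * heat l (lap f) x) l := by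
  obtain ⟨C0, hC0⟩ := (hf.pd 0).bdd
  obtain ⟨C1, hC1⟩ := (hf.pd 1).bdd
  have hfc := hf.cont
  have hrc := nice_rho.cont
  have h0c := (hf.pd 0).cont
  have h1c := (hf.pd 1).cont
  have hr0 := (nice_rho.pd 0).int
  have hr1 := (nice_rho.pd 1).int
  have main := hasDerivAt_integral_of_dominated_loc_of_deriv_le (μ := (volume : Measure V))
    (F := fun l z => f (x + l • z) * rho z)
    (F' := fun l z => -(pd 0 f (x + l • z) * pd 0 rho z) - pd 1 f (x + l • z) * pd 1 rho z)
    (bound := fun z => C0 * |pd 0 rho z| + C1 * |pd 1 rho z|) (x₀ := l) (s := Set.univ)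
    Filter.univ_mem
    (Eventually.of_forall fun l => (integrable_wav hf nice_rho.int l x).aestronglyMeasurable)
    (integrable_wav hf nice_rho.int l x)
    ((integrable_wav (hf.pd 0) hr0 l x).neg.sub
      (integrable_wav (hf.pd 1) hr1 l x)).aestronglyMeasurable
    (ae_of_all _ fun z l _ => by
      rw [Real.norm_eq_abs]
      refine (abs_sub _ _).trans ?_
      rw [abs_neg, abs_mul, abs_mul]
      gcongr
      · exact hC0 _
      · exact hC1 _)
    ((hr0.abs.const_mul C0).add (hr1.abs.const_mul C1))
    (ae_of_all _ fun z l _ => by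
      have h1 : HasDerivAt (fun l : ℝ => x + l • z) z l := by
        simpa using ((hasDerivAt_id l).smul_const z).const_add x
      have h2 := ((hf.diff (x + l • z)).hasFDerivAt.comp_hasDerivAt l h1).mul_const (rho z)
      refine h2.congr_deriv ?_
      rw [fderiv_apply_eq_sum, Fin.sum_univ_two, pd_rho, pd_rho]
      ring)
  refine main.2.congr_deriv ?_
  refine (integral_sub (integrable_wav (hf.pd 0) hr0 l x).neg
    (integrable_wav (hf.pd 1) hr1 l x)).trans ?_
  simp only [Pi.neg_apply]
  rw [integral_neg]
  have e0 := wav_pd (hf.pd 0) nice_rho 0 l x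
  have e1 := wav_pd (hf.pd 1) nice_rho 1 l x
  have e2 : heat l (lap f) x = wav rho l (pd 0 (pd 0 f)) x + wav rho l (pd 1 (pd 1 f)) x := by
    simp only [heat, wav]
    rw [← integral_add (integrable_wav ((hf.pd 0).pd 0) nice_rho.int l x)
      (integrable_wav ((hf.pd 1).pd 1) nice_rho.int l x)]
    congr 1; funext z
    simp [lap, Fin.sum_univ_two]; ring
  rw [e2, mul_add, e0, e1]
  simp only [wav]
  ring

theorem heat_zero : heat 0 f = f := by
  funext x
  simp [heat, wav, integral_const_mul, integral_rho]

theorem abs_heat_le (hf : Nice f) {l : ℝ} (hl : 0 < l) (x : V) :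
    |heat l f x| ≤ (l ^ 2)⁻¹ * ∫ y, |f y| := by
  have hb : ∀ z, rho z ≤ 1 := by
    intro z
    have : ∀ t, gs t ≤ 1 := by
      intro t
      have h1 : (√(2 * Real.pi))⁻¹ ≤ 1 := inv_le_one_of_one_le₀
        (Real.one_le_sqrt.2 (by linarith [Real.pi_gt_three]))
      have h2 : Real.exp (-(1 / 2) * t ^ 2) ≤ 1 := Real.exp_le_one_iff.2 (by nlinarith [sq_nonneg t])
      exact mul_le_one₀ h1 (by positivity) h2
    exact Finset.prod_le_one (fun i _ => (gs_pos _).le) fun i _ => this _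
  have hi : Integrable (fun z : V => |f (x + l • z)|) :=
    ((hf.int.comp_add_left x).comp_smul hl.ne').abs
  calc |heat l f x| ≤ ∫ z, |f (x + l • z)| := by
        refine norm_integral_le_of_norm_le (f := fun z => f (x + l • z) * rho z) hi (ae_of_all _ fun z => ?_)
        rw [Real.norm_eq_abs, abs_mul, abs_of_pos (rho_pos z)]
        exact mul_le_of_le_one_right (abs_nonneg _) (hb z)
    _ = (l ^ 2)⁻¹ * ∫ y, |f (x + y)| := by
        have := Measure.integral_comp_smul (volume : Measure V) (fun y => |f (x + y)|) l
        rw [this]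
        simp
    _ = _ := by rw [integral_add_left_eq_self (fun y => |f y|) x]

end wav

/-- The standard Gaussian measure on the plane. -/
def gauss : Measure V := volume.withDensity fun z => ENNReal.ofReal (rho z)

theorem integral_gauss (f : V → ℝ) : ∫ z, f z ∂gauss = ∫ z, f z * rho z := by
  have hm : Measurable fun z => ENNReal.ofReal (rho z) := nice_rho.cont.measurable.ennreal_ofReal
  rw [gauss, integral_withDensity_eq_integral_toReal_smul hm (ae_of_all _ fun _ => by simp)]
  refine integral_congr_ae (ae_of_all _ fun z => ?_)
  simp [ENNReal.toReal_ofReal (rho_pos z).le, mul_comm]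

instance : IsProbabilityMeasure gauss := by
  constructor
  rw [gauss, withDensity_apply _ MeasurableSet.univ, Measure.restrict_univ,
    ← ofReal_integral_eq_lintegral_ofReal nice_rho.int (ae_of_all _ fun z => (rho_pos z).le),
    integral_rho]
  simp

theorem map_neg_gauss : gauss.map Neg.neg = gauss := by
  ext s hs
  rw [Measure.map_apply measurable_neg hs, gauss, withDensity_apply _ (measurable_neg hs),
    withDensity_apply _ hs, ← lintegral_indicator (measurable_neg hs), ← lintegral_indicator hs,
    ← lintegral_neg_eq_self (μ := (volume : Measure V))]
  refine lintegral_congr fun z => ?_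
  have e : (-z ∈ Neg.neg ⁻¹' s) ↔ z ∈ s := by rw [Set.mem_preimage, neg_neg]
  by_cases hz : z ∈ s
  · rw [Set.indicator_of_mem (e.2 hz), Set.indicator_of_mem hz, rho_neg]
  · rw [Set.indicator_of_notMem (fun h => hz (e.1 h)), Set.indicator_of_notMem hz]

/-- The law of `l • z` for a standard Gaussian `z`. -/
def gam (l : ℝ) : Measure V := gauss.map fun z => l • z

theorem measurable_lsmul (l : ℝ) : Measurable fun z : V => l • z := measurable_const_smul l

instance (l : ℝ) : IsProbabilityMeasure (gam l) :=
  Measure.isProbabilityMeasure_map (measurable_lsmul l).aemeasurable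

theorem cv_gam {f : V → ℝ} (hf : Continuous f) (l : ℝ) : cv (gam l) f = heat l f := by
  funext x
  rw [cv, gam, integral_map (measurable_lsmul l).aemeasurable
    (Continuous.aestronglyMeasurable (by fun_prop)), integral_gauss]
  rfl

/-- The measure `l dl` on `(r, L]`. -/
def scl (r L : ℝ) : Measure ℝ := (volume.restrict (Set.Ioc r L)).withDensity ENNReal.ofReal

theorem integral_scl {r L : ℝ} (hr : 0 ≤ r) (f : ℝ → ℝ) :
    ∫ l, f l ∂(scl r L) = ∫ l in Set.Ioc r L, l * f l := by
  rw [scl, integral_withDensity_eq_integral_toReal_smul (by fun_prop) (ae_of_all _ fun _ => by simp)]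
  refine setIntegral_congr_fun measurableSet_Ioc fun l hl => ?_
  simp [ENNReal.toReal_ofReal (hr.trans hl.1.le)]

instance (r L : ℝ) : IsFiniteMeasure (scl r L) :=
  isFiniteMeasure_withDensity_ofReal
    ((continuous_id.integrableOn_Icc (a := r) (b := L)).mono_set Set.Ioc_subset_Icc_self).2

/-- The law of `l • z` for a standard Gaussian `z` and `l` in `(r, L]` with weight `l dl`. -/
def nu (r L : ℝ) : Measure V := ((scl r L).prod gauss).map fun p => p.1 • p.2

theorem measurable_smul2 : Measurable fun p : ℝ × V => p.1 • p.2 :=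
  measurable_fst.smul measurable_snd

instance (r L : ℝ) : IsFiniteMeasure (nu r L) := by unfold nu; infer_instance

instance (r L : ℝ) : (nu r L).IsNegInvariant := by
  constructor
  have h : (((scl r L).prod gauss).map (Prod.map id Neg.neg)) = (scl r L).prod gauss := by
    rw [← Measure.map_prod_map _ _ measurable_id measurable_neg, map_neg_gauss, Measure.map_id]
  rw [Measure.neg, nu, Measure.map_map measurable_neg measurable_smul2]
  conv_rhs => rw [← h, Measure.map_map measurable_smul2 (measurable_id.prodMap measurable_neg)]
  congr 1
  funext z; simp

theorem cv_nu {f : V → ℝ} (hf : Continuous f) (hb : ∃ C, ∀ x, |f x| ≤ C) {r L : ℝ} (hr : 0 ≤ r)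
    (hL : r ≤ L) (x : V) :
    cv (nu r L) f x = ∫ l in r..L, l * heat l f x := by
  obtain ⟨C, hC⟩ := hb
  rw [cv, nu, integral_map measurable_smul2.aemeasurable
    (Continuous.aestronglyMeasurable (by fun_prop)), integral_prod _ ?_,
    intervalIntegral.integral_of_le hL, integral_scl hr]
  · simp only [integral_gauss]; rfl
  · exact Integrable.of_bound (Continuous.aestronglyMeasurable (by fun_prop)) C
      (ae_of_all _ fun y => hC _)

theorem nu_real {r L : ℝ} (hr : 0 ≤ r) (hL : r ≤ L) : (nu r L).real Set.univ = (L ^ 2 - r ^ 2) / 2 := by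
  have h := cv_nu (f := fun _ => 1) continuous_const ⟨1, fun _ => by simp⟩ hr hL 0
  simp only [cv, integral_const, smul_eq_mul, mul_one] at h
  rw [h]
  simp [heat, wav, integral_rho]

theorem heat_sub_heat {f : V → ℝ} (hf : Nice f) {r L : ℝ} (hr : 0 ≤ r) (hL : r ≤ L) (x : V) :
    heat L f x - heat r f x = cv (nu r L) (lap f) x := by
  rw [cv_nu hf.lap.cont hf.lap.bdd hr hL]
  have hc : Continuous fun l : ℝ => l * heat l (lap f) x :=
    continuous_id.mul ((continuous_wav hf.lap nice_rho).comp (by fun_prop : Continuous fun l : ℝ => (l, x)))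
  exact (intervalIntegral.integral_eq_sub_of_hasDerivAt (fun l _ => hasDerivAt_heat hf l x)
    (hc.intervalIntegrable _ _)).symm

theorem nice_heat {f : V → ℝ} (hf : Nice f) (l : ℝ) : Nice (heat l f) := by
  rw [← cv_gam hf.cont]; exact hf.cv _

theorem pd_heat {f : V → ℝ} (hf : Nice f) (l : ℝ) (i : Fin 2) :
    pd i (heat l f) = heat l (pd i f) := by
  rw [← cv_gam hf.cont, ← cv_gam (hf.pd i).cont, pd_cv _ hf]

theorem integral_abs_heat_le {f : V → ℝ} (hf : Nice f) (l : ℝ) :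
    ∫ x, |heat l f x| ≤ ∫ x, |f x| := by
  rw [← cv_gam hf.cont]
  simpa using integral_abs_cv_le (gam l) hf.cont hf.int

theorem integral_heat_sq_le {f : V → ℝ} (hf : Nice f) (l : ℝ) :
    ∫ x, heat l f x ^ 2 ≤ ∫ x, f x ^ 2 := by
  rw [← cv_gam hf.cont]
  simpa using integral_cv_sq_le (gam l) hf

theorem abs_heat_le_sup {f : V → ℝ} {C : ℝ} (hC : ∀ x, |f x| ≤ C) (l : ℝ) (x : V) :
    |heat l f x| ≤ C := by
  have := abs_wav_le nice_rho.int hC l x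
  simpa [abs_of_pos (rho_pos _), integral_rho] using this

/-- Lebesgue measure on `(0, L] × ℝ²`. -/
def muL (L : ℝ) : Measure (ℝ × V) := (volume.restrict (Set.Ioc 0 L)).prod volume

/-- Continuous families of functions, uniformly bounded and uniformly integrable in `[0, L]`. -/
structure Fam (L : ℝ) (q : ℝ → V → ℝ) : Prop where
  cont : Continuous fun p : ℝ × V => q p.1 p.2
  bdd : ∃ C, ∀ r ∈ Set.Icc 0 L, ∀ x, |q r x| ≤ C
  int : ∀ r ∈ Set.Icc 0 L, Integrable (q r)
  l1 : ∃ C, ∀ r ∈ Set.Icc 0 L, ∫ x, |q r x| ≤ C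

namespace Fam
variable {L : ℝ} {q q' : ℝ → V → ℝ}

protected theorem add (h : Fam L q) (h' : Fam L q') : Fam L fun r x => q r x + q' r x := by
  obtain ⟨C, hC⟩ := h.bdd
  obtain ⟨D, hD⟩ := h'.bdd
  obtain ⟨C1, hC1⟩ := h.l1
  obtain ⟨D1, hD1⟩ := h'.l1
  refine ⟨h.cont.add h'.cont, ⟨C + D, fun r hr x =>
    (abs_add_le _ _).trans (add_le_add (hC r hr x) (hD r hr x))⟩,
    fun r hr => (h.int r hr).add (h'.int r hr), ⟨C1 + D1, fun r hr => ?_⟩⟩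
  refine le_trans ?_ (add_le_add (hC1 r hr) (hD1 r hr))
  rw [← integral_add (h.int r hr).abs (h'.int r hr).abs]
  exact integral_mono ((h.int r hr).add (h'.int r hr)).abs
    ((h.int r hr).abs.add (h'.int r hr).abs) fun x => abs_add_le _ _

theorem bdd_mul (hc : Continuous fun p : ℝ × V => q p.1 p.2)
    (hb : ∃ C, ∀ r ∈ Set.Icc 0 L, ∀ x, |q r x| ≤ C) (h' : Fam L q') :
    Fam L fun r x => q r x * q' r x := by
  obtain ⟨C, hC⟩ := hb
  obtain ⟨D, hD⟩ := h'.bdd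
  obtain ⟨D1, hD1⟩ := h'.l1
  have hi : ∀ r ∈ Set.Icc 0 L, Integrable fun x => q r x * q' r x := fun r hr =>
    (h'.int r hr).bdd_mul (c := C)
      (hc.comp (by fun_prop : Continuous fun x : V => (r, x))).aestronglyMeasurable
      (ae_of_all _ (hC r hr))
  refine ⟨hc.mul h'.cont, ⟨C * D, fun r hr x => ?_⟩, hi, ⟨C * D1, fun r hr => ?_⟩⟩
  · rw [abs_mul]
    exact mul_le_mul (hC r hr x) (hD r hr x) (abs_nonneg _) ((abs_nonneg _).trans (hC r hr x))
  · have hC0 : 0 ≤ C := (abs_nonneg _).trans (hC r hr 0)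
    refine le_trans ?_ (mul_le_mul_of_nonneg_left (hD1 r hr) hC0)
    rw [← integral_const_mul]
    refine integral_mono (hi r hr).abs ((h'.int r hr).abs.const_mul C) fun x => ?_
    simp only [abs_mul]
    exact mul_le_mul_of_nonneg_right (hC r hr x) (abs_nonneg _)

protected theorem mul (h : Fam L q) (h' : Fam L q') : Fam L fun r x => q r x * q' r x :=
  bdd_mul h.cont h.bdd h'

theorem smul (h : Fam L q) {c : ℝ → ℝ} (hc : Continuous c) : Fam L fun r x => c r * q r x := by
  obtain ⟨C, hC⟩ := (isCompact_Icc (a := (0 : ℝ)) (b := L)).exists_bound_of_continuousOn hc.continuousOn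
  exact bdd_mul (q := fun r _ => c r) (by fun_prop) ⟨C, fun r hr _ => hC r hr⟩ h

theorem neg (h : Fam L q) : Fam L fun r x => - q r x := by
  simpa using h.smul (c := fun _ => -1) continuous_const

theorem sub (h : Fam L q) (h' : Fam L q') : Fam L fun r x => q r x - q' r x := by
  simpa [sub_eq_add_neg] using h.add h'.neg

theorem sq (h : Fam L q) : Fam L fun r x => q r x ^ 2 := by
  simpa [pow_two] using h.mul h

protected theorem integrable (h : Fam L q) : Integrable (fun p : ℝ × V => q p.1 p.2) (muL L) := by
  obtain ⟨C, hC⟩ := h.l1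
  have hm : AEStronglyMeasurable (fun p : ℝ × V => q p.1 p.2) (muL L) := h.cont.aestronglyMeasurable
  have hmem : ∀ᵐ r ∂(volume.restrict (Set.Ioc 0 L)), r ∈ Set.Ioc 0 L :=
    ae_restrict_mem measurableSet_Ioc
  rw [muL] at hm ⊢
  rw [integrable_prod_iff hm]
  constructor
  · filter_upwards [hmem] with r hr using h.int r (Set.Ioc_subset_Icc_self hr)
  · refine Integrable.of_bound hm.norm.integral_prod_right' C ?_
    filter_upwards [hmem] with r hr
    rw [Real.norm_eq_abs, abs_of_nonneg (integral_nonneg fun _ => norm_nonneg _)]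
    exact hC r (Set.Ioc_subset_Icc_self hr)

theorem integral_deriv (h : Fam L q) (h' : Fam L q') (hL : 0 ≤ L)
    (hd : ∀ r ∈ Set.Icc 0 L, ∀ x, HasDerivAt (fun r => q r x) (q' r x) r) :
    ∫ p, q' p.1 p.2 ∂(muL L) = (∫ x, q L x) - ∫ x, q 0 x := by
  have i2 := h'.integrable
  rw [muL] at *
  rw [integral_prod_symm _ i2, ← integral_sub (h.int L ⟨hL, le_rfl⟩) (h.int 0 ⟨le_rfl, hL⟩)]
  refine integral_congr_ae (ae_of_all _ fun x => ?_)
  simp only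
  rw [← intervalIntegral.integral_of_le hL]
  refine intervalIntegral.integral_eq_sub_of_hasDerivAt (f := fun r => q r x) (f' := fun r => q' r x)
    (fun r hr => hd r (by rwa [Set.uIcc_of_le hL] at hr) x) ?_
  exact (h'.cont.comp (by fun_prop : Continuous fun r : ℝ => (r, x))).intervalIntegrable _ _

end Fam

theorem fam_heat {f : V → ℝ} (hf : Nice f) (L : ℝ) : Fam L fun r x => heat r f x := by
  obtain ⟨C, hC⟩ := hf.bdd
  exact ⟨continuous_wav hf nice_rho, ⟨C, fun r _ x => abs_heat_le_sup hC r x⟩,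
    fun r _ => (nice_heat hf r).int, ⟨_, fun r _ => integral_abs_heat_le hf r⟩⟩

/-- The truncated potential `∫_r^L l (heat l h) dl`. -/
def Xi (L : ℝ) (h : V → ℝ) (r : ℝ) (x : V) : ℝ := ∫ l in r..L, l * heat l h x

section Xi
variable {L : ℝ} {h : V → ℝ}

theorem Xi_eq (hh : Nice h) {r : ℝ} (hr : r ∈ Set.Icc 0 L) : Xi L h r = cv (nu r L) h := by
  funext x
  rw [cv_nu hh.cont hh.bdd hr.1 hr.2]; rfl

theorem Xi_self : Xi L h L = fun _ => 0 := by
  funext x; simp [Xi]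

theorem nice_Xi (hh : Nice h) {r : ℝ} (hr : r ∈ Set.Icc 0 L) : Nice (Xi L h r) := by
  rw [Xi_eq hh hr]; exact hh.cv _

theorem pd_Xi (hh : Nice h) {r : ℝ} (hr : r ∈ Set.Icc 0 L) (i : Fin 2) :
    pd i (Xi L h r) = Xi L (pd i h) r := by
  rw [Xi_eq hh hr, Xi_eq (hh.pd i) hr, pd_cv _ hh]

theorem continuous_heat_mul (hh : Nice h) (x : V) : Continuous fun l : ℝ => l * heat l h x :=
  continuous_id.mul ((continuous_wav hh nice_rho).comp (by fun_prop : Continuous fun l : ℝ => (l, x)))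

theorem hasDerivAt_Xi (hh : Nice h) (r : ℝ) (x : V) :
    HasDerivAt (fun r => Xi L h r x) (-(r * heat r h x)) r := by
  have hc := continuous_heat_mul hh x
  exact intervalIntegral.integral_hasDerivAt_left (hc.intervalIntegrable _ _)
    (hc.stronglyMeasurableAtFilter _ _) hc.continuousAt

theorem fam_Xi (hh : Nice h) : Fam L (Xi L h) := by
  obtain ⟨C, hC⟩ := hh.bdd
  have hmass : ∀ r ∈ Set.Icc 0 L, (nu r L).real Set.univ ≤ L ^ 2 := fun r hr => by
    rw [nu_real hr.1 hr.2]; nlinarith [sq_nonneg r, sq_nonneg L]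
  have hC0 : 0 ≤ C := (abs_nonneg _).trans (hC 0)
  refine ⟨?_, ⟨C * L ^ 2, fun r hr x => ?_⟩, fun r hr => (nice_Xi hh hr).int,
    ⟨L ^ 2 * ∫ x, |h x|, fun r hr => ?_⟩⟩
  · have hk := continuous_wav hh nice_rho
    have h1 : Continuous fun p : (ℝ × V) × ℝ => p.2 * heat p.2 h p.1.2 :=
      continuous_snd.mul (hk.comp (by fun_prop : Continuous fun p : (ℝ × V) × ℝ => (p.2, p.1.2)))
    have h2 := intervalIntegral.continuous_parametric_intervalIntegral_of_continuous (a₀ := L)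
      (μ := volume) (f := fun (p : ℝ × V) l => l * heat l h p.2) h1 (s := fun p => p.1) continuous_fst
    refine h2.neg.congr fun p => ?_
    exact (intervalIntegral.integral_symm _ _).symm
  · rw [Xi_eq hh hr]
    exact (abs_cv_le _ hC x).trans (mul_le_mul_of_nonneg_left (hmass r hr) hC0)
  · rw [Xi_eq hh hr]
    exact (integral_abs_cv_le _ hh.cont hh.int).trans
      (mul_le_mul_of_nonneg_right (hmass r hr) (integral_nonneg fun _ => abs_nonneg _))

end Xi

/-- Squared length of the gradient. -/
def gsq (f : V → ℝ) (x : V) : ℝ := ∑ i, pd i f x ^ 2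

/-- The Jacobian determinant of the map `(a, b)`. -/
def jac (a b : V → ℝ) (x : V) : ℝ := pd 0 a x * pd 1 b x - pd 1 a x * pd 0 b x

theorem gsq_nonneg (f : V → ℝ) (x : V) : 0 ≤ gsq f x := Finset.sum_nonneg fun _ _ => sq_nonneg _

theorem Nice.integral_pd {f : V → ℝ} (h : Nice f) (i : Fin 2) : ∫ x, _root_.pd i f x = 0 :=
  integral_pd_eq_zero i h.diff h.int (h.pd i).int

theorem Nice.sq {f : V → ℝ} (h : Nice f) : Nice fun x => f x ^ 2 := by
  simpa [pow_two] using h.mul h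

theorem Nice.gsq {f : V → ℝ} (h : Nice f) : Nice (gsq f) := by
  have : _root_.gsq f = fun x => _root_.pd 0 f x ^ 2 + _root_.pd 1 f x ^ 2 := by
    funext x; simp [_root_.gsq]
  rw [this]; exact (h.pd 0).sq.add (h.pd 1).sq

theorem Nice.jac {a b : V → ℝ} (h : Nice a) (h' : Nice b) : Nice (jac a b) :=
  ((h.pd 0).mul (h'.pd 1)).sub ((h.pd 1).mul (h'.pd 0))

theorem integral_le_of_le_add_div {A B : V → ℝ} (hA : Integrable A) (hB : Integrable B)
    {W : Fin 2 → V → ℝ} (hW : ∀ i, Nice (W i))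
    (h : ∀ x, A x ≤ B x + ∑ i, pd i (W i) x) : ∫ x, A x ≤ ∫ x, B x := by
  have hWi : Integrable fun x => ∑ i, pd i (W i) x :=
    integrable_finsetSum _ fun i _ => ((hW i).pd i).int
  calc ∫ x, A x ≤ ∫ x, (B x + ∑ i, pd i (W i) x) := integral_mono hA (hB.add hWi) h
    _ = ∫ x, B x := by
      rw [integral_add hB hWi, integral_finsetSum _ fun i _ => ((hW i).pd i).int]
      simp [(hW _).integral_pd]

theorem carleson_slice {f g : V → ℝ} (hf : Nice f) (hg : Nice g) {c : ℝ} (hc : 0 ≤ c) :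
    ∫ x, (c * (gsq f x * g x ^ 2)
      + c * (2 * f x * lap f x * g x ^ 2 + 2 * f x ^ 2 * g x * lap g x)) ≤
    ∫ x, 14 * (c * (f x ^ 2 * gsq g x)) := by
  have hW : ∀ i, Nice fun x => c * (2 * (f x * pd i f x * g x ^ 2) + 2 * (f x ^ 2 * (g x * pd i g x))) :=
    fun i => (((hf.mul (hf.pd i)).mul hg.sq).const_mul 2 |>.add
      ((hf.sq.mul (hg.mul (hg.pd i))).const_mul 2)).const_mul c
  refine integral_le_of_le_add_div ?_ ?_ hW fun x => ?_
  · refine ((((hf.gsq.mul hg.sq).const_mul c).add ((((hf.mul hf.lap).mul hg.sq).const_mul 2 |>.add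
      ((hf.sq.mul (hg.mul hg.lap)).const_mul 2)).const_mul c)).int).congr (ae_of_all _ fun x => ?_)
    simp only; ring
  · exact (((hf.sq.mul hg.gsq).const_mul c).const_mul 14).int
  · have e : ∀ i, pd i (fun x => c * (2 * (f x * pd i f x * g x ^ 2)
        + 2 * (f x ^ 2 * (g x * pd i g x)))) x
        = c * (2 * (pd i f x ^ 2 * g x ^ 2 + f x * pd i (pd i f) x * g x ^ 2
          + 2 * f x * pd i f x * g x * pd i g x)
          + 2 * (2 * f x * pd i f x * g x * pd i g x + f x ^ 2 * pd i g x ^ 2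
            + f x ^ 2 * g x * pd i (pd i g) x)) := fun i => by
      have n1 := hf.mul (hf.pd i)
      have n2 := n1.mul hg.sq
      have n3 := hg.mul (hg.pd i)
      have n4 := hf.sq.mul n3
      rw [pd_const_mul i c ((n2.const_mul 2).add (n4.const_mul 2)).diff,
        pd_add i (n2.const_mul 2).diff (n4.const_mul 2).diff,
        pd_const_mul i 2 n2.diff, pd_const_mul i 2 n4.diff,
        pd_mul i n1.diff hg.sq.diff, pd_mul i hf.diff (hf.pd i).diff, pd_mul i hf.sq.diff n3.diff,
        pd_mul i hg.diff (hg.pd i).diff, pd_sq i hf.diff, pd_sq i hg.diff]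
      ring
    simp only [e, gsq, lap, Fin.sum_univ_two]
    have k : ∀ i, 0 ≤ c * (pd i f x * g x + 4 * (f x * pd i g x)) ^ 2 := fun i => by positivity
    nlinarith [k 0, k 1]

theorem energy_slice {g : V → ℝ} (hg : Nice g) :
    ∫ x, (2 * gsq g x + 2 * g x * lap g x) ≤ ∫ _ : V, (0 : ℝ) := by
  have hW : ∀ i, Nice fun x => 2 * (g x * pd i g x) := fun i => (hg.mul (hg.pd i)).const_mul 2
  refine integral_le_of_le_add_div ?_ (integrable_zero _ _ _) hW fun x => ?_
  · refine ((hg.gsq.const_mul 2).add ((hg.mul hg.lap).const_mul 2)).int.congr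
      (ae_of_all _ fun x => ?_)
    simp only; ring
  · have e : ∀ i, pd i (fun x => 2 * (g x * pd i g x)) x
        = 2 * (pd i g x ^ 2 + g x * pd i (pd i g) x) := fun i => by
      rw [pd_const_mul i 2 (hg.mul (hg.pd i)).diff, pd_mul i hg.diff (hg.pd i).diff]
      ring
    simp only [e, gsq, lap, Fin.sum_univ_two]
    nlinarith

theorem potential_slice {X h g : V → ℝ} (hX : Nice X) (hh : Nice h) (hg : Nice g) {r C3 C4 : ℝ}
    (hr : 0 ≤ r) (h3 : ∀ x, |r * X x| ≤ C3) (h4 : ∀ i x, |r ^ 2 * pd i X x| ≤ C4) :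
    ∫ x, r * (X x ^ 2 * g x ^ 2) ≤
    ∫ x, ((2 * r * (X x * g x) ^ 2 - 2 * r ^ 3 * X x * h x * g x ^ 2
        + 2 * r ^ 3 * X x ^ 2 * g x * lap g x)
      + (2 * (r ^ 5 * (h x ^ 2 * g x ^ 2)) + 2 * (8 * C4 ^ 2 + C3 ^ 2) * (r * gsq g x))) := by
  have hW : ∀ i, Nice fun x => (-2 * r ^ 3) * (X x ^ 2 * (g x * pd i g x)) := fun i =>
    (hX.sq.mul (hg.mul (hg.pd i))).const_mul _
  refine integral_le_of_le_add_div ?_ ?_ hW fun x => ?_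
  · exact ((hX.sq.mul hg.sq).const_mul r).int
  · refine (((((hX.mul hg).sq.const_mul (2 * r)).sub (((hX.mul hh).mul hg.sq).const_mul (2 * r ^ 3))).add
      ((hX.sq.mul (hg.mul hg.lap)).const_mul (2 * r ^ 3))).add
      (((hh.sq.mul hg.sq).const_mul (2 * r ^ 5)).add
        (hg.gsq.const_mul (2 * (8 * C4 ^ 2 + C3 ^ 2) * r)))).int.congr (ae_of_all _ fun x => ?_)
    simp only; ring
  · have e : ∀ i, pd i (fun x => (-2 * r ^ 3) * (X x ^ 2 * (g x * pd i g x))) x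
        = (-2 * r ^ 3) * (2 * X x * pd i X x * (g x * pd i g x)
          + X x ^ 2 * (pd i g x ^ 2 + g x * pd i (pd i g) x)) := fun i => by
      rw [pd_const_mul i _ (hX.sq.mul (hg.mul (hg.pd i))).diff, pd_mul i hX.sq.diff
        (hg.mul (hg.pd i)).diff, pd_sq i hX.diff, pd_mul i hg.diff (hg.pd i).diff]
      ring
    simp only [e, gsq, lap, Fin.sum_univ_two]
    have h3' : (r * X x) ^ 2 ≤ C3 ^ 2 := sq_le_sq' (by linarith [abs_le.1 (h3 x)]) (abs_le.1 (h3 x)).2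
    have h4' : ∀ i, (r ^ 2 * pd i X x) ^ 2 ≤ C4 ^ 2 := fun i =>
      sq_le_sq' (by linarith [abs_le.1 (h4 i x)]) (abs_le.1 (h4 i x)).2
    have a1 : 2 * r ^ 3 * X x * h x * g x ^ 2 ≤ r * (X x ^ 2 * g x ^ 2) / 2
        + 2 * (r ^ 5 * (h x ^ 2 * g x ^ 2)) := by
      have : 0 ≤ r * (X x * g x - 2 * r ^ 2 * h x * g x) ^ 2 := by positivity
      nlinarith
    have a2 : ∀ i, 4 * r ^ 3 * X x * pd i X x * g x * pd i g x ≤ r * (X x ^ 2 * g x ^ 2) / 4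
        + 16 * (C4 ^ 2 * (r * pd i g x ^ 2)) := fun i => by
      have b1 : 0 ≤ r * (X x * g x - 8 * (r ^ 2 * pd i X x) * pd i g x) ^ 2 := by positivity
      have b2 := mul_le_mul_of_nonneg_right (h4' i) (by positivity : 0 ≤ r * pd i g x ^ 2)
      nlinarith
    have a3 : ∀ i, 2 * r ^ 3 * X x ^ 2 * pd i g x ^ 2 ≤ 2 * (C3 ^ 2 * (r * pd i g x ^ 2)) := fun i => by
      have b2 := mul_le_mul_of_nonneg_right h3' (by positivity : 0 ≤ r * pd i g x ^ 2)
      nlinarith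
    nlinarith [a1, a2 0, a2 1, a3 0, a3 1]

theorem lap_pd {f : V → ℝ} (hf : Sm f) (i : Fin 2) : lap (pd i f) = pd i (lap f) := by
  have : lap f = fun x => ∑ k, pd k (pd k f) x := rfl
  rw [this, pd_sum i _ fun k _ => ((hf.pd k).pd k).diff]
  funext x
  simp only [lap]
  refine Finset.sum_congr rfl fun k _ => ?_
  rw [pd_comm k i hf, pd_comm k i (hf.pd k)]

theorem jacobian_slice {S X a b : V → ℝ} (hS : Nice S) (hX : Nice X) (ha : Nice a) (hb : Nice b)
    (i j : Fin 2) {r : ℝ} (hr : 0 ≤ r) :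
    ∫ x, r * (pd i (pd j S) x * jac a b x - X x * (jac (lap a) b x + jac a (lap b) x)) ≤
    ∫ x, 4 * ∑ k, (r * (pd j S x ^ 2 * pd k a x ^ 2) + r * (gsq X x * pd k a x ^ 2)
        + r * gsq (pd k a) x + (r * (pd j S x ^ 2 * pd k b x ^ 2)
        + r * (gsq X x * pd k b x ^ 2) + r * gsq (pd k b) x)) := by
  let Z0 : V → ℝ := fun x => lap b x * pd 1 a x - lap a x * pd 1 b x
  let Z1 : V → ℝ := fun x => lap a x * pd 0 b x - lap b x * pd 0 a x
  have hZ0 : Nice Z0 := (hb.lap.mul (ha.pd 1)).sub (ha.lap.mul (hb.pd 1))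
  have hZ1 : Nice Z1 := (ha.lap.mul (hb.pd 0)).sub (hb.lap.mul (ha.pd 0))
  let W : Fin 2 → V → ℝ := fun k x => r * ((if k = i then 1 else 0) * (pd j S x * jac a b x)
    + X x * (![Z0, Z1] k x))
  have hZ : ∀ k, Nice (![Z0, Z1] k) := by
    intro k; fin_cases k
    · exact hZ0
    · exact hZ1
  have hW : ∀ k, Nice (W k) := fun k =>
    ((((hS.pd j).mul (ha.jac hb)).const_mul _).add (hX.mul (hZ k))).const_mul r
  have hpdW : ∀ k x, pd k (W k) x = r * ((if k = i then 1 else 0)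
      * (pd k (pd j S) x * jac a b x + pd j S x * pd k (jac a b) x)
      + (pd k X x * ![Z0, Z1] k x + X x * pd k (![Z0, Z1] k) x)) := fun k x => by
    simp only [W]
    have d1 := ((hS.pd j).mul (ha.jac hb)).diff
    rw [pd_const_mul k r (((((hS.pd j).mul (ha.jac hb)).const_mul _).add (hX.mul (hZ k))).diff),
      pd_add k (((hS.pd j).mul (ha.jac hb)).const_mul _).diff (hX.mul (hZ k)).diff,
      pd_const_mul k _ d1, pd_mul k (hS.pd j).diff (ha.jac hb).diff, pd_mul k hX.diff (hZ k).diff]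
  have hZ0' : ∀ x, pd 0 Z0 x = pd 0 (lap b) x * pd 1 a x + lap b x * pd 0 (pd 1 a) x
      - (pd 0 (lap a) x * pd 1 b x + lap a x * pd 0 (pd 1 b) x) := fun x => by
    simp only [Z0]
    rw [pd_sub 0 (hb.lap.mul (ha.pd 1)).diff (ha.lap.mul (hb.pd 1)).diff,
      pd_mul 0 hb.lap.diff (ha.pd 1).diff, pd_mul 0 ha.lap.diff (hb.pd 1).diff]
  have hZ1' : ∀ x, pd 1 Z1 x = pd 1 (lap a) x * pd 0 b x + lap a x * pd 0 (pd 1 b) x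
      - (pd 1 (lap b) x * pd 0 a x + lap b x * pd 0 (pd 1 a) x) := fun x => by
    simp only [Z1]
    rw [pd_sub 1 (ha.lap.mul (hb.pd 0)).diff (hb.lap.mul (ha.pd 0)).diff,
      pd_mul 1 ha.lap.diff (hb.pd 0).diff, pd_mul 1 hb.lap.diff (ha.pd 0).diff,
      pd_comm 1 0 hb.sm, pd_comm 1 0 ha.sm]
  have hjac : ∀ k x, pd k (jac a b) x = pd k (pd 0 a) x * pd 1 b x + pd 0 a x * pd k (pd 1 b) x
      - (pd k (pd 1 a) x * pd 0 b x + pd 1 a x * pd k (pd 0 b) x) := fun k x => by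
    have : jac a b = fun x => pd 0 a x * pd 1 b x - pd 1 a x * pd 0 b x := rfl
    rw [this, pd_sub k ((ha.pd 0).mul (hb.pd 1)).diff ((ha.pd 1).mul (hb.pd 0)).diff,
      pd_mul k (ha.pd 0).diff (hb.pd 1).diff, pd_mul k (ha.pd 1).diff (hb.pd 0).diff]
  refine integral_le_of_le_add_div ?_ ?_ hW fun x => ?_
  · exact (((((hS.pd j).pd i).mul (ha.jac hb)).sub
      (hX.mul ((ha.lap.jac hb).add (ha.jac hb.lap)))).const_mul r).int
  · refine (integrable_finsetSum _ fun k _ => ?_).const_mul 4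
    exact ((((hS.pd j).sq.mul (ha.pd k).sq).const_mul r).add
      ((hX.gsq.mul (ha.pd k).sq).const_mul r) |>.add ((ha.pd k).gsq.const_mul r) |>.add
      ((((hS.pd j).sq.mul (hb.pd k).sq).const_mul r).add
      ((hX.gsq.mul (hb.pd k).sq).const_mul r) |>.add ((hb.pd k).gsq.const_mul r))).int
  · simp only [hpdW, ite_mul, one_mul, zero_mul, Fin.sum_univ_two]
    have hz0 : ![Z0, Z1] 0 = Z0 := rfl
    have hz1 : ![Z0, Z1] 1 = Z1 := rfl
    rw [hz0, hz1, hZ0', hZ1']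
    have key : r * (pd i (pd j S) x * jac a b x - X x * (jac (lap a) b x + jac a (lap b) x))
        = r * (- (pd j S x * pd i (jac a b) x) - pd 0 X x * Z0 x - pd 1 X x * Z1 x)
        + (r * ((if (0 : Fin 2) = i then pd 0 (pd j S) x * jac a b x + pd j S x * pd 0 (jac a b) x else 0)
          + (pd 0 X x * Z0 x + X x * (pd 0 (lap b) x * pd 1 a x + lap b x * pd 0 (pd 1 a) x
      - (pd 0 (lap a) x * pd 1 b x + lap a x * pd 0 (pd 1 b) x))))
        + r * ((if (1 : Fin 2) = i then pd 1 (pd j S) x * jac a b x + pd j S x * pd 1 (jac a b) x else 0)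
          + (pd 1 X x * Z1 x + X x * (pd 1 (lap a) x * pd 0 b x + lap a x * pd 0 (pd 1 b) x
      - (pd 1 (lap b) x * pd 0 a x + lap b x * pd 0 (pd 1 a) x))))) := by
      have hi : i = 0 ∨ i = 1 := by omega
      rcases hi with rfl | rfl
      · simp only [jac, if_true, if_neg (by decide : ¬ (1 : Fin 2) = 0)]; ring
      · simp only [jac, if_true, if_neg (by decide : ¬ (0 : Fin 2) = 1)]; ring
    rw [key]
    refine add_le_add_left ?_ _
    have bound : - (pd j S x * pd i (jac a b) x) - pd 0 X x * Z0 x - pd 1 X x * Z1 x ≤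
        4 * ((pd j S x ^ 2 * pd 0 a x ^ 2 + gsq X x * pd 0 a x ^ 2 + gsq (pd 0 a) x
          + (pd j S x ^ 2 * pd 0 b x ^ 2 + gsq X x * pd 0 b x ^ 2 + gsq (pd 0 b) x))
          + (pd j S x ^ 2 * pd 1 a x ^ 2 + gsq X x * pd 1 a x ^ 2 + gsq (pd 1 a) x
          + (pd j S x ^ 2 * pd 1 b x ^ 2 + gsq X x * pd 1 b x ^ 2 + gsq (pd 1 b) x))) := by
      have am : ∀ p q s : ℝ, -(p * q * s) ≤ (p * s) ^ 2 / 2 + q ^ 2 / 2 := fun p q s => by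
        nlinarith [sq_nonneg (p * s + q)]
      have am' : ∀ p q s : ℝ, (p * q * s) ≤ (p * s) ^ 2 / 2 + q ^ 2 / 2 := fun p q s => by
        nlinarith [sq_nonneg (p * s - q)]
      have hz : ∀ k f, pd i (pd k f) x ^ 2 ≤ gsq (pd k f) x := fun k f =>
        Finset.single_le_sum (f := fun i => pd i (pd k f) x ^ 2) (fun _ _ => sq_nonneg _)
          (Finset.mem_univ i)
      have lp : ∀ f, lap f x ^ 2 ≤ 2 * gsq (pd 0 f) x + 2 * gsq (pd 1 f) x := fun f => by
        simp only [lap, gsq, Fin.sum_univ_two]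
        nlinarith [sq_nonneg (pd 0 (pd 0 f) x - pd 1 (pd 1 f) x), sq_nonneg (pd 1 (pd 0 f) x),
          sq_nonneg (pd 0 (pd 1 f) x)]
      have hg : gsq X x = pd 0 X x ^ 2 + pd 1 X x ^ 2 := by simp [gsq]
      rw [hjac]
      simp only [Z0, Z1]
      rw [hg]
      have n1 := mul_nonneg (sq_nonneg (pd j S x)) (sq_nonneg (pd 0 a x))
      have n2 := mul_nonneg (sq_nonneg (pd j S x)) (sq_nonneg (pd 1 a x))
      have n3 := mul_nonneg (sq_nonneg (pd j S x)) (sq_nonneg (pd 0 b x))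
      have n4 := mul_nonneg (sq_nonneg (pd j S x)) (sq_nonneg (pd 1 b x))
      have m : ∀ k l f, 0 ≤ pd k X x ^ 2 * pd l f x ^ 2 := fun k l f =>
        mul_nonneg (sq_nonneg _) (sq_nonneg _)
      linarith [am (pd j S x) (pd i (pd 0 a) x) (pd 1 b x), am (pd j S x) (pd i (pd 1 b) x) (pd 0 a x),
        am' (pd j S x) (pd i (pd 1 a) x) (pd 0 b x), am' (pd j S x) (pd i (pd 0 b) x) (pd 1 a x),
        hz 0 a, hz 1 a, hz 0 b, hz 1 b, lp a, lp b,
        am (pd 0 X x) (lap b x) (pd 1 a x), am' (pd 0 X x) (lap a x) (pd 1 b x),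
        am (pd 1 X x) (lap a x) (pd 0 b x), am' (pd 1 X x) (lap b x) (pd 0 a x),
        m 0 0 a, m 0 1 a, m 1 0 a, m 1 1 a, m 0 0 b, m 0 1 b, m 1 0 b, m 1 1 b, n1, n2, n3, n4,
        gsq_nonneg (pd 0 a) x, gsq_nonneg (pd 1 a) x, gsq_nonneg (pd 0 b) x, gsq_nonneg (pd 1 b) x]
    refine (mul_le_mul_of_nonneg_left bound hr).trans (le_of_eq ?_)
    ring

/-- The integral of a family over `(0, L] × ℝ²`. -/
def IL (L : ℝ) (q : ℝ → V → ℝ) : ℝ := ∫ p, q p.1 p.2 ∂(muL L)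

section IL
variable {L : ℝ} {q q' : ℝ → V → ℝ}

theorem IL_add (h : Fam L q) (h' : Fam L q') :
    IL L (fun r x => q r x + q' r x) = IL L q + IL L q' := integral_add h.integrable h'.integrable

theorem IL_const_mul (c : ℝ) : IL L (fun r x => c * q r x) = c * IL L q := integral_const_mul _ _

theorem IL_sum {ι : Type*} (s : Finset ι) {q : ι → ℝ → V → ℝ} (h : ∀ i ∈ s, Fam L (q i)) :
    IL L (fun r x => ∑ i ∈ s, q i r x) = ∑ i ∈ s, IL L (q i) :=
  integral_finsetSum _ fun i hi => (h i hi).integrable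

theorem IL_mono (h : Fam L q) (h' : Fam L q')
    (he : ∀ r ∈ Set.Ioc 0 L, ∀ x, q r x ≤ q' r x) : IL L q ≤ IL L q' := by
  have i1 := h.integrable
  have i2 := h'.integrable
  have hm : ∀ᵐ p ∂(muL L), p.1 ∈ Set.Ioc 0 L := by
    have : ∀ᵐ r ∂(volume.restrict (Set.Ioc 0 L)), r ∈ Set.Ioc 0 L := ae_restrict_mem measurableSet_Ioc
    exact Measure.quasiMeasurePreserving_fst.ae this
  refine integral_mono_ae i1 i2 ?_
  filter_upwards [hm] with p hp using he p.1 hp p.2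

theorem IL_mono_slice (h : Fam L q) (h' : Fam L q')
    (he : ∀ r ∈ Set.Ioc 0 L, ∫ x, q r x ≤ ∫ x, q' r x) : IL L q ≤ IL L q' := by
  have i1 := h.integrable
  have i2 := h'.integrable
  rw [IL, IL]
  rw [muL] at *
  rw [integral_prod _ i1, integral_prod _ i2]
  exact setIntegral_mono_on i1.integral_prod_left i2.integral_prod_left measurableSet_Ioc he

theorem IL_deriv (h : Fam L q) (h' : Fam L q') (hL : 0 ≤ L)
    (hd : ∀ r ∈ Set.Icc 0 L, ∀ x, HasDerivAt (fun r => q r x) (q' r x) r) :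
    IL L q' = (∫ x, q L x) - ∫ x, q 0 x := h.integral_deriv h' hL hd

theorem Fam.sum {ι : Type*} {s : Finset ι} {q : ι → ℝ → V → ℝ} (h : ∀ i ∈ s, Fam L (q i)) :
    Fam L fun r x => ∑ i ∈ s, q i r x := by
  classical
  induction s using Finset.induction_on with
  | empty =>
    simp only [Finset.sum_empty]
    exact ⟨continuous_const, ⟨0, by simp⟩, by simp, ⟨0, by simp⟩⟩
  | insert a s ha ih =>
    simp only [Finset.sum_insert ha]
    exact (h a (by simp)).add (ih fun i hi => h i (by simp [hi]))

end IL

/-- Sums of the `L¹` norms of the derivatives of order `n`. -/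
def kap : ℕ → (V → ℝ) → ℝ
  | 0, w => ∫ z, |w z|
  | n + 1, w => ∑ i, kap n (pd i w)

theorem kap_nonneg (n : ℕ) (w : V → ℝ) : 0 ≤ kap n w := by
  induction n generalizing w with
  | zero => exact integral_nonneg fun _ => abs_nonneg _
  | succ n ih => exact Finset.sum_nonneg fun i _ => ih _

theorem wav_iterated_pd {s : V → ℝ} (hs : Nice s) (hb : ∀ x, |s x| ≤ 1) (l : List (Fin 2)) (r : ℝ) (x : V)
    {w : V → ℝ} (hw : Nice w) :
    Nice (l.foldr pd s) ∧ |r ^ l.length * wav w r (l.foldr pd s) x| ≤ kap l.length w := by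
  induction l generalizing w with
  | nil =>
    refine ⟨hs, ?_⟩
    simpa [kap] using abs_wav_le hw.int hb r x
  | cons i l ih =>
    have hn := (ih hw).1
    refine ⟨hn.pd i, ?_⟩
    have h := (ih (hw.pd i)).2
    have e := wav_pd hn hw i r x
    simp only [List.foldr_cons, List.length_cons, kap]
    rw [pow_succ, mul_assoc, e, mul_neg, abs_neg]
    exact h.trans (Finset.single_le_sum (f := fun i => kap l.length (pd i w))
      (fun _ _ => kap_nonneg _ _) (Finset.mem_univ i))

theorem abs_Xi_le {h : V → ℝ} {x : V} {C L r : ℝ} (n : ℕ) (hr : 0 < r) (hL : r ≤ L)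
    (hC : ∀ l, |l ^ (n + 3) * heat l h x| ≤ C) : |r ^ (n + 1) * Xi L h r x| ≤ C := by
  have hC0 : 0 ≤ C := (abs_nonneg _).trans (hC 0)
  have hd : ∀ l ∈ Set.uIcc r L, HasDerivAt (fun l : ℝ => -(C * r * l⁻¹)) (C * r * (l ^ 2)⁻¹) l := by
    intro l hl
    rw [Set.uIcc_of_le hL] at hl
    have := ((hasDerivAt_inv (hr.trans_le hl.1).ne').const_mul (C * r)).neg
    exact this.congr_deriv (by ring)
  have hcont : ContinuousOn (fun l : ℝ => C * r * (l ^ 2)⁻¹) (Set.uIcc r L) := by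
    refine continuousOn_const.mul (ContinuousOn.inv₀ (by fun_prop) fun l hl => ?_)
    rw [Set.uIcc_of_le hL] at hl
    have := hr.trans_le hl.1
    positivity
  have h_int := intervalIntegral.integral_eq_sub_of_hasDerivAt hd hcont.intervalIntegrable
  have hle : ‖∫ l in r..L, r ^ (n + 1) * (l * heat l h x)‖ ≤ ∫ l in r..L, C * r * (l ^ 2)⁻¹ := by
    refine intervalIntegral.norm_integral_le_of_norm_le hL (ae_of_all _ fun l hl => ?_)
      hcont.intervalIntegrable
    have hl0 : 0 < l := hr.trans hl.1
    have h1 := hC l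
    rw [abs_mul, abs_of_pos (by positivity)] at h1
    rw [Real.norm_eq_abs, abs_mul, abs_mul, abs_of_pos (by positivity : 0 < r ^ (n + 1)), abs_of_pos hl0]
    rw [← div_eq_mul_inv, le_div_iff₀ (by positivity)]
    have h2 : r ^ n ≤ l ^ n := pow_le_pow_left₀ hr.le hl.1.le n
    calc r ^ (n + 1) * (l * |heat l h x|) * l ^ 2 = r ^ n * (r * l ^ 3 * |heat l h x|) := by ring
      _ ≤ l ^ n * (r * l ^ 3 * |heat l h x|) := by gcongr
      _ = l ^ (n + 3) * |heat l h x| * r := by ring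
      _ ≤ C * r := by gcongr
  rw [intervalIntegral.integral_const_mul] at hle
  refine hle.trans ?_
  rw [h_int]
  have : 0 ≤ C * r * L⁻¹ := by
    have := hr.trans_le hL
    positivity
  have e : C * r * r⁻¹ = C := by field_simp
  linarith

section estimates
variable {L : ℝ}

theorem heat_zero_apply (f : V → ℝ) (x : V) : heat 0 f x = f x := congr_fun heat_zero x

theorem lap_heat {g : V → ℝ} (hg : Nice g) (r : ℝ) : lap (heat r g) = heat r (lap g) := by
  rw [← cv_gam hg.cont, ← cv_gam hg.lap.cont]
  have e : ∀ i, pd i (pd i (cv (gam r) g)) = cv (gam r) (pd i (pd i g)) := fun i => by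
    rw [pd_cv _ hg, pd_cv _ (hg.pd i)]
  have e2 : lap g = fun x => pd 0 (pd 0 g) x + pd 1 (pd 1 g) x := by
    funext x; simp [lap]
  rw [e2, cv_add _ ((hg.pd 0).pd 0) ((hg.pd 1).pd 1)]
  funext x
  simp only [lap, e, Fin.sum_univ_two]

theorem energy_le {g : V → ℝ} (hg : Nice g) (hL : 0 ≤ L) :
    Fam L (fun r x => r * gsq (heat r g) x) ∧
    IL L (fun r x => r * gsq (heat r g) x) ≤ (∫ x, g x ^ 2) / 2 := by
  have hgs : ∀ r x, gsq (heat r g) x = ∑ i, heat r (pd i g) x ^ 2 := fun r x => by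
    simp only [gsq, pd_heat hg]
  have f1 : Fam L (fun r x => r * gsq (heat r g) x) := by
    simp only [hgs]
    exact (Fam.sum fun i _ => (fam_heat (hg.pd i) L).sq).smul continuous_id
  refine ⟨f1, ?_⟩
  have fq : Fam L (fun r x => heat r g x ^ 2) := (fam_heat hg L).sq
  have fq' : Fam L (fun r x => r * (2 * (heat r g x * heat r (lap g) x))) :=
    (((fam_heat hg L).mul (fam_heat hg.lap L)).smul (c := fun _ => 2) continuous_const).smul continuous_id
  have hder := IL_deriv fq fq' hL fun r _ x => by
    have := (hasDerivAt_heat hg r x).pow 2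
    exact this.congr_deriv (by simp; ring)
  have h0 : Fam L fun _ _ => 0 := ⟨continuous_const, ⟨0, by simp⟩, by simp, ⟨0, by simp⟩⟩
  have hs := IL_mono_slice ((f1.smul (c := fun _ => 2) continuous_const).add fq') h0 fun r hr => by
    have h := mul_le_mul_of_nonneg_left (energy_slice (nice_heat hg r)) hr.1.le
    rw [← integral_const_mul, ← integral_const_mul] at h
    simp only [mul_zero] at h
    refine le_trans (le_of_eq ?_) h
    refine integral_congr_ae (ae_of_all _ fun x => ?_)
    simp only [lap_heat hg]; ring
  rw [IL_add (f1.smul (c := fun _ => 2) continuous_const) fq', IL_const_mul, hder] at hs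
  simp only [heat_zero_apply] at hs
  have hz : IL L (fun _ _ => 0) = 0 := by simp [IL]
  have hp : 0 ≤ ∫ x, heat L g x ^ 2 := integral_nonneg fun _ => sq_nonneg _
  linarith

theorem carleson_le {f g : V → ℝ} (hf : Nice f) (hg : Nice g) (hL : 0 ≤ L) (k : ℕ) :
    IL L (fun r x => r ^ (2 * k + 1) * (gsq (heat r f) x * heat r g x ^ 2)) ≤
      0 ^ (2 * k) * (∫ x, f x ^ 2 * g x ^ 2)
      + 2 * k * IL L (fun r x => r ^ (2 * k - 1) * (heat r f x ^ 2 * heat r g x ^ 2))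
      + 14 * IL L (fun r x => r ^ (2 * k + 1) * (heat r f x ^ 2 * gsq (heat r g) x)) := by
  have Ff := fam_heat hf L
  have Fg := fam_heat hg L
  have Flf := fam_heat hf.lap L
  have Flg := fam_heat hg.lap L
  have Fgs : ∀ {g : V → ℝ}, Nice g → Fam L (fun r x => gsq (heat r g) x) := fun {g} hg => by
    simp only [gsq, pd_heat hg]
    exact Fam.sum fun i _ => (fam_heat (hg.pd i) L).sq
  have cp : ∀ n : ℕ, Continuous fun r : ℝ => r ^ n := fun n => by fun_prop
  have F1 : Fam L (fun r x => r ^ (2 * k + 1) * (gsq (heat r f) x * heat r g x ^ 2)) :=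
    ((Fgs hf).mul Fg.sq).smul (cp _)
  have F2 : Fam L (fun r x => r ^ (2 * k - 1) * (heat r f x ^ 2 * heat r g x ^ 2)) :=
    (Ff.sq.mul Fg.sq).smul (cp _)
  have F3 : Fam L (fun r x => r ^ (2 * k + 1) * (heat r f x ^ 2 * gsq (heat r g) x)) :=
    (Ff.sq.mul (Fgs hg)).smul (cp _)
  have F4 : Fam L (fun r x => r ^ (2 * k + 1) * (2 * (heat r f x * heat r (lap f) x * heat r g x ^ 2)
      + 2 * (heat r f x ^ 2 * (heat r g x * heat r (lap g) x)))) :=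
    ((((Ff.mul Flf).mul Fg.sq).smul (c := fun _ => 2) continuous_const).add
      ((Ff.sq.mul (Fg.mul Flg)).smul (c := fun _ => 2) continuous_const)).smul (cp _)
  have Q : Fam L (fun r x => r ^ (2 * k) * (heat r f x ^ 2 * heat r g x ^ 2)) :=
    (Ff.sq.mul Fg.sq).smul (cp _)
  have F2' := F2.smul (c := fun _ => 2 * (k : ℝ)) continuous_const
  have F3' := F3.smul (c := fun _ => 14) continuous_const
  have hder := IL_deriv Q (F2'.add F4) hL fun r _ x => by
    have h1 := (hasDerivAt_heat hf r x).pow 2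
    have h2 := (hasDerivAt_heat hg r x).pow 2
    have := (hasDerivAt_pow (2 * k) r).mul (h1.mul h2)
    refine this.congr_deriv ?_
    simp only [Pi.pow_apply, Pi.mul_apply]
    push_cast
    ring
  have hs := IL_mono_slice (F1.add F4) F3' fun r hr => by
    have h := carleson_slice (nice_heat hf r) (nice_heat hg r) (pow_nonneg hr.1.le (2 * k + 1))
    refine le_trans (le_of_eq ?_) h
    refine integral_congr_ae (ae_of_all _ fun x => ?_)
    simp only [lap_heat hf, lap_heat hg]; ring
  rw [IL_add F1 F4, IL_const_mul] at hs
  rw [IL_add F2' F4, IL_const_mul] at hder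
  have hp : 0 ≤ ∫ x, L ^ (2 * k) * (heat L f x ^ 2 * heat L g x ^ 2) :=
    integral_nonneg fun _ => by positivity
  simp only [heat_zero_apply, integral_const_mul] at hder hp
  linarith

theorem potential_le {h g : V → ℝ} (hh : Nice h) (hg : Nice g) (hL : 0 ≤ L) {C3 C4 : ℝ}
    (h3 : ∀ l x, |l ^ 3 * heat l h x| ≤ C3) (h4 : ∀ i l x, |l ^ 4 * heat l (pd i h) x| ≤ C4) :
    IL L (fun r x => r * (Xi L h r x ^ 2 * heat r g x ^ 2)) ≤
      2 * IL L (fun r x => r ^ 5 * (heat r h x ^ 2 * heat r g x ^ 2))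
      + 2 * (8 * C4 ^ 2 + C3 ^ 2) * IL L (fun r x => r * gsq (heat r g) x) := by
  have FX : Fam L (Xi L h) := fam_Xi hh
  have Fh := fam_heat hh L
  have Fg := fam_heat hg L
  have Flg := fam_heat hg.lap L
  have cp : ∀ n : ℕ, Continuous fun r : ℝ => r ^ n := fun n => by fun_prop
  have F1 : Fam L (fun r x => r * (Xi L h r x ^ 2 * heat r g x ^ 2)) :=
    (FX.sq.mul Fg.sq).smul continuous_id
  have F2 : Fam L (fun r x => r ^ 5 * (heat r h x ^ 2 * heat r g x ^ 2)) :=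
    (Fh.sq.mul Fg.sq).smul (cp _)
  have F3 := (energy_le hg hL).1
  have Q : Fam L (fun r x => r ^ 2 * (Xi L h r x ^ 2 * heat r g x ^ 2)) :=
    (FX.sq.mul Fg.sq).smul (cp _)
  have Q' : Fam L (fun r x => 2 * r * (Xi L h r x * heat r g x) ^ 2
      - 2 * r ^ 3 * (Xi L h r x * heat r h x * heat r g x ^ 2)
      + 2 * r ^ 3 * (Xi L h r x ^ 2 * (heat r g x * heat r (lap g) x))) :=
    (((FX.mul Fg).sq.smul (by fun_prop)).sub (((FX.mul Fh).mul Fg.sq).smul (by fun_prop))).add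
      ((FX.sq.mul (Fg.mul Flg)).smul (by fun_prop))
  have hder := IL_deriv Q Q' hL fun r _ x => by
    have h1 := (hasDerivAt_Xi (L := L) hh r x).pow 2
    have h2 := (hasDerivAt_heat hg r x).pow 2
    have := (hasDerivAt_pow 2 r).mul (h1.mul h2)
    refine this.congr_deriv ?_
    simp only [Pi.pow_apply, Pi.mul_apply]
    push_cast
    ring
  have F2' := F2.smul (c := fun _ => 2) continuous_const
  have F3' := F3.smul (c := fun _ => 2 * (8 * C4 ^ 2 + C3 ^ 2)) continuous_const
  have hs := IL_mono_slice F1 (Q'.add (F2'.add F3')) fun r hr => by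
    have hr' := Set.Ioc_subset_Icc_self hr
    have h := potential_slice (nice_Xi hh hr') (nice_heat hh r) (nice_heat hg r) (C3 := C3) (C4 := C4)
      hr.1.le (fun x => by simpa using abs_Xi_le 0 hr.1 hr.2 fun l => h3 l x)
      (fun i x => by
        rw [pd_Xi hh hr' i]
        exact abs_Xi_le 1 hr.1 hr.2 fun l => h4 i l x)
    refine h.trans (le_of_eq ?_)
    refine integral_congr_ae (ae_of_all _ fun x => ?_)
    simp only [lap_heat hg]; ring
  rw [IL_add Q' (F2'.add F3'), IL_add F2' F3', IL_const_mul, IL_const_mul, hder] at hs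
  simp only [Xi_self] at hs
  simp at hs
  exact hs

end estimates

section
variable {L : ℝ}

theorem fam_gsq_heat {g : V → ℝ} (hg : Nice g) (L : ℝ) : Fam L (fun r x => gsq (heat r g) x) := by
  simp only [gsq, pd_heat hg]
  exact Fam.sum fun i _ => (fam_heat (hg.pd i) L).sq

theorem IL_sq_mul_gsq_le {f g : V → ℝ} (hf : Nice f) (hg : Nice g) (hL : 0 ≤ L) (k : ℕ) {C : ℝ}
    (hC : ∀ r x, |r ^ k * heat r f x| ≤ C) :
    IL L (fun r x => r ^ (2 * k + 1) * (heat r f x ^ 2 * gsq (heat r g) x)) ≤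
      C ^ 2 * ((∫ x, g x ^ 2) / 2) := by
  obtain ⟨F, hE⟩ := energy_le hg hL
  have F1 : Fam L (fun r x => r ^ (2 * k + 1) * (heat r f x ^ 2 * gsq (heat r g) x)) :=
    ((fam_heat hf L).sq.mul (fam_gsq_heat hg L)).smul (by fun_prop)
  refine (IL_mono F1 (F.smul (c := fun _ => C ^ 2) continuous_const) fun r hr x => ?_).trans ?_
  · have h := sq_le_sq' (by linarith [abs_le.1 (hC r x)]) (abs_le.1 (hC r x)).2
    have := mul_le_mul_of_nonneg_right h (mul_nonneg hr.1.le (gsq_nonneg (heat r g) x))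
    refine le_trans (le_of_eq ?_) this
    ring
  · rw [IL_const_mul]
    exact mul_le_mul_of_nonneg_left hE (sq_nonneg _)

theorem IL_pd_le {f g : V → ℝ} (hf : Nice f) (hg : Nice g) (n : ℕ) (i : Fin 2) :
    IL L (fun r x => r ^ n * (heat r (pd i f) x ^ 2 * heat r g x ^ 2)) ≤
    IL L (fun r x => r ^ n * (gsq (heat r f) x * heat r g x ^ 2)) := by
  refine IL_mono (((fam_heat (hf.pd i) L).sq.mul (fam_heat hg L).sq).smul (by fun_prop))
    (((fam_gsq_heat hf L).mul (fam_heat hg L).sq).smul (by fun_prop)) fun r hr x => ?_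
  have hr := hr.1.le
  have : heat r (pd i f) x ^ 2 ≤ gsq (heat r f) x := by
    rw [← pd_heat hf]
    exact Finset.single_le_sum (f := fun i => pd i (heat r f) x ^ 2) (fun _ _ => sq_nonneg _)
      (Finset.mem_univ i)
  gcongr

theorem weighted_bounds : ∃ C : ℝ, 0 ≤ C ∧ ∀ (L : ℝ), 0 ≤ L → ∀ s g : V → ℝ, Nice s → Nice g →
    (∀ x, |s x| ≤ 1) → ∀ i j,
    IL L (fun r x => r * (pd j (heat r s) x ^ 2 * heat r g x ^ 2)) ≤ C * ∫ x, g x ^ 2 ∧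
    ∀ l, IL L (fun r x => r * (Xi L (pd l (pd i (pd j s))) r x ^ 2 * heat r g x ^ 2)) ≤ C * ∫ x, g x ^ 2 := by
  set K := fun n => kap n rho
  have hK : ∀ n, 0 ≤ K n := fun n => kap_nonneg n rho
  refine ⟨8 + 2 * (64 + 28 * K 1 ^ 2 + 7 * K 2 ^ 2) + (8 * K 4 ^ 2 + K 3 ^ 2), by positivity, ?_⟩
  intro L hL s g hs hg hb i j
  have hw := fun (l : List (Fin 2)) r x => (wav_iterated_pd hs hb l r x nice_rho).2
  have b0 : ∀ r x, |r ^ 0 * heat r s x| ≤ 1 := fun r x => by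
    simpa using abs_heat_le_sup hb r x
  have b1 : ∀ r x, |r ^ 1 * heat r (pd j s) x| ≤ K 1 := fun r x => hw [j] r x
  have b2 : ∀ r x, |r ^ 2 * heat r (pd i (pd j s)) x| ≤ K 2 := fun r x => hw [i, j] r x
  have b3 : ∀ l r x, |r ^ 3 * heat r (pd l (pd i (pd j s))) x| ≤ K 3 := fun l r x => hw [l, i, j] r x
  have b4 : ∀ m l r x, |r ^ 4 * heat r (pd m (pd l (pd i (pd j s)))) x| ≤ K 4 := fun m l r x =>
    hw [m, l, i, j] r x
  have G0 : 0 ≤ ∫ x, g x ^ 2 := integral_nonneg fun _ => sq_nonneg _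
  have J0 : IL L (fun r x => r ^ 1 * (gsq (heat r s) x * heat r g x ^ 2)) ≤ 8 * ∫ x, g x ^ 2 := by
    have h1 := carleson_le hs hg hL 0
    have h2 := IL_sq_mul_gsq_le hs hg hL 0 b0
    simp only [mul_zero, pow_zero, one_mul, Nat.cast_zero, zero_mul, add_zero, zero_add] at h1 h2
    have h3 : ∫ x, s x ^ 2 * g x ^ 2 ≤ ∫ x, g x ^ 2 := by
      refine integral_mono (hs.sq.mul hg.sq).int hg.sq_int fun x => ?_
      have : s x ^ 2 ≤ 1 := by
        rw [← sq_abs]; exact pow_le_one₀ (abs_nonneg _) (hb x)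
      exact mul_le_of_le_one_left (sq_nonneg _) this
    linarith
  have J1 : IL L (fun r x => r ^ 3 * (gsq (heat r (pd j s)) x * heat r g x ^ 2)) ≤
      (16 + 7 * K 1 ^ 2) * ∫ x, g x ^ 2 := by
    have h1 := carleson_le (hs.pd j) hg hL 1
    have h2 := IL_sq_mul_gsq_le (hs.pd j) hg hL 1 b1
    have h3 := IL_pd_le (L := L) hs hg 1 j
    norm_num at h1 h2 h3 J0 ⊢
    linarith
  have J2 : IL L (fun r x => r ^ 5 * (gsq (heat r (pd i (pd j s))) x * heat r g x ^ 2)) ≤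
      (64 + 28 * K 1 ^ 2 + 7 * K 2 ^ 2) * ∫ x, g x ^ 2 := by
    have h1 := carleson_le ((hs.pd j).pd i) hg hL 2
    have h2 := IL_sq_mul_gsq_le ((hs.pd j).pd i) hg hL 2 b2
    have h3 := IL_pd_le (L := L) (hs.pd j) hg 3 i
    norm_num at h1 h2 h3 J1 ⊢
    linarith
  have hE := (energy_le hg hL).2
  refine ⟨?_, fun l => ?_⟩
  · have h3 := IL_pd_le (L := L) hs hg 1 j
    simp only [pd_heat hs, pow_one] at h3 J0 ⊢
    have : 0 ≤ (2 * (64 + 28 * K 1 ^ 2 + 7 * K 2 ^ 2) + (8 * K 4 ^ 2 + K 3 ^ 2)) * ∫ x, g x ^ 2 := by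
      positivity
    linarith
  · have h1 := potential_le (((hs.pd j).pd i).pd l) hg hL (fun r x => b3 l r x) fun m r x => b4 m l r x
    have h3 := IL_pd_le (L := L) ((hs.pd j).pd i) hg 5 l
    have h4 := mul_le_mul_of_nonneg_left hE (by positivity : 0 ≤ 2 * (8 * K 4 ^ 2 + K 3 ^ 2))
    linarith

theorem Nice.lap_pd {f : V → ℝ} (hf : Nice f) (i : Fin 2) : lap (_root_.pd i f) = _root_.pd i (lap f) :=
  _root_.lap_pd hf.sm i

theorem jacobian_le : ∃ C : ℝ, 0 ≤ C ∧ ∀ (L : ℝ), 0 ≤ L → ∀ s a b : V → ℝ, Nice s → Nice a → Nice b →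
    (∀ x, |s x| ≤ 1) → ∀ i j,
    ∫ x, s x * pd i (pd j (cv (nu 0 L) (jac a b))) x ≤ C * ((∫ x, gsq a x) + ∫ x, gsq b x) := by
  obtain ⟨C, hC0, hC⟩ := weighted_bounds
  refine ⟨4 * (3 * C + 1), by positivity, ?_⟩
  intro L hL s a b hs ha hb h1 i j
  have h0 : (0 : ℝ) ∈ Set.Icc 0 L := ⟨le_rfl, hL⟩
  set h := pd i (pd j s) with hdef
  have hh : Nice h := (hs.pd j).pd i
  have hjac : ∀ r, jac (heat r a) (heat r b) = fun x => heat r (pd 0 a) x * heat r (pd 1 b) x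
      - heat r (pd 1 a) x * heat r (pd 0 b) x := fun r => by
    funext x; simp only [jac, pd_heat ha, pd_heat hb]
  have hjac' : ∀ {a b : V → ℝ}, Nice a → Nice b →
      Fam L fun r x => jac (heat r a) (heat r b) x := fun {a b} ha hb => by
    simp only [jac, pd_heat ha, pd_heat hb]
    exact ((fam_heat (ha.pd 0) L).mul (fam_heat (hb.pd 1) L)).sub
      ((fam_heat (ha.pd 1) L).mul (fam_heat (hb.pd 0) L))
  -- rewriting the left side as the initial value of a family
  have e1 : ∫ x, s x * pd i (pd j (cv (nu 0 L) (jac a b))) x = ∫ x, Xi L h 0 x * jac a b x := by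
    have hj := ha.jac hb
    have hcv := hj.cv (nu 0 L)
    rw [hs.integral_mul_pd (hcv.pd j) i, (hs.pd i).integral_mul_pd hcv j, neg_neg,
      integral_mul_cv _ ((hs.pd i).pd j) hj, pd_comm j i hs.sm, ← hdef, Xi_eq hh h0]
  have FX : Fam L (Xi L h) := fam_Xi hh
  have Fh := fam_heat hh L
  have Q : Fam L (fun r x => Xi L h r x * jac (heat r a) (heat r b) x) := FX.mul (hjac' ha hb)
  have R : Fam L (fun r x => r * (heat r h x * jac (heat r a) (heat r b) x
      - Xi L h r x * (jac (heat r (lap a)) (heat r b) x + jac (heat r a) (heat r (lap b)) x))) :=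
    ((Fh.mul (hjac' ha hb)).sub (FX.mul ((hjac' ha.lap hb).add (hjac' ha hb.lap)))).smul continuous_id
  have hder := IL_deriv Q.neg R hL fun r _ x => by
    have d0 := hasDerivAt_Xi (L := L) hh r x
    have da := fun k => hasDerivAt_heat (ha.pd k) r x
    have db := fun k => hasDerivAt_heat (hb.pd k) r x
    have := (d0.mul (((da 0).mul (db 1)).sub ((da 1).mul (db 0)))).neg
    simp only [hjac]
    refine this.congr_deriv ?_
    simp only [jac, pd_heat ha, pd_heat hb, pd_heat ha.lap, pd_heat hb.lap, ha.lap_pd, hb.lap_pd,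
      Pi.mul_apply, Pi.sub_apply]
    ring
  have e2 : ∫ x, Xi L h 0 x * jac a b x = IL L (fun r x => r * (heat r h x * jac (heat r a) (heat r b) x
      - Xi L h r x * (jac (heat r (lap a)) (heat r b) x + jac (heat r a) (heat r (lap b)) x))) := by
    rw [hder]
    simp only [Xi_self, zero_mul, neg_zero, integral_zero, integral_neg, zero_sub, neg_neg]
    simp only [show heat 0 a = a from heat_zero, show heat 0 b = b from heat_zero]
  -- the majorant
  let B : (V → ℝ) → ℝ → V → ℝ := fun g r x => r * (pd j (heat r s) x ^ 2 * heat r g x ^ 2)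
      + r * (gsq (Xi L h r) x * heat r g x ^ 2) + r * gsq (heat r g) x
  let B' : (V → ℝ) → ℝ → V → ℝ := fun g r x => r * (pd j (heat r s) x ^ 2 * heat r g x ^ 2)
      + ∑ l, r * (Xi L (pd l h) r x ^ 2 * heat r g x ^ 2) + r * gsq (heat r g) x
  have F1 : ∀ g, Nice g → Fam L (fun r x => r * (pd j (heat r s) x ^ 2 * heat r g x ^ 2)) := fun g hg => by
    simp only [pd_heat hs]
    exact ((fam_heat (hs.pd j) L).sq.mul (fam_heat hg L).sq).smul continuous_id
  have F2 : ∀ g, Nice g → ∀ l, Fam L (fun r x => r * (Xi L (pd l h) r x ^ 2 * heat r g x ^ 2)) :=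
    fun g hg l => ((fam_Xi (hh.pd l)).sq.mul (fam_heat hg L).sq).smul continuous_id
  have FB' : ∀ g, Nice g → Fam L (B' g) := fun g hg =>
    ((F1 g hg).add (Fam.sum fun l _ => F2 g hg l)).add (energy_le hg hL).1
  have hBB : ∀ g, ∀ r ∈ Set.Icc 0 L, ∀ x, B g r x = B' g r x := fun g r hr x => by
    simp only [B, B', gsq, pd_Xi hh hr, Fin.sum_univ_two]
    ring
  have hIB : ∀ g, Nice g → IL L (B' g) ≤ (3 * C + 1) * ∫ x, g x ^ 2 := fun g hg => by
    have hb := hC L hL s g hs hg h1 i j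
    have hE := (energy_le hg hL).2
    have G0 : 0 ≤ ∫ x, g x ^ 2 := integral_nonneg fun _ => sq_nonneg _
    simp only [B']
    rw [IL_add ((F1 g hg).add (Fam.sum fun l _ => F2 g hg l)) (energy_le hg hL).1,
      IL_add (F1 g hg) (Fam.sum fun l _ => F2 g hg l), IL_sum _ fun l _ => F2 g hg l, Fin.sum_univ_two]
    linarith [hb.1, hb.2 0, hb.2 1]
  have FT : Fam L (fun r x => 4 * ∑ k, (B' (pd k a) r x + B' (pd k b) r x)) :=
    (Fam.sum fun k _ => (FB' _ (ha.pd k)).add (FB' _ (hb.pd k))).smul (c := fun _ => 4) continuous_const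
  have hs1 := IL_mono_slice R FT fun r hr => by
    have hr' := Set.Ioc_subset_Icc_self hr
    have := jacobian_slice (nice_heat hs r) (nice_Xi hh hr') (nice_heat ha r) (nice_heat hb r) i j hr.1.le
    refine le_trans (le_of_eq ?_) (this.trans (le_of_eq ?_))
    · simp only [lap_heat ha, lap_heat hb, pd_heat hs, pd_heat (hs.pd j), hdef]
    · refine integral_congr_ae (ae_of_all _ fun x => ?_)
      simp only [← hBB _ r hr', B, pd_heat ha, pd_heat hb]
  rw [IL_const_mul, IL_sum _ fun k _ => (FB' _ (ha.pd k)).add (FB' _ (hb.pd k)), Fin.sum_univ_two,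
    IL_add (FB' _ (ha.pd 0)) (FB' _ (hb.pd 0)), IL_add (FB' _ (ha.pd 1)) (FB' _ (hb.pd 1))] at hs1
  have eg : ∀ f, Nice f → ∫ x, gsq f x = (∫ x, pd 0 f x ^ 2) + ∫ x, pd 1 f x ^ 2 := fun f hf => by
    simp only [gsq, Fin.sum_univ_two]
    exact integral_add (hf.pd 0).sq_int (hf.pd 1).sq_int
  rw [e1, e2, eg a ha, eg b hb]
  linarith [hIB _ (ha.pd 0), hIB _ (ha.pd 1), hIB _ (hb.pd 0), hIB _ (hb.pd 1)]

/-- Compensated compactness: second derivatives of the potential of a Jacobian are controlled in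
`L¹` by the Dirichlet energy, uniformly in the truncation. -/
theorem abs_jacobian_le : ∃ C : ℝ, 0 ≤ C ∧ ∀ (L : ℝ), 0 ≤ L → ∀ s a b : V → ℝ, Nice s → Nice a → Nice b →
    (∀ x, |s x| ≤ 1) → ∀ i j,
    |∫ x, s x * pd i (pd j (cv (nu 0 L) (jac a b))) x| ≤ C * ((∫ x, gsq a x) + ∫ x, gsq b x) := by
  obtain ⟨C, hC0, hC⟩ := jacobian_le
  refine ⟨C, hC0, fun L hL s a b hs ha hb h1 i j => abs_le.2 ⟨?_, hC L hL s a b hs ha hb h1 i j⟩⟩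
  have h := hC L hL (fun x => -s x) a b hs.neg ha hb (by simpa using h1) i j
  simp only [neg_mul, integral_neg] at h
  linarith

end

theorem integrable_mul_of_sq {α : Type*} [MeasurableSpace α] {μ : Measure α} {f g : α → ℝ}
    (hf : AEStronglyMeasurable f μ) (hg : AEStronglyMeasurable g μ)
    (hf2 : Integrable (fun x => f x ^ 2) μ) (hg2 : Integrable (fun x => g x ^ 2) μ) :
    Integrable (fun x => f x * g x) μ := by
  refine (hf2.add hg2).mono' (hf.mul hg) (ae_of_all _ fun x => ?_)
  simp only [Real.norm_eq_abs, abs_mul, Pi.add_apply]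
  nlinarith [sq_nonneg (|f x| - |g x|), sq_abs (f x), sq_abs (g x), sq_nonneg (f x), sq_nonneg (g x)]

/-- A fixed smooth cutoff function. -/
def bump : ContDiffBump (0 : V) := ⟨1, 2, by norm_num, by norm_num⟩

/-- The cutoff function at scale `R`. -/
def eta (R : ℝ) (x : V) : ℝ := bump (R⁻¹ • x)

theorem sm_bump : Sm (bump : V → ℝ) := bump.contDiff

theorem sm_eta (R : ℝ) : Sm (eta R) := sm_bump.comp (contDiff_const_smul _)

theorem eta_nonneg (R : ℝ) (x : V) : 0 ≤ eta R x := bump.nonneg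

theorem eta_le_one (R : ℝ) (x : V) : eta R x ≤ 1 := bump.le_one

theorem eta_eq_one {R : ℝ} (hR : 0 < R) {x : V} (hx : ‖x‖ ≤ R) : eta R x = 1 := by
  refine bump.one_of_mem_closedBall ?_
  rw [mem_closedBall_zero_iff, norm_smul, norm_inv, Real.norm_of_nonneg hR.le]
  change _ ≤ (1 : ℝ)
  rw [inv_mul_le_iff₀ hR]; linarith

theorem eta_eq_zero {R : ℝ} (hR : 0 < R) {x : V} (hx : 2 * R ≤ ‖x‖) : eta R x = 0 := by
  refine bump.zero_of_le_dist ?_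
  rw [dist_zero_right, norm_smul, norm_inv, Real.norm_of_nonneg hR.le]
  change (2 : ℝ) ≤ _
  rw [le_inv_mul_iff₀ hR]; linarith

theorem eta_compact {R : ℝ} (hR : 0 < R) : HasCompactSupport (eta R) := by
  refine HasCompactSupport.of_support_subset_isCompact (isCompact_closedBall (0 : V) (2 * R)) fun x hx => ?_
  rw [mem_closedBall_zero_iff]
  by_contra h
  exact hx (eta_eq_zero hR (not_le.1 h).le)

theorem nice_eta {R : ℝ} (hR : 0 < R) : Nice (eta R) := Nice.of_compact (sm_eta R) (eta_compact hR)

theorem pd_eta (R : ℝ) (i : Fin 2) : pd i (eta R) = fun x => R⁻¹ * pd i bump (R⁻¹ • x) := by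
  have h := pd_affine i sm_bump.diff 0 R⁻¹
  simp only [zero_add] at h
  exact h

theorem pd_pd_eta (R : ℝ) (i j : Fin 2) :
    pd j (pd i (eta R)) = fun x => R⁻¹ * (R⁻¹ * pd j (pd i bump) (R⁻¹ • x)) := by
  rw [pd_eta]
  have h := pd_affine j (sm_bump.pd i).diff 0 R⁻¹
  simp only [zero_add] at h
  have hd : Sm fun x => pd i bump (R⁻¹ • x) := (sm_bump.pd i).comp (contDiff_const_smul _)
  rw [pd_const_mul j _ hd.diff, h]

theorem exists_eta_bound : ∃ C : ℝ, 0 ≤ C ∧ ∀ R : ℝ, 0 < R → ∀ (i j : Fin 2) (x : V),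
    |pd i (eta R) x| ≤ C / R ∧ |pd j (pd i (eta R)) x| ≤ C / R ^ 2 := by
  have hn : Nice (bump : V → ℝ) := Nice.of_compact sm_bump bump.hasCompactSupport
  choose C1 h1 using fun i => (hn.pd i).bdd
  choose C2 h2 using fun i j => ((hn.pd i).pd j).bdd
  have p1 : ∀ i, 0 ≤ C1 i := fun i => (abs_nonneg _).trans (h1 i 0)
  have p2 : ∀ i j, 0 ≤ C2 i j := fun i j => (abs_nonneg _).trans (h2 i j 0)
  refine ⟨∑ i, C1 i + ∑ i, ∑ j, C2 i j, add_nonneg (Finset.sum_nonneg fun i _ => p1 i)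
    (Finset.sum_nonneg fun i _ => Finset.sum_nonneg fun j _ => p2 i j), fun R hR i j x => ?_⟩
  have q1 : C1 i ≤ ∑ i, C1 i := Finset.single_le_sum (fun i _ => p1 i) (Finset.mem_univ i)
  have q2 : C2 i j ≤ ∑ i, ∑ j, C2 i j :=
    (Finset.single_le_sum (fun j _ => p2 i j) (Finset.mem_univ j)).trans
    (Finset.single_le_sum (f := fun i => ∑ j, C2 i j)
      (fun i _ => Finset.sum_nonneg fun j _ => p2 i j) (Finset.mem_univ i))
  have q3 : 0 ≤ ∑ i, C1 i := Finset.sum_nonneg fun i _ => p1 i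
  have q4 : 0 ≤ ∑ i, ∑ j, C2 i j := Finset.sum_nonneg fun i _ => Finset.sum_nonneg fun j _ => p2 i j
  constructor
  · rw [pd_eta, abs_mul, abs_inv, abs_of_pos hR, div_eq_inv_mul]
    refine mul_le_mul_of_nonneg_left ?_ (by positivity)
    linarith [h1 i (R⁻¹ • x)]
  · rw [pd_pd_eta, abs_mul, abs_mul, abs_inv, abs_of_pos hR, div_eq_inv_mul, pow_two, mul_inv, mul_assoc]
    refine mul_le_mul_of_nonneg_left (mul_le_mul_of_nonneg_left ?_ (by positivity)) (by positivity)
    linarith [h2 i j (R⁻¹ • x)]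

/-- Cutoff radii tending to infinity. -/
def rad (n : ℕ) : ℝ := n + 1

theorem rad_pos (n : ℕ) : 0 < rad n := by unfold rad; positivity

theorem one_le_rad (n : ℕ) : 1 ≤ rad n := by unfold rad; linarith [(Nat.cast_nonneg n : (0 : ℝ) ≤ n)]

theorem tendsto_rad : Tendsto rad atTop atTop :=
  tendsto_atTop_add_const_right _ _ tendsto_natCast_atTop_atTop

theorem tendsto_const_div_rad (C : ℝ) : Tendsto (fun n => C / rad n) atTop (nhds 0) :=
  tendsto_const_nhds.div_atTop tendsto_rad

theorem eventually_eta_eq_one (x : V) : ∀ᶠ n in atTop, eta (rad n) x = 1 := by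
  filter_upwards [tendsto_rad.eventually_ge_atTop ‖x‖] with n hn using eta_eq_one (rad_pos n) hn

theorem tendsto_eta (x : V) : Tendsto (fun n => eta (rad n) x) atTop (nhds 1) :=
  tendsto_const_nhds.congr' ((eventually_eta_eq_one x).mono fun _ h => h.symm)

theorem tendsto_integral_eta_mul {f : V → ℝ} (hf : Integrable f) :
    Tendsto (fun n => ∫ x, eta (rad n) x * f x) atTop (nhds (∫ x, f x)) := by
  refine tendsto_integral_of_dominated_convergence (fun x => |f x|)
    (fun n => ((sm_eta _).diff.continuous.aestronglyMeasurable).mul hf.1) hf.abs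
    (fun n => ae_of_all _ fun x => ?_) (ae_of_all _ fun x => ?_)
  · rw [Real.norm_eq_abs, abs_mul, abs_of_nonneg (eta_nonneg _ _)]
    exact mul_le_of_le_one_left (abs_nonneg _) (eta_le_one _ _)
  · simpa using (tendsto_eta x).mul_const (f x)

/-- Integrals against a product with a small bounded factor vanish in the limit. -/
theorem tendsto_integral_small_mul {f : V → ℝ} (hf : Integrable f) {a : ℕ → V → ℝ}
    {b : ℕ → ℝ} (hb : ∀ n x, |a n x| ≤ b n)
    (hb0 : Tendsto b atTop (nhds 0)) :
    Tendsto (fun n => ∫ x, a n x * f x) atTop (nhds 0) := by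
  refine squeeze_zero_norm (a := fun n => b n * ∫ x, |f x|) (fun n => ?_) ?_
  · rw [← integral_const_mul]
    refine norm_integral_le_of_norm_le (f := fun x => a n x * f x) (hf.abs.const_mul _)
      (ae_of_all _ fun x => ?_)
    rw [Real.norm_eq_abs, abs_mul]
    exact mul_le_mul_of_nonneg_right (hb n x) (abs_nonneg _)
  · simpa using hb0.mul_const (∫ x, |f x|)

theorem integrable_bdd_mul {f g : V → ℝ} (hf : Integrable f) (hg : Continuous g) {C : ℝ}
    (hC : ∀ x, |g x| ≤ C) : Integrable fun x => g x * f x :=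
  hf.bdd_mul (c := C) hg.aestronglyMeasurable (ae_of_all _ hC)

theorem tendsto_integral_pd_cutoff {T φ : V → ℝ} (hT : Continuous T) (hT2 : Integrable fun x => T x ^ 2)
    (hφ : Nice φ) (j : Fin 2) :
    Tendsto (fun n => ∫ x, T x * pd j (fun y => eta (rad n) y * φ y) x) atTop
      (nhds (∫ x, T x * pd j φ x)) := by
  obtain ⟨C, _, hC⟩ := exists_eta_bound
  have i0 : Integrable fun x => T x * φ x := integrable_mul_of_sq hT.aestronglyMeasurable
    hφ.cont.aestronglyMeasurable hT2 hφ.sq_int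
  have i1 : Integrable fun x => T x * pd j φ x := integrable_mul_of_sq hT.aestronglyMeasurable
    (hφ.pd j).cont.aestronglyMeasurable hT2 (hφ.pd j).sq_int
  have l0 := tendsto_integral_small_mul i0 (fun n x => (hC (rad n) (rad_pos n) j j x).1) (tendsto_const_div_rad C)
  have l1 := tendsto_integral_eta_mul i1
  have := l0.add l1
  rw [zero_add] at this
  refine this.congr fun n => ?_
  have k0 := integrable_bdd_mul i0 ((sm_eta (rad n)).pd j).diff.continuous
    (fun x => (hC (rad n) (rad_pos n) j j x).1)
  have k1 := integrable_bdd_mul i1 (sm_eta (rad n)).diff.continuous (C := 1)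
    (fun x => by rw [abs_of_nonneg (eta_nonneg _ _)]; exact eta_le_one _ _)
  rw [← integral_add k0 k1, pd_mul j (sm_eta _).diff hφ.diff]
  refine integral_congr_ae (ae_of_all _ fun x => ?_)
  simp only; ring

theorem tendsto_integral_pd_pd_cutoff {T φ : V → ℝ} (hT : Continuous T)
    (hT2 : Integrable fun x => T x ^ 2) (hφ : Nice φ) (i j : Fin 2) :
    Tendsto (fun n => ∫ x, T x * pd j (pd i (fun y => eta (rad n) y * φ y)) x) atTop
      (nhds (∫ x, T x * pd j (pd i φ) x)) := by
  obtain ⟨C, hC0, hC⟩ := exists_eta_bound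
  have i0 : Integrable fun x => T x * φ x := integrable_mul_of_sq hT.aestronglyMeasurable
    hφ.cont.aestronglyMeasurable hT2 hφ.sq_int
  have i1 : ∀ j, Integrable fun x => T x * pd j φ x := fun j =>
    integrable_mul_of_sq hT.aestronglyMeasurable
    (hφ.pd j).cont.aestronglyMeasurable hT2 (hφ.pd j).sq_int
  have l0 := tendsto_integral_small_mul i0 (b := fun n => C / rad n) (fun n x => ((hC (rad n) (rad_pos n) i j x).2).trans (by
      have := one_le_rad n
      gcongr
      nlinarith)) (tendsto_const_div_rad C)
  have l1 := tendsto_integral_small_mul (i1 j) (fun n x => (hC (rad n) (rad_pos n) i i x).1) (tendsto_const_div_rad C)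
  have l2 := tendsto_integral_pd_cutoff hT hT2 (hφ.pd i) j
  have := (l0.add l1).add l2
  rw [zero_add, zero_add] at this
  refine this.congr fun n => ?_
  have hn := nice_eta (rad_pos n)
  have k0 : Integrable fun x => pd j (pd i (eta (rad n))) x * (T x * φ x) :=
    integrable_bdd_mul i0 (((sm_eta (rad n)).pd i).pd j).diff.continuous
    (fun x => (hC (rad n) (rad_pos n) i j x).2)
  have k1 : Integrable fun x => pd i (eta (rad n)) x * (T x * pd j φ x) :=
    integrable_bdd_mul (i1 j) ((sm_eta (rad n)).pd i).diff.continuous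
    (fun x => (hC (rad n) (rad_pos n) i i x).1)
  have k2 : Integrable fun x => T x * pd j (fun y => eta (rad n) y * pd i φ y) x :=
    integrable_mul_of_sq hT.aestronglyMeasurable ((hn.mul (hφ.pd i)).pd j).cont.aestronglyMeasurable
      hT2 ((hn.mul (hφ.pd i)).pd j).sq_int
  have k01 : Integrable fun x => pd j (pd i (eta (rad n))) x * (T x * φ x) +
      pd i (eta (rad n)) x * (T x * pd j φ x) := k0.add k1
  rw [← integral_add k0 k1, ← integral_add k01 k2, pd_mul i hn.diff hφ.diff,
    pd_add j ((hn.pd i).mul hφ).diff (hn.mul (hφ.pd i)).diff, pd_mul j (hn.pd i).diff hφ.diff]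
  refine integral_congr_ae (ae_of_all _ fun x => ?_)
  simp only; ring

/-- Integration by parts against a compactly supported function. -/
theorem integral_mul_pd_compact {f g : V → ℝ} (hf : Sm f) (hg : Sm g) (hc : HasCompactSupport g)
    (i : Fin 2) : ∫ x, f x * pd i g x = - ∫ x, pd i f x * g x :=
  integral_mul_pd i hf.diff hg.diff
    ((hf.diff.continuous.mul hg.diff.continuous).integrable_of_hasCompactSupport hc.mul_left)
    (((hf.pd i).diff.continuous.mul hg.diff.continuous).integrable_of_hasCompactSupport hc.mul_left)
    ((hf.diff.continuous.mul (hg.pd i).diff.continuous).integrable_of_hasCompactSupport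
      (hasCompactSupport_pd hc i).mul_left)

theorem integrable_mul_compact {f g : V → ℝ} (hf : Continuous f) (hg : Continuous g)
    (hc : HasCompactSupport g) : Integrable fun x => f x * g x :=
  (hf.mul hg).integrable_of_hasCompactSupport hc.mul_left

/-- Square integrable divergence free fields are orthogonal to gradients. -/
theorem integral_divFree_mul_grad {X : Fin 2 → V → ℝ} (hX : ∀ i, Sm (X i))
    (h2 : ∀ i, Integrable fun x => X i x ^ 2) (hd : ∀ x, ∑ i, pd i (X i) x = 0) {φ : V → ℝ}
    (hφ : Nice φ) : ∑ i, ∫ x, X i x * pd i φ x = 0 := by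
  have l := tendsto_finsetSum (Finset.univ : Finset (Fin 2)) fun i _ =>
    tendsto_integral_pd_cutoff (hX i).diff.continuous (h2 i) hφ i
  refine tendsto_nhds_unique l (tendsto_const_nhds.congr fun n => ?_)
  have hs : Sm fun y => eta (rad n) y * φ y := (sm_eta _).mul hφ.sm
  have hc : HasCompactSupport fun y => eta (rad n) y * φ y := (eta_compact (rad_pos n)).mul_right
  simp only [fun i => integral_mul_pd_compact (hX i) hs hc i]
  rw [Finset.sum_neg_distrib, ← integral_finsetSum]
  · simp only [← Finset.sum_mul, hd]; simp
  · intro i _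
    exact integrable_mul_compact ((hX i).pd i).diff.continuous hs.diff.continuous hc

theorem integral_pd_pd_sq {q : V → ℝ} (hq : Nice q) (i j : Fin 2) :
    ∫ x, pd j (pd i q) x ^ 2 = ∫ x, pd j (pd j q) x * pd i (pd i q) x := by
  have h1 := ((hq.pd i).pd j).integral_mul_pd (hq.pd i) j
  have h2 := ((hq.pd j).pd j).integral_mul_pd (hq.pd i) i
  have e : pd i (pd j (pd j q)) = pd j (pd j (pd i q)) := by
    rw [pd_comm i j (hq.sm.pd j), pd_comm i j hq.sm]
  rw [h2, e, ← h1]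
  simp only [pow_two]

theorem sum_integral_pd_pd_sq {q : V → ℝ} (hq : Nice q) :
    ∑ i, ∑ j, ∫ x, pd j (pd i q) x ^ 2 = ∫ x, lap q x ^ 2 := by
  have hi : ∀ i j, Integrable fun x => pd j (pd j q) x * pd i (pd i q) x := fun i j =>
    (((hq.pd j).pd j).mul ((hq.pd i).pd i)).int
  have e : ∀ x, lap q x ^ 2 = ∑ i, ∑ j, pd j (pd j q) x * pd i (pd i q) x := fun x => by
    simp only [lap, ← Finset.sum_mul, ← Finset.mul_sum, pow_two]
  simp only [integral_pd_pd_sq hq, e]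
  rw [integral_finsetSum _ fun i _ => integrable_finsetSum _ fun j _ => hi i j]
  exact Finset.sum_congr rfl fun i _ => (integral_finsetSum _ fun j _ => hi i j).symm

/-- Cauchy–Schwarz for finite families of functions. -/
theorem abs_sum_integral_mul_le {ι α : Type*} [MeasurableSpace α] {μ : Measure α} (s : Finset ι)
    {f g : ι → α → ℝ}
    (hf : ∀ i, AEStronglyMeasurable (f i) μ) (hg : ∀ i, AEStronglyMeasurable (g i) μ)
    (hf2 : ∀ i, Integrable (fun x => f i x ^ 2) μ) (hg2 : ∀ i, Integrable (fun x => g i x ^ 2) μ) :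
    |∑ i ∈ s, ∫ x, f i x * g i x ∂μ| ≤
      √(∑ i ∈ s, ∫ x, f i x ^ 2 ∂μ) * √(∑ i ∈ s, ∫ x, g i x ^ 2 ∂μ) := by
  refine (Finset.abs_sum_le_sum_abs _ _).trans ((Finset.sum_le_sum fun i _ =>
    abs_integral_mul_le_sqrt (hf i) (hg i) (hf2 i) (hg2 i)).trans ?_)
  exact Real.sum_sqrt_mul_sqrt_le s (fun i => integral_nonneg fun x => sq_nonneg _)
    (fun i => integral_nonneg fun x => sq_nonneg _)

/-- Cauchy–Schwarz for matrix fields. -/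
theorem abs_sum_sum_integral_mul_le {f g : Fin 2 → Fin 2 → V → ℝ}
    (hf : ∀ i j, Continuous (f i j)) (hg : ∀ i j, Continuous (g i j))
    (hf2 : ∀ i j, Integrable (fun x => f i j x ^ 2)) (hg2 : ∀ i j, Integrable (fun x => g i j x ^ 2)) :
    |∑ i, ∑ j, ∫ x, f i j x * g i j x| ≤
      √(∑ i, ∑ j, ∫ x, f i j x ^ 2) * √(∑ i, ∑ j, ∫ x, g i j x ^ 2) := by
  have := abs_sum_integral_mul_le (Finset.univ : Finset (Fin 2 × Fin 2)) (μ := volume)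
    (f := fun p => f p.1 p.2) (g := fun p => g p.1 p.2)
    (fun p => (hf _ _).aestronglyMeasurable) (fun p => (hg _ _).aestronglyMeasurable)
    (fun p => hf2 _ _) (fun p => hg2 _ _)
  simpa only [Fintype.sum_prod_type] using this

theorem lap_cv_nu {g : V → ℝ} (hg : Nice g) {L : ℝ} (hL : 0 ≤ L) (x : V) :
    lap (cv (nu 0 L) g) x = heat L g x - g x := by
  have h := heat_sub_heat hg le_rfl hL x
  rw [heat_zero_apply] at h
  rw [h]
  have e : ∀ i, pd i (pd i (cv (nu 0 L) g)) = cv (nu 0 L) (pd i (pd i g)) := fun i => by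
    rw [pd_cv _ hg, pd_cv _ (hg.pd i)]
  have e2 : lap g = fun x => pd 0 (pd 0 g) x + pd 1 (pd 1 g) x := by
    funext x; simp [lap, Fin.sum_univ_two]
  rw [e2, cv_add _ ((hg.pd 0).pd 0) ((hg.pd 1).pd 1)]
  simp only [lap, Fin.sum_univ_two, e]

theorem integral_lap_cv_nu_sq_le {g : V → ℝ} (hg : Nice g) {L : ℝ} (hL : 0 ≤ L) :
    ∫ x, lap (cv (nu 0 L) g) x ^ 2 ≤ 4 * ∫ x, g x ^ 2 := by
  have hh := nice_heat hg L
  calc ∫ x, lap (cv (nu 0 L) g) x ^ 2 ≤ ∫ x, (2 * heat L g x ^ 2 + 2 * g x ^ 2) := by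
        refine integral_mono (hg.cv _).lap.sq_int ((hh.sq_int.const_mul 2).add (hg.sq_int.const_mul 2))
          fun x => ?_
        simp only [lap_cv_nu hg hL]
        nlinarith [sq_nonneg (heat L g x + g x)]
    _ = 2 * (∫ x, heat L g x ^ 2) + 2 * ∫ x, g x ^ 2 := by
        rw [integral_add (hh.sq_int.const_mul 2) (hg.sq_int.const_mul 2), integral_const_mul,
          integral_const_mul]
    _ ≤ _ := by linarith [integral_heat_sq_le hg L]

/-- `L²` bound for the truncated double Riesz transforms. -/
theorem abs_sum_integral_mul_hess_le {M : Fin 2 → Fin 2 → V → ℝ} (hM : ∀ i j, Continuous (M i j))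
    (hM2 : ∀ i j, Integrable fun x => M i j x ^ 2) {g : V → ℝ} (hg : Nice g) {L : ℝ} (hL : 0 ≤ L) :
    |∑ i, ∑ j, ∫ x, M i j x * pd j (pd i (cv (nu 0 L) g)) x| ≤
      2 * √(∑ i, ∑ j, ∫ x, M i j x ^ 2) * √(∫ x, g x ^ 2) := by
  have hq := hg.cv (nu 0 L)
  refine (abs_sum_sum_integral_mul_le hM (fun i j => ((hq.pd i).pd j).cont) hM2
    fun i j => ((hq.pd i).pd j).sq_int).trans ?_
  rw [sum_integral_pd_pd_sq hq]
  have := Real.sqrt_le_sqrt (integral_lap_cv_nu_sq_le hg hL)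
  rw [Real.sqrt_mul (by norm_num), show √(4 : ℝ) = 2 by
    rw [show (4 : ℝ) = 2 ^ 2 by norm_num]; exact Real.sqrt_sq (by norm_num)] at this
  calc _ ≤ √(∑ i, ∑ j, ∫ x, M i j x ^ 2) * (2 * √(∫ x, g x ^ 2)) := by gcongr
    _ = _ := by ring

theorem sqrt_integral_heat_sq_le {f : V → ℝ} (hf : Nice f) {L : ℝ} (hL : 0 < L) :
    √(∫ x, heat L f x ^ 2) ≤ (∫ x, |f x|) / L := by
  have h0 : 0 ≤ ∫ x, |f x| := integral_nonneg fun x => abs_nonneg _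
  refine Real.sqrt_le_iff.2 ⟨by positivity, ?_⟩
  have hh := nice_heat hf L
  calc ∫ x, heat L f x ^ 2 ≤ ∫ x, ((L ^ 2)⁻¹ * ∫ y, |f y|) * |heat L f x| := by
        refine integral_mono hh.sq_int (hh.int.abs.const_mul _) fun x => ?_
        simp only [← sq_abs (heat L f x), pow_two |heat L f x|]
        exact mul_le_mul_of_nonneg_right (abs_heat_le hf hL x) (abs_nonneg _)
    _ = ((L ^ 2)⁻¹ * ∫ y, |f y|) * ∫ x, |heat L f x| := integral_const_mul _ _
    _ ≤ ((L ^ 2)⁻¹ * ∫ y, |f y|) * ∫ x, |f x| := by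
        have := integral_abs_heat_le hf L
        gcongr
    _ = _ := by field_simp

theorem tendsto_integral_mul_heat {T f : V → ℝ} (hT : Continuous T) (hT2 : Integrable fun x => T x ^ 2)
    (hf : Nice f) : Tendsto (fun L => ∫ x, T x * heat L f x) atTop (nhds 0) := by
  have l : Tendsto (fun L : ℝ => √(∫ x, T x ^ 2) * ((∫ x, |f x|) / L)) atTop (nhds 0) := by
    simpa using (tendsto_const_nhds (x := ∫ x, |f x|).div_atTop tendsto_id).const_mul √(∫ x, T x ^ 2)
  refine squeeze_zero_norm' ?_ l
  filter_upwards [eventually_gt_atTop 0] with L hL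
  have hh := nice_heat hf L
  refine (abs_integral_mul_le_sqrt hT.aestronglyMeasurable hh.cont.aestronglyMeasurable hT2
    hh.sq_int).trans ?_
  have := sqrt_integral_heat_sq_le hf hL
  gcongr

/-- The data of a pressure equation `∇P = div (W + M) - c` with `div div W = 0`, `div c = 0`. -/
structure PressureEq (P : V → ℝ) (W M : Fin 2 → Fin 2 → V → ℝ) (c : Fin 2 → V → ℝ) : Prop where
  smP : Sm P
  smW : ∀ i j, Sm (W i j)
  smM : ∀ i j, Sm (M i j)
  smc : ∀ i, Sm (c i)
  W2 : ∀ i j, Integrable fun x => W i j x ^ 2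
  M2 : ∀ i j, Integrable fun x => M i j x ^ 2
  c2 : ∀ i, Integrable fun x => c i x ^ 2
  eq : ∀ i x, pd i P x = ∑ j, (pd j (W i j) x + pd j (M i j) x) - c i x
  divW : ∀ j x, ∑ i, pd i (W i j) x = 0
  divc : ∀ x, ∑ i, pd i (c i) x = 0

/-- The weak pressure functional. -/
def pressureForm (W M : Fin 2 → Fin 2 → V → ℝ) (c Z : Fin 2 → V → ℝ) : ℝ :=
  -(∑ i, ∑ j, ((∫ x, W i j x * pd j (Z i) x) + ∫ x, M i j x * pd j (Z i) x)) - ∑ i, ∫ x, c i x * Z i x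

theorem integrable_sq_mul {T f : V → ℝ} (hT : Continuous T) (hT2 : Integrable fun x => T x ^ 2)
    (hf : Nice f) : Integrable fun x => T x * f x :=
  integrable_mul_of_sq hT.aestronglyMeasurable hf.cont.aestronglyMeasurable hT2 hf.sq_int

/-- The rotated gradient. -/
def rotGrad (φ : V → ℝ) (i : Fin 2) : V → ℝ :=
  if i = 0 then fun x => - pd 1 φ x else pd 0 φ

namespace PressureEq
variable {P : V → ℝ} {W M : Fin 2 → Fin 2 → V → ℝ} {c : Fin 2 → V → ℝ}

theorem integral_eq (h : PressureEq P W M c) {Z : Fin 2 → V → ℝ} (hZ : ∀ i, Sm (Z i))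
    (hc : ∀ i, HasCompactSupport (Z i)) :
    ∑ i, ∫ x, pd i P x * Z i x = pressureForm W M c Z := by
  simp only [pressureForm]
  rw [← Finset.sum_neg_distrib, ← Finset.sum_sub_distrib]
  refine Finset.sum_congr rfl fun i _ => ?_
  have iW : ∀ j, Integrable fun x => pd j (W i j) x * Z i x := fun j =>
    integrable_mul_compact ((h.smW i j).pd j).diff.continuous (hZ i).diff.continuous (hc i)
  have iM : ∀ j, Integrable fun x => pd j (M i j) x * Z i x := fun j =>
    integrable_mul_compact ((h.smM i j).pd j).diff.continuous (hZ i).diff.continuous (hc i)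
  have iWM : ∀ j, Integrable fun x => pd j (W i j) x * Z i x + pd j (M i j) x * Z i x := fun j =>
    (iW j).add (iM j)
  have iS : Integrable fun x => ∑ j, (pd j (W i j) x * Z i x + pd j (M i j) x * Z i x) :=
    integrable_finsetSum _ fun j _ => iWM j
  have ic : Integrable fun x => c i x * Z i x :=
    integrable_mul_compact (h.smc i).diff.continuous (hZ i).diff.continuous (hc i)
  simp only [fun j => integral_mul_pd_compact (h.smW i j) (hZ i) (hc i) j,
    fun j => integral_mul_pd_compact (h.smM i j) (hZ i) (hc i) j]
  rw [← Finset.sum_neg_distrib]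
  simp only [h.eq, sub_mul, Finset.sum_mul, add_mul]
  rw [integral_sub iS ic, integral_finsetSum _ fun j _ => iWM j]
  congr 1
  refine Finset.sum_congr rfl fun j _ => ?_
  rw [integral_add (iW j) (iM j)]; ring

theorem form_add (h : PressureEq P W M c) {Y Z : Fin 2 → V → ℝ} (hY : ∀ i, Nice (Y i))
    (hZ : ∀ i, Nice (Z i)) : pressureForm W M c (fun i x => Y i x + Z i x) =
      pressureForm W M c Y + pressureForm W M c Z := by
  have key : ∀ {T f g : V → ℝ}, Sm T → (Integrable fun x => T x ^ 2) → Nice f → Nice g →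
      ∫ x, T x * (f x + g x) = (∫ x, T x * f x) + ∫ x, T x * g x := fun hT hT2 hf hg => by
    simp only [mul_add]
    exact integral_add (integrable_sq_mul hT.diff.continuous hT2 hf)
      (integrable_sq_mul hT.diff.continuous hT2 hg)
  have e : ∀ i j, pd j (fun x => Y i x + Z i x) = fun x => pd j (Y i) x + pd j (Z i) x := fun i j =>
    pd_add j (hY i).diff (hZ i).diff
  simp only [pressureForm, e, fun i => key (h.smc i) (h.c2 i) (hY i) (hZ i),
    fun i j => key (h.smW i j) (h.W2 i j) ((hY i).pd j) ((hZ i).pd j),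
    fun i j => key (h.smM i j) (h.M2 i j) ((hY i).pd j) ((hZ i).pd j), Finset.sum_add_distrib]
  ring

theorem form_grad (h : PressureEq P W M c) {q : V → ℝ} (hq : Nice q) :
    pressureForm W M c (fun i => pd i q) = -∑ i, ∑ j, ∫ x, M i j x * pd j (pd i q) x := by
  have h1 := integral_divFree_mul_grad h.smc h.c2 h.divc hq
  have h2 : ∑ i, ∑ j, ∫ x, W i j x * pd j (pd i q) x = 0 := by
    rw [Finset.sum_comm]
    refine Finset.sum_eq_zero fun j _ => ?_
    simp only [fun i => pd_comm j i hq.sm]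
    exact integral_divFree_mul_grad (fun i => h.smW i j) (fun i => h.W2 i j) (h.divW j) (hq.pd j)
  simp only [pressureForm, Finset.sum_add_distrib, h1, h2]
  ring

theorem form_rotGrad_compact (h : PressureEq P W M c) {φ : V → ℝ} (hs : Sm φ)
    (hc : HasCompactSupport φ) : pressureForm W M c (rotGrad φ) = 0 := by
  have s : ∀ i, Sm (rotGrad φ i) := by
    intro i; fin_cases i
    · exact (hs.pd 1).neg
    · exact hs.pd 0
  have k : ∀ i, HasCompactSupport (rotGrad φ i) := by
    intro i; fin_cases i
    · exact (hasCompactSupport_pd hc 1).neg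
    · exact hasCompactSupport_pd hc 0
  rw [← h.integral_eq s k]
  have e := fun i => integral_mul_pd_compact (h.smP.pd i) hs hc (1 - i)
  have e0 := e 0
  have e1 := e 1
  simp only [Fin.sum_univ_two, rotGrad]
  simp only [sub_zero, sub_self] at e0 e1
  rw [pd_comm 1 0 h.smP] at e0
  simp [integral_neg, e0, e1]

theorem form_rotGrad (h : PressureEq P W M c) {φ : V → ℝ} (hφ : Nice φ) :
    pressureForm W M c (rotGrad φ) = 0 := by
  have l : ∀ {T : V → ℝ}, Sm T → (Integrable fun x => T x ^ 2) → ∀ i j,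
      Tendsto (fun n => ∫ x, T x * pd j (rotGrad (fun y => eta (rad n) y * φ y) i) x) atTop
      (nhds (∫ x, T x * pd j (rotGrad φ i) x)) := by
    intro T hT hT2 i j
    fin_cases i
    · simp only [rotGrad, if_true, Fin.zero_eta, pd_neg, mul_neg, integral_neg]
      exact (tendsto_integral_pd_pd_cutoff hT.diff.continuous hT2 hφ 1 j).neg
    · exact tendsto_integral_pd_pd_cutoff hT.diff.continuous hT2 hφ 0 j
  have l' : ∀ {T : V → ℝ}, Sm T → (Integrable fun x => T x ^ 2) → ∀ i,
      Tendsto (fun n => ∫ x, T x * rotGrad (fun y => eta (rad n) y * φ y) i x) atTop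
      (nhds (∫ x, T x * rotGrad φ i x)) := by
    intro T hT hT2 i
    fin_cases i
    · simp only [rotGrad, if_true, Fin.zero_eta, mul_neg, integral_neg]
      exact (tendsto_integral_pd_cutoff hT.diff.continuous hT2 hφ 1).neg
    · exact tendsto_integral_pd_cutoff hT.diff.continuous hT2 hφ 0
  have L := ((tendsto_finsetSum Finset.univ fun i _ => tendsto_finsetSum Finset.univ fun j _ =>
    (l (h.smW i j) (h.W2 i j) i j).add (l (h.smM i j) (h.M2 i j) i j)).neg).sub
    (tendsto_finsetSum Finset.univ fun i _ => l' (h.smc i) (h.c2 i) i)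
  refine tendsto_nhds_unique L (tendsto_const_nhds.congr fun n => ?_)
  exact (h.form_rotGrad_compact ((sm_eta _).mul hφ.sm) (eta_compact (rad_pos n)).mul_right).symm

theorem tendsto_form_heat (h : PressureEq P W M c) {Z : Fin 2 → V → ℝ} (hZ : ∀ i, Nice (Z i)) :
    Tendsto (fun L => pressureForm W M c fun i => heat L (Z i)) atTop (nhds 0) := by
  have L := ((tendsto_finsetSum Finset.univ fun i _ => tendsto_finsetSum Finset.univ fun j _ =>
    (tendsto_integral_mul_heat (h.smW i j).diff.continuous (h.W2 i j) ((hZ i).pd j)).add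
    (tendsto_integral_mul_heat (h.smM i j).diff.continuous (h.M2 i j) ((hZ i).pd j))).neg).sub
    (tendsto_finsetSum Finset.univ fun i _ =>
      tendsto_integral_mul_heat (h.smc i).diff.continuous (h.c2 i) (hZ i))
  simp only [add_zero, Finset.sum_const_zero, neg_zero, sub_zero] at L
  refine L.congr fun l => ?_
  simp only [pressureForm, fun i j => pd_heat (hZ i) l j]

/-- Representation of the pressure term through the Helmholtz decomposition of the test field. -/
theorem tendsto_integral (h : PressureEq P W M c) {Z : Fin 2 → V → ℝ} (hZ : ∀ i, Sm (Z i))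
    (hc : ∀ i, HasCompactSupport (Z i)) :
    Tendsto (fun L => ∑ i, ∑ j, ∫ x, M i j x *
      pd j (pd i (cv (nu 0 L) (fun y => pd 0 (Z 0) y + pd 1 (Z 1) y))) x) atTop
      (nhds (∑ i, ∫ x, pd i P x * Z i x)) := by
  have hN : ∀ i, Nice (Z i) := fun i => Nice.of_compact (hZ i) (hc i)
  have hd : Nice fun y => pd 0 (Z 0) y + pd 1 (Z 1) y := ((hN 0).pd 0).add ((hN 1).pd 1)
  have hr : Nice fun y => pd 0 (Z 1) y - pd 1 (Z 0) y := ((hN 1).pd 0).sub ((hN 0).pd 1)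
  have hl := (h.tendsto_form_heat hN).const_sub (∑ i, ∫ x, pd i P x * Z i x)
  rw [sub_zero] at hl
  refine hl.congr' ?_
  filter_upwards [eventually_ge_atTop 0] with L hL
  set q : V → ℝ := fun x => -cv (nu 0 L) (fun y => pd 0 (Z 0) y + pd 1 (Z 1) y) x with hq
  set θ : V → ℝ := fun x => -cv (nu 0 L) (fun y => pd 0 (Z 1) y - pd 1 (Z 0) y) x with hθ
  have nq : Nice q := (hd.cv _).neg
  have nθ : Nice θ := (hr.cv _).neg
  have nrot : ∀ i, Nice (rotGrad θ i) := by
    intro i; fin_cases i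
    · exact (nθ.pd 1).neg
    · exact nθ.pd 0
  have dec : ∀ i x, heat L (Z i) x - Z i x = - (pd i q x + rotGrad θ i x) := by
    intro i x
    have a := heat_sub_heat (hN i) le_rfl hL x
    rw [heat_zero_apply] at a
    rw [a]
    have n := hN
    have b0 : lap (Z 0) = fun x => pd 0 (fun y => pd 0 (Z 0) y + pd 1 (Z 1) y) x -
        pd 1 (fun y => pd 0 (Z 1) y - pd 1 (Z 0) y) x := by
      funext x
      rw [pd_add 0 ((n 0).pd 0).diff ((n 1).pd 1).diff, pd_sub 1 ((n 1).pd 0).diff ((n 0).pd 1).diff,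
        pd_comm 1 0 (hZ 1)]
      simp only [lap, Fin.sum_univ_two]; ring
    have b1 : lap (Z 1) = fun x => pd 1 (fun y => pd 0 (Z 0) y + pd 1 (Z 1) y) x +
        pd 0 (fun y => pd 0 (Z 1) y - pd 1 (Z 0) y) x := by
      funext x
      rw [pd_add 1 ((n 0).pd 0).diff ((n 1).pd 1).diff, pd_sub 0 ((n 1).pd 0).diff ((n 0).pd 1).diff,
        pd_comm 1 0 (hZ 0)]
      simp only [lap, Fin.sum_univ_two]; ring
    fin_cases i
    · simp only [Fin.zero_eta, rotGrad, if_true, hq, hθ, pd_neg]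
      rw [b0, cv_sub _ (hd.pd 0) (hr.pd 1), pd_cv _ hd, pd_cv _ hr]; ring
    · simp only [Fin.mk_one, rotGrad, one_ne_zero, if_false, hq, hθ, pd_neg]
      rw [b1, cv_add _ (hd.pd 1) (hr.pd 0), pd_cv _ hd, pd_cv _ hr]; ring
  have e : Z = fun i x => heat L (Z i) x + (pd i q x + rotGrad θ i x) := by
    funext i x; linarith [dec i x]
  rw [h.integral_eq hZ hc]
  conv_lhs => enter [1]; rw [e]
  rw [h.form_add (fun i => nice_heat (hN i) L) (fun i => (nq.pd i).add (nrot i)),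
    h.form_add (fun i => nq.pd i) nrot, h.form_grad nq, h.form_rotGrad nθ]
  simp only [hq, pd_neg, mul_neg, integral_neg, Finset.sum_neg_distrib]
  ring

/-- Pressure bound by the divergence of the test field. -/
theorem abs_integral_le (h : PressureEq P W M c) {Z : Fin 2 → V → ℝ} (hZ : ∀ i, Sm (Z i))
    (hc : ∀ i, HasCompactSupport (Z i)) :
    |∑ i, ∫ x, pd i P x * Z i x| ≤ 2 * √(∑ i, ∑ j, ∫ x, M i j x ^ 2) *
      √(∫ x, (pd 0 (Z 0) x + pd 1 (Z 1) x) ^ 2) := by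
  have hN : ∀ i, Nice (Z i) := fun i => Nice.of_compact (hZ i) (hc i)
  have hd : Nice fun y => pd 0 (Z 0) y + pd 1 (Z 1) y := ((hN 0).pd 0).add ((hN 1).pd 1)
  refine le_of_tendsto (h.tendsto_integral hZ hc).abs ?_
  filter_upwards [eventually_ge_atTop 0] with L hL
  exact abs_sum_integral_mul_hess_le (fun i j => (h.smM i j).diff.continuous) h.M2 hd hL

end PressureEq

theorem abs_integral_hess_jac_le : ∃ C : ℝ, 0 ≤ C ∧ ∀ (s : V → ℝ), Sm s →
    (Integrable fun x => s x ^ 2) → (∀ x, |s x| ≤ 1) → ∀ a b, Nice a → Nice b → ∀ L, 0 ≤ L → ∀ i j,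
    |∫ x, s x * pd j (pd i (cv (nu 0 L) (jac a b))) x| ≤ C * ((∫ x, gsq a x) + ∫ x, gsq b x) := by
  obtain ⟨C, hC0, hC⟩ := abs_jacobian_le
  refine ⟨C, hC0, fun s hs hs2 hs1 a b ha hb L hL i j => ?_⟩
  have hq := (((ha.jac hb).cv (nu 0 L)).pd i).pd j
  have l := tendsto_integral_eta_mul (integrable_sq_mul hs.diff.continuous hs2 hq)
  refine le_of_tendsto l.abs (Eventually.of_forall fun n => ?_)
  have hn : Nice fun x => eta (rad n) x * s x :=
    Nice.of_compact ((sm_eta _).mul hs) (eta_compact (rad_pos n)).mul_right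
  have := hC L hL _ a b hn ha hb (fun x => by
    rw [abs_mul, abs_of_nonneg (eta_nonneg _ _)]
    exact mul_le_one₀ (eta_le_one _ _) (abs_nonneg _) (hs1 x)) j i
  simpa only [mul_assoc] using this

/-- Pressure bound for test fields whose divergence is a Jacobian. -/
theorem PressureEq.abs_integral_jac_le : ∃ C : ℝ, 0 ≤ C ∧
    ∀ (P : V → ℝ) (W S U : Fin 2 → Fin 2 → V → ℝ) (c : Fin 2 → V → ℝ),
    PressureEq P W (fun i j x => S i j x + U i j x) c →
    (∀ i j, Sm (S i j)) → (∀ i j, Sm (U i j)) →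
    (∀ i j, Integrable fun x => S i j x ^ 2) → (∀ i j, Integrable fun x => U i j x ^ 2) →
    (∀ i j x, |S i j x| ≤ 1) → ∀ Z : Fin 2 → V → ℝ, (∀ i, Sm (Z i)) → (∀ i, HasCompactSupport (Z i)) →
    ∀ a b, Nice a → Nice b → (∀ x, pd 0 (Z 0) x + pd 1 (Z 1) x = -2 * jac a b x) →
    |∑ i, ∫ x, pd i P x * Z i x| ≤ C * ((∫ x, gsq a x) + ∫ x, gsq b x) +
      4 * √(∑ i, ∑ j, ∫ x, U i j x ^ 2) * √(∫ x, jac a b x ^ 2) := by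
  obtain ⟨C, hC0, hC⟩ := abs_integral_hess_jac_le
  refine ⟨8 * C, by positivity, fun P W S U c h hS hU hS2 hU2 hS1 Z hZ hc a b ha hb hj => ?_⟩
  have hJ := ha.jac hb
  refine le_of_tendsto (h.tendsto_integral hZ hc).abs ?_
  filter_upwards [eventually_ge_atTop 0] with L hL
  have hq := hJ.cv (nu 0 L)
  have e : cv (nu 0 L) (fun y => pd 0 (Z 0) y + pd 1 (Z 1) y) =
      fun x => -2 * cv (nu 0 L) (jac a b) x := by
    simp only [hj]; exact cv_const_mul _ _
  have e2 : ∀ i j, pd j (pd i (fun x => -2 * cv (nu 0 L) (jac a b) x)) =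
      fun x => -2 * pd j (pd i (cv (nu 0 L) (jac a b))) x := fun i j => by
    rw [pd_const_mul i _ hq.diff, pd_const_mul j _ (hq.pd i).diff]
  have e3 : ∀ i j, ∫ x, (S i j x + U i j x) * (-2 * pd j (pd i (cv (nu 0 L) (jac a b))) x) =
      -2 * (∫ x, S i j x * pd j (pd i (cv (nu 0 L) (jac a b))) x) +
      -2 * ∫ x, U i j x * pd j (pd i (cv (nu 0 L) (jac a b))) x := fun i j => by
    have i1 := integrable_sq_mul (hS i j).diff.continuous (hS2 i j) ((hq.pd i).pd j)
    have i2 := integrable_sq_mul (hU i j).diff.continuous (hU2 i j) ((hq.pd i).pd j)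
    rw [← integral_const_mul, ← integral_const_mul, ← integral_add (i1.const_mul _) (i2.const_mul _)]
    congr 1; funext x; ring
  rw [e]
  simp only [e2, e3, Finset.sum_add_distrib, ← Finset.mul_sum]
  have b1 := abs_sum_integral_mul_hess_le (fun i j => (hU i j).diff.continuous) hU2 hJ hL
  have b2 : |∑ i, ∑ j, ∫ x, S i j x * pd j (pd i (cv (nu 0 L) (jac a b))) x| ≤
      ∑ _i : Fin 2, ∑ _j : Fin 2, C * ((∫ x, gsq a x) + ∫ x, gsq b x) := by
    refine (Finset.abs_sum_le_sum_abs _ _).trans (Finset.sum_le_sum fun i _ => ?_)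
    refine (Finset.abs_sum_le_sum_abs _ _).trans (Finset.sum_le_sum fun j _ => ?_)
    exact hC _ (hS i j) (hS2 i j) (hS1 i j) a b ha hb L hL i j
  simp only [Finset.sum_const, Finset.card_univ, Fintype.card_fin, nsmul_eq_mul, Nat.cast_ofNat] at b2
  refine (abs_add_le _ _).trans ?_
  rw [abs_mul, abs_mul, show |(-2 : ℝ)| = 2 by norm_num]
  linarith

/-- Joint smoothness in time and space. -/
abbrev JS (g : ℝ → V → ℝ) : Prop := ContDiff ℝ (⊤ : ℕ∞) (fun p : ℝ × V => g p.1 p.2)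

/-- Time derivative. -/
def dt (g : ℝ → V → ℝ) (t : ℝ) (x : V) : ℝ := deriv (fun s => g s x) t

namespace JS
variable {g h : ℝ → V → ℝ}

theorem sm (hg : JS g) (t : ℝ) : Sm (g t) := hg.comp (contDiff_const.prodMk contDiff_id)

theorem cont (hg : JS g) : Continuous fun p : ℝ × V => g p.1 p.2 := hg.continuous

theorem hasFDerivAt (hg : JS g) (p : ℝ × V) :
    HasFDerivAt (fun p : ℝ × V => g p.1 p.2) (fderiv ℝ (fun p : ℝ × V => g p.1 p.2) p) p :=
  (hg.differentiable (by simp) p).hasFDerivAt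

theorem pd_eq (hg : JS g) (i : Fin 2) (t : ℝ) (x : V) :
    pd i (g t) x = fderiv ℝ (fun p : ℝ × V => g p.1 p.2) (t, x) (0, Pi.single i 1) := by
  have h1 : HasFDerivAt (fun y : V => (t, y)) (ContinuousLinearMap.inr ℝ ℝ V) x := by
    exact hasFDerivAt_prodMk_right t x
  have h2 := (hg.hasFDerivAt (t, x)).comp x h1
  have h3 : HasFDerivAt (g t) ((fderiv ℝ (fun p : ℝ × V => g p.1 p.2) (t, x)).comp
    (ContinuousLinearMap.inr ℝ ℝ V)) x := h2
  rw [_root_.pd, h3.fderiv]; simp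

theorem hasDerivAt' (hg : JS g) (t : ℝ) (x : V) : HasDerivAt (fun s => g s x)
    (fderiv ℝ (fun p : ℝ × V => g p.1 p.2) (t, x) (1, 0)) t := by
  have h1 : HasDerivAt (fun s : ℝ => (s, x)) ((1 : ℝ), (0 : V)) t :=
    (hasDerivAt_id t).prodMk (hasDerivAt_const t x)
  exact (hg.hasFDerivAt (t, x)).comp_hasDerivAt t h1

theorem dt_eq (hg : JS g) (t : ℝ) (x : V) :
    dt g t x = fderiv ℝ (fun p : ℝ × V => g p.1 p.2) (t, x) (1, 0) := (hg.hasDerivAt' t x).deriv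

theorem hasDerivAt (hg : JS g) (t : ℝ) (x : V) : HasDerivAt (fun s => g s x) (dt g t x) t := by
  rw [hg.dt_eq]; exact hg.hasDerivAt' t x

theorem fderiv_const (hg : JS g) (v : ℝ × V) :
    ContDiff ℝ (⊤ : ℕ∞) (fun p => fderiv ℝ (fun p : ℝ × V => g p.1 p.2) p v) :=
  (hg.fderiv_right (m := (⊤ : ℕ∞)) (by simp)).clm_apply contDiff_const

protected theorem pd (hg : JS g) (i : Fin 2) : JS (fun t => pd i (g t)) := by
  have e : (fun p : ℝ × V => pd i (g p.1) p.2) =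
    fun p => fderiv ℝ (fun p : ℝ × V => g p.1 p.2) p (0, Pi.single i 1) := by
    funext p; exact hg.pd_eq i p.1 p.2
  change ContDiff _ _ _
  rw [e]; exact hg.fderiv_const _

protected theorem dt (hg : JS g) : JS (dt g) := by
  have e : (fun p : ℝ × V => _root_.dt g p.1 p.2) =
    fun p => fderiv ℝ (fun p : ℝ × V => g p.1 p.2) p (1, 0) := by
    funext p; exact hg.dt_eq p.1 p.2
  change ContDiff _ _ _
  rw [e]; exact hg.fderiv_const _

protected theorem add (hg : JS g) (hh : JS h) : JS (fun t x => g t x + h t x) := ContDiff.add hg hh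
protected theorem sub (hg : JS g) (hh : JS h) : JS (fun t x => g t x - h t x) := ContDiff.sub hg hh
protected theorem mul (hg : JS g) (hh : JS h) : JS (fun t x => g t x * h t x) := ContDiff.mul hg hh
protected theorem const (c : ℝ) : JS (fun _ _ => c) := contDiff_const
protected theorem pow (hg : JS g) (n : ℕ) : JS (fun t x => g t x ^ n) := ContDiff.pow hg n
protected theorem sum {ι : Type*} (s : Finset ι) {g : ι → ℝ → V → ℝ} (hg : ∀ i, JS (g i)) :
    JS (fun t x => ∑ i ∈ s, g i t x) := ContDiff.sum fun i _ => hg i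
protected theorem space {φ : V → ℝ} (hφ : Sm φ) : JS (fun _ => φ) := hφ.comp contDiff_snd

theorem dt_pd (hg : JS g) (i : Fin 2) (t : ℝ) (x : V) :
    _root_.dt (fun t => _root_.pd i (g t)) t x = _root_.pd i (_root_.dt g t) x := by
  set G : ℝ × V → ℝ := fun p => g p.1 p.2 with hG
  have hd : DifferentiableAt ℝ (fderiv ℝ G) (t, x) :=
    (hg.fderiv_right (m := (⊤ : ℕ∞)) (by simp)).differentiable (by simp) _
  rw [(hg.pd i).dt_eq, hg.dt.pd_eq]
  have e1 : (fun p : ℝ × V => _root_.pd i (g p.1) p.2) = fun p => fderiv ℝ G p (0, Pi.single i 1) := by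
    funext p; exact hg.pd_eq i p.1 p.2
  have e2 : (fun p : ℝ × V => _root_.dt g p.1 p.2) = fun p => fderiv ℝ G p (1, 0) := by
    funext p; exact hg.dt_eq p.1 p.2
  rw [e1, e2, fderiv_clm_apply hd (differentiableAt_const _),
    fderiv_clm_apply hd (differentiableAt_const _)]
  simp only [fderiv_fun_const, Pi.zero_apply, ContinuousLinearMap.comp_zero, zero_add,
    ContinuousLinearMap.flip_apply]
  have hs : IsSymmSndFDerivAt ℝ G (t, x) :=
    (ContDiff.contDiffAt hg).isSymmSndFDerivAt (by
      simp only [minSmoothness_of_isRCLikeNormedField]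
      exact WithTop.coe_le_coe.2 (le_top (a := (2 : ℕ∞))))
  exact hs _ _

theorem dt_add (hg : JS g) (hh : JS h) (t : ℝ) (x : V) :
    _root_.dt (fun t x => g t x + h t x) t x = _root_.dt g t x + _root_.dt h t x :=
  ((hg.hasDerivAt t x).add (hh.hasDerivAt t x)).deriv

theorem dt_mul (hg : JS g) (hh : JS h) (t : ℝ) (x : V) :
    _root_.dt (fun t x => g t x * h t x) t x = _root_.dt g t x * h t x + g t x * _root_.dt h t x :=
  ((hg.hasDerivAt t x).mul (hh.hasDerivAt t x)).deriv

/-- Differentiation under the integral sign over a compact set. -/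
theorem hasDerivAt_setIntegral (hg : JS g) {K : Set V} (hK : IsCompact K) (t : ℝ) :
    HasDerivAt (fun t => ∫ x in K, g t x) (∫ x in K, _root_.dt g t x) t := by
  obtain ⟨C, hC⟩ := (isCompact_Icc (a := t - 1) (b := t + 1)).prod hK |>.exists_bound_of_continuousOn
    (f := fun p : ℝ × V => _root_.dt g p.1 p.2) hg.dt.cont.continuousOn
  have : IsFiniteMeasure (volume.restrict K) := ⟨by simpa using hK.measure_lt_top⟩
  refine (hasDerivAt_integral_of_dominated_loc_of_deriv_le (bound := fun _ => C)
    (F' := fun t x => _root_.dt g t x) (Icc_mem_nhds (show t - 1 < t by linarith) (show t < t + 1 by linarith))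
    (Eventually.of_forall fun s => (hg.sm s).diff.continuous.aestronglyMeasurable)
    ((hg.sm t).diff.continuous.continuousOn.integrableOn_compact hK)
    (hg.dt.sm t).diff.continuous.aestronglyMeasurable ?_ (integrable_const _) ?_).2
  · filter_upwards [ae_restrict_mem hK.measurableSet] with x hx s hs
    exact hC (s, x) ⟨hs, hx⟩
  · exact ae_of_all _ fun x s _ => hg.hasDerivAt s x

theorem hasDerivAt_integral_compact (hg : JS g) {φ : V → ℝ} (hφ : Sm φ) (hc : HasCompactSupport φ)
    (t : ℝ) : HasDerivAt (fun t => ∫ x, φ x * g t x) (∫ x, φ x * _root_.dt g t x) t := by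
  have hJ : JS (fun t x => φ x * g t x) := (JS.space hφ).mul hg
  have hd := hJ.hasDerivAt_setIntegral (K := tsupport φ) hc t
  have z : ∀ x, x ∉ tsupport φ → φ x = 0 := fun x hx => image_eq_zero_of_notMem_tsupport hx
  have e1 : ∀ t, ∫ x in tsupport φ, φ x * g t x = ∫ x, φ x * g t x := fun t =>
    setIntegral_eq_integral_of_forall_compl_eq_zero fun x hx => by rw [z x hx, zero_mul]
  have e2 : ∫ x in tsupport φ, _root_.dt (fun t x => φ x * g t x) t x = ∫ x, φ x * _root_.dt g t x := by
    have : ∀ x, _root_.dt (fun t x => φ x * g t x) t x = φ x * _root_.dt g t x := fun x => by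
      exact ((hg.hasDerivAt t x).const_mul (φ x)).deriv
    simp only [this]
    exact setIntegral_eq_integral_of_forall_compl_eq_zero fun x hx => by rw [z x hx, zero_mul]
  rw [← e2]
  simpa only [e1] using hd

theorem measurable_integral (hg : Continuous fun p : ℝ × V => g p.1 p.2) :
    Measurable fun t => ∫ x, g t x :=
  (hg.stronglyMeasurable.integral_prod_right (ν := volume)).measurable

end JS

theorem abs_pd_le_sqrt_gsq (f : V → ℝ) (i : Fin 2) (x : V) : |pd i f x| ≤ √(gsq f x) :=
  Real.abs_le_sqrt (Finset.single_le_sum (f := fun i => pd i f x ^ 2) (fun _ _ => sq_nonneg _)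
    (Finset.mem_univ i))

theorem continuous_gsq {f : V → ℝ} (hf : Sm f) : Continuous (gsq f) :=
  continuous_finsetSum _ fun i _ => (hf.pd i).diff.continuous.pow 2

theorem abs_fderiv_le (f : V → ℝ) (x v : V) : |fderiv ℝ f x v| ≤ 2 * ‖v‖ * √(gsq f x) := by
  rw [fderiv_apply_eq_sum, Fin.sum_univ_two]
  have h : ∀ i, |v i * pd i f x| ≤ ‖v‖ * √(gsq f x) := fun i => by
    rw [abs_mul]
    exact mul_le_mul (norm_le_pi_norm v i) (abs_pd_le_sqrt_gsq f i x) (abs_nonneg _) (norm_nonneg _)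
  refine (abs_add_le _ _).trans ?_
  linarith [h 0, h 1]

theorem abs_sub_le_of_deriv_le_inv_sqrt {g g' : ℝ → ℝ} {A : ℝ} (hg : ∀ s, HasDerivAt g (g' s) s)
    (h : ∀ s, 0 < s → |g' s| ≤ A / √s) : |g 1 - g 0| ≤ 2 * A := by
  have hs : ∀ s : ℝ, 0 < s → HasDerivAt (fun s => 2 * A * √s) (A / √s) s := fun s hs => by
    refine ((Real.hasDerivAt_sqrt hs.ne').const_mul (2 * A)).congr_deriv ?_
    field_simp
  have hc : Continuous g := continuous_iff_continuousAt.2 fun s => (hg s).continuousAt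
  have hcs : Continuous fun s : ℝ => 2 * A * √s := continuous_const.mul Real.continuous_sqrt
  have key : ∀ f f' : ℝ → ℝ, (∀ s, HasDerivAt f (f' s) s) → Continuous f →
      (∀ s, 0 < s → f' s ≤ A / √s) → f 1 - f 0 ≤ 2 * A := by
    intro f f' hf hfc hb
    have hd : ∀ s : ℝ, 0 < s → HasDerivAt (fun s => f s - 2 * A * √s) (f' s - A / √s) s :=
      fun s h0 => (hf s).sub (hs s h0)
    have := antitoneOn_of_deriv_nonpos (convex_Icc (0 : ℝ) 1) (hfc.sub hcs).continuousOn
      (fun s h => by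
        rw [interior_Icc] at h
        exact (hd s h.1).differentiableAt.differentiableWithinAt)
      (fun s h => by
        rw [interior_Icc] at h
        change deriv (fun s => f s - 2 * A * √s) s ≤ 0
        rw [(hd s h.1).deriv]
        linarith [hb s h.1])
    have := this (Set.left_mem_Icc.2 zero_le_one) (Set.right_mem_Icc.2 zero_le_one) zero_le_one
    simp only [Pi.sub_apply, Real.sqrt_one, Real.sqrt_zero, mul_zero, mul_one, sub_zero] at this
    linarith
  rw [abs_le]
  constructor
  · have := key (fun s => - g s) (fun s => - g' s) (fun s => (hg s).neg) hc.neg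
      fun s h0 => (neg_le_abs _).trans (h s h0)
    linarith
  · exact key g g' hg hc fun s h0 => (le_abs_self _).trans (h s h0)

theorem integrable_dilate {G : V → ℝ} (hG : Integrable G) (p : V) {s : ℝ} (hs : 0 < s) :
    (Integrable fun z => G (p + s • (z - p))) ∧
      ∫ z, G (p + s • (z - p)) = (s ^ 2)⁻¹ * ∫ z, G z := by
  have h1 : Integrable fun w => G (p + w) := hG.comp_add_left p
  have h2 : Integrable fun w => G (p + s • w) := h1.comp_smul hs.ne'
  refine ⟨h2.comp_sub_right p, ?_⟩
  rw [integral_sub_right_eq_self (fun w => G (p + s • w)) p,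
    Measure.integral_comp_smul volume (fun w => G (p + w)) s, integral_add_left_eq_self]
  simp [abs_of_pos hs]

theorem real_volume_closedBall (c : V) {l : ℝ} (hl : 0 ≤ l) :
    volume.real (Metric.closedBall c l) = (2 * l) ^ 2 := by
  rw [Measure.real, Real.volume_pi_closedBall c hl, ENNReal.toReal_ofReal (by positivity)]
  simp

theorem setIntegral_le_sqrt {f : V → ℝ} (hf : Continuous f) (c : V) {l : ℝ} (hl : 0 ≤ l) :
    ∫ x in Metric.closedBall c l, |f x| ≤ 2 * l * √(∫ x in Metric.closedBall c l, f x ^ 2) := by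
  have hK := isCompact_closedBall c l
  have h := (integral_mul_le_sqrt (μ := volume.restrict (Metric.closedBall c l)) (f := fun _ => (1 : ℝ))
    (g := f) aestronglyMeasurable_const hf.aestronglyMeasurable
    ((continuous_const.continuousOn).integrableOn_compact hK)
    ((hf.pow 2).continuousOn.integrableOn_compact hK)).2
  simpa [real_volume_closedBall c hl, hl] using h

/-- Morrey's estimate for the deviation from a mean value. -/
theorem abs_sub_average_le {f : V → ℝ} (hf : Sm f) (hD : Integrable fun x => gsq f x ^ 2) (c p : V)
    {l : ℝ} (hl : 0 < l) (hp : ‖p - c‖ ≤ l) :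
    |f p - ((2 * l) ^ 2)⁻¹ * ∫ z in Metric.closedBall c l, f z| ≤
      6 * √l * √√(∫ x, gsq f x ^ 2) := by
  set D := ∫ x, gsq f x ^ 2 with hDdef
  have hD0 : 0 ≤ D := integral_nonneg fun x => sq_nonneg _
  have hK := isCompact_closedBall c l
  have hJ : JS (fun s z => f (p + s • (z - p))) := by
    refine hf.comp ?_
    exact contDiff_const.add (contDiff_fst.smul (contDiff_snd.sub contDiff_const))
  have hdt : ∀ s z, dt (fun s z => f (p + s • (z - p))) s z = fderiv ℝ f (p + s • (z - p)) (z - p) := by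
    intro s z
    have h1 : HasDerivAt (fun s : ℝ => p + s • (z - p)) (z - p) s := by
      simpa using ((hasDerivAt_id s).smul_const (z - p)).const_add p
    exact ((hf.diff _).hasFDerivAt.comp_hasDerivAt s h1).deriv
  have hder := fun s => hJ.hasDerivAt_setIntegral hK s
  have hgc := continuous_gsq hf
  have hb : ∀ s, 0 < s → |∫ z in Metric.closedBall c l, dt (fun s z => f (p + s • (z - p))) s z| ≤
      (8 * l ^ 2 * √(2 * l) * √√D) / √s := by
    intro s hs
    have hac : Continuous fun z : V => p + s • (z - p) := by fun_prop
    have hg1 : Continuous fun z => gsq f (p + s • (z - p)) := hgc.comp hac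
    have e1 := (integrable_dilate hD p hs)
    have e2 : ∫ z in Metric.closedBall c l, gsq f (p + s • (z - p)) ^ 2 ≤ (s ^ 2)⁻¹ * D := by
      rw [hDdef, ← e1.2]
      exact setIntegral_le_integral e1.1 (ae_of_all _ fun x => sq_nonneg _)
    have e3 : ∫ z in Metric.closedBall c l, gsq f (p + s • (z - p)) ≤ 2 * l * (√D / s) := by
      have := setIntegral_le_sqrt hg1 c hl.le
      simp only [abs_of_nonneg (gsq_nonneg f _)] at this
      refine this.trans (mul_le_mul_of_nonneg_left ?_ (by positivity))
      refine (Real.sqrt_le_sqrt e2).trans_eq ?_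
      rw [Real.sqrt_mul (by positivity), Real.sqrt_inv, Real.sqrt_sq hs.le]; field_simp
    have e4 : ∫ z in Metric.closedBall c l, √(gsq f (p + s • (z - p))) ≤
        2 * l * (√(2 * l) * (√√D / √s)) := by
      have := setIntegral_le_sqrt hg1.sqrt c hl.le
      simp only [abs_of_nonneg (Real.sqrt_nonneg _), Real.sq_sqrt (gsq_nonneg f _)] at this
      refine this.trans (mul_le_mul_of_nonneg_left ?_ (by positivity))
      refine (Real.sqrt_le_sqrt e3).trans_eq ?_
      rw [Real.sqrt_mul (by positivity), Real.sqrt_div (Real.sqrt_nonneg _)]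
    calc _ ≤ ∫ z in Metric.closedBall c l, 4 * l * √(gsq f (p + s • (z - p))) := by
          refine norm_integral_le_of_norm_le
            (f := fun z => dt (fun s z => f (p + s • (z - p))) s z)
            (((continuous_const.mul hg1.sqrt).continuousOn.integrableOn_compact hK)) ?_
          filter_upwards [ae_restrict_mem hK.measurableSet] with z hz
          rw [hdt]
          refine (abs_fderiv_le _ _ _).trans (mul_le_mul_of_nonneg_right ?_ (Real.sqrt_nonneg _))
          have : ‖z - p‖ ≤ ‖z - c‖ + ‖p - c‖ := by
            rw [show z - p = (z - c) - (p - c) by abel]; exact norm_sub_le _ _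
          rw [mem_closedBall_iff_norm] at hz
          linarith
      _ = 4 * l * ∫ z in Metric.closedBall c l, √(gsq f (p + s • (z - p))) := integral_const_mul _ _
      _ ≤ 4 * l * (2 * l * (√(2 * l) * (√√D / √s))) := by gcongr
      _ = _ := by ring
  have key := abs_sub_le_of_deriv_le_inv_sqrt hder hb
  simp only [one_smul, add_sub_cancel, zero_smul, add_zero, setIntegral_const,
    real_volume_closedBall c hl.le, smul_eq_mul] at key
  have e : f p - ((2 * l) ^ 2)⁻¹ * ∫ z in Metric.closedBall c l, f z =
      -(((2 * l) ^ 2)⁻¹ * ((∫ z in Metric.closedBall c l, f z) - (2 * l) ^ 2 * f p)) := by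
    field_simp; ring
  rw [e, abs_neg, abs_mul, abs_of_nonneg (by positivity)]
  have h2 : √(2 * l) ≤ 3 / 2 * √l := by
    rw [Real.sqrt_mul (by norm_num)]
    have : √2 ≤ 3 / 2 := by rw [Real.sqrt_le_iff]; norm_num
    gcongr
  calc _ ≤ ((2 * l) ^ 2)⁻¹ * (2 * (8 * l ^ 2 * √(2 * l) * √√D)) := by gcongr
    _ = 4 * √(2 * l) * √√D := by field_simp; ring
    _ ≤ 4 * (3 / 2 * √l) * √√D := by gcongr
    _ = _ := by ring

/-- Growth estimate. -/
theorem abs_sub_zero_le {f : V → ℝ} (hf : Sm f) (hD : Integrable fun x => gsq f x ^ 2)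
    {l : ℝ} (hl : 0 < l) {p : V} (hp : ‖p‖ ≤ l) :
    |f p| ≤ |f 0| + 12 * √l * √√(∫ x, gsq f x ^ 2) := by
  have h1 := abs_sub_average_le hf hD 0 p hl (by simpa using hp)
  have h2 := abs_sub_average_le hf hD 0 0 hl (by simpa using hl.le)
  have h3 := abs_sub_abs_le_abs_sub (f p) (f 0)
  set A := ((2 * l) ^ 2)⁻¹ * ∫ z in Metric.closedBall (0 : V) l, f z
  have h4 : |f p - f 0| ≤ |f p - A| + |f 0 - A| := by
    rw [show f p - f 0 = (f p - A) - (f 0 - A) by ring]; exact abs_sub _ _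
  linarith

/-- Sup-norm estimate. -/
theorem abs_le_of_gsq_sq {f : V → ℝ} (hf : Sm f) (hD : Integrable fun x => gsq f x ^ 2)
    (h2 : Integrable fun x => f x ^ 2) (p : V) :
    |f p| ≤ √(∫ x, f x ^ 2) + 6 * √√(∫ x, gsq f x ^ 2) := by
  have h1 := abs_sub_average_le hf hD p p one_pos (by simp)
  have h3 := setIntegral_le_sqrt hf.diff.continuous p (zero_le_one (α := ℝ))
  have h4 : ∫ x in Metric.closedBall p 1, f x ^ 2 ≤ ∫ x, f x ^ 2 :=
    setIntegral_le_integral h2 (ae_of_all _ fun x => sq_nonneg _)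
  have h5 := Real.sqrt_le_sqrt h4
  have h6 : |∫ x in Metric.closedBall p 1, f x| ≤ ∫ x in Metric.closedBall p 1, |f x| :=
    abs_integral_le_integral_abs
  have h7 := abs_sub_abs_le_abs_sub (f p) (((2 * 1) ^ 2)⁻¹ * ∫ z in Metric.closedBall p 1, f z)
  rw [abs_mul, abs_of_nonneg (by positivity : (0 : ℝ) ≤ ((2 * 1) ^ 2)⁻¹)] at h7
  rw [Real.sqrt_one, mul_one] at h1
  have := Real.sqrt_nonneg (∫ x, f x ^ 2)
  norm_num at h1 h7 h3
  linarith

/-- Fatou's lemma for real integrals. -/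
theorem integrable_of_tendsto {α : Type*} [MeasurableSpace α] {μ : Measure α} {F : ℕ → α → ℝ} {f : α → ℝ}
    {B : ℕ → ℝ} {b : ℝ} (hF : ∀ n, Integrable (F n) μ) (hF0 : ∀ n, ∀ᵐ x ∂μ, 0 ≤ F n x)
    (hf : AEStronglyMeasurable f μ)
    (hlim : ∀ᵐ x ∂μ, Tendsto (fun n => F n x) atTop (nhds (f x)))
    (hB : ∀ n, ∫ x, F n x ∂μ ≤ B n) (hb : Tendsto B atTop (nhds b)) :
    Integrable f μ ∧ ∫ x, f x ∂μ ≤ b := by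
  have hf0 : ∀ᵐ x ∂μ, 0 ≤ f x := by
    filter_upwards [ae_all_iff.2 hF0, hlim] with x h1 h2
    exact ge_of_tendsto' h2 h1
  have hb0 : 0 ≤ b := ge_of_tendsto' hb fun n => (integral_nonneg_of_ae (hF0 n)).trans (hB n)
  have key : ∫⁻ x, ENNReal.ofReal (f x) ∂μ ≤ ENNReal.ofReal b := by
    calc ∫⁻ x, ENNReal.ofReal (f x) ∂μ
        = ∫⁻ x, liminf (fun n => ENNReal.ofReal (F n x)) atTop ∂μ := by
          refine lintegral_congr_ae ?_
          filter_upwards [hlim] with x hx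
          exact ((ENNReal.continuous_ofReal.tendsto _).comp hx).liminf_eq.symm
      _ ≤ liminf (fun n => ∫⁻ x, ENNReal.ofReal (F n x) ∂μ) atTop :=
          lintegral_liminf_le' fun n => (hF n).aestronglyMeasurable.aemeasurable.ennreal_ofReal
      _ ≤ liminf (fun n => ENNReal.ofReal (B n)) atTop := by
          refine liminf_le_liminf (Eventually.of_forall fun n => ?_)
          rw [← ofReal_integral_eq_lintegral_ofReal (hF n) (hF0 n)]
          exact ENNReal.ofReal_le_ofReal (hB n)
      _ = ENNReal.ofReal b := ((ENNReal.continuous_ofReal.tendsto _).comp hb).liminf_eq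
  have hi : Integrable f μ := by
    refine ⟨hf, ?_⟩
    rw [hasFiniteIntegral_iff_ofReal hf0]
    exact key.trans_lt ENNReal.ofReal_lt_top
  refine ⟨hi, ?_⟩
  rw [← ofReal_integral_eq_lintegral_ofReal hi hf0] at key
  exact (ENNReal.ofReal_le_ofReal_iff hb0).1 key

theorem integral_sq_le_of_compact {w : V → ℝ} (hw : Sm w) (hc : HasCompactSupport w) :
    ∫ x, w x ^ 2 ≤ (∫ x, ‖fderiv ℝ w x‖) ^ 2 := by
  have hp : Real.HolderConjugate (Fintype.card (Fin 2)) 2 := by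
    rw [Real.holderConjugate_iff]; norm_num
  have hw1 : ContDiff ℝ 1 w := hw.of_le (by exact_mod_cast le_top)
  have h := lintegral_pow_le_pow_lintegral_fderiv_aux hp hw1 hc
  have hfd : Continuous fun x => fderiv ℝ w x := hw1.continuous_fderiv (by norm_num)
  have hfi : Integrable fun x => ‖fderiv ℝ w x‖ :=
    (hfd.integrable_of_hasCompactSupport (hc.fderiv (𝕜 := ℝ))).norm
  have hwi : Integrable fun x => w x ^ 2 := by
    have := integrable_mul_compact hw.continuous hw.continuous hc
    simpa only [pow_two] using this
  have e1 : ∫⁻ x, ‖w x‖ₑ ^ (2:ℝ) = ENNReal.ofReal (∫ x, w x ^ 2) := by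
    rw [ofReal_integral_eq_lintegral_ofReal hwi (ae_of_all _ fun x => sq_nonneg _)]
    refine lintegral_congr fun x => ?_
    rw [← sq_abs, ENNReal.ofReal_pow (abs_nonneg _), ← Real.norm_eq_abs, ofReal_norm]
    norm_num
  have e2 : ∫⁻ x, ‖fderiv ℝ w x‖ₑ = ENNReal.ofReal (∫ x, ‖fderiv ℝ w x‖) := by
    rw [ofReal_integral_eq_lintegral_ofReal hfi (ae_of_all _ fun x => norm_nonneg _)]
    exact lintegral_congr fun x => (ofReal_norm _).symm
  have hn : 0 ≤ ∫ x, ‖fderiv ℝ w x‖ := integral_nonneg fun x => norm_nonneg _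
  rw [e1, e2, show (2:ℝ) = ((2:ℕ):ℝ) by norm_num, ENNReal.rpow_natCast, ← ENNReal.ofReal_pow hn] at h
  exact (ENNReal.ofReal_le_ofReal_iff (by positivity)).1 h

theorem gsq_eta_le : ∃ C : ℝ, 0 ≤ C ∧ ∀ R : ℝ, 0 < R → ∀ x, √(gsq (eta R) x) ≤ C / R := by
  obtain ⟨C, hC, h⟩ := exists_eta_bound
  refine ⟨2 * C, by positivity, fun R hR x => ?_⟩
  rw [Real.sqrt_le_iff]
  refine ⟨by positivity, ?_⟩
  have h0 := sq_le_sq' (by linarith [neg_abs_le (pd 0 (eta R) x), (h R hR 0 0 x).1]) ((le_abs_self _).trans (h R hR 0 0 x).1)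
  have h1 := sq_le_sq' (by linarith [neg_abs_le (pd 1 (eta R) x), (h R hR 1 1 x).1]) ((le_abs_self _).trans (h R hR 1 1 x).1)
  simp only [gsq, Fin.sum_univ_two]
  have : 0 ≤ (C / R)^2 := sq_nonneg _
  calc _ ≤ (C/R)^2 + (C/R)^2 := add_le_add h0 h1
    _ ≤ (2 * C / R)^2 := by rw [mul_div_assoc, mul_pow]; nlinarith

/-- Ladyzhenskaya's inequality. -/
theorem ladyzhenskaya {f : V → ℝ} (hf : Sm f) (h2 : Integrable fun x => f x ^ 2)
    (hg : Integrable (gsq f)) : Integrable (fun x => f x ^ 4) ∧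
      ∫ x, f x ^ 4 ≤ 16 * (∫ x, f x ^ 2) * ∫ x, gsq f x := by
  obtain ⟨C, hC, hη⟩ := gsq_eta_le
  have hf1 : Sm fun x => f x ^ 2 := hf.pow 2
  set B : ℕ → ℝ := fun n => (2 * C / rad n * (∫ x, f x ^ 2) + 4 * (√(∫ x, f x ^ 2) * √(∫ x, gsq f x))) ^ 2
  have hs : ∀ n, Sm fun x => eta (rad n) x * f x ^ 2 := fun n => (sm_eta _).mul hf1
  have hcs : ∀ n, HasCompactSupport fun x => eta (rad n) x * f x ^ 2 := fun n =>
    (eta_compact (rad_pos n)).mul_right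
  have hgs : AEStronglyMeasurable (fun x => √(gsq f x)) := (continuous_gsq hf).sqrt.aestronglyMeasurable
  have hge : (fun x => √(gsq f x) ^ 2) = gsq f := funext fun x => Real.sq_sqrt (gsq_nonneg f x)
  obtain ⟨hi, hle⟩ := integral_mul_le_sqrt (μ := volume) (f := fun x => |f x|) (g := fun x => √(gsq f x))
    hf.continuous.abs.aestronglyMeasurable hgs (by simpa only [sq_abs] using h2) (by rw [hge]; exact hg)
  simp only [sq_abs, hge] at hle
  have hB : ∀ n, ∫ x, (eta (rad n) x * f x ^ 2) ^ 2 ≤ B n := fun n => by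
    refine (integral_sq_le_of_compact (hs n) (hcs n)).trans ?_
    refine pow_le_pow_left₀ (integral_nonneg fun x => norm_nonneg _) ?_ 2
    have hpt : ∀ x, ‖fderiv ℝ (fun x => eta (rad n) x * f x ^ 2) x‖ ≤
        2 * C / rad n * f x ^ 2 + 4 * (|f x| * √(gsq f x)) := fun x => by
      refine ContinuousLinearMap.opNorm_le_bound _ (by have := rad_pos n; positivity) fun v => ?_
      have hd : fderiv ℝ (fun x => eta (rad n) x * f x ^ 2) x v =
          fderiv ℝ (eta (rad n)) x v * f x ^ 2 + eta (rad n) x * (2 * f x * fderiv ℝ f x v) := by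
        have h1 := ((sm_eta (rad n)).diff x).hasFDerivAt.mul ((hf.diff x).hasFDerivAt.pow 2)
        rw [show (fun x => eta (rad n) x * f x ^ 2) = eta (rad n) * fun x => f x ^ 2 from rfl, h1.fderiv]
        simp; ring
      rw [hd, Real.norm_eq_abs]
      have a1 := abs_fderiv_le (eta (rad n)) x v
      have a2 := abs_fderiv_le f x v
      have a3 := hη (rad n) (rad_pos n) x
      have a4 := eta_nonneg (rad n) x
      have a5 := eta_le_one (rad n) x
      calc _ ≤ |fderiv ℝ (eta (rad n)) x v| * f x ^ 2 + eta (rad n) x * (2 * |f x| * |fderiv ℝ f x v|) := by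
            refine (abs_add_le _ _).trans (le_of_eq ?_)
            simp only [abs_mul, abs_pow, sq_abs, abs_of_nonneg a4, abs_two]
        _ ≤ (2 * ‖v‖ * (C / rad n)) * f x ^ 2 + 1 * (2 * |f x| * (2 * ‖v‖ * √(gsq f x))) := by
            gcongr
            exact a1.trans (by gcongr)
        _ = _ := by ring
    refine (integral_mono_of_nonneg (ae_of_all _ fun x => norm_nonneg _) ?_ (ae_of_all _ hpt)).trans ?_
    · exact (h2.const_mul _).add (hi.const_mul 4)
    · rw [integral_add (h2.const_mul _) (hi.const_mul 4), integral_const_mul, integral_const_mul]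
      gcongr
      exact (integral_mono hi hi.abs fun x => le_abs_self _).trans hle
  have hlimB : Tendsto B atTop (nhds ((0 * (∫ x, f x ^ 2) + 4 * (√(∫ x, f x ^ 2) * √(∫ x, gsq f x))) ^ 2)) :=
    (((tendsto_const_div_rad (2 * C)).mul_const _).add_const _).pow 2
  have := integrable_of_tendsto (μ := volume) (F := fun n x => (eta (rad n) x * f x ^ 2) ^ 2) (f := fun x => f x ^ 4)
    (fun n => by
      have := integrable_mul_compact (hs n).continuous (hs n).continuous (hcs n)
      simpa only [pow_two] using this)
    (fun n => ae_of_all _ fun x => sq_nonneg _) (hf.continuous.pow 4).aestronglyMeasurable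
    (ae_of_all _ fun x => by
      have := ((tendsto_eta x).mul_const (f x ^ 2)).pow 2
      simpa [← pow_mul] using this) hB hlimB
  refine ⟨this.1, this.2.trans (le_of_eq ?_)⟩
  rw [zero_mul, zero_add, mul_pow, mul_pow, Real.sq_sqrt (integral_nonneg fun x => sq_nonneg _),
    Real.sq_sqrt (integral_nonneg fun x => gsq_nonneg f x)]
  ring

/-- The derivative of `g` along the flow of `U`. -/
def matd (U : Fin 2 → ℝ → V → ℝ) (g : ℝ → V → ℝ) (t : ℝ) (x : V) : ℝ :=
  dt g t x + ∑ k, U k t x * pd k (g t) x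

/-- The acceleration field. -/
def acc (U : Fin 2 → ℝ → V → ℝ) (i : Fin 2) : ℝ → V → ℝ := matd U (U i)

/-- The elastic stress `H + H Hᵀ`. -/
def stress (H : Fin 2 → Fin 2 → ℝ → V → ℝ) (i j : Fin 2) (t : ℝ) (x : V) : ℝ :=
  H i j t x + ∑ k, H i k t x * H j k t x

/-- Viscous plus elastic stress. -/
def tens (U : Fin 2 → ℝ → V → ℝ) (H : Fin 2 → Fin 2 → ℝ → V → ℝ) (i j : Fin 2) (t : ℝ) (x : V) : ℝ :=
  pd j (U i t) x + stress H i j t x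

def vsq (U : Fin 2 → ℝ → V → ℝ) (t : ℝ) (x : V) : ℝ := ∑ i, U i t x ^ 2

def msq (H : Fin 2 → Fin 2 → ℝ → V → ℝ) (t : ℝ) (x : V) : ℝ := ∑ i, ∑ j, H i j t x ^ 2

def grad (U : Fin 2 → ℝ → V → ℝ) (i j : Fin 2) (t : ℝ) : V → ℝ := pd j (U i t)

/-- The smooth viscoelastic flows, written for the velocity and the displacement gradient `F - I`. -/
structure VFlow (T : ℝ) (U : Fin 2 → ℝ → V → ℝ) (H : Fin 2 → Fin 2 → ℝ → V → ℝ) (P : ℝ → V → ℝ) : Prop where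
  sU : ∀ i, JS (U i)
  sH : ∀ i j, JS (H i j)
  sP : JS P
  mom : ∀ t ∈ Set.Icc 0 T, ∀ x i, acc U i t x + pd i (P t) x = ∑ j, pd j (tens U H i j t) x
  tr : ∀ t ∈ Set.Icc 0 T, ∀ x i j, matd U (H i j) t x = pd j (U i t) x + ∑ k, pd k (U i t) x * H k j t x
  divU : ∀ t ∈ Set.Icc 0 T, ∀ x, ∑ i, pd i (U i t) x = 0
  divH : ∀ t ∈ Set.Icc 0 T, ∀ x j, ∑ i, pd i (H i j t) x = 0
  small : ∀ t ∈ Set.Icc 0 T, ∀ x, msq H t x ≤ 1 / 4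
  iU : ∀ t ∈ Set.Icc 0 T, Integrable (vsq U t)
  iH : ∀ t ∈ Set.Icc 0 T, Integrable (msq H t)
  iG : ∀ t ∈ Set.Icc 0 T, Integrable (msq (grad U) t)
  iA : ∀ t ∈ Set.Icc 0 T, Integrable (vsq (acc U) t)
  iD : ∀ t ∈ Set.Icc 0 T, Integrable fun x => msq (grad U) t x ^ 2

section Fields

variable {U : Fin 2 → ℝ → V → ℝ} {H : Fin 2 → Fin 2 → ℝ → V → ℝ}

theorem JS.matd (hU : ∀ i, JS (U i)) {g : ℝ → V → ℝ} (hg : JS g) : JS (matd U g) :=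
  hg.dt.add (JS.sum _ fun k => (hU k).mul (hg.pd k))

theorem JS.acc (hU : ∀ i, JS (U i)) (i : Fin 2) : JS (acc U i) := JS.matd hU (hU i)

theorem JS.stress (hH : ∀ i j, JS (H i j)) (i j : Fin 2) : JS (stress H i j) :=
  (hH i j).add (JS.sum _ fun k => (hH i k).mul (hH j k))

theorem JS.tens (hU : ∀ i, JS (U i)) (hH : ∀ i j, JS (H i j)) (i j : Fin 2) : JS (tens U H i j) :=
  ((hU i).pd j).add (JS.stress hH i j)

theorem JS.grad (hU : ∀ i, JS (U i)) (i j : Fin 2) : JS (grad U i j) := (hU i).pd j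

theorem JS.vsq (hU : ∀ i, JS (U i)) : JS (vsq U) := JS.sum _ fun i => (hU i).pow 2

theorem JS.msq (hH : ∀ i j, JS (H i j)) : JS (msq H) := JS.sum _ fun i => JS.sum _ fun j => (hH i j).pow 2

theorem vsq_nonneg (U : Fin 2 → ℝ → V → ℝ) (t : ℝ) (x : V) : 0 ≤ vsq U t x :=
  Finset.sum_nonneg fun _ _ => sq_nonneg _

theorem msq_nonneg (H : Fin 2 → Fin 2 → ℝ → V → ℝ) (t : ℝ) (x : V) : 0 ≤ msq H t x :=
  Finset.sum_nonneg fun _ _ => Finset.sum_nonneg fun _ _ => sq_nonneg _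

theorem sq_le_vsq (U : Fin 2 → ℝ → V → ℝ) (i : Fin 2) (t : ℝ) (x : V) : U i t x ^ 2 ≤ vsq U t x :=
  Finset.single_le_sum (f := fun i => U i t x ^ 2) (fun _ _ => sq_nonneg _) (Finset.mem_univ i)

theorem sq_le_msq (H : Fin 2 → Fin 2 → ℝ → V → ℝ) (i j : Fin 2) (t : ℝ) (x : V) :
    H i j t x ^ 2 ≤ msq H t x :=
  (Finset.single_le_sum (f := fun j => H i j t x ^ 2) (fun _ _ => sq_nonneg _) (Finset.mem_univ j)).trans
    (Finset.single_le_sum (f := fun i => ∑ j, H i j t x ^ 2)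
      (fun _ _ => Finset.sum_nonneg fun _ _ => sq_nonneg _) (Finset.mem_univ i))

theorem abs_le_vsq (U : Fin 2 → ℝ → V → ℝ) (i : Fin 2) (t : ℝ) (x : V) : |U i t x| ≤ √(vsq U t x) :=
  Real.abs_le_sqrt (sq_le_vsq U i t x)

theorem abs_le_msq (H : Fin 2 → Fin 2 → ℝ → V → ℝ) (i j : Fin 2) (t : ℝ) (x : V) :
    |H i j t x| ≤ √(msq H t x) :=
  Real.abs_le_sqrt (sq_le_msq H i j t x)

theorem abs_sum_two_le {f : Fin 2 → ℝ} {m : ℝ} (h : ∀ i, |f i| ≤ m) : |∑ i, f i| ≤ 2 * m := by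
  rw [Fin.sum_univ_two]
  linarith [abs_add_le (f 0) (f 1), h 0, h 1]

theorem matd_add {g h : ℝ → V → ℝ} (hg : JS g) (hh : JS h) (t : ℝ) (x : V) :
    matd U (fun t x => g t x + h t x) t x = matd U g t x + matd U h t x := by
  unfold matd
  rw [JS.dt_add hg hh, Fin.sum_univ_two, Fin.sum_univ_two, Fin.sum_univ_two]
  simp only [fun k => pd_add k (hg.sm t).diff (hh.sm t).diff]
  ring

theorem matd_mul {g h : ℝ → V → ℝ} (hg : JS g) (hh : JS h) (t : ℝ) (x : V) :
    matd U (fun t x => g t x * h t x) t x = matd U g t x * h t x + g t x * matd U h t x := by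
  unfold matd
  rw [JS.dt_mul hg hh, Fin.sum_univ_two, Fin.sum_univ_two, Fin.sum_univ_two]
  simp only [fun k => pd_mul k (hg.sm t).diff (hh.sm t).diff]
  ring

theorem matd_sum {g : Fin 2 → ℝ → V → ℝ} (hg : ∀ i, JS (g i)) (t : ℝ) (x : V) :
    matd U (fun t x => ∑ i, g i t x) t x = ∑ i, matd U (g i) t x := by
  simp only [Fin.sum_univ_two]
  exact matd_add (hg 0) (hg 1) t x

theorem matd_sq {g : ℝ → V → ℝ} (hg : JS g) (t : ℝ) (x : V) :
    matd U (fun t x => g t x ^ 2) t x = 2 * g t x * matd U g t x := by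
  have := matd_mul (U := U) hg hg t x
  simp only [← pow_two] at this
  rw [this]; ring

theorem matd_vsq {g : Fin 2 → ℝ → V → ℝ} (hg : ∀ i, JS (g i)) (t : ℝ) (x : V) :
    matd U (vsq g) t x = ∑ i, 2 * g i t x * matd U (g i) t x := by
  rw [show vsq g = fun t x => ∑ i, g i t x ^ 2 from rfl, matd_sum fun i => (hg i).pow 2]
  simp only [matd_sq (hg _)]

theorem matd_msq {g : Fin 2 → Fin 2 → ℝ → V → ℝ} (hg : ∀ i j, JS (g i j)) (t : ℝ)
    (x : V) : matd U (msq g) t x = ∑ i, ∑ j, 2 * g i j t x * matd U (g i j) t x := by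
  rw [show msq g = fun t x => ∑ i, (fun i t x => ∑ j, g i j t x ^ 2) i t x from rfl,
    matd_sum fun i => JS.sum _ fun j => (hg i j).pow 2]
  exact Finset.sum_congr rfl fun i _ => matd_vsq (hg i) t x

theorem matd_grad (hU : ∀ i, JS (U i)) (i j : Fin 2) (t : ℝ) (x : V) :
    matd U (grad U i j) t x = pd j (acc U i t) x - ∑ k, pd j (U k t) x * pd k (U i t) x := by
  have e : acc U i t = fun x => dt (U i) t x + ∑ k, U k t x * pd k (U i t) x := rfl
  have h1 : ∀ k, Sm fun x => U k t x * pd k (U i t) x := fun k => ((hU k).sm t).mul (((hU i).sm t).pd k)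
  rw [e, pd_add j ((hU i).dt.sm t).diff (Sm.diff (ContDiff.sum fun k _ => h1 k)),
    pd_sum j Finset.univ fun k _ => (h1 k).diff]
  simp only
  unfold matd grad
  rw [JS.dt_pd (hU i)]
  simp only [fun k => pd_mul j ((hU k).sm t).diff (((hU i).sm t).pd k).diff, Fin.sum_univ_two,
    fun k => pd_comm k j ((hU i).sm t)]
  ring

/-- Integrals of divergences of cut off fields vanish. -/
theorem integral_cutoff_div {φ : V → ℝ} (hφ : Sm φ) (hc : HasCompactSupport φ) {K : Fin 2 → V → ℝ}
    (hK : ∀ j, Sm (K j)) : ∫ x, φ x * ∑ j, pd j (K j) x = - ∫ x, ∑ j, pd j φ x * K j x := by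
  have i1 : ∀ j, Integrable fun x => pd j (K j) x * φ x := fun j =>
    integrable_mul_compact ((hK j).pd j).diff.continuous hφ.diff.continuous hc
  have i2 : ∀ j, Integrable fun x => K j x * pd j φ x := fun j =>
    integrable_mul_compact (hK j).diff.continuous (hφ.pd j).diff.continuous (hasCompactSupport_pd hc j)
  simp only [Finset.mul_sum]
  simp only [mul_comm (φ _), mul_comm (pd _ φ _)]
  rw [integral_finsetSum _ fun j _ => i1 j, integral_finsetSum _ fun j _ => i2 j, ← Finset.sum_neg_distrib]
  exact Finset.sum_congr rfl fun j _ => by rw [integral_mul_pd_compact (hK j) hφ hc, neg_neg]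

/-- The time derivative of a localized integral, up to a divergence. -/
theorem integral_cutoff_dt (hU : ∀ i, JS (U i)) {g : ℝ → V → ℝ} (hg : JS g) {φ : V → ℝ} (hφ : Sm φ)
    (hc : HasCompactSupport φ) {t : ℝ} (hd : ∀ x, ∑ i, pd i (U i t) x = 0) {K : Fin 2 → V → ℝ}
    (hK : ∀ j, Sm (K j)) : ∫ x, φ x * dt g t x =
      ∫ x, (φ x * (matd U g t x - ∑ j, pd j (K j) x) + ∑ j, pd j φ x * (U j t x * g t x - K j x)) := by
  have hL : ∀ j, Sm fun x => K j x - U j t x * g t x := fun j =>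
    (hK j).sub (((hU j).sm t).mul (hg.sm t))
  have h := integral_cutoff_div hφ hc hL
  have hm : ∀ j, Sm fun x => U j t x * g t x := fun j => ((hU j).sm t).mul (hg.sm t)
  have e : ∀ x, ∑ j, pd j (fun x => K j x - U j t x * g t x) x =
      (∑ j, pd j (K j) x) - ∑ j, U j t x * pd j (g t) x := fun x => by
    have := hd x
    simp only [fun j => pd_sub j (hK j).diff (hm j).diff,
      fun j => pd_mul j ((hU j).sm t).diff (hg.sm t).diff, Fin.sum_univ_two] at this ⊢
    linear_combination - g t x * this
  have c1 : Continuous fun x => ∑ j, pd j (fun x => K j x - U j t x * g t x) x :=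
    continuous_finsetSum _ fun j _ => ((hL j).pd j).diff.continuous
  have i0 : Integrable fun x => φ x * dt g t x := by
    have := integrable_mul_compact (hg.dt.sm t).diff.continuous hφ.diff.continuous hc
    simpa only [mul_comm] using this
  have i1 : Integrable fun x => φ x * ∑ j, pd j (fun x => K j x - U j t x * g t x) x := by
    have := integrable_mul_compact c1 hφ.diff.continuous hc
    simpa only [mul_comm] using this
  have i2 : Integrable fun x => ∑ j, pd j φ x * (K j x - U j t x * g t x) :=
    integrable_finsetSum _ fun j _ => by
      have := integrable_mul_compact (hL j).diff.continuous (hφ.pd j).diff.continuous (hasCompactSupport_pd hc j)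
      simpa only [mul_comm] using this
  have h3 : ∫ x, (φ x * dt g t x - φ x * ∑ j, pd j (fun x => K j x - U j t x * g t x) x -
      ∑ j, pd j φ x * (K j x - U j t x * g t x)) = ∫ x, φ x * dt g t x := by
    have k := i0.sub i1
    rw [integral_sub (by exact k) i2, integral_sub i0 i1, h]; ring
  rw [← h3]
  refine integral_congr_ae (ae_of_all _ fun x => ?_)
  simp only [e, matd, Fin.sum_univ_two]
  ring

end Fields

theorem pd_sum_mul {f g : Fin 2 → V → ℝ} (hf : ∀ i, Sm (f i)) (hg : ∀ i, Sm (g i)) (j : Fin 2) (x : V) :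
    pd j (fun x => ∑ i, f i x * g i x) x = ∑ i, (pd j (f i) x * g i x + f i x * pd j (g i) x) := by
  have h : ∀ i, Sm fun x => f i x * g i x := fun i => (hf i).mul (hg i)
  rw [pd_sum j Finset.univ fun i _ => (h i).diff]
  simp only [fun i => pd_mul j (hf i).diff (hg i).diff]

/-- The stress power appearing in the second energy identity. -/
def work (U : Fin 2 → ℝ → V → ℝ) (H : Fin 2 → Fin 2 → ℝ → V → ℝ) (t : ℝ) (x : V) : ℝ :=
  ∑ i, ∑ j, stress H i j t x * pd j (U i t) x

def enstrophy (U : Fin 2 → ℝ → V → ℝ) (H : Fin 2 → Fin 2 → ℝ → V → ℝ) (t : ℝ) (x : V) : ℝ :=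
  2⁻¹ * msq (grad U) t x + work U H t x

def remainder (U : Fin 2 → ℝ → V → ℝ) (H : Fin 2 → Fin 2 → ℝ → V → ℝ) (t : ℝ) (x : V) : ℝ :=
  ∑ i, ∑ j, (matd U (stress H i j) t x * pd j (U i t) x -
    stress H i j t x * ∑ k, pd j (U k t) x * pd k (U i t) x)

namespace VFlow
variable {T : ℝ} {U : Fin 2 → ℝ → V → ℝ} {H : Fin 2 → Fin 2 → ℝ → V → ℝ} {P : ℝ → V → ℝ}

theorem smU (h : VFlow T U H P) (i : Fin 2) (t : ℝ) : Sm (U i t) := (h.sU i).sm t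
theorem smH (h : VFlow T U H P) (i j : Fin 2) (t : ℝ) : Sm (H i j t) := (h.sH i j).sm t
theorem smP (h : VFlow T U H P) (t : ℝ) : Sm (P t) := h.sP.sm t
theorem smA (h : VFlow T U H P) (i : Fin 2) (t : ℝ) : Sm (acc U i t) := (JS.acc h.sU i).sm t
theorem smB (h : VFlow T U H P) (i j : Fin 2) (t : ℝ) : Sm (stress H i j t) := (JS.stress h.sH i j).sm t
theorem smT (h : VFlow T U H P) (i j : Fin 2) (t : ℝ) : Sm (tens U H i j t) := (JS.tens h.sU h.sH i j).sm t
theorem jG (h : VFlow T U H P) : JS (msq (grad U)) := JS.msq (JS.grad h.sU)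
theorem jU (h : VFlow T U H P) : JS (vsq U) := JS.vsq h.sU
theorem jH (h : VFlow T U H P) : JS (msq H) := JS.msq h.sH
theorem jA (h : VFlow T U H P) : JS (vsq (acc U)) := JS.vsq (JS.acc h.sU)

theorem jwork (h : VFlow T U H P) : JS (work U H) :=
  JS.sum _ fun i => JS.sum _ fun j => (JS.stress h.sH i j).mul ((h.sU i).pd j)

theorem jens (h : VFlow T U H P) : JS (enstrophy U H) :=
  ((JS.const _).mul h.jG).add h.jwork

theorem integral_cutoff_energy_dt (h : VFlow T U H P) {φ : V → ℝ} (hφ : Sm φ) (hc : HasCompactSupport φ)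
    {t : ℝ} (ht : t ∈ Set.Icc 0 T) :
    ∫ x, φ x * dt (fun t x => vsq U t x + msq H t x) t x =
      ∫ x, (φ x * (-2 * msq (grad U) t x - 2 * ∑ i, U i t x * pd i (P t) x) +
        ∑ j, pd j φ x * (U j t x * (vsq U t x + msq H t x) - 2 * ∑ i, U i t x * tens U H i j t x)) := by
  have hs : ∀ j, Sm fun x => ∑ i, U i t x * tens U H i j t x := fun j =>
    ContDiff.sum fun i _ => (h.smU i t).mul (h.smT i j t)
  have hK : ∀ j, Sm fun x => 2 * ∑ i, U i t x * tens U H i j t x := fun j => contDiff_const.mul (hs j)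
  rw [integral_cutoff_dt h.sU (h.jU.add h.jH) hφ hc (h.divU t ht) hK]
  refine integral_congr_ae (ae_of_all _ fun x => ?_)
  simp only
  congr 2
  rw [matd_add h.jU h.jH, matd_vsq h.sU, matd_msq h.sH]
  simp only [h.tr t ht, fun j => pd_const_mul j 2 (hs j).diff,
    fun j => pd_sum_mul (fun i => h.smU i t) (fun i => h.smT i j t) j x]
  have m := h.mom t ht x
  have m0 := m 0
  have m1 := m 1
  simp only [acc, Fin.sum_univ_two] at m0 m1
  simp only [Fin.sum_univ_two, tens, stress, msq, grad, Fin.sum_univ_two]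
  linear_combination 2 * U 0 t x * m0 + 2 * U 1 t x * m1

theorem integral_cutoff_enstrophy_dt (h : VFlow T U H P) {φ : V → ℝ} (hφ : Sm φ) (hc : HasCompactSupport φ)
    {t : ℝ} (ht : t ∈ Set.Icc 0 T) :
    ∫ x, φ x * dt (enstrophy U H) t x =
      ∫ x, (φ x * (remainder U H t x - vsq (acc U) t x - ∑ i, pd i (P t) x * acc U i t x) +
        ∑ j, pd j φ x * (U j t x * enstrophy U H t x - ∑ i, tens U H i j t x * acc U i t x)) := by
  have hK : ∀ j, Sm fun x => ∑ i, tens U H i j t x * acc U i t x := fun j =>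
    ContDiff.sum fun i _ => (h.smT i j t).mul (h.smA i t)
  rw [integral_cutoff_dt h.sU h.jens hφ hc (h.divU t ht) hK]
  refine integral_congr_ae (ae_of_all _ fun x => ?_)
  simp only
  congr 2
  have e1 : matd U (enstrophy U H) t x = (∑ i, ∑ j, pd j (U i t) x * matd U (grad U i j) t x) +
      ∑ i, ∑ j, (matd U (stress H i j) t x * pd j (U i t) x + stress H i j t x * matd U (grad U i j) t x) := by
    have w : matd U (work U H) t x = ∑ i, ∑ j, (matd U (stress H i j) t x * pd j (U i t) x +
        stress H i j t x * matd U (grad U i j) t x) := by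
      rw [show work U H = fun t x => ∑ i, (fun i t x => ∑ j, (fun j t x =>
        stress H i j t x * grad U i j t x) j t x) i t x from rfl,
        matd_sum fun i => JS.sum _ fun j => (JS.stress h.sH i j).mul (JS.grad h.sU i j)]
      refine Finset.sum_congr rfl fun i _ => ?_
      rw [matd_sum fun j => (JS.stress h.sH i j).mul (JS.grad h.sU i j)]
      refine Finset.sum_congr rfl fun j _ => ?_
      exact matd_mul (JS.stress h.sH i j) (JS.grad h.sU i j) t x
    have c : matd U (fun t x => 2⁻¹ * msq (grad U) t x) t x = 2⁻¹ * matd U (msq (grad U)) t x := by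
      rw [matd_mul (JS.const _) h.jG]
      have z : matd U (fun _ _ => (2⁻¹ : ℝ)) t x = 0 := by
        simp [matd, dt, pd_const]
      rw [z]; ring
    rw [show enstrophy U H = fun t x => (fun t x => 2⁻¹ * msq (grad U) t x) t x + work U H t x from rfl,
      matd_add ((JS.const _).mul h.jG) h.jwork, w, c, matd_msq (JS.grad h.sU)]
    congr 1
    simp only [Fin.sum_univ_two, grad]; ring
  rw [e1]
  simp only [matd_grad h.sU, fun j => pd_sum_mul (fun i => h.smT i j t) (fun i => h.smA i t) j x]
  have m := h.mom t ht x
  have m0 := m 0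
  have m1 := m 1
  have d := h.divU t ht x
  simp only [remainder, Fin.sum_univ_two, vsq] at m0 m1 d ⊢
  simp only [show ∀ i j, tens U H i j t x = pd j (U i t) x + stress H i j t x from fun _ _ => rfl]
  have d' : pd 1 (U 1 t) x = - pd 0 (U 0 t) x := by linarith
  rw [d']
  linear_combination acc U 0 t x * m0 + acc U 1 t x * m1
end VFlow

theorem abs_integral_le_sqrt {F p q : V → ℝ} {c : ℝ} (hc : 0 ≤ c) (hF : Continuous F)
    (hp : Continuous p) (hq : Continuous q) (hp0 : ∀ x, 0 ≤ p x) (hq0 : ∀ x, 0 ≤ q x)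
    (ip : Integrable p) (iq : Integrable q) (h : ∀ x, |F x| ≤ c * (√(p x) * √(q x))) :
    Integrable F ∧ |∫ x, F x| ≤ c * (√(∫ x, p x) * √(∫ x, q x)) := by
  obtain ⟨k1, k2⟩ := integral_mul_le_sqrt (μ := volume) (f := fun x => √(p x)) (g := fun x => √(q x))
    hp.sqrt.aestronglyMeasurable hq.sqrt.aestronglyMeasurable
    (by simpa only [Real.sq_sqrt (hp0 _)] using ip) (by simpa only [Real.sq_sqrt (hq0 _)] using iq)
  simp only [Real.sq_sqrt (hp0 _), Real.sq_sqrt (hq0 _),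
    abs_of_nonneg (mul_nonneg (Real.sqrt_nonneg _) (Real.sqrt_nonneg _))] at k2
  have i2 := k1.const_mul c
  refine ⟨i2.mono' hF.aestronglyMeasurable (ae_of_all _ h), ?_⟩
  have := norm_integral_le_of_norm_le (f := F) i2 (ae_of_all _ h)
  rw [integral_const_mul] at this
  exact this.trans (mul_le_mul_of_nonneg_left k2 hc)

theorem abs_mul_le {a b c d : ℝ} (h1 : |a| ≤ c) (h2 : |b| ≤ d) : |a * b| ≤ c * d := by
  rw [abs_mul]; exact mul_le_mul h1 h2 (abs_nonneg _) ((abs_nonneg _).trans h1)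

namespace VFlow
variable {T : ℝ} {U : Fin 2 → ℝ → V → ℝ} {H : Fin 2 → Fin 2 → ℝ → V → ℝ} {P : ℝ → V → ℝ} {t : ℝ}

theorem sqrt_small (h : VFlow T U H P) (ht : t ∈ Set.Icc 0 T) (x : V) : √(msq H t x) ≤ 1 / 2 := by
  rw [Real.sqrt_le_iff]; exact ⟨by norm_num, (h.small t ht x).trans (by norm_num)⟩

theorem abs_quad_le (i j : Fin 2) (x : V) : |∑ k, H i k t x * H j k t x| ≤ 2 * msq H t x := by
  refine (abs_sum_two_le fun k => abs_mul_le (abs_le_msq H i k t x) (abs_le_msq H j k t x)).trans ?_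
  rw [Real.mul_self_sqrt (msq_nonneg H t x)]

theorem abs_stress_le (h : VFlow T U H P) (ht : t ∈ Set.Icc 0 T) (i j : Fin 2) (x : V) :
    |stress H i j t x| ≤ 2 * √(msq H t x) := by
  have h1 := abs_le_msq H i j t x
  have h2 := abs_quad_le (t := t) (H := H) i j x
  have h3 := h.sqrt_small ht x
  have h4 := Real.mul_self_sqrt (msq_nonneg H t x)
  have h5 := Real.sqrt_nonneg (msq H t x)
  refine (abs_add_le _ _).trans ?_
  nlinarith

theorem abs_grad_le (i j : Fin 2) (x : V) : |pd j (U i t) x| ≤ √(msq (grad U) t x) :=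
  abs_le_msq (grad U) i j t x

theorem abs_matd_le (h : VFlow T U H P) (ht : t ∈ Set.Icc 0 T) (i j : Fin 2) (x : V) :
    |matd U (H i j) t x| ≤ 2 * √(msq (grad U) t x) := by
  rw [h.tr t ht]
  have h2 := abs_sum_two_le fun k => abs_mul_le (abs_grad_le (U := U) (t := t) i k x) (abs_le_msq H k j t x)
  have h3 := h.sqrt_small ht x
  have h5 := Real.sqrt_nonneg (msq (grad U) t x)
  refine (abs_add_le _ _).trans ((add_le_add (abs_grad_le i j x) h2).trans ?_)
  nlinarith

theorem abs_matd_stress_le (h : VFlow T U H P) (ht : t ∈ Set.Icc 0 T) (i j : Fin 2) (x : V) :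
    |matd U (stress H i j) t x| ≤ 6 * √(msq (grad U) t x) := by
  have e : matd U (stress H i j) t x = matd U (H i j) t x +
      ∑ k, (matd U (H i k) t x * H j k t x + H i k t x * matd U (H j k) t x) := by
    rw [show stress H i j = fun t x => H i j t x + (fun t x => ∑ k, (fun k t x => H i k t x * H j k t x) k t x) t x
      from rfl, matd_add (h.sH i j) (JS.sum _ fun k => (h.sH i k).mul (h.sH j k)),
      matd_sum fun k => (h.sH i k).mul (h.sH j k)]
    congr 1
    exact Finset.sum_congr rfl fun k _ => matd_mul (h.sH i k) (h.sH j k) t x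
  have h3 := h.sqrt_small ht x
  have h5 := Real.sqrt_nonneg (msq (grad U) t x)
  have h6 := Real.sqrt_nonneg (msq H t x)
  rw [e]
  have h2 : ∀ k, |matd U (H i k) t x * H j k t x + H i k t x * matd U (H j k) t x| ≤
      2 * √(msq (grad U) t x) * √(msq H t x) + √(msq H t x) * (2 * √(msq (grad U) t x)) := fun k =>
    (abs_add_le _ _).trans (add_le_add (abs_mul_le (h.abs_matd_le ht i k x) (abs_le_msq H j k t x))
      (abs_mul_le (abs_le_msq H i k t x) (h.abs_matd_le ht j k x)))
  refine (abs_add_le _ _).trans ((add_le_add (h.abs_matd_le ht i j x) (abs_sum_two_le h2)).trans ?_)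
  nlinarith

theorem abs_remainder_le (h : VFlow T U H P) (ht : t ∈ Set.Icc 0 T) (x : V) :
    |remainder U H t x| ≤ 32 * msq (grad U) t x := by
  have h3 := h.sqrt_small ht x
  have h4 := Real.mul_self_sqrt (msq_nonneg (grad U) t x)
  have h5 := Real.sqrt_nonneg (msq (grad U) t x)
  have hb : ∀ i j, |matd U (stress H i j) t x * pd j (U i t) x -
      stress H i j t x * ∑ k, pd j (U k t) x * pd k (U i t) x| ≤ 8 * msq (grad U) t x := fun i j => by
    have h1 : |stress H i j t x| ≤ 1 := (h.abs_stress_le ht i j x).trans (by linarith)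
    have a1 := abs_mul_le (h.abs_matd_stress_le ht i j x) (abs_grad_le (U := U) (t := t) i j x)
    have a2 := abs_mul_le h1 (abs_sum_two_le fun k => abs_mul_le (abs_grad_le (U := U) (t := t) k j x)
      (abs_grad_le (U := U) (t := t) i k x))
    refine (abs_sub _ _).trans ((add_le_add a1 a2).trans ?_)
    nlinarith
  refine (abs_sum_two_le fun i => abs_sum_two_le fun j => hb i j).trans (by linarith)

theorem abs_work_le (h : VFlow T U H P) (ht : t ∈ Set.Icc 0 T) (x : V) :
    |work U H t x| ≤ 8 * (√(msq H t x) * √(msq (grad U) t x)) :=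
  (abs_sum_two_le fun i => abs_sum_two_le fun j =>
    abs_mul_le (h.abs_stress_le ht i j x) (abs_grad_le (U := U) (t := t) i j x)).trans (by linarith)

theorem abs_tens_le (h : VFlow T U H P) (ht : t ∈ Set.Icc 0 T) (i j : Fin 2) (x : V) :
    |tens U H i j t x| ≤ √(msq (grad U) t x) + 2 * √(msq H t x) :=
  (abs_add_le _ _).trans (add_le_add (abs_grad_le i j x) (h.abs_stress_le ht i j x))

theorem gsq_le (i : Fin 2) (x : V) : gsq (U i t) x ≤ msq (grad U) t x :=
  Finset.single_le_sum (f := fun i => ∑ j, grad U i j t x ^ 2)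
      (fun _ _ => Finset.sum_nonneg fun _ _ => sq_nonneg _) (Finset.mem_univ i)

theorem contU (h : VFlow T U H P) (t : ℝ) : Continuous (vsq U t) := (h.jU.sm t).diff.continuous
theorem contH (h : VFlow T U H P) (t : ℝ) : Continuous (msq H t) := (h.jH.sm t).diff.continuous
theorem contG (h : VFlow T U H P) (t : ℝ) : Continuous (msq (grad U) t) := (h.jG.sm t).diff.continuous
theorem contA (h : VFlow T U H P) (t : ℝ) : Continuous (vsq (acc U) t) := (h.jA.sm t).diff.continuous

theorem int_gsq (h : VFlow T U H P) (ht : t ∈ Set.Icc 0 T) (i : Fin 2) : Integrable (gsq (U i t)) :=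
  (h.iG t ht).mono' (continuous_gsq (h.smU i t)).aestronglyMeasurable (ae_of_all _ fun x => by
    rw [Real.norm_eq_abs, abs_of_nonneg (gsq_nonneg _ _)]; exact gsq_le i x)

theorem int_gsq_sq (h : VFlow T U H P) (ht : t ∈ Set.Icc 0 T) (i : Fin 2) :
    Integrable fun x => gsq (U i t) x ^ 2 :=
  (h.iD t ht).mono' ((continuous_gsq (h.smU i t)).pow 2).aestronglyMeasurable (ae_of_all _ fun x => by
    rw [Real.norm_eq_abs, abs_of_nonneg (by positivity)]
    exact pow_le_pow_left₀ (gsq_nonneg _ _) (gsq_le i x) 2)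

theorem int_sqU (h : VFlow T U H P) (ht : t ∈ Set.Icc 0 T) (i : Fin 2) :
    Integrable fun x => U i t x ^ 2 :=
  (h.iU t ht).mono' ((h.smU i t).diff.continuous.pow 2).aestronglyMeasurable (ae_of_all _ fun x => by
    rw [Real.norm_eq_abs, abs_of_nonneg (by positivity)]; exact sq_le_vsq U i t x)

theorem int_vsq_sq (h : VFlow T U H P) (ht : t ∈ Set.Icc 0 T) :
    Integrable (fun x => vsq U t x ^ 2) ∧
      ∫ x, vsq U t x ^ 2 ≤ 64 * ((∫ x, vsq U t x) * ∫ x, msq (grad U) t x) := by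
  have L := fun i => ladyzhenskaya (h.smU i t) (h.int_sqU ht i) (h.int_gsq ht i)
  have ip : Integrable fun x => 2 * (U 0 t x ^ 4 + U 1 t x ^ 4) := ((L 0).1.add (L 1).1).const_mul 2
  have hp : ∀ x, vsq U t x ^ 2 ≤ 2 * (U 0 t x ^ 4 + U 1 t x ^ 4) := fun x => by
    simp only [vsq, Fin.sum_univ_two]; nlinarith [sq_nonneg (U 0 t x ^ 2 - U 1 t x ^ 2)]
  have i1 : Integrable fun x => vsq U t x ^ 2 := ip.mono' ((h.contU t).pow 2).aestronglyMeasurable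
    (ae_of_all _ fun x => by rw [Real.norm_eq_abs, abs_of_nonneg (by positivity)]; exact hp x)
  refine ⟨i1, (integral_mono i1 ip hp).trans ?_⟩
  rw [integral_const_mul, integral_add (L 0).1 (L 1).1]
  have b : ∀ i, ∫ x, U i t x ^ 4 ≤ 16 * ((∫ x, vsq U t x) * ∫ x, msq (grad U) t x) := fun i => by
    refine (L i).2.trans ?_
    rw [mul_assoc]
    refine mul_le_mul_of_nonneg_left ?_ (by norm_num)
    exact mul_le_mul (integral_mono (h.int_sqU ht i) (h.iU t ht) fun x => sq_le_vsq U i t x)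
      (integral_mono (h.int_gsq ht i) (h.iG t ht) fun x => gsq_le i x)
      (integral_nonneg fun x => gsq_nonneg _ _) (integral_nonneg fun x => vsq_nonneg _ _ _)
  linarith [b 0, b 1]

theorem int_msq_sq (h : VFlow T U H P) (ht : t ∈ Set.Icc 0 T) :
    Integrable (fun x => msq H t x ^ 2) ∧ ∫ x, msq H t x ^ 2 ≤ ∫ x, msq H t x := by
  have hp : ∀ x, msq H t x ^ 2 ≤ msq H t x := fun x => by
    have := h.small t ht x
    have := msq_nonneg H t x
    nlinarith
  have i1 : Integrable fun x => msq H t x ^ 2 := (h.iH t ht).mono' ((h.contH t).pow 2).aestronglyMeasurable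
    (ae_of_all _ fun x => by rw [Real.norm_eq_abs, abs_of_nonneg (by positivity)]; exact hp x)
  exact ⟨i1, integral_mono i1 (h.iH t ht) hp⟩

theorem sqrt_vsq_le_add (U : Fin 2 → ℝ → V → ℝ) (t : ℝ) (x : V) :
    √(vsq U t x) ≤ |U 0 t x| + |U 1 t x| := by
  rw [Real.sqrt_le_iff]
  refine ⟨by positivity, ?_⟩
  simp only [vsq, Fin.sum_univ_two]
  nlinarith [sq_abs (U 0 t x), sq_abs (U 1 t x), mul_nonneg (abs_nonneg (U 0 t x)) (abs_nonneg (U 1 t x))]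

theorem fourth_root_mono (h : VFlow T U H P) (ht : t ∈ Set.Icc 0 T) (i : Fin 2) :
    √√(∫ x, gsq (U i t) x ^ 2) ≤ √√(∫ x, msq (grad U) t x ^ 2) :=
  Real.sqrt_le_sqrt (Real.sqrt_le_sqrt (integral_mono (h.int_gsq_sq ht i) (h.iD t ht)
    fun x => pow_le_pow_left₀ (gsq_nonneg _ _) (gsq_le i x) 2))

theorem sqrt_vsq_le (h : VFlow T U H P) (ht : t ∈ Set.Icc 0 T) (x : V) :
    √(vsq U t x) ≤ 2 * √(∫ x, vsq U t x) + 12 * √√(∫ x, msq (grad U) t x ^ 2) := by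
  have b : ∀ i, |U i t x| ≤ √(∫ x, vsq U t x) + 6 * √√(∫ x, msq (grad U) t x ^ 2) := fun i =>
    (abs_le_of_gsq_sq (h.smU i t) (h.int_gsq_sq ht i) (h.int_sqU ht i) x).trans
      (add_le_add (Real.sqrt_le_sqrt (integral_mono (h.int_sqU ht i) (h.iU t ht) fun x => sq_le_vsq U i t x))
        (by linarith [h.fourth_root_mono ht i]))
  linarith [sqrt_vsq_le_add U t x, b 0, b 1]

theorem sqrt_vsq_le_local (h : VFlow T U H P) (ht : t ∈ Set.Icc 0 T) {l : ℝ} (hl : 0 < l) {x : V}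
    (hx : ‖x‖ ≤ l) : √(vsq U t x) ≤ |U 0 t 0| + |U 1 t 0| + 24 * √l * √√(∫ x, msq (grad U) t x ^ 2) := by
  have b : ∀ i, |U i t x| ≤ |U i t 0| + 12 * √l * √√(∫ x, msq (grad U) t x ^ 2) := fun i =>
    (abs_sub_zero_le (h.smU i t) (h.int_gsq_sq ht i) hl hx).trans
      (by have := mul_le_mul_of_nonneg_left (h.fourth_root_mono ht i) (by positivity : 0 ≤ 12 * √l); linarith)
  linarith [sqrt_vsq_le_add U t x, b 0, b 1]

end VFlow

def cut (R : ℝ) (x : V) : ℝ := eta R x ^ 2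

theorem sm_cut (R : ℝ) : Sm (cut R) := (sm_eta R).pow 2

theorem cut_nonneg (R : ℝ) (x : V) : 0 ≤ cut R x := sq_nonneg _

theorem cut_le_one (R : ℝ) (x : V) : cut R x ≤ 1 := pow_le_one₀ (eta_nonneg R x) (eta_le_one R x)

theorem cut_compact {R : ℝ} (hR : 0 < R) : HasCompactSupport (cut R) := by
  have := (eta_compact hR).mul_right (f' := eta R)
  rwa [show cut R = eta R * eta R from funext fun x => pow_two _]

theorem tendsto_cut (x : V) : Tendsto (fun n => cut (rad n) x) atTop (nhds 1) := by
  simpa [cut] using (tendsto_eta x).pow 2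

theorem abs_le_mul_eta {f : V → ℝ} {R c : ℝ} (hR : 0 < R) (hf : ∀ x, 2 * R < ‖x‖ → f x = 0)
    (hc : ∀ x, |f x| ≤ c) (x : V) : |f x| ≤ c * eta (2 * R) x := by
  rcases le_or_gt ‖x‖ (2 * R) with hx | hx
  · rw [eta_eq_one (by positivity) hx, mul_one]; exact hc x
  · rw [hf x hx, abs_zero]
    exact mul_nonneg ((abs_nonneg _).trans (hc x)) (eta_nonneg _ _)

theorem pd_eq_zero_of_eventually {f : V → ℝ} {x : V} (i : Fin 2) (h : f =ᶠ[nhds x] fun _ => 0) :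
    pd i f x = 0 := by
  unfold pd
  rw [h.fderiv_eq]; simp

theorem pd_eta_eq_zero {R : ℝ} (hR : 0 < R) (i : Fin 2) {x : V} (hx : 2 * R < ‖x‖) :
    pd i (eta R) x = 0 := by
  refine pd_eq_zero_of_eventually i ?_
  filter_upwards [(isOpen_lt continuous_const continuous_norm).mem_nhds hx] with y hy
  exact eta_eq_zero hR (le_of_lt hy)

theorem pd_cut (R : ℝ) (i : Fin 2) (x : V) : pd i (cut R) x = 2 * (eta R x * pd i (eta R) x) := by
  have : pd i (fun x => eta R x * eta R x) x = _ := congrFun (pd_mul i (sm_eta R).diff (sm_eta R).diff) x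
  rw [show cut R = fun x => eta R x * eta R x from funext fun x => pow_two _, this]
  ring

theorem exists_cut_bound : ∃ C : ℝ, 0 ≤ C ∧ ∀ R : ℝ, 0 < R → ∀ (i : Fin 2) (x : V),
    |pd i (eta R) x| ≤ C / R * eta (2 * R) x ∧ |pd i (cut R) x| ≤ C / R * eta (2 * R) x ∧
    √(gsq (eta R) x) ≤ C / R := by
  obtain ⟨C, hC, h⟩ := exists_eta_bound
  obtain ⟨C', hC', h'⟩ := gsq_eta_le
  refine ⟨2 * C + C', by positivity, fun R hR i x => ?_⟩
  have h0 : ∀ x, |pd i (eta R) x| ≤ C / R := fun x => (h R hR i i x).1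
  have h1 : C / R ≤ (2 * C + C') / R := by gcongr; linarith
  have h2 : 2 * (C / R) ≤ (2 * C + C') / R := by rw [← mul_div_assoc]; gcongr; linarith
  refine ⟨abs_le_mul_eta hR (fun x hx => pd_eta_eq_zero hR i hx) (fun x => (h0 x).trans h1) x,
    abs_le_mul_eta hR (fun x hx => ?_) (fun x => ?_) x, (h' R hR x).trans (by gcongr; linarith)⟩
  · rw [pd_cut, pd_eta_eq_zero hR i hx]; ring
  · rw [pd_cut, abs_mul, abs_two]
    refine le_trans ?_ h2
    have := abs_mul_le ((abs_of_nonneg (eta_nonneg R x)).le.trans (eta_le_one R x)) (h0 x)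
    linarith

theorem integral_eta_le {R : ℝ} (hR : 0 < R) : ∫ x, eta R x ≤ 16 * R ^ 2 := by
  have hi : Integrable fun x => eta R x := (nice_eta hR).int
  have hz : ∀ x, x ∉ Metric.closedBall (0 : V) (2 * R) → eta R x = 0 := fun x hx => by
    rw [Metric.mem_closedBall, dist_zero_right, not_le] at hx
    exact eta_eq_zero hR hx.le
  rw [← setIntegral_eq_integral_of_forall_compl_eq_zero hz]
  calc ∫ x in Metric.closedBall (0 : V) (2 * R), eta R x
      ≤ ∫ x in Metric.closedBall (0 : V) (2 * R), (1 : ℝ) :=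
        setIntegral_mono hi.integrableOn (integrableOn_const (by
          exact (isCompact_closedBall (0 : V) (2 * R)).measure_lt_top.ne)) fun x => eta_le_one R x
    _ = 16 * R ^ 2 := by
        rw [setIntegral_const, real_volume_closedBall _ (by positivity)]
        simp; ring

def tder (U : Fin 2 → ℝ → V → ℝ) (i : Fin 2) : ℝ → V → ℝ := dt (U i)

/-- The elastic and convective parts of the tensor entering the pressure equation. -/
def elast (H : Fin 2 → Fin 2 → ℝ → V → ℝ) (i j : Fin 2) (t : ℝ) (x : V) : ℝ := ∑ k, H i k t x * H j k t x

def convT (U : Fin 2 → ℝ → V → ℝ) (i j : Fin 2) (t : ℝ) (x : V) : ℝ := -(U i t x * U j t x)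

namespace VFlow
variable {T : ℝ} {U : Fin 2 → ℝ → V → ℝ} {H : Fin 2 → Fin 2 → ℝ → V → ℝ} {P : ℝ → V → ℝ} {t : ℝ}

theorem integrable_sq_of_le {f q : V → ℝ} (hf : Continuous f) (hq : Integrable q) (h : ∀ x, f x ^ 2 ≤ q x) :
    Integrable fun x => f x ^ 2 :=
  hq.mono' (hf.pow 2).aestronglyMeasurable (ae_of_all _ fun x => by
    rw [Real.norm_eq_abs, abs_of_nonneg (sq_nonneg _)]; exact h x)

theorem smElast (h : VFlow T U H P) (i j : Fin 2) (t : ℝ) : Sm (elast H i j t) :=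
  ContDiff.sum fun k _ => (h.smH i k t).mul (h.smH j k t)

theorem smConv (h : VFlow T U H P) (i j : Fin 2) (t : ℝ) : Sm (convT U i j t) :=
  ((h.smU i t).mul (h.smU j t)).neg

theorem elast_sq_le (i j : Fin 2) (x : V) : elast H i j t x ^ 2 ≤ 4 * msq H t x ^ 2 := by
  have := pow_le_pow_left₀ (abs_nonneg _) (abs_quad_le (t := t) (H := H) i j x) 2
  rw [sq_abs] at this
  unfold elast; linarith

theorem convT_sq_le (i j : Fin 2) (x : V) : convT U i j t x ^ 2 ≤ vsq U t x ^ 2 := by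
  have h1 := sq_le_vsq U i t x
  have h2 := sq_le_vsq U j t x
  have : convT U i j t x ^ 2 = U i t x ^ 2 * U j t x ^ 2 := by unfold convT; ring
  rw [this, pow_two (vsq U t x)]
  exact mul_le_mul h1 h2 (sq_nonneg _) (vsq_nonneg _ _ _)

theorem int_elast (h : VFlow T U H P) (ht : t ∈ Set.Icc 0 T) (i j : Fin 2) :
    Integrable fun x => elast H i j t x ^ 2 :=
  integrable_sq_of_le (h.smElast i j t).diff.continuous ((h.int_msq_sq ht).1.const_mul 4) (elast_sq_le i j)

theorem int_conv (h : VFlow T U H P) (ht : t ∈ Set.Icc 0 T) (i j : Fin 2) :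
    Integrable fun x => convT U i j t x ^ 2 :=
  integrable_sq_of_le (h.smConv i j t).diff.continuous (h.int_vsq_sq ht).1 (convT_sq_le i j)

theorem sum_conv_le (h : VFlow T U H P) (ht : t ∈ Set.Icc 0 T) :
    ∑ i, ∑ j, ∫ x, convT U i j t x ^ 2 ≤ 4 * ∫ x, vsq U t x ^ 2 := by
  have := fun i j => integral_mono (h.int_conv ht i j) (h.int_vsq_sq ht).1 (convT_sq_le i j)
  simp only [Fin.sum_univ_two]
  linarith [this 0 0, this 0 1, this 1 0, this 1 1]

theorem sum_elast_conv_le (h : VFlow T U H P) (ht : t ∈ Set.Icc 0 T) :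
    ∑ i, ∑ j, ∫ x, (elast H i j t x + convT U i j t x) ^ 2 ≤
      32 * (∫ x, msq H t x ^ 2) + 8 * ∫ x, vsq U t x ^ 2 := by
  have ib : Integrable fun x => 8 * msq H t x ^ 2 + 2 * vsq U t x ^ 2 :=
    ((h.int_msq_sq ht).1.const_mul 8).add ((h.int_vsq_sq ht).1.const_mul 2)
  have hb : ∀ i j x, (elast H i j t x + convT U i j t x) ^ 2 ≤ 8 * msq H t x ^ 2 + 2 * vsq U t x ^ 2 :=
    fun i j x => by
      nlinarith [elast_sq_le (H := H) (t := t) i j x, convT_sq_le (U := U) (t := t) i j x,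
        sq_nonneg (elast H i j t x - convT U i j t x)]
  have := fun i j => integral_mono (integrable_sq_of_le
    ((h.smElast i j t).add (h.smConv i j t)).continuous ib (hb i j)) ib (hb i j)
  rw [integral_add ((h.int_msq_sq ht).1.const_mul 8) ((h.int_vsq_sq ht).1.const_mul 2),
    integral_const_mul, integral_const_mul] at this
  simp only [Fin.sum_univ_two]
  linarith [this 0 0, this 0 1, this 1 0, this 1 1]

theorem int_vsq_msq (h : VFlow T U H P) (ht : t ∈ Set.Icc 0 T) :
    Integrable (fun x => vsq U t x * msq (grad U) t x) ∧ ∫ x, vsq U t x * msq (grad U) t x ≤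
      8 * √((∫ x, vsq U t x) * ∫ x, msq (grad U) t x) * √(∫ x, msq (grad U) t x ^ 2) := by
  obtain ⟨h1, h2⟩ := integral_mul_le_sqrt (μ := volume) (h.contU t).aestronglyMeasurable
    (h.contG t).aestronglyMeasurable (h.int_vsq_sq ht).1 (h.iD t ht)
  refine ⟨h1, (integral_mono h1 h1.abs fun x => le_abs_self _).trans (h2.trans ?_)⟩
  refine mul_le_mul_of_nonneg_right ?_ (Real.sqrt_nonneg _)
  refine (Real.sqrt_le_sqrt (h.int_vsq_sq ht).2).trans ?_
  rw [Real.sqrt_mul (by norm_num), show (64:ℝ) = 8 ^ 2 by norm_num, Real.sqrt_sq (by norm_num)]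

theorem tder_eq (i : Fin 2) (x : V) :
    tder U i t x = acc U i t x - ∑ k, U k t x * pd k (U i t) x := by
  unfold tder acc matd; ring

theorem vsq_tder_le (x : V) :
    vsq (tder U) t x ≤ 2 * vsq (acc U) t x + 16 * (vsq U t x * msq (grad U) t x) := by
  have hb : ∀ i, tder U i t x ^ 2 ≤ 2 * acc U i t x ^ 2 + 8 * (vsq U t x * msq (grad U) t x) := fun i => by
    have h1 := abs_sum_two_le fun k => abs_mul_le (abs_le_vsq U k t x) (abs_grad_le (U := U) (t := t) i k x)
    have h2 := pow_le_pow_left₀ (abs_nonneg _) h1 2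
    rw [sq_abs, mul_pow, mul_pow, Real.sq_sqrt (vsq_nonneg _ _ _), Real.sq_sqrt (msq_nonneg _ _ _)] at h2
    rw [tder_eq]
    nlinarith [sq_nonneg (acc U i t x + ∑ k, U k t x * pd k (U i t) x)]
  have h0 := hb 0
  have h1 := hb 1
  simp only [vsq, Fin.sum_univ_two] at h0 h1 ⊢
  linarith

theorem int_tder (h : VFlow T U H P) (ht : t ∈ Set.Icc 0 T) : Integrable (vsq (tder U) t) ∧
    ∫ x, vsq (tder U) t x ≤ 2 * (∫ x, vsq (acc U) t x) +
      128 * (√((∫ x, vsq U t x) * ∫ x, msq (grad U) t x) * √(∫ x, msq (grad U) t x ^ 2)) := by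
  have i1 := (h.iA t ht).const_mul 2
  have i2 := (h.int_vsq_msq ht).1.const_mul 16
  have ib : Integrable fun x => 2 * vsq (acc U) t x + 16 * (vsq U t x * msq (grad U) t x) := i1.add i2
  have hj : JS (vsq (tder U)) := JS.vsq fun i => (h.sU i).dt
  have i0 : Integrable (vsq (tder U) t) := ib.mono' (hj.sm t).continuous.aestronglyMeasurable
    (ae_of_all _ fun x => by
      rw [Real.norm_eq_abs, abs_of_nonneg (vsq_nonneg _ _ _)]; exact vsq_tder_le x)
  refine ⟨i0, (integral_mono i0 ib fun x => vsq_tder_le x).trans ?_⟩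
  rw [integral_add i1 i2, integral_const_mul, integral_const_mul]
  linarith [(h.int_vsq_msq ht).2]

theorem div_tder (h : VFlow T U H P) (ht : t ∈ Set.Ioo 0 T) (x : V) : ∑ i, pd i (tder U i t) x = 0 := by
  have hj : ∀ i, JS (fun t => pd i (U i t)) := fun i => (h.sU i).pd i
  have e : ∀ i, pd i (tder U i t) x = deriv (fun s => pd i (U i s) x) t := fun i =>
    (JS.dt_pd (h.sU i) i t x).symm
  simp only [e]
  have hd : HasDerivAt (fun s => ∑ i, pd i (U i s) x) (∑ i, deriv (fun s => pd i (U i s) x) t) t :=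
    HasDerivAt.fun_sum fun i _ => (hj i).hasDerivAt t x
  have hz : (fun s => ∑ i, pd i (U i s) x) =ᶠ[nhds t] fun _ => 0 := by
    filter_upwards [Ioo_mem_nhds ht.1 ht.2] with s hs
    exact h.divU s ⟨hs.1.le, hs.2.le⟩ x
  rw [← hd.deriv, hz.deriv_eq]
  simp

theorem pressureEq (h : VFlow T U H P) (ht : t ∈ Set.Ioo 0 T) :
    PressureEq (P t) (fun i j x => pd j (U i t) x + H i j t x)
      (fun i j x => elast H i j t x + convT U i j t x) (fun i => tder U i t) := by
  have ht' : t ∈ Set.Icc 0 T := ⟨ht.1.le, ht.2.le⟩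
  have sW : ∀ i j, Sm fun x => pd j (U i t) x + H i j t x := fun i j => ((h.smU i t).pd j).add (h.smH i j t)
  have sM : ∀ i j, Sm fun x => elast H i j t x + convT U i j t x := fun i j =>
    (h.smElast i j t).add (h.smConv i j t)
  have sc : ∀ i, Sm (tder U i t) := fun i => (h.sU i).dt.sm t
  refine ⟨h.smP t, sW, sM, sc, fun i j => ?_, fun i j => ?_, fun i => ?_, fun i x => ?_, fun j x => ?_,
    h.div_tder ht⟩
  · refine integrable_sq_of_le (q := fun x => 2 * msq (grad U) t x + 2 * msq H t x) (sW i j).continuous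
      (((h.iG t ht').const_mul 2).add ((h.iH t ht').const_mul 2)) fun x => ?_
    have h1 := sq_le_msq (grad U) i j t x
    have h2 := sq_le_msq H i j t x
    simp only [grad] at h1
    nlinarith [sq_nonneg (pd j (U i t) x - H i j t x)]
  · refine integrable_sq_of_le (q := fun x => 2 * elast H i j t x ^ 2 + 2 * convT U i j t x ^ 2) (sM i j).continuous
      (((h.int_elast ht' i j).const_mul 2).add ((h.int_conv ht' i j).const_mul 2)) fun x => ?_
    nlinarith [sq_nonneg (elast H i j t x - convT U i j t x)]
  · exact integrable_sq_of_le (sc i).continuous (h.int_tder ht').1 fun x => sq_le_vsq (tder U) i t x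
  · have m := h.mom t ht' x i
    have e1 : ∀ j, pd j (tens U H i j t) x = pd j (fun x => pd j (U i t) x + H i j t x) x + pd j (elast H i j t) x :=
      fun j => by
        rw [show tens U H i j t = fun x => (fun x => pd j (U i t) x + H i j t x) x + elast H i j t x from
          funext fun x => by simp only [tens, stress, elast]; ring,
          pd_add j (sW i j).diff (h.smElast i j t).diff]
    have e2 : ∀ j, pd j (fun x => elast H i j t x + convT U i j t x) x = pd j (elast H i j t) x -
        (pd j (U i t) x * U j t x + U i t x * pd j (U j t) x) := fun j => by
      have hm : Sm fun x => U i t x * U j t x := (h.smU i t).mul (h.smU j t)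
      have e : pd j (convT U i j t) x = -(pd j (U i t) x * U j t x + U i t x * pd j (U j t) x) := by
        rw [show convT U i j t = fun x => -(U i t x * U j t x) from rfl, pd_neg j]
        simp only [pd_mul j (h.smU i t).diff (h.smU j t).diff]
      rw [pd_add j (h.smElast i j t).diff (h.smConv i j t).diff]
      simp only [e]; ring
    have d := h.divU t ht' x
    have c := tder_eq (U := U) (t := t) i x
    simp only [e1, e2, Fin.sum_univ_two] at m d c ⊢
    linear_combination m + c + U i t x * d
  · have d := h.divU t ht'
    have e : ∀ i, pd i (fun x => pd j (U i t) x + H i j t x) x = pd j (pd i (U i t)) x + pd i (H i j t) x :=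
      fun i => by
        rw [pd_add i ((h.smU i t).pd j).diff (h.smH i j t).diff]
        simp only [pd_comm i j (h.smU i t)]
    simp only [e]
    rw [Finset.sum_add_distrib, h.divH t ht' x j, add_zero]
    have : pd j (fun x => ∑ i, pd i (U i t) x) x = ∑ i, pd j (pd i (U i t)) x := by
      rw [pd_sum j Finset.univ fun i _ => ((h.smU i t).pd i).diff]
    rw [← this, show (fun x => ∑ i, pd i (U i t) x) = fun _ => 0 from funext d]
    simp [pd_const]
end VFlow

/-- Spatial integrals of a space-time function and of its square. -/
def tot (f : ℝ → V → ℝ) (t : ℝ) : ℝ := ∫ x, f t x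

def totSq (f : ℝ → V → ℝ) (t : ℝ) : ℝ := ∫ x, f t x ^ 2

theorem totSq_nonneg (f : ℝ → V → ℝ) (t : ℝ) : 0 ≤ totSq f t := integral_nonneg fun _ => sq_nonneg _

theorem tot_vsq_nonneg (U : Fin 2 → ℝ → V → ℝ) (t : ℝ) : 0 ≤ tot (vsq U) t :=
  integral_nonneg fun x => vsq_nonneg U t x

theorem tot_msq_nonneg (H : Fin 2 → Fin 2 → ℝ → V → ℝ) (t : ℝ) : 0 ≤ tot (msq H) t :=
  integral_nonneg fun x => msq_nonneg H t x

/-- The `L²`-size of the tensor controlling the pressure. -/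
def pressSize (U : Fin 2 → ℝ → V → ℝ) (H : Fin 2 → Fin 2 → ℝ → V → ℝ) (t : ℝ) : ℝ :=
  √(32 * totSq (msq H) t + 8 * totSq (vsq U) t)

theorem pressSize_nonneg (U : Fin 2 → ℝ → V → ℝ) (H : Fin 2 → Fin 2 → ℝ → V → ℝ) (t : ℝ) :
    0 ≤ pressSize U H t := Real.sqrt_nonneg _

theorem gsq_mul_le {f g : V → ℝ} (hf : Sm f) (hg : Sm g) (x : V) :
    gsq (fun x => f x * g x) x ≤ 2 * (f x ^ 2 * gsq g x + g x ^ 2 * gsq f x) := by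
  simp only [gsq, Fin.sum_univ_two, pd_mul _ hf.diff hg.diff]
  nlinarith [sq_nonneg (pd 0 f x * g x - f x * pd 0 g x), sq_nonneg (pd 1 f x * g x - f x * pd 1 g x)]

theorem jac_sq_le (a b : V → ℝ) (x : V) : jac a b x ^ 2 ≤ gsq a x * gsq b x := by
  simp only [jac, gsq, Fin.sum_univ_two]
  nlinarith [sq_nonneg (pd 0 a x * pd 0 b x + pd 1 a x * pd 1 b x)]

namespace VFlow
variable {T : ℝ} {U : Fin 2 → ℝ → V → ℝ} {H : Fin 2 → Fin 2 → ℝ → V → ℝ} {P : ℝ → V → ℝ} {t : ℝ}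

theorem exists_pressure_div_free : ∃ C : ℝ, 0 ≤ C ∧ ∀ (T : ℝ) (U : Fin 2 → ℝ → V → ℝ)
    (H : Fin 2 → Fin 2 → ℝ → V → ℝ) (P : ℝ → V → ℝ), VFlow T U H P → ∀ t ∈ Set.Ioo 0 T,
    ∀ w : Fin 2 → ℝ → V → ℝ, (∀ i, Sm (w i t)) → (∀ x, ∑ i, pd i (w i t) x = 0) →
    Integrable (vsq w t) → ∀ R : ℝ, 0 < R →
    |∑ i, ∫ x, pd i (P t) x * (cut R x * w i t x)| ≤ C / R * (pressSize U H t * √(tot (vsq w) t)) := by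
  obtain ⟨C, hC, hb⟩ := exists_cut_bound
  refine ⟨4 * C, by positivity, fun T U H P h t ht w hw hd hi R hR => ?_⟩
  have ht' : t ∈ Set.Icc 0 T := ⟨ht.1.le, ht.2.le⟩
  have hZ : ∀ i, Sm fun x => cut R x * w i t x := fun i => (sm_cut R).mul (hw i)
  have hZc : ∀ i, HasCompactSupport fun x => cut R x * w i t x := fun i => (cut_compact hR).mul_right
  refine ((h.pressureEq ht).abs_integral_le hZ hZc).trans ?_
  have h1 : √(∑ i, ∑ j, ∫ x, (elast H i j t x + convT U i j t x) ^ 2) ≤ pressSize U H t :=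
    Real.sqrt_le_sqrt (h.sum_elast_conv_le ht')
  have e : ∀ x, pd 0 (fun x => cut R x * w 0 t x) x + pd 1 (fun x => cut R x * w 1 t x) x =
      pd 0 (cut R) x * w 0 t x + pd 1 (cut R) x * w 1 t x := fun x => by
    have := hd x
    simp only [Fin.sum_univ_two] at this
    simp only [pd_mul _ (sm_cut R).diff (hw _).diff]
    linear_combination cut R x * this
  have hq : ∀ x, (pd 0 (cut R) x * w 0 t x + pd 1 (cut R) x * w 1 t x) ^ 2 ≤ (2 * C / R) ^ 2 * vsq w t x := fun x => by
    have hx : ∀ i, |pd i (cut R) x| ≤ C / R := fun i => ((hb R hR i x).2.1).trans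
      (mul_le_of_le_one_right (by positivity) (eta_le_one _ _))
    have h2 := add_le_add (abs_mul_le (hx 0) (abs_le_vsq w 0 t x)) (abs_mul_le (hx 1) (abs_le_vsq w 1 t x))
    have h3 := pow_le_pow_left₀ (abs_nonneg _) ((abs_add_le _ _).trans h2) 2
    rw [sq_abs] at h3
    refine h3.trans (le_of_eq ?_)
    rw [← two_mul, ← mul_assoc, mul_pow, Real.sq_sqrt (vsq_nonneg _ _ _)]; ring
  have h2 : √(∫ x, (pd 0 (fun x => cut R x * w 0 t x) x + pd 1 (fun x => cut R x * w 1 t x) x) ^ 2) ≤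
      2 * C / R * √(tot (vsq w) t) := by
    simp only [e]
    rw [← Real.sqrt_sq (by positivity : 0 ≤ 2 * C / R), ← Real.sqrt_mul (by positivity)]
    refine Real.sqrt_le_sqrt ?_
    rw [tot, ← integral_const_mul]
    exact integral_mono_of_nonneg (ae_of_all _ fun x => sq_nonneg _) (hi.const_mul _) (ae_of_all _ hq)
  have h0 := pressSize_nonneg U H t
  calc _ ≤ 2 * pressSize U H t * (2 * C / R * √(tot (vsq w) t)) := by gcongr
    _ = _ := by ring

theorem exists_pressure_convection : ∃ C : ℝ, 0 ≤ C ∧ ∀ (T : ℝ) (U : Fin 2 → ℝ → V → ℝ)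
    (H : Fin 2 → Fin 2 → ℝ → V → ℝ) (P : ℝ → V → ℝ), VFlow T U H P → ∀ t ∈ Set.Ioo 0 T,
    ∀ R : ℝ, 1 ≤ R →
    |∑ i, ∫ x, pd i (P t) x * (cut R x * ∑ k, U k t x * pd k (U i t) x)| ≤
      C * (tot (msq (grad U)) t + √(totSq (vsq U) t) * √(totSq (msq (grad U)) t)) +
        C / R * (tot (vsq U) t + totSq (vsq U) t) := by
  obtain ⟨C, hC, hb⟩ := exists_cut_bound
  obtain ⟨K, hK, hJ⟩ := PressureEq.abs_integral_jac_le
  refine ⟨4 * K + 24 + (4 * K * C ^ 2 + 24 * C ^ 2), by positivity, fun T U H P h t ht R hR => ?_⟩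
  have hR0 : 0 < R := by linarith
  have ht' : t ∈ Set.Icc 0 T := ⟨ht.1.le, ht.2.le⟩
  have sZ : ∀ i, Sm fun x => ∑ k, U k t x * pd k (U i t) x := fun i =>
    ContDiff.sum fun k _ => (h.smU k t).mul ((h.smU i t).pd k)
  have sa : ∀ i, Sm fun x => eta R x * U i t x := fun i => (sm_eta R).mul (h.smU i t)
  have na : ∀ i, Nice fun x => eta R x * U i t x := fun i =>
    Nice.of_compact (sa i) (eta_compact hR0).mul_right
  have hS1 : ∀ i j x, |elast H i j t x| ≤ 1 := fun i j x => by
    have := abs_quad_le (t := t) (H := H) i j x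
    have h4 := h.small t ht' x
    unfold elast; linarith
  have hdiv : ∀ x, pd 0 (fun x => cut R x * ∑ k, U k t x * pd k (U 0 t) x) x +
      pd 1 (fun x => cut R x * ∑ k, U k t x * pd k (U 1 t) x) x =
      -2 * jac (fun x => eta R x * U 0 t x) (fun x => eta R x * U 1 t x) x := fun x => by
    have d0 := h.divU t ht' 
    have d1 : ∀ i, pd i (fun x => pd 0 (U 0 t) x + pd 1 (U 1 t) x) x = 0 := fun i => by
      have : (fun x => pd 0 (U 0 t) x + pd 1 (U 1 t) x) = fun _ => 0 := funext fun y => by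
        simpa only [Fin.sum_univ_two] using d0 y
      rw [this, pd_const]
    have e1 : ∀ i, pd i (fun x => pd 0 (U 0 t) x + pd 1 (U 1 t) x) x =
        pd i (pd 0 (U 0 t)) x + pd i (pd 1 (U 1 t)) x := fun i =>
      congrFun (pd_add i ((h.smU 0 t).pd 0).diff ((h.smU 1 t).pd 1).diff) x
    have c0 := (e1 0).symm.trans (d1 0)
    have c1 := (e1 1).symm.trans (d1 1)
    have d00 := d0 x
    have comm : ∀ i, pd 1 (pd 0 (U i t)) x = pd 0 (pd 1 (U i t)) x := fun i =>
      congrFun (pd_comm 1 0 (h.smU i t)) x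
    have ez : ∀ i j, pd j (fun x => ∑ k, U k t x * pd k (U i t) x) x =
        ∑ k, (pd j (U k t) x * pd k (U i t) x + U k t x * pd j (pd k (U i t)) x) := fun i j => by
      have m : ∀ k, Sm fun x => U k t x * pd k (U i t) x := fun k => (h.smU k t).mul ((h.smU i t).pd k)
      rw [pd_sum j Finset.univ fun k _ => (m k).diff]
      simp only [pd_mul _ (h.smU _ t).diff ((h.smU _ t).pd _).diff]
    have e2 : ∀ i, pd i (fun x => cut R x * ∑ k, U k t x * pd k (U i t) x) x = _ := fun i =>
      congrFun (pd_mul i (sm_cut R).diff (sZ i).diff) x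
    rw [e2, e2]
    simp only [jac, pd_mul _ (sm_eta R).diff (h.smU _ t).diff, ez, pd_cut, cut]
    simp only [Fin.sum_univ_two] at d00 ⊢
    have q0 := comm 0
    have q1 := comm 1
    rw [q0] at c1
    rw [q1]
    have s1 : pd 1 (U 1 t) x = - pd 0 (U 0 t) x := by linarith
    have s2 : pd 1 (pd 1 (U 1 t)) x = - pd 0 (pd 1 (U 0 t)) x := by linarith
    have s3 : pd 0 (pd 1 (U 1 t)) x = - pd 0 (pd 0 (U 0 t)) x := by linarith
    rw [s2, s3, s1]; ring
  refine (hJ _ _ _ _ _ (h.pressureEq ht) (h.smElast · · t) (h.smConv · · t) (h.int_elast ht') (h.int_conv ht')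
    hS1 _ (fun i => (sm_cut R).mul (sZ i)) (fun i => (cut_compact hR0).mul_right) _ _ (na 0) (na 1) hdiv).trans ?_
  have hg : ∀ i x, gsq (fun x => eta R x * U i t x) x ≤ 2 * (msq (grad U) t x + (C / R) ^ 2 * vsq U t x) :=
    fun i x => by
      refine (gsq_mul_le (sm_eta R) (h.smU i t) x).trans ?_
      have a1 : eta R x ^ 2 * gsq (U i t) x ≤ msq (grad U) t x :=
        (mul_le_of_le_one_left (gsq_nonneg _ _) (cut_le_one R x)).trans (gsq_le i x)
      have a2 : gsq (eta R) x ≤ (C / R) ^ 2 := by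
        have := pow_le_pow_left₀ (Real.sqrt_nonneg _) (hb R hR0 i x).2.2 2
        rwa [Real.sq_sqrt (gsq_nonneg _ _)] at this
      have a3 := mul_le_mul (sq_le_vsq U i t x) a2 (gsq_nonneg _ _) (vsq_nonneg _ _ _)
      linarith
  have ib : Integrable fun x => 2 * (msq (grad U) t x + (C / R) ^ 2 * vsq U t x) :=
    ((h.iG t ht').add ((h.iU t ht').const_mul _)).const_mul 2
  have hgi : ∀ i, ∫ x, gsq (fun x => eta R x * U i t x) x ≤
      2 * (tot (msq (grad U)) t + (C / R) ^ 2 * tot (vsq U) t) := fun i => by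
    refine (integral_mono_of_nonneg (ae_of_all _ fun x => gsq_nonneg _ _) ib (ae_of_all _ (hg i))).trans
      (le_of_eq ?_)
    rw [integral_const_mul, integral_add (h.iG t ht') ((h.iU t ht').const_mul _), integral_const_mul]; rfl
  have ij : Integrable fun x => 8 * msq (grad U) t x ^ 2 + 8 * (C / R) ^ 4 * vsq U t x ^ 2 :=
    ((h.iD t ht').const_mul 8).add ((h.int_vsq_sq ht').1.const_mul _)
  have hji : ∫ x, jac (fun x => eta R x * U 0 t x) (fun x => eta R x * U 1 t x) x ^ 2 ≤
      8 * totSq (msq (grad U)) t + 8 * (C / R) ^ 4 * totSq (vsq U) t := by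
    refine (integral_mono_of_nonneg (ae_of_all _ fun x => sq_nonneg _) ij (ae_of_all _ fun x => ?_)).trans
      (le_of_eq ?_)
    · have b1 := mul_le_mul (hg 0 x) (hg 1 x) (gsq_nonneg _ _) ((gsq_nonneg _ _).trans (hg 0 x))
      refine (jac_sq_le _ _ x).trans (b1.trans ?_)
      nlinarith [sq_nonneg (msq (grad U) t x - (C / R) ^ 2 * vsq U t x)]
    · rw [integral_add ((h.iD t ht').const_mul 8) ((h.int_vsq_sq ht').1.const_mul _), integral_const_mul,
        integral_const_mul]; rfl
  have hjs : √(∫ x, jac (fun x => eta R x * U 0 t x) (fun x => eta R x * U 1 t x) x ^ 2) ≤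
      3 * √(totSq (msq (grad U)) t) + 3 * (C / R) ^ 2 * √(totSq (vsq U) t) := by
    have n1 := totSq_nonneg (msq (grad U)) t
    have n2 := totSq_nonneg (vsq U) t
    rw [Real.sqrt_le_left (by positivity)]
    have r1 := Real.sq_sqrt n1
    have r2 := Real.sq_sqrt n2
    have : 0 ≤ √(totSq (msq (grad U)) t) * ((C / R) ^ 2 * √(totSq (vsq U) t)) := by positivity
    have n3 : 0 ≤ (C / R) ^ 4 * totSq (vsq U) t := by positivity
    refine hji.trans ?_
    have : (3 * √(totSq (msq (grad U)) t) + 3 * (C / R) ^ 2 * √(totSq (vsq U) t)) ^ 2 =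
      9 * √(totSq (msq (grad U)) t) ^ 2 + 9 * (C / R) ^ 4 * √(totSq (vsq U) t) ^ 2 +
        18 * (√(totSq (msq (grad U)) t) * ((C / R) ^ 2 * √(totSq (vsq U) t))) := by ring
    rw [this, r1, r2]; linarith
  have hc : √(∑ i, ∑ j, ∫ x, convT U i j t x ^ 2) ≤ 2 * √(totSq (vsq U) t) := by
    refine (Real.sqrt_le_sqrt (h.sum_conv_le ht')).trans (le_of_eq ?_)
    rw [Real.sqrt_mul (by norm_num), show (4:ℝ) = 2 ^ 2 by norm_num, Real.sqrt_sq (by norm_num)]; rfl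
  have hCR : (C / R) ^ 2 ≤ C ^ 2 / R := by
    rw [div_pow, div_le_div_iff₀ (by positivity) hR0]
    nlinarith [mul_nonneg (sq_nonneg C) (mul_nonneg hR0.le (sub_nonneg.2 hR))]
  have hGn := tot_msq_nonneg (grad U) t
  have hUn := tot_vsq_nonneg U t
  have hWn := totSq_nonneg (vsq U) t
  have hW2 := Real.sq_sqrt hWn
  have hD0 := Real.sqrt_nonneg (totSq (msq (grad U)) t)
  have hW0 := Real.sqrt_nonneg (totSq (vsq U) t)
  have e3 : C ^ 2 / R = C ^ 2 * (1 / R) := by ring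
  have hRi : 0 ≤ 1 / R := by positivity
  calc _ ≤ K * (2 * (tot (msq (grad U)) t + C ^ 2 / R * tot (vsq U) t) +
        2 * (tot (msq (grad U)) t + C ^ 2 / R * tot (vsq U) t)) +
        4 * (2 * √(totSq (vsq U) t)) *
          (3 * √(totSq (msq (grad U)) t) + 3 * (C ^ 2 / R) * √(totSq (vsq U) t)) := by
        refine add_le_add (mul_le_mul_of_nonneg_left (add_le_add ((hgi 0).trans ?_) ((hgi 1).trans ?_)) hK) ?_
        · gcongr
        · gcongr
        · refine mul_le_mul (by linarith) (hjs.trans ?_) (Real.sqrt_nonneg _) (by positivity)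
          gcongr
    _ = 4 * K * tot (msq (grad U)) t + 24 * (√(totSq (vsq U) t) * √(totSq (msq (grad U)) t)) +
        (1 / R) * (4 * K * C ^ 2 * tot (vsq U) t + 24 * C ^ 2 * √(totSq (vsq U) t) ^ 2) := by rw [e3]; ring
    _ ≤ _ := by
      rw [hW2, div_eq_mul_one_div (_ + _) R, mul_comm _ (1 / R), mul_assoc (1 / R)]
      refine add_le_add ?_ (mul_le_mul_of_nonneg_left ?_ hRi)
      · have m1 := mul_nonneg hW0 hD0
        have m2 : 0 ≤ K * (√(totSq (vsq U) t) * √(totSq (msq (grad U)) t)) := by positivity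
        have m3 : 0 ≤ (4 * K * C ^ 2 + 24 * C ^ 2) *
          (tot (msq (grad U)) t + √(totSq (vsq U) t) * √(totSq (msq (grad U)) t)) := by positivity
        nlinarith
      · have m1 : 0 ≤ (4 * K + 24) * (tot (vsq U) t + totSq (vsq U) t) := by positivity
        have m2 : 0 ≤ K * C ^ 2 * totSq (vsq U) t := by positivity
        have m3 : 0 ≤ C ^ 2 * tot (vsq U) t := by positivity
        nlinarith

end VFlow

theorem sub_le_setIntegral {y y' g : ℝ → ℝ} {a b : ℝ} (hab : a ≤ b) (hc : ContinuousOn y (Set.Icc a b))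
    (hd : ∀ t ∈ Set.Ioo a b, HasDerivWithinAt y (y' t) (Set.Ioi t) t) (hg : IntegrableOn g (Set.Ioc a b))
    (hle : ∀ t ∈ Set.Ioo a b, y' t ≤ g t) : y b - y a ≤ ∫ t in Set.Ioc a b, g t := by
  rw [← intervalIntegral.integral_of_le hab]
  exact intervalIntegral.sub_le_integral_of_hasDeriv_right_of_le hab hc hd
    ((integrableOn_Icc_iff_integrableOn_Ioc (by simp)).2 hg) hle

theorem tendsto_integral_cut_mul {f : V → ℝ} (hf : Integrable f) :
    Tendsto (fun n => ∫ x, cut (rad n) x * f x) atTop (nhds (∫ x, f x)) := by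
  refine tendsto_integral_of_dominated_convergence (fun x => |f x|) (fun n => ?_) hf.abs
    (fun n => ae_of_all _ fun x => ?_) (ae_of_all _ fun x => ?_)
  · exact (sm_cut _).continuous.aestronglyMeasurable.mul hf.aestronglyMeasurable
  · rw [Real.norm_eq_abs, abs_mul, abs_of_nonneg (cut_nonneg _ _)]
    exact mul_le_of_le_one_left (abs_nonneg _) (cut_le_one _ _)
  · simpa using (tendsto_cut x).mul_const (f x)

/-- A dyadic recursion with decaying coefficient improves polynomial growth to boundedness. -/
theorem bounded_of_dyadic {Y : ℝ → ℝ} {B κ : ℝ} (hB : 0 ≤ B) (hκ : 0 ≤ κ)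
    (h : ∀ R, 1 ≤ R → Y R ≤ B + κ / √R * Y (2 * R)) (m : ℕ) :
    ∀ K, 0 ≤ K → (∀ R, 1 ≤ R → Y R ≤ K * √R ^ m) → ∃ K', 0 ≤ K' ∧ ∀ R, 1 ≤ R → Y R ≤ K' := by
  induction m with
  | zero => exact fun K hK hY => ⟨K, hK, by simpa using hY⟩
  | succ m ih =>
    intro K hK hY
    refine ih (B + κ * K * 2 ^ (m + 1)) (by positivity) fun R hR => ?_
    have hs : 1 ≤ √R := Real.one_le_sqrt.2 hR
    have h2 : √(2 * R) ≤ 2 * √R := by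
      rw [Real.sqrt_le_left (by positivity), mul_pow, Real.sq_sqrt (by linarith)]; linarith
    have h3 := hY (2 * R) (by linarith)
    have h4 : √(2 * R) ^ (m + 1) ≤ (2 * √R) ^ (m + 1) := pow_le_pow_left₀ (Real.sqrt_nonneg _) h2 _
    calc Y R ≤ B + κ / √R * Y (2 * R) := h R hR
      _ ≤ B + κ / √R * (K * (2 * √R) ^ (m + 1)) := by
        gcongr; exact h3.trans (by gcongr)
      _ = B + κ * K * 2 ^ (m + 1) * √R ^ m := by
        have : √R ≠ 0 := by positivity
        field_simp
        ring
      _ ≤ _ := by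
        rw [add_mul]
        have := le_mul_of_one_le_right hB (one_le_pow₀ hs (n := m))
        linarith

/-- The fourth root of the spatial integral of `|∇u|⁴`. -/
def quartG (U : Fin 2 → ℝ → V → ℝ) (t : ℝ) : ℝ := √√(totSq (msq (grad U)) t)

theorem quartG_nonneg (U : Fin 2 → ℝ → V → ℝ) (t : ℝ) : 0 ≤ quartG U t := Real.sqrt_nonneg _

theorem quartG_pow (U : Fin 2 → ℝ → V → ℝ) (t : ℝ) : quartG U t ^ 4 = totSq (msq (grad U)) t := by
  rw [show quartG U t ^ 4 = (quartG U t ^ 2) ^ 2 by ring, quartG, Real.sq_sqrt (Real.sqrt_nonneg _),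
    Real.sq_sqrt (totSq_nonneg _ _)]

namespace VFlow
variable {T : ℝ} {U : Fin 2 → ℝ → V → ℝ} {H : Fin 2 → Fin 2 → ℝ → V → ℝ} {P : ℝ → V → ℝ} {t : ℝ}

theorem integrable_eta_mul {f : V → ℝ} (hf : Continuous f) {R : ℝ} (hR : 0 < R) :
    Integrable fun x => eta R x * f x := by
  simpa only [mul_comm] using integrable_mul_compact hf (sm_eta R).continuous (eta_compact hR)

theorem integral_eta_mul_le {f : V → ℝ} (hf : Integrable f) (h0 : ∀ x, 0 ≤ f x) (R : ℝ) :
    ∫ x, eta R x * f x ≤ ∫ x, f x :=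
  integral_mono_of_nonneg (ae_of_all _ fun x => mul_nonneg (eta_nonneg R x) (h0 x)) hf
    (ae_of_all _ fun x => mul_le_of_le_one_left (h0 x) (eta_le_one R x))

theorem integral_eta_nonneg {f : V → ℝ} (h0 : ∀ x, 0 ≤ f x) (R : ℝ) : 0 ≤ ∫ x, eta R x * f x :=
  integral_nonneg fun x => mul_nonneg (eta_nonneg R x) (h0 x)

/-- The velocity at the origin. -/
def centerSize (U : Fin 2 → ℝ → V → ℝ) (t : ℝ) : ℝ := |U 0 t 0| + |U 1 t 0|

theorem centerSize_nonneg (U : Fin 2 → ℝ → V → ℝ) (t : ℝ) : 0 ≤ centerSize U t := by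
  unfold centerSize; positivity

theorem sqrt_vsq_le_ball (h : VFlow T U H P) (ht : t ∈ Set.Icc 0 T) {R : ℝ} (hR : 1 ≤ R) {x : V}
    (hx : ‖x‖ ≤ 4 * R) : √(vsq U t x) ≤ 48 * √R * (centerSize U t + quartG U t) := by
  have hs : 1 ≤ √R := Real.one_le_sqrt.2 hR
  refine (h.sqrt_vsq_le_local ht (by linarith : 0 < 4 * R) hx).trans ?_
  rw [Real.sqrt_mul (by norm_num), show (4:ℝ) = 2 ^ 2 by norm_num, Real.sqrt_sq (by norm_num)]
  have c0 := centerSize_nonneg U t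
  have : |U 0 t 0| + |U 1 t 0| = centerSize U t := rfl
  rw [this]
  have : √√(∫ x, msq (grad U) t x ^ 2) = quartG U t := rfl
  rw [this]
  nlinarith

theorem exists_kinetic_dt_bound : ∃ C : ℝ, 0 ≤ C ∧ ∀ (T : ℝ) (U : Fin 2 → ℝ → V → ℝ)
    (H : Fin 2 → Fin 2 → ℝ → V → ℝ) (P : ℝ → V → ℝ), VFlow T U H P → ∀ t ∈ Set.Icc 0 T, ∀ R : ℝ, 1 ≤ R →
    |∫ x, eta R x * dt (vsq U) t x| ≤ 4 * (√(∫ x, eta R x * vsq U t x) * √(tot (vsq (acc U)) t)) +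
      C / √R * ((centerSize U t + quartG U t) * ∫ x, eta (2 * R) x * vsq U t x) := by
  obtain ⟨C, hC, hb⟩ := exists_cut_bound
  refine ⟨2 * (C * 48), by positivity, fun T U H P h t ht R hR => ?_⟩
  have hR0 : 0 < R := by linarith
  rw [integral_cutoff_dt h.sU h.jU (sm_eta R) (eta_compact hR0) (h.divU t ht) (K := fun _ _ => 0)
    fun _ => contDiff_const]
  simp only [pd_const, Finset.sum_const_zero, sub_zero]
  have cM : Continuous (matd U (vsq U) t) := ((JS.matd h.sU h.jU).sm t).continuous
  have cT : ∀ j, Continuous fun x => pd j (eta R) x * (U j t x * vsq U t x) := fun j =>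
    ((sm_eta R).pd j).continuous.mul ((h.smU j t).continuous.mul (h.contU t))
  have k1 : Integrable (fun x => eta R x * matd U (vsq U) t x) ∧
      |∫ x, eta R x * matd U (vsq U) t x| ≤
        4 * (√(∫ x, eta R x * vsq U t x) * √(∫ x, vsq (acc U) t x)) := by
    refine abs_integral_le_sqrt (by norm_num) ((sm_eta R).continuous.mul cM)
      ((sm_eta R).continuous.mul (h.contU t)) (h.contA t) (fun x => mul_nonneg (eta_nonneg _ _) (vsq_nonneg _ _ _))
      (vsq_nonneg _ _) (integrable_eta_mul (h.contU t) hR0) (h.iA t ht) fun x => ?_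
    have b1 : |matd U (vsq U) t x| ≤ 2 * (2 * (√(vsq U t x) * √(vsq (acc U) t x))) := by
      rw [matd_vsq h.sU]
      refine abs_sum_two_le fun i => ?_
      have := abs_mul_le (abs_le_vsq U i t x) (abs_le_vsq (acc U) i t x)
      rw [mul_assoc, abs_mul, abs_two]
      exact mul_le_mul_of_nonneg_left this (by norm_num)
    have e0 := eta_nonneg R x
    have e1 : eta R x ≤ √(eta R x) := by
      have s1 := Real.sq_sqrt e0
      have s2 : √(eta R x) ≤ 1 := Real.sqrt_le_one.2 (eta_le_one R x)
      nlinarith [Real.sqrt_nonneg (eta R x)]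
    rw [abs_mul, abs_of_nonneg e0, Real.sqrt_mul e0]
    calc _ ≤ √(eta R x) * (2 * (2 * (√(vsq U t x) * √(vsq (acc U) t x)))) := by gcongr
      _ = _ := by ring
  have k2 : |∫ x, ∑ j, pd j (eta R) x * (U j t x * vsq U t x)| ≤
      2 * (C * 48) / √R * ((centerSize U t + quartG U t) * ∫ x, eta (2 * R) x * vsq U t x) := by
    rw [← mul_assoc, ← integral_const_mul]
    rw [← Real.norm_eq_abs]
    refine norm_integral_le_of_norm_le
      (f := fun x => ∑ j, pd j (eta R) x * (U j t x * vsq U t x))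
      ((integrable_eta_mul (h.contU t) (by linarith : 0 < 2 * R)).const_mul _) (ae_of_all _ fun x => ?_)
    rw [Real.norm_eq_abs]
    have e0 := eta_nonneg (2 * R) x
    have hs : 1 ≤ √R := Real.one_le_sqrt.2 hR
    rcases le_or_gt ‖x‖ (4 * R) with hx | hx
    · have q1 := h.sqrt_vsq_le_ball ht hR hx
      have q2 : ∀ j, |pd j (eta R) x * (U j t x * vsq U t x)| ≤
          C / R * eta (2 * R) x * (48 * √R * (centerSize U t + quartG U t) * vsq U t x) := fun j =>
        abs_mul_le (hb R hR0 j x).1 (abs_mul_le ((abs_le_vsq U j t x).trans q1)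
          (le_of_eq (abs_of_nonneg (vsq_nonneg _ _ _))))
      refine (abs_sum_two_le q2).trans (le_of_eq ?_)
      have s1 : √R ^ 2 = R := Real.sq_sqrt hR0.le
      have s2 : √R ≠ 0 := by positivity
      field_simp
      rw [s1]; ring
    · have z : ∀ j, pd j (eta R) x = 0 := fun j => pd_eta_eq_zero hR0 j (by linarith)
      simp only [z, zero_mul, Finset.sum_const_zero, abs_zero]
      have c0 : 0 ≤ centerSize U t + quartG U t := add_nonneg (centerSize_nonneg U t) (quartG_nonneg U t)
      have := vsq_nonneg U t x
      positivity
  have iT : Integrable fun x => ∑ j, pd j (eta R) x * (U j t x * vsq U t x) := by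
    refine integrable_finsetSum _ fun j _ => ?_
    exact (cT j).integrable_of_hasCompactSupport (hasCompactSupport_pd (eta_compact hR0) j).mul_right
  rw [integral_add k1.1 iT]
  exact (abs_add_le _ _).trans (add_le_add k1.2 k2)

end VFlow

namespace VFlow
variable {T : ℝ} {U : Fin 2 → ℝ → V → ℝ} {H : Fin 2 → Fin 2 → ℝ → V → ℝ} {P : ℝ → V → ℝ} {t : ℝ}

theorem measurable_totA (h : VFlow T U H P) : Measurable (tot (vsq (acc U))) :=
  JS.measurable_integral h.jA.continuous

theorem measurable_totG (h : VFlow T U H P) : Measurable (tot (msq (grad U))) :=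
  JS.measurable_integral h.jG.continuous

theorem measurable_totSqG (h : VFlow T U H P) : Measurable (totSq (msq (grad U))) :=
  JS.measurable_integral (g := fun t x => msq (grad U) t x ^ 2) (h.jG.continuous.pow 2)

theorem measurable_quartG (h : VFlow T U H P) : Measurable (quartG U) := h.measurable_totSqG.sqrt.sqrt

theorem continuous_integral_eta (h : VFlow T U H P) {R : ℝ} (hR : 0 < R) :
    Continuous fun s => ∫ x, eta R x * vsq U s x :=
  continuous_iff_continuousAt.2 fun s =>
    (JS.hasDerivAt_integral_compact h.jU (sm_eta R) (eta_compact hR) s).continuousAt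

theorem exists_centerSize_le (h : VFlow T U H P) : ∃ M, 0 ≤ M ∧ ∀ t ∈ Set.Icc 0 T, centerSize U t ≤ M := by
  have hc : ∀ i, Continuous fun t => U i t 0 := fun i =>
    (h.sU i).continuous.comp (continuous_id.prodMk continuous_const)
  have : Continuous (centerSize U) := (hc 0).abs.add (hc 1).abs
  obtain ⟨M, hM⟩ := (isCompact_Icc (a := (0:ℝ)) (b := T)).bddAbove_image this.continuousOn
  exact ⟨max M 0, le_max_right _ _, fun t ht => (hM (Set.mem_image_of_mem _ ht)).trans (le_max_left _ _)⟩

theorem integral_eta_vsq_le (h : VFlow T U H P) (ht : t ∈ Set.Icc 0 T) {R M : ℝ} (hR : 1 ≤ R)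
    (hM : centerSize U t ≤ M) :
    ∫ x, eta (2 * R) x * vsq U t x ≤ 64 * 48 ^ 2 * √R ^ 6 * (M + quartG U t) ^ 2 := by
  have h2R : 0 < 2 * R := by linarith
  have hb : ∀ x, eta (2 * R) x * vsq U t x ≤ (48 * √R * (M + quartG U t)) ^ 2 * eta (2 * R) x := fun x => by
    have e0 := eta_nonneg (2 * R) x
    rcases le_or_gt ‖x‖ (4 * R) with hx | hx
    · have k := (h.sqrt_vsq_le_ball ht hR hx).trans (b := _) (c := 48 * √R * (M + quartG U t)) (by gcongr)
      have := pow_le_pow_left₀ (Real.sqrt_nonneg _) k 2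
      rw [Real.sq_sqrt (vsq_nonneg _ _ _)] at this
      rw [mul_comm]
      gcongr
    · rw [eta_eq_zero h2R (by linarith)]; simp
  have ie : Integrable (eta (2 * R)) := (sm_eta _).continuous.integrable_of_hasCompactSupport (eta_compact h2R)
  have s1 : √R ^ 2 = R := Real.sq_sqrt (by linarith)
  calc _ ≤ ∫ x, (48 * √R * (M + quartG U t)) ^ 2 * eta (2 * R) x :=
        integral_mono (integrable_eta_mul (h.contU t) h2R) (ie.const_mul _) hb
    _ = (48 * √R * (M + quartG U t)) ^ 2 * ∫ x, eta (2 * R) x := integral_const_mul _ _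
    _ ≤ (48 * √R * (M + quartG U t)) ^ 2 * (16 * (2 * R) ^ 2) := by
        gcongr; exact integral_eta_le h2R
    _ = 64 * 48 ^ 2 * √R ^ 2 * R ^ 2 * (M + quartG U t) ^ 2 := by ring
    _ = 64 * 48 ^ 2 * √R ^ 2 * (√R ^ 2) ^ 2 * (M + quartG U t) ^ 2 := by rw [s1]
    _ = _ := by ring

theorem integrableOn_of_weighted {f : ℝ → ℝ} {a : ℝ} (k : ℕ) (ha : 0 < a) (hf : Measurable f) (h0 : ∀ t, 0 ≤ f t)
    (hi : IntegrableOn (fun t => t ^ k * f t) (Set.Ioc 0 T)) : IntegrableOn f (Set.Ioc a T) := by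
  have : IntegrableOn (fun t => (a ^ k)⁻¹ * (t ^ k * f t)) (Set.Ioc a T) :=
    (hi.mono_set (Set.Ioc_subset_Ioc_left ha.le)).const_mul _
  refine this.mono' hf.aestronglyMeasurable ((ae_restrict_iff' measurableSet_Ioc).2 (ae_of_all _ fun t ht => ?_))
  rw [Real.norm_eq_abs, abs_of_nonneg (h0 t), ← mul_assoc]
  refine le_mul_of_one_le_left (h0 t) ?_
  rw [inv_mul_eq_div, one_le_div (by positivity)]
  exact pow_le_pow_left₀ ha.le ht.1.le k

theorem tot_vsq_le (h : VFlow T U H P)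
    (h1 : IntegrableOn (fun t => t * tot (vsq (acc U)) t) (Set.Ioc 0 T))
    (h2 : IntegrableOn (fun t => t ^ 2 * totSq (msq (grad U)) t) (Set.Ioc 0 T)) {a : ℝ} (ha : a ∈ Set.Ioc 0 T) :
    tot (vsq U) a ≤ 2 * tot (vsq U) T + 16 * (∫ t in Set.Ioc a T, √(tot (vsq (acc U)) t)) ^ 2 := by
  obtain ⟨C, hC, hb⟩ := exists_kinetic_dt_bound
  obtain ⟨M, hM0, hM⟩ := h.exists_centerSize_le
  have hT : T ∈ Set.Icc 0 T := ⟨ha.1.le.trans ha.2, le_rfl⟩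
  have hsub : Set.Icc a T ⊆ Set.Icc 0 T := Set.Icc_subset_Icc_left ha.1.le
  have iA : IntegrableOn (tot (vsq (acc U))) (Set.Ioc a T) :=
    integrableOn_of_weighted 1 ha.1 h.measurable_totA (tot_vsq_nonneg _) (by simpa using h1)
  have iD : IntegrableOn (totSq (msq (grad U))) (Set.Ioc a T) :=
    integrableOn_of_weighted 2 ha.1 h.measurable_totSqG (totSq_nonneg _) h2
  have ic : ∀ c : ℝ, IntegrableOn (fun _ : ℝ => c) (Set.Ioc a T) := fun c =>
    integrableOn_const (by simp) (by simp)
  have isA : IntegrableOn (fun t => √(tot (vsq (acc U)) t)) (Set.Ioc a T) := by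
    refine ((ic 1).add iA).mono' h.measurable_totA.sqrt.aestronglyMeasurable (ae_of_all _ fun t => ?_)
    have s1 := Real.sq_sqrt (tot_vsq_nonneg (acc U) t)
    have s0 := Real.sqrt_nonneg (tot (vsq (acc U)) t)
    rw [Real.norm_eq_abs, abs_of_nonneg s0]
    change _ ≤ 1 + tot (vsq (acc U)) t
    nlinarith [sq_nonneg (√(tot (vsq (acc U)) t) - 1)]
  have iq : ∀ k ≤ 4, IntegrableOn (fun t => (M + quartG U t) ^ k) (Set.Ioc a T) := fun k hk => by
    have ib : IntegrableOn (fun t => 1 + 8 * (M ^ 4 + totSq (msq (grad U)) t)) (Set.Ioc a T) :=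
      (ic 1).add (((ic (M ^ 4)).add iD).const_mul 8)
    refine ib.mono' ((h.measurable_quartG.const_add M).pow_const k).aestronglyMeasurable
      (ae_of_all _ fun t => ?_)
    have q0 := quartG_nonneg U t
    have p0 : 0 ≤ M + quartG U t := by positivity
    rw [Real.norm_eq_abs, abs_of_nonneg (by positivity), ← quartG_pow]
    have l1 : (M + quartG U t) ^ k ≤ 1 + (M + quartG U t) ^ 4 := by
      rcases le_total (M + quartG U t) 1 with l | l
      · linarith [pow_le_one₀ p0 l (n := k), pow_nonneg p0 4]
      · linarith [pow_le_pow_right₀ l hk]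
    have l2 : (M + quartG U t) ^ 4 ≤ 8 * (M ^ 4 + quartG U t ^ 4) := by
      have a1 : (M + quartG U t) ^ 2 ≤ 2 * (M ^ 2 + quartG U t ^ 2) := by nlinarith [sq_nonneg (M - quartG U t)]
      have a2 := pow_le_pow_left₀ (by positivity) a1 2
      nlinarith [sq_nonneg (M ^ 2 - quartG U t ^ 2)]
    linarith
  set J := ∫ t in Set.Ioc a T, √(tot (vsq (acc U)) t) with hJ
  have hJ0 : 0 ≤ J := integral_nonneg fun _ => Real.sqrt_nonneg _
  set y : ℝ → ℝ → ℝ := fun R s => ∫ x, eta R x * vsq U s x with hy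
  have y0 : ∀ R s, 0 ≤ y R s := fun R s => integral_eta_nonneg (vsq_nonneg U s) R
  have hmx : ∀ R, ∃ s ∈ Set.Icc a T, 1 ≤ R → ∀ s' ∈ Set.Icc a T, y R s' ≤ y R s := fun R => by
    rcases le_or_gt 1 R with hR | hR
    · obtain ⟨s, hs, hm⟩ := (isCompact_Icc (a := a) (b := T)).exists_isMaxOn ⟨a, le_rfl, ha.2⟩
        (h.continuous_integral_eta (by linarith : 0 < R)).continuousOn
      exact ⟨s, hs, fun _ s' hs' => hm hs'⟩
    · exact ⟨a, ⟨le_rfl, ha.2⟩, fun h' => absurd h' (not_le.2 hR)⟩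
  choose s hs hmax using hmx
  have key : ∀ R, 1 ≤ R → ∀ W : ℝ → ℝ, IntegrableOn W (Set.Ioc a T) → (∀ t, 0 ≤ W t) →
      (∀ t ∈ Set.Icc a T, (M + quartG U t) * y (2 * R) t ≤ W t) →
      y R (s R) ≤ 2 * tot (vsq U) T + 16 * J ^ 2 + 2 * (C / √R * ∫ t in Set.Ioc a T, W t) := by
    intro R hR W iW W0 hW
    have hR0 : 0 < R := by linarith
    set S := y R (s R) with hS
    have S0 : 0 ≤ S := y0 _ _
    have ig : IntegrableOn (fun t => 4 * (√S * √(tot (vsq (acc U)) t)) + C / √R * W t) (Set.Ioc a T) :=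
      ((isA.const_mul _).const_mul 4).add (iW.const_mul _)
    have step : -y R T - -y R (s R) ≤ ∫ t in Set.Ioc (s R) T, (4 * (√S * √(tot (vsq (acc U)) t)) + C / √R * W t) := by
      refine sub_le_setIntegral (y := fun t => -y R t) (y' := fun t => -∫ x, eta R x * dt (vsq U) t x) (hs R).2
        (h.continuous_integral_eta hR0).neg.continuousOn
        (fun t _ => (JS.hasDerivAt_integral_compact h.jU (sm_eta R) (eta_compact hR0) t).neg.hasDerivWithinAt)
        (ig.mono_set (Set.Ioc_subset_Ioc_left (hs R).1)) fun t ht => ?_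
      have ht' : t ∈ Set.Icc a T := ⟨(hs R).1.trans ht.1.le, ht.2.le⟩
      refine (neg_le_abs _).trans ((hb T U H P h t (hsub ht') R hR).trans ?_)
      have l1 : y R t ≤ S := hmax R hR t ht'
      have l2 := hM t (hsub ht')
      have l3 : (centerSize U t + quartG U t) * y (2 * R) t ≤ W t :=
        (mul_le_mul_of_nonneg_right (by linarith) (y0 _ _)).trans (hW t ht')
      have l4 : √(y R t) ≤ √S := Real.sqrt_le_sqrt l1
      gcongr
    have mono : ∫ t in Set.Ioc (s R) T, (4 * (√S * √(tot (vsq (acc U)) t)) + C / √R * W t) ≤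
        ∫ t in Set.Ioc a T, (4 * (√S * √(tot (vsq (acc U)) t)) + C / √R * W t) := by
      refine setIntegral_mono_set ig (ae_of_all _ fun t => ?_) (Set.Ioc_subset_Ioc_left (hs R).1).eventuallyLE
      have := W0 t
      change 0 ≤ _
      positivity
    have ev : ∫ t in Set.Ioc a T, (4 * (√S * √(tot (vsq (acc U)) t)) + C / √R * W t) =
        4 * (√S * J) + C / √R * ∫ t in Set.Ioc a T, W t := by
      rw [integral_add ((isA.const_mul _).const_mul 4) (iW.const_mul _), integral_const_mul, integral_const_mul,
        integral_const_mul]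
    have yT : y R T ≤ tot (vsq U) T := integral_eta_mul_le (h.iU T hT) (vsq_nonneg U T) R
    have sq := Real.sq_sqrt S0
    nlinarith [sq_nonneg (√S - 4 * J)]
  set B := 2 * tot (vsq U) T + 16 * J ^ 2 with hBd
  have hB : 0 ≤ B := by have := tot_vsq_nonneg U T; positivity
  set I1 := ∫ t in Set.Ioc a T, (M + quartG U t) ^ 1 with hI1
  set I3 := ∫ t in Set.Ioc a T, (M + quartG U t) ^ 3 with hI3
  have p0 : ∀ t, 0 ≤ M + quartG U t := fun t => add_nonneg hM0 (quartG_nonneg U t)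
  have hI10 : 0 ≤ I1 := integral_nonneg fun t => pow_nonneg (p0 t) _
  have hI30 : 0 ≤ I3 := integral_nonneg fun t => pow_nonneg (p0 t) _
  have r1 : ∀ R, 1 ≤ R → y R (s R) ≤ B + 2 * C * I1 / √R * y (2 * R) (s (2 * R)) := fun R hR => by
    refine (key R hR (fun t => (M + quartG U t) ^ 1 * y (2 * R) (s (2 * R))) ((iq 1 (by norm_num)).mul_const _)
      (fun t => mul_nonneg (pow_nonneg (p0 t) _) (y0 _ _)) fun t ht => ?_).trans (le_of_eq ?_)
    · rw [pow_one]
      exact mul_le_mul_of_nonneg_left (hmax (2 * R) (by linarith) t ht) (p0 t)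
    · rw [integral_mul_const]; ring
  have r2 : ∀ R, 1 ≤ R → y R (s R) ≤ (B + 2 * C * (64 * 48 ^ 2) * I3) * √R ^ 5 := fun R hR => by
    have s1 : 1 ≤ √R := Real.one_le_sqrt.2 hR
    refine (key R hR (fun t => 64 * 48 ^ 2 * √R ^ 6 * (M + quartG U t) ^ 3) ((iq 3 (by norm_num)).const_mul _)
      (fun t => mul_nonneg (by positivity) (pow_nonneg (p0 t) _)) fun t ht => ?_).trans ?_
    · have := mul_le_mul_of_nonneg_left (h.integral_eta_vsq_le (hsub ht) hR (hM t (hsub ht))) (p0 t)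
      exact this.trans (le_of_eq (by ring))
    · rw [integral_const_mul, ← hI3, add_mul]
      have s2 : √R ≠ 0 := by positivity
      refine add_le_add (le_mul_of_one_le_right hB (one_le_pow₀ s1)) (le_of_eq ?_)
      field_simp
  obtain ⟨K, hK, hYK⟩ := bounded_of_dyadic (Y := fun R => y R (s R)) hB (by positivity) r1 5 _ (by positivity) r2
  have lim1 : Tendsto (fun n => y (rad n) a) atTop (nhds (tot (vsq U) a)) :=
    tendsto_integral_eta_mul (h.iU a ⟨ha.1.le, ha.2⟩)
  have lim2 : Tendsto (fun n => B + 2 * C * I1 * K / √(rad n)) atTop (nhds (B + 0)) :=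
    tendsto_const_nhds.add (tendsto_const_nhds.div_atTop (Real.tendsto_sqrt_atTop.comp tendsto_rad))
  rw [add_zero] at lim2
  refine le_of_tendsto_of_tendsto' lim1 lim2 fun n => ?_
  have hR := one_le_rad n
  refine (hmax (rad n) hR a ⟨le_rfl, ha.2⟩).trans ((r1 _ hR).trans ?_)
  have := hYK (2 * rad n) (by linarith)
  rw [mul_div_right_comm (2 * C * I1) K]
  have : 0 ≤ 2 * C * I1 / √(rad n) := by positivity
  gcongr

end VFlow

theorem integrableOn_rpow_Ioc {r : ℝ} (hr : -1 < r) (T : ℝ) :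
    IntegrableOn (fun t : ℝ => t ^ r) (Set.Ioc 0 T) :=
  (intervalIntegral.intervalIntegrable_rpow' hr).1

theorem mul_cube_le {b r : ℝ} (hb : 0 ≤ b) (hr : 0 ≤ r) : b * r ^ 3 ≤ b ^ 4 + r ^ 4 := by
  rcases le_total b r with h | h
  · have := mul_le_mul_of_nonneg_right h (pow_nonneg hr 3)
    nlinarith [pow_nonneg hb 4]
  · have := mul_le_mul_of_nonneg_left (pow_le_pow_left₀ hr h 3) hb
    nlinarith [pow_nonneg hr 4]

namespace VFlow
variable {T : ℝ} {U : Fin 2 → ℝ → V → ℝ} {H : Fin 2 → Fin 2 → ℝ → V → ℝ} {P : ℝ → V → ℝ} {t : ℝ}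

/-- A majorant of `‖u‖_{L²}` whose powers needed in the energy estimate are integrable in time. -/
theorem exists_rate (h : VFlow T U H P) (hT : 0 < T)
    (h1 : IntegrableOn (fun t => t * tot (vsq (acc U)) t) (Set.Ioc 0 T))
    (h2 : IntegrableOn (fun t => t ^ 2 * totSq (msq (grad U)) t) (Set.Ioc 0 T)) :
    ∃ N : ℝ → ℝ, (∀ t ∈ Set.Ioc 0 T, 1 ≤ N t ∧ √(tot (vsq U) t) ≤ N t) ∧
      IntegrableOn (fun t => N t ^ 3 + quartG U t * N t ^ 2) (Set.Ioc 0 T) := by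
  set p : ℝ → ℝ := fun t => t ^ (-(1/16) : ℝ) with hp
  have p_ge : ∀ t ∈ Set.Ioc 0 T, 1 ≤ (1 + T) * p t := fun t ht => by
    have a1 : (1 + T) ^ (-(1:ℝ)) ≤ (1 + T) ^ (-(1/16) : ℝ) :=
      Real.rpow_le_rpow_of_exponent_le (by linarith) (by norm_num)
    have a2 : (1 + T) ^ (-(1/16) : ℝ) ≤ p t :=
      Real.rpow_le_rpow_of_nonpos ht.1 (by linarith [ht.2]) (by norm_num)
    rw [Real.rpow_neg_one] at a1
    have := mul_le_mul_of_nonneg_left (a1.trans a2) (by linarith : 0 ≤ 1 + T)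
    rwa [mul_inv_cancel₀ (by linarith)] at this
  have p_pos : ∀ t ∈ Set.Ioc 0 T, 0 < p t := fun t ht => Real.rpow_pos_of_pos ht.1 _
  set I1 := ∫ t in Set.Ioc 0 T, (t : ℝ) ^ (-(15/16) : ℝ) with hI1
  set I2 := ∫ t in Set.Ioc 0 T, t * tot (vsq (acc U)) t with hI2
  have i1 : IntegrableOn (fun t : ℝ => t ^ (-(15/16) : ℝ)) (Set.Ioc 0 T) := integrableOn_rpow_Ioc (by norm_num) T
  have hI10 : 0 ≤ I1 := setIntegral_nonneg measurableSet_Ioc fun t ht => Real.rpow_nonneg ht.1.le _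
  have hI20 : 0 ≤ I2 := setIntegral_nonneg measurableSet_Ioc fun t ht => mul_nonneg ht.1.le (tot_vsq_nonneg _ _)
  have hJ : ∀ a ∈ Set.Ioc 0 T, ∫ t in Set.Ioc a T, √(tot (vsq (acc U)) t) ≤ (I1 + I2 * (1 + T)) * p a := by
    intro a ha
    have hs : Set.Ioc a T ⊆ Set.Ioc 0 T := Set.Ioc_subset_Ioc_left ha.1.le
    have ib : IntegrableOn (fun t => p a * t ^ (-(15/16) : ℝ) + t * tot (vsq (acc U)) t) (Set.Ioc 0 T) :=
      (i1.const_mul _).add h1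
    have nb : ∀ t ∈ Set.Ioc 0 T, 0 ≤ p a * t ^ (-(15/16) : ℝ) + t * tot (vsq (acc U)) t := fun t ht =>
      add_nonneg (mul_nonneg (p_pos a ha).le (Real.rpow_nonneg ht.1.le _)) (mul_nonneg ht.1.le (tot_vsq_nonneg _ _))
    have b1 : ∫ t in Set.Ioc a T, √(tot (vsq (acc U)) t) ≤
        ∫ t in Set.Ioc a T, (p a * t ^ (-(15/16) : ℝ) + t * tot (vsq (acc U)) t) := by
      refine integral_mono_of_nonneg (ae_of_all _ fun t => Real.sqrt_nonneg _) (ib.mono_set hs)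
        ((ae_restrict_iff' measurableSet_Ioc).2 (ae_of_all _ fun t ht => ?_))
      have t0 : 0 < t := ha.1.trans ht.1
      have e1 : t⁻¹ = t ^ (-(1/16) : ℝ) * t ^ (-(15/16) : ℝ) := by
        rw [← Real.rpow_add t0, ← Real.rpow_neg_one]; norm_num
      have e2 : t ^ (-(1/16) : ℝ) ≤ p a := Real.rpow_le_rpow_of_nonpos ha.1 ht.1.le (by norm_num)
      have e3 : t⁻¹ ≤ p a * t ^ (-(15/16) : ℝ) := by
        rw [e1]; exact mul_le_mul_of_nonneg_right e2 (Real.rpow_nonneg t0.le _)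
      have hA := tot_vsq_nonneg (acc U) t
      have e4 : √(tot (vsq (acc U)) t) ≤ t⁻¹ + t * tot (vsq (acc U)) t := by
        rw [Real.sqrt_le_left (by positivity)]
        have : (t⁻¹ + t * tot (vsq (acc U)) t) ^ 2 =
          2 * tot (vsq (acc U)) t * (t * t⁻¹) + (t⁻¹) ^ 2 + (t * tot (vsq (acc U)) t) ^ 2 := by ring
        rw [this, mul_inv_cancel₀ t0.ne']
        nlinarith [sq_nonneg t⁻¹, sq_nonneg (t * tot (vsq (acc U)) t)]
      linarith
    refine b1.trans ?_
    have b2 : ∫ t in Set.Ioc a T, (p a * t ^ (-(15/16) : ℝ) + t * tot (vsq (acc U)) t) ≤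
        ∫ t in Set.Ioc 0 T, (p a * t ^ (-(15/16) : ℝ) + t * tot (vsq (acc U)) t) :=
      setIntegral_mono_set ib ((ae_restrict_iff' measurableSet_Ioc).2 (ae_of_all _ nb)) hs.eventuallyLE
    refine b2.trans ?_
    rw [integral_add (i1.const_mul _) h1, integral_const_mul]
    have := mul_le_mul_of_nonneg_left (p_ge a ha) hI20
    nlinarith
  set K2 := 2 * tot (vsq U) T * (1 + T) ^ 2 + 16 * (I1 + I2 * (1 + T)) ^ 2 with hK2
  have hNT := tot_vsq_nonneg U T
  have hK20 : 0 ≤ K2 := by positivity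
  have hn : ∀ a ∈ Set.Ioc 0 T, √(tot (vsq U) a) ≤ √K2 * p a := fun a ha => by
    have pa := p_pos a ha
    rw [Real.sqrt_le_left (by positivity), mul_pow, Real.sq_sqrt hK20]
    refine (h.tot_vsq_le h1 h2 ha).trans ?_
    have c1 := pow_le_pow_left₀ (integral_nonneg fun t => Real.sqrt_nonneg _) (hJ a ha) 2
    have c2 := mul_le_mul_of_nonneg_left (one_le_pow₀ (p_ge a ha) (n := 2)) hNT
    rw [mul_pow] at c1 c2
    nlinarith
  set K := √K2 + (1 + T) with hK
  have hK0 : 0 ≤ K := by positivity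
  refine ⟨fun t => K * p t, fun t ht => ⟨?_, ?_⟩, ?_⟩
  · have := mul_nonneg (Real.sqrt_nonneg K2) (p_pos t ht).le
    linarith [p_ge t ht, add_mul (√K2) (1 + T) (p t)]
  · have := mul_nonneg (by linarith : 0 ≤ 1 + T) (p_pos t ht).le
    linarith [hn t ht, add_mul (√K2) (1 + T) (p t)]
  · have j1 : IntegrableOn (fun t : ℝ => t ^ (-(3/16) : ℝ)) (Set.Ioc 0 T) := integrableOn_rpow_Ioc (by norm_num) T
    have j2 : IntegrableOn (fun t : ℝ => t ^ (-(5/6) : ℝ)) (Set.Ioc 0 T) := integrableOn_rpow_Ioc (by norm_num) T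
    have jb : IntegrableOn (fun t => K ^ 3 * t ^ (-(3/16) : ℝ) +
        K ^ 2 * (t ^ 2 * totSq (msq (grad U)) t + t ^ (-(5/6) : ℝ))) (Set.Ioc 0 T) :=
      (j1.const_mul _).add ((h2.add j2).const_mul _)
    have mp : Measurable p := measurable_id.pow_const _
    refine jb.mono' ((((mp.const_mul K).pow_const 3).add
      (h.measurable_quartG.mul ((mp.const_mul K).pow_const 2))).aestronglyMeasurable)
      ((ae_restrict_iff' measurableSet_Ioc).2 (ae_of_all _ fun t ht => ?_))
    have t0 := ht.1
    have pt := p_pos t ht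
    have q0 := quartG_nonneg U t
    rw [Real.norm_eq_abs, abs_of_nonneg (by positivity)]
    have e3 : p t ^ 3 = t ^ (-(3/16) : ℝ) := by
      rw [hp, ← Real.rpow_natCast, ← Real.rpow_mul t0.le]; norm_num
    set r := t ^ (-(5/24) : ℝ) with hr
    set s := t ^ (1/2 : ℝ) with hs
    have r0 : 0 < r := Real.rpow_pos_of_pos t0 _
    have s0 : 0 < s := Real.rpow_pos_of_pos t0 _
    have e4 : r ^ 4 = t ^ (-(5/6) : ℝ) := by
      rw [hr, ← Real.rpow_natCast, ← Real.rpow_mul t0.le]; norm_num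
    have e5 : s ^ 4 = t ^ 2 := by
      rw [hs, ← Real.rpow_natCast, ← Real.rpow_mul t0.le, ← Real.rpow_natCast]; norm_num
    have e6 : s * r ^ 3 = p t ^ 2 := by
      simp only [hs, hr, hp]
      rw [← Real.rpow_natCast, ← Real.rpow_mul t0.le, ← Real.rpow_natCast, ← Real.rpow_mul t0.le,
        ← Real.rpow_add t0]; norm_num
    have y := mul_cube_le (mul_nonneg s0.le q0) r0.le
    rw [mul_pow s, e5, quartG_pow, e4] at y
    have e7 : quartG U t * (K * p t) ^ 2 = K ^ 2 * (s * quartG U t * r ^ 3) := by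
      rw [mul_pow, ← e6]; ring
    rw [e7, mul_pow, e3]
    gcongr

end VFlow

theorem le_sqrt_self {a : ℝ} (h0 : 0 ≤ a) (h1 : a ≤ 1) : a ≤ √a := by
  have s1 := Real.sq_sqrt h0
  have s2 : √a ≤ 1 := Real.sqrt_le_one.2 h1
  nlinarith [Real.sqrt_nonneg a]

theorem eta_le_sqrt (R : ℝ) (x : V) : eta R x ≤ √(eta R x) := le_sqrt_self (eta_nonneg R x) (eta_le_one R x)

theorem integrable_eta {R : ℝ} (hR : 0 < R) : Integrable (eta R) :=
  (sm_eta _).continuous.integrable_of_hasCompactSupport (eta_compact hR)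

theorem sqrt_integral_eta_le {R : ℝ} (hR : 0 < R) : √(∫ x, eta (2 * R) x) ≤ 8 * R := by
  rw [Real.sqrt_le_left (by positivity)]
  exact (integral_eta_le (by positivity)).trans (le_of_eq (by ring))

namespace VFlow
variable {T : ℝ} {U : Fin 2 → ℝ → V → ℝ} {H : Fin 2 → Fin 2 → ℝ → V → ℝ} {P : ℝ → V → ℝ} {t : ℝ}

theorem exists_strain_dt_bound : ∃ C : ℝ, 0 ≤ C ∧ ∀ (T : ℝ) (U : Fin 2 → ℝ → V → ℝ)
    (H : Fin 2 → Fin 2 → ℝ → V → ℝ) (P : ℝ → V → ℝ), VFlow T U H P → ∀ t ∈ Set.Icc 0 T, ∀ R : ℝ, 0 < R →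
    |∫ x, eta R x * dt (fun t x => msq H t x ^ 2) t x| ≤
      32 * (√√(∫ x, eta R x * msq H t x ^ 2) ^ 3 * quartG U t) + C * √(tot (vsq U) t) := by
  obtain ⟨C, hC, hb⟩ := exists_cut_bound
  refine ⟨16 * C, by positivity, fun T U H P h t ht R hR0 => ?_⟩
  have jh2 : JS fun t x => msq H t x ^ 2 := h.jH.pow 2
  rw [integral_cutoff_dt h.sU jh2 (sm_eta R) (eta_compact hR0) (h.divU t ht) (K := fun _ _ => 0)
    fun _ => contDiff_const]
  simp only [pd_const, Finset.sum_const_zero, sub_zero]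
  have cM : Continuous (matd U (fun t x => msq H t x ^ 2) t) := ((JS.matd h.sU jh2).sm t).continuous
  have cT : ∀ j, Continuous fun x => pd j (eta R) x * (U j t x * msq H t x ^ 2) := fun j =>
    ((sm_eta R).pd j).continuous.mul ((h.smU j t).continuous.mul ((h.contH t).pow 2))
  have cE : Continuous (eta R) := (sm_eta R).continuous
  set y := ∫ x, eta R x * msq H t x ^ 2 with hy
  have i2 : Integrable fun x => eta R x * msq H t x ^ 2 := integrable_eta_mul ((h.contH t).pow 2) hR0
  have i3 : Integrable fun x => eta R x * (msq H t x * msq (grad U) t x) :=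
    integrable_eta_mul ((h.contH t).mul (h.contG t)) hR0
  have k0 : ∫ x, eta R x * (msq H t x * msq (grad U) t x) ≤ √y * √(totSq (msq (grad U)) t) := by
    have := (abs_integral_le_sqrt (c := 1) (F := fun x => eta R x * (msq H t x * msq (grad U) t x))
      (p := fun x => eta R x * msq H t x ^ 2)
      (q := fun x => msq (grad U) t x ^ 2) zero_le_one (cE.mul ((h.contH t).mul (h.contG t)))
      (cE.mul ((h.contH t).pow 2)) ((h.contG t).pow 2)
      (fun x => mul_nonneg (eta_nonneg _ _) (sq_nonneg _)) (fun x => sq_nonneg _) i2 (h.iD t ht) fun x => by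
        have g0 := msq_nonneg (grad U) t x
        have h0 := msq_nonneg H t x
        have e0 := eta_nonneg R x
        rw [Real.sqrt_mul e0, Real.sqrt_sq h0, Real.sqrt_sq g0, abs_of_nonneg (by positivity), one_mul, mul_assoc]
        exact mul_le_mul_of_nonneg_right (eta_le_sqrt R x) (by positivity)).2
    rw [one_mul] at this
    exact (le_abs_self _).trans this
  have k1 : Integrable (fun x => eta R x * matd U (fun t x => msq H t x ^ 2) t x) ∧
      |∫ x, eta R x * matd U (fun t x => msq H t x ^ 2) t x| ≤
        32 * (√y * √(∫ x, eta R x * (msq H t x * msq (grad U) t x))) := by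
    refine abs_integral_le_sqrt (by norm_num) (cE.mul cM)
      (cE.mul ((h.contH t).pow 2)) (cE.mul ((h.contH t).mul (h.contG t)))
      (fun x => mul_nonneg (eta_nonneg _ _) (sq_nonneg _))
      (fun x => mul_nonneg (eta_nonneg _ _) (mul_nonneg (msq_nonneg _ _ _) (msq_nonneg _ _ _))) i2 i3 fun x => ?_
    have h0 := msq_nonneg H t x
    have e0 := eta_nonneg R x
    have b1 : |matd U (msq H) t x| ≤ 2 * (2 * (2 * √(msq H t x) * (2 * √(msq (grad U) t x)))) := by
      rw [matd_msq h.sH]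
      refine abs_sum_two_le fun i => abs_sum_two_le fun j => abs_mul_le ?_ (h.abs_matd_le ht i j x)
      rw [abs_mul, abs_two]
      exact mul_le_mul_of_nonneg_left (abs_le_msq H i j t x) (by norm_num)
    rw [matd_sq h.jH, Real.sqrt_mul e0, Real.sqrt_mul e0, Real.sqrt_mul h0, Real.sqrt_sq h0]
    have b2 : |2 * msq H t x * matd U (msq H) t x| ≤
        2 * msq H t x * (2 * (2 * (2 * √(msq H t x) * (2 * √(msq (grad U) t x))))) :=
      abs_mul_le (le_of_eq (abs_of_nonneg (by positivity))) b1
    rw [abs_mul, abs_of_nonneg e0]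
    have s1 := Real.mul_self_sqrt e0
    calc _ ≤ eta R x * (2 * msq H t x * (2 * (2 * (2 * √(msq H t x) * (2 * √(msq (grad U) t x)))))) := by gcongr
      _ = (√(eta R x) * √(eta R x)) * (2 * msq H t x * (2 * (2 * (2 * √(msq H t x) * (2 * √(msq (grad U) t x)))))) := by
        rw [s1]
      _ = 32 * (√(eta R x) * msq H t x * (√(eta R x) * (√(msq H t x) * √(msq (grad U) t x)))) := by ring
      _ ≤ _ := le_rfl
  have k1' : |∫ x, eta R x * matd U (fun t x => msq H t x ^ 2) t x| ≤ 32 * (√√y ^ 3 * quartG U t) := by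
    refine k1.2.trans ?_
    have : √(∫ x, eta R x * (msq H t x * msq (grad U) t x)) ≤ √√y * quartG U t := by
      rw [quartG, ← Real.sqrt_mul (Real.sqrt_nonneg _)]
      exact Real.sqrt_le_sqrt k0
    have s1 : √√y ^ 2 = √y := Real.sq_sqrt (Real.sqrt_nonneg _)
    have q0 := quartG_nonneg U t
    calc _ ≤ 32 * (√y * (√√y * quartG U t)) := by gcongr
      _ = 32 * (√√y ^ 2 * (√√y * quartG U t)) := by rw [s1]
      _ = _ := by ring
  have k2 : Integrable (fun x => ∑ j, pd j (eta R) x * (U j t x * msq H t x ^ 2)) ∧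
      |∫ x, ∑ j, pd j (eta R) x * (U j t x * msq H t x ^ 2)| ≤
      2 * (C / R) * (√(∫ x, eta (2 * R) x) * √(tot (vsq U) t)) := by
    refine abs_integral_le_sqrt (by positivity) (continuous_finsetSum _ fun j _ => cT j)
      (sm_eta (2 * R)).continuous (h.contU t) (eta_nonneg _) (vsq_nonneg U t)
      (integrable_eta (by linarith)) (h.iU t ht) fun x => ?_
    have e0 := eta_nonneg (2 * R) x
    have hs : msq H t x ^ 2 ≤ 1 := pow_le_one₀ (msq_nonneg H t x) ((h.small t ht x).trans (by norm_num))
    have q2 : ∀ j, |pd j (eta R) x * (U j t x * msq H t x ^ 2)| ≤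
        C / R * √(eta (2 * R) x) * (√(vsq U t x) * 1) := fun j =>
      abs_mul_le ((hb R hR0 j x).1.trans (by gcongr; exact eta_le_sqrt _ _)) (abs_mul_le (abs_le_vsq U j t x)
        ((abs_of_nonneg (sq_nonneg _)).trans_le hs))
    exact (abs_sum_two_le q2).trans (le_of_eq (by ring))
  rw [integral_add k1.1 k2.1]
  refine (abs_add_le _ _).trans (add_le_add k1' (k2.2.trans ?_))
  calc _ ≤ 2 * (C / R) * (8 * R * √(tot (vsq U) t)) := by gcongr; exact sqrt_integral_eta_le hR0
    _ = _ := by field_simp; ring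

theorem exists_totSq_strain_le (h : VFlow T U H P) (hT : 0 ≤ T) {E : ℝ → ℝ} (iE : IntegrableOn E (Set.Ioc 0 T))
    (hE : ∀ t ∈ Set.Ioc 0 T, quartG U t ≤ E t ∧ √(tot (vsq U) t) ≤ E t) :
    ∃ K, 0 ≤ K ∧ ∀ t ∈ Set.Icc 0 T, totSq (msq H) t ≤ K := by
  obtain ⟨C, hC, hb⟩ := exists_strain_dt_bound
  set I := ∫ t in Set.Ioc 0 T, E t with hI
  have E0 : ∀ t ∈ Set.Ioc 0 T, 0 ≤ E t := fun t ht => (quartG_nonneg U t).trans (hE t ht).1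
  have hI0 : 0 ≤ I := setIntegral_nonneg measurableSet_Ioc E0
  have h0 : (0:ℝ) ∈ Set.Icc 0 T := ⟨le_rfl, hT⟩
  have q0 := totSq_nonneg (msq H) 0
  refine ⟨2 * (totSq (msq H) 0 + (256 * I) ^ 4 + C * I), by positivity, fun t ht => ?_⟩
  refine le_of_tendsto' (tendsto_integral_eta_mul (h.int_msq_sq ht).1) fun n => ?_
  have hR := rad_pos n
  set R := rad n
  have jh2 : JS fun t x => msq H t x ^ 2 := h.jH.pow 2
  set y : ℝ → ℝ := fun s => ∫ x, eta R x * msq H s x ^ 2 with hy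
  have hder : ∀ s, HasDerivAt y (∫ x, eta R x * dt (fun t x => msq H t x ^ 2) s x) s := fun s =>
    JS.hasDerivAt_integral_compact jh2 (sm_eta R) (eta_compact hR) s
  have hcy : Continuous y := continuous_iff_continuousAt.2 fun s => (hder s).continuousAt
  have y0 : ∀ s, 0 ≤ y s := fun s => integral_eta_nonneg (fun x => sq_nonneg _) R
  obtain ⟨s, hs, hm⟩ := (isCompact_Icc (a := (0:ℝ)) (b := T)).exists_isMaxOn ⟨0, h0⟩ hcy.continuousOn
  set S := √√(y s) with hS
  have S0 : 0 ≤ S := Real.sqrt_nonneg _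
  have S4 : S ^ 4 = y s := by
    rw [show S ^ 4 = (S ^ 2) ^ 2 by ring, hS, Real.sq_sqrt (Real.sqrt_nonneg _), Real.sq_sqrt (y0 s)]
  have hsub : Set.Ioc 0 s ⊆ Set.Ioc 0 T := Set.Ioc_subset_Ioc_right hs.2
  have c0 : 0 ≤ 32 * S ^ 3 + C := by positivity
  have step : y s - y 0 ≤ ∫ t in Set.Ioc 0 s, (32 * S ^ 3 + C) * E t := by
    refine sub_le_setIntegral hs.1 hcy.continuousOn (fun r _ => (hder r).hasDerivWithinAt)
      ((iE.mono_set hsub).const_mul _) fun r hr => ?_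
    have hr' : r ∈ Set.Ioc 0 T := ⟨hr.1, hr.2.le.trans hs.2⟩
    have hri : r ∈ Set.Icc 0 T := ⟨hr.1.le, hr'.2⟩
    refine (le_abs_self _).trans ((hb T U H P h r hri R hR).trans ?_)
    have l1 : √√(∫ x, eta R x * msq H r x ^ 2) ≤ S := Real.sqrt_le_sqrt (Real.sqrt_le_sqrt (hm hri))
    have e1 := (hE r hr').1
    have e2 := (hE r hr').2
    have e3 := E0 r hr'
    calc _ ≤ 32 * (S ^ 3 * E r) + C * E r := by gcongr; exact quartG_nonneg U r
      _ = _ := by ring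
  have mono : ∫ t in Set.Ioc 0 s, (32 * S ^ 3 + C) * E t ≤ (32 * S ^ 3 + C) * I := by
    rw [integral_const_mul]
    exact mul_le_mul_of_nonneg_left (setIntegral_mono_set iE
      ((ae_restrict_iff' measurableSet_Ioc).2 (ae_of_all _ E0)) hsub.eventuallyLE) c0
  have z : y 0 ≤ totSq (msq H) 0 := integral_eta_mul_le (h.int_msq_sq h0).1 (fun x => sq_nonneg _) R
  have Y := mul_cube_le (b := 256 * I) (r := S / 2) (by positivity) (by positivity)
  have : y t ≤ y s := hm ht
  change y t ≤ _
  nlinarith [y0 s]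

end VFlow

theorem integrable_cut_mul {f : V → ℝ} (hf : Continuous f) {R : ℝ} (hR : 0 < R) :
    Integrable fun x => cut R x * f x := by
  simpa only [mul_comm] using integrable_mul_compact hf (sm_cut R).continuous (cut_compact hR)

theorem integrable_sum_pd_cut_mul {f : Fin 2 → V → ℝ} (hf : ∀ j, Continuous (f j)) {R : ℝ} (hR : 0 < R) :
    Integrable fun x => ∑ j, pd j (cut R) x * f j x :=
  integrable_finsetSum _ fun j _ => (((sm_cut R).pd j).continuous.mul (hf j)).integrable_of_hasCompactSupport
    (hasCompactSupport_pd (cut_compact hR) j).mul_right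

theorem integral_cut_mul_le {f : V → ℝ} (hf : Integrable f) (h0 : ∀ x, 0 ≤ f x) (R : ℝ) :
    ∫ x, cut R x * f x ≤ ∫ x, f x :=
  integral_mono_of_nonneg (ae_of_all _ fun x => mul_nonneg (cut_nonneg R x) (h0 x)) hf
    (ae_of_all _ fun x => mul_le_of_le_one_left (h0 x) (cut_le_one R x))

theorem integral_cut_nonneg {f : V → ℝ} (h0 : ∀ x, 0 ≤ f x) (R : ℝ) : 0 ≤ ∫ x, cut R x * f x :=
  integral_nonneg fun x => mul_nonneg (cut_nonneg R x) (h0 x)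

theorem continuous_integral_cut {g : ℝ → V → ℝ} (hg : JS g) {R : ℝ} (hR : 0 < R) :
    Continuous fun s => ∫ x, cut R x * g s x :=
  continuous_iff_continuousAt.2 fun s =>
    (JS.hasDerivAt_integral_compact hg (sm_cut R) (cut_compact hR) s).continuousAt

theorem integral_cut_sum {q : V → ℝ} (hq : Sm q) {w : Fin 2 → V → ℝ} (hw : ∀ i, Continuous (w i)) {R : ℝ}
    (hR : 0 < R) : ∫ x, cut R x * ∑ i, pd i q x * w i x = ∑ i, ∫ x, pd i q x * (cut R x * w i x) := by
  have hi : ∀ i, Integrable fun x => pd i q x * (cut R x * w i x) := fun i => by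
    have : Integrable fun x => cut R x * (pd i q x * w i x) :=
      integrable_cut_mul ((hq.pd i).continuous.mul (hw i)) hR
    simpa only [mul_left_comm] using this
  rw [← integral_finsetSum _ fun i _ => hi i]
  refine integral_congr_ae (ae_of_all _ fun x => ?_)
  simp only [Finset.mul_sum]
  exact Finset.sum_congr rfl fun i _ => by ring

namespace VFlow
variable {T : ℝ} {U : Fin 2 → ℝ → V → ℝ} {H : Fin 2 → Fin 2 → ℝ → V → ℝ} {P : ℝ → V → ℝ} {t : ℝ}

theorem pressSize_le (h : VFlow T U H P) (ht : t ∈ Set.Icc 0 T) :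
    pressSize U H t ≤ 6 * √(totSq (msq H) t) +
      3 * ((2 * √(tot (vsq U) t) + 12 * quartG U t) * √(tot (vsq U) t)) := by
  have q0 := quartG_nonneg U t
  have n0 := Real.sqrt_nonneg (tot (vsq U) t)
  have Q0 := Real.sq_sqrt (totSq_nonneg (msq H) t)
  have Q1 := Real.sqrt_nonneg (totSq (msq H) t)
  have n1 := Real.sq_sqrt (tot_vsq_nonneg U t)
  have b : totSq (vsq U) t ≤ ((2 * √(tot (vsq U) t) + 12 * quartG U t) * √(tot (vsq U) t)) ^ 2 := by
    rw [mul_pow, n1, tot, ← integral_const_mul]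
    refine integral_mono (h.int_vsq_sq ht).1 ((h.iU t ht).const_mul _) fun x => ?_
    have v0 := vsq_nonneg U t x
    have := pow_le_pow_left₀ (Real.sqrt_nonneg _) (h.sqrt_vsq_le ht x) 2
    rw [Real.sq_sqrt v0] at this
    have := mul_le_mul_of_nonneg_right this v0
    rw [pow_two]
    exact this
  rw [pressSize, Real.sqrt_le_left (by positivity)]
  have : 0 ≤ √(totSq (msq H) t) * ((2 * √(tot (vsq U) t) + 12 * quartG U t) * √(tot (vsq U) t)) := by positivity
  nlinarith [sq_nonneg ((2 * √(tot (vsq U) t) + 12 * quartG U t) * √(tot (vsq U) t))]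

theorem exists_energy_flux_bound : ∃ C : ℝ, 0 ≤ C ∧ ∀ (T : ℝ) (U : Fin 2 → ℝ → V → ℝ)
    (H : Fin 2 → Fin 2 → ℝ → V → ℝ) (P : ℝ → V → ℝ), VFlow T U H P → ∀ t ∈ Set.Icc 0 T, ∀ R : ℝ, 0 < R →
    ∫ x, (cut R x * (-2 * msq (grad U) t x) + ∑ j, pd j (cut R) x *
      (U j t x * (vsq U t x + msq H t x) - 2 * ∑ i, U i t x * tens U H i j t x)) ≤
    -(∫ x, cut R x * msq (grad U) t x) + (64 * (C / R) ^ 2 * tot (vsq U) t + 2 * (C / R) *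
      ((2 * √(tot (vsq U) t) + 12 * quartG U t) * tot (vsq U) t + √(tot (vsq U) t) * √(totSq (msq H) t)) +
      16 * (C / R) * (√(tot (vsq U) t) * √(8 * R * √(totSq (msq H) t)))) := by
  obtain ⟨C, hC, hb⟩ := exists_cut_bound
  refine ⟨C, hC, fun T U H P h t ht R hR => ?_⟩
  have cE : Continuous (eta (2 * R)) := (sm_eta _).continuous
  have k1 : Integrable (fun x => √(vsq U t x) * msq H t x) ∧
      |∫ x, √(vsq U t x) * msq H t x| ≤ 1 * (√(∫ x, vsq U t x) * √(∫ x, msq H t x ^ 2)) :=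
    abs_integral_le_sqrt zero_le_one ((h.contU t).sqrt.mul (h.contH t)) (h.contU t) ((h.contH t).pow 2)
      (vsq_nonneg U t) (fun x => sq_nonneg _) (h.iU t ht) (h.int_msq_sq ht).1 fun x => by
        rw [Real.sqrt_sq (msq_nonneg H t x), one_mul, abs_of_nonneg]
        exact mul_nonneg (Real.sqrt_nonneg _) (msq_nonneg H t x)
  have k2 : Integrable (fun x => √(vsq U t x) * √(eta (2 * R) x * msq H t x)) ∧
      |∫ x, √(vsq U t x) * √(eta (2 * R) x * msq H t x)| ≤
        1 * (√(∫ x, vsq U t x) * √(∫ x, eta (2 * R) x * msq H t x)) :=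
    abs_integral_le_sqrt zero_le_one ((h.contU t).sqrt.mul (cE.mul (h.contH t)).sqrt) (h.contU t)
      (cE.mul (h.contH t)) (vsq_nonneg U t) (fun x => mul_nonneg (eta_nonneg _ _) (msq_nonneg _ _ _)) (h.iU t ht)
      (integrable_eta_mul (h.contH t) (by linarith)) fun x => by
        rw [one_mul, abs_of_nonneg (by positivity)]
  have k3 : ∫ x, eta (2 * R) x * msq H t x ≤ 8 * R * √(totSq (msq H) t) := by
    have := (abs_integral_le_sqrt (c := 1) (F := fun x => eta (2 * R) x * msq H t x) (p := eta (2 * R))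
      (q := fun x => msq H t x ^ 2) zero_le_one (cE.mul (h.contH t)) cE ((h.contH t).pow 2)
      (eta_nonneg _) (fun x => sq_nonneg _) (integrable_eta (by linarith)) (h.int_msq_sq ht).1 fun x => by
        rw [Real.sqrt_sq (msq_nonneg H t x), one_mul,
          abs_of_nonneg (mul_nonneg (eta_nonneg _ _) (msq_nonneg H t x))]
        exact mul_le_mul_of_nonneg_right (eta_le_sqrt _ x) (msq_nonneg H t x)).2
    refine (le_abs_self _).trans (this.trans ?_)
    rw [one_mul]
    exact mul_le_mul_of_nonneg_right (sqrt_integral_eta_le hR) (Real.sqrt_nonneg _)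
  set m := 2 * √(tot (vsq U) t) + 12 * quartG U t with hm
  have iφG : Integrable fun x => cut R x * msq (grad U) t x := integrable_cut_mul (h.contG t) hR
  have iB : Integrable fun x => 64 * (C / R) ^ 2 * vsq U t x + 2 * (C / R) *
      (m * vsq U t x + √(vsq U t x) * msq H t x) + 16 * (C / R) * (√(vsq U t x) * √(eta (2 * R) x * msq H t x)) :=
    (((h.iU t ht).const_mul _).add ((((h.iU t ht).const_mul m).add k1.1).const_mul _)).add (k2.1.const_mul _)
  have mono : ∫ x, (cut R x * (-2 * msq (grad U) t x) + ∑ j, pd j (cut R) x *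
      (U j t x * (vsq U t x + msq H t x) - 2 * ∑ i, U i t x * tens U H i j t x)) ≤
      ∫ x, (-(cut R x * msq (grad U) t x) + (64 * (C / R) ^ 2 * vsq U t x + 2 * (C / R) *
      (m * vsq U t x + √(vsq U t x) * msq H t x) +
        16 * (C / R) * (√(vsq U t x) * √(eta (2 * R) x * msq H t x)))) := by
    refine integral_mono ((integrable_cut_mul (continuous_const.mul (h.contG t)) hR).add
      (integrable_sum_pd_cut_mul (fun j => ?_) hR)) (iφG.neg.add iB) fun x => ?_
    · exact ((h.smU j t).continuous.mul ((h.contU t).add (h.contH t))).sub (continuous_const.mul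
        (continuous_finsetSum _ fun i _ => (h.smU i t).continuous.mul (h.smT i j t).continuous))
    have u0 := vsq_nonneg U t x
    have h0 := msq_nonneg H t x
    have g0 := msq_nonneg (grad U) t x
    have e0 := eta_nonneg R x
    have f0 := eta_nonneg (2 * R) x
    have f1 := eta_le_one (2 * R) x
    have su := Real.sqrt_nonneg (vsq U t x)
    have sg := Real.sqrt_nonneg (msq (grad U) t x)
    have sh := Real.sqrt_nonneg (msq H t x)
    have d0 : 0 ≤ C / R := by positivity
    have c1 : ∀ j, |pd j (cut R) x| ≤ 2 * (eta R x * (C / R)) := fun j => by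
      rw [pd_cut, abs_mul, abs_mul, abs_two, abs_of_nonneg e0]
      have := (hb R hR j x).1.trans (mul_le_of_le_one_right d0 f1)
      gcongr
    have c2 : ∀ j, |pd j (cut R) x| ≤ C / R * eta (2 * R) x := fun j => (hb R hR j x).2.1
    have c3 : ∀ j, |pd j (cut R) x| ≤ C / R := fun j => (c2 j).trans (mul_le_of_le_one_right d0 f1)
    have split : ∑ j, pd j (cut R) x *
        (U j t x * (vsq U t x + msq H t x) - 2 * ∑ i, U i t x * tens U H i j t x) =
        (∑ j, pd j (cut R) x * (U j t x * (vsq U t x + msq H t x))) -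
        2 * (∑ j, pd j (cut R) x * ∑ i, U i t x * pd j (U i t) x) -
        2 * ∑ j, pd j (cut R) x * ∑ i, U i t x * stress H i j t x := by
      simp only [Fin.sum_univ_two, tens]; ring
    have t1 : |∑ j, pd j (cut R) x * (U j t x * (vsq U t x + msq H t x))| ≤
        2 * (C / R * (√(vsq U t x) * (vsq U t x + msq H t x))) :=
      abs_sum_two_le fun j => abs_mul_le (c3 j) (abs_mul_le (abs_le_vsq U j t x)
        (abs_of_nonneg (add_nonneg u0 h0)).le)
    have t2 : |∑ j, pd j (cut R) x * ∑ i, U i t x * pd j (U i t) x| ≤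
        2 * (2 * (eta R x * (C / R)) * (2 * (√(vsq U t x) * √(msq (grad U) t x)))) :=
      abs_sum_two_le fun j => abs_mul_le (c1 j) (abs_sum_two_le fun i =>
        abs_mul_le (abs_le_vsq U i t x) (abs_grad_le i j x))
    have t3 : |∑ j, pd j (cut R) x * ∑ i, U i t x * stress H i j t x| ≤
        2 * (C / R * eta (2 * R) x * (2 * (√(vsq U t x) * (2 * √(msq H t x))))) :=
      abs_sum_two_le fun j => abs_mul_le (c2 j) (abs_sum_two_le fun i =>
        abs_mul_le (abs_le_vsq U i t x) (h.abs_stress_le ht i j x))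
    have q1 := le_abs_self (∑ j, pd j (cut R) x * (U j t x * (vsq U t x + msq H t x)))
    have q2 := neg_abs_le (∑ j, pd j (cut R) x * ∑ i, U i t x * pd j (U i t) x)
    have q3 := neg_abs_le (∑ j, pd j (cut R) x * ∑ i, U i t x * stress H i j t x)
    have r1 : √(vsq U t x) * vsq U t x ≤ m * vsq U t x :=
      mul_le_mul_of_nonneg_right (h.sqrt_vsq_le ht x) u0
    have r1' := mul_le_mul_of_nonneg_left r1 d0
    have r2 : 16 * (eta R x * √(msq (grad U) t x) * ((C / R) * √(vsq U t x))) ≤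
        cut R x * msq (grad U) t x + 64 * (C / R) ^ 2 * vsq U t x := by
      have s1 := Real.sq_sqrt u0
      have s2 := Real.sq_sqrt g0
      have := sq_nonneg (eta R x * √(msq (grad U) t x) - 8 * ((C / R) * √(vsq U t x)))
      rw [cut]
      nlinarith
    have r3 : eta (2 * R) x * √(msq H t x) ≤ √(eta (2 * R) x * msq H t x) := by
      rw [Real.sqrt_mul f0]
      exact mul_le_mul_of_nonneg_right (eta_le_sqrt _ x) sh
    have r3' := mul_le_mul_of_nonneg_left r3 (mul_nonneg d0 su)
    change cut R x * (-2 * msq (grad U) t x) + ∑ j, pd j (cut R) x *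
        (U j t x * (vsq U t x + msq H t x) - 2 * ∑ i, U i t x * tens U H i j t x) ≤ _
    rw [split]
    linear_combination t1 + 2 * t2 + 2 * t3 + q1 + 2 * q2 + 2 * q3 + 2 * r1' + r2 + 16 * r3'
  refine mono.trans ?_
  have iφG' : Integrable fun x => -(cut R x * msq (grad U) t x) := iφG.neg
  have j1 : Integrable fun x => m * vsq U t x + √(vsq U t x) * msq H t x := ((h.iU t ht).const_mul m).add k1.1
  have j2 : Integrable fun x => 64 * (C / R) ^ 2 * vsq U t x + 2 * (C / R) *
      (m * vsq U t x + √(vsq U t x) * msq H t x) := ((h.iU t ht).const_mul _).add (j1.const_mul _)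
  rw [integral_add iφG' iB, integral_neg, integral_add j2 (k2.1.const_mul _),
    integral_add ((h.iU t ht).const_mul _) (j1.const_mul _),
    integral_const_mul, integral_const_mul, integral_const_mul, integral_add ((h.iU t ht).const_mul m) k1.1,
    integral_const_mul]
  have d0 : 0 ≤ C / R := by positivity
  have l1 := (le_abs_self _).trans k1.2
  have l2 := (le_abs_self _).trans k2.2
  rw [one_mul] at l1 l2
  have l3 : √(∫ x, vsq U t x) * √(∫ x, eta (2 * R) x * msq H t x) ≤
      √(∫ x, vsq U t x) * √(8 * R * √(totSq (msq H) t)) := by gcongr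
  have l4 := l2.trans l3
  change _ ≤ -(∫ x, cut R x * msq (grad U) t x) + (64 * (C / R) ^ 2 * (∫ x, vsq U t x) + 2 * (C / R) *
      (m * (∫ x, vsq U t x) + √(∫ x, vsq U t x) * √(∫ x, msq H t x ^ 2)) +
      16 * (C / R) * (√(∫ x, vsq U t x) * √(8 * R * √(totSq (msq H) t))))
  gcongr

end VFlow

namespace VFlow
variable {T : ℝ} {U : Fin 2 → ℝ → V → ℝ} {H : Fin 2 → Fin 2 → ℝ → V → ℝ} {P : ℝ → V → ℝ} {t : ℝ}

theorem exists_energy_dt_bound : ∃ C : ℝ, 0 ≤ C ∧ ∀ (T : ℝ) (U : Fin 2 → ℝ → V → ℝ)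
    (H : Fin 2 → Fin 2 → ℝ → V → ℝ) (P : ℝ → V → ℝ), VFlow T U H P → ∀ t ∈ Set.Ioo 0 T, ∀ R : ℝ, 1 ≤ R →
    ∀ N : ℝ, 1 ≤ N → √(tot (vsq U) t) ≤ N →
    ∫ x, cut R x * dt (fun t x => vsq U t x + msq H t x) t x ≤ -(∫ x, cut R x * msq (grad U) t x) +
      C * (1 + √(totSq (msq H) t)) / √R * (N ^ 3 + quartG U t * N ^ 2) := by
  obtain ⟨C, hC, hb⟩ := exists_energy_flux_bound
  obtain ⟨C', hC', hp⟩ := exists_pressure_div_free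
  refine ⟨64 * C ^ 2 + 78 * C + 84 * C', by positivity, fun T U H P h t ht R hR N hN hn => ?_⟩
  have hR0 : 0 < R := by linarith
  have ht' : t ∈ Set.Icc 0 T := ⟨ht.1.le, ht.2.le⟩
  have hdiv := h.divU t ht'
  rw [h.integral_cutoff_energy_dt (sm_cut R) (cut_compact hR0) ht']
  have f := hb T U H P h t ht' R hR0
  have p := hp T U H P h t ht U (fun i => h.smU i t) hdiv (h.iU t ht') R hR0
  rw [← integral_cut_sum (h.smP t) (fun i => (h.smU i t).continuous) hR0] at p
  have cS : Continuous fun x => ∑ i, pd i (P t) x * U i t x :=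
    continuous_finsetSum _ fun i _ => ((h.smP t).pd i).continuous.mul (h.smU i t).continuous
  have i1 : Integrable fun x => cut R x * (-2 * msq (grad U) t x) + ∑ j, pd j (cut R) x *
      (U j t x * (vsq U t x + msq H t x) - 2 * ∑ i, U i t x * tens U H i j t x) := by
    refine (integrable_cut_mul (continuous_const.mul (h.contG t)) hR0).add
      (integrable_sum_pd_cut_mul (fun j => ?_) hR0)
    exact ((h.smU j t).continuous.mul ((h.contU t).add (h.contH t))).sub (continuous_const.mul
        (continuous_finsetSum _ fun i _ => (h.smU i t).continuous.mul (h.smT i j t).continuous))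
  have i2 : Integrable fun x => 2 * (cut R x * ∑ i, pd i (P t) x * U i t x) :=
    (integrable_cut_mul cS hR0).const_mul 2
  have e : ∫ x, (cut R x * (-2 * msq (grad U) t x - 2 * ∑ i, U i t x * pd i (P t) x) +
        ∑ j, pd j (cut R) x * (U j t x * (vsq U t x + msq H t x) - 2 * ∑ i, U i t x * tens U H i j t x)) =
      (∫ x, (cut R x * (-2 * msq (grad U) t x) + ∑ j, pd j (cut R) x *
      (U j t x * (vsq U t x + msq H t x) - 2 * ∑ i, U i t x * tens U H i j t x))) -
      2 * ∫ x, cut R x * ∑ i, pd i (P t) x * U i t x := by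
    rw [← integral_const_mul, ← integral_sub i1 i2]
    refine integral_congr_ae (ae_of_all _ fun x => ?_)
    simp only [Fin.sum_univ_two]; ring
  rw [e]
  have p' := (neg_abs_le _).trans' (neg_le_neg p)
  have ps := h.pressSize_le ht'
  have ps0 := pressSize_nonneg U H t
  have q0 := quartG_nonneg U t
  have n0 := Real.sqrt_nonneg (tot (vsq U) t)
  have Q0 := Real.sqrt_nonneg (totSq (msq H) t)
  have n2 : tot (vsq U) t = √(tot (vsq U) t) ^ 2 := (Real.sq_sqrt (tot_vsq_nonneg U t)).symm
  have s1 : 1 ≤ √R := Real.one_le_sqrt.2 hR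
  have sR : R = √R ^ 2 := (Real.sq_sqrt hR0.le).symm
  set n := √(tot (vsq U) t)
  set a := quartG U t
  set q := √(totSq (msq H) t)
  set s := √R
  set E := N ^ 3 + a * N ^ 2 with hE
  have E0 : 0 ≤ E := by positivity
  have N0 : 0 ≤ N := by linarith
  have Na : 0 ≤ a * N ^ 2 := by positivity
  have N23 : N ^ 2 ≤ N ^ 3 := pow_le_pow_right₀ hN (by norm_num)
  have N13 : N ≤ N ^ 3 := le_self_pow₀ hN (by norm_num)
  have m1 : n ^ 2 ≤ E := by linarith [pow_le_pow_left₀ n0 hn 2]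
  have m2 : (2 * n + 12 * a) * n ^ 2 ≤ 12 * E := by
    have := pow_le_pow_left₀ n0 hn 3
    have := mul_le_mul_of_nonneg_left (pow_le_pow_left₀ n0 hn 2) q0
    have := pow_nonneg N0 3
    nlinarith
  have m3 : n * q ≤ q * E := by
    rw [mul_comm]
    exact mul_le_mul_of_nonneg_left (by linarith) Q0
  have m4 : n * √(8 * R * q) ≤ 3 * s * (1 + q) * E := by
    have : √(8 * R * q) ≤ 3 * s * (1 + q) := by
      rw [Real.sqrt_le_left (by positivity), sR]
      have : 0 ≤ s ^ 2 := sq_nonneg s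
      nlinarith [mul_nonneg this Q0, mul_nonneg this (mul_nonneg Q0 Q0)]
    rw [mul_comm]
    exact mul_le_mul this (by linarith) n0 (by positivity)
  have m5 : pressSize U H t * n ≤ 42 * ((1 + q) * E) := by
    have := mul_le_mul_of_nonneg_right ps n0
    have := mul_nonneg Q0 E0
    nlinarith
  have d0 : 0 ≤ C / R := by positivity
  have d0' : 0 ≤ C' / R := by positivity
  have dR : 1 / R ≤ 1 / s := by
    rw [sR]; exact one_div_le_one_div_of_le (by positivity) (le_self_pow₀ s1 (by norm_num))
  have ds : 1 / s ≤ 1 := by rw [div_le_one (by positivity)]; exact s1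
  have ds0 : 0 < 1 / s := by positivity
  have qE : 0 ≤ q * E := mul_nonneg Q0 E0
  have dC : C / R ≤ C * (1 / s) := by rw [div_eq_mul_one_div]; gcongr
  have dC' : C' / R ≤ C' * (1 / s) := by rw [div_eq_mul_one_div]; gcongr
  have w1 : 64 * (C / R) ^ 2 * tot (vsq U) t ≤ 64 * C ^ 2 * (1 / s) * ((1 + q) * E) := by
    rw [n2]
    have : (C / R) ^ 2 ≤ C ^ 2 * (1 / s) := by
      calc (C / R) ^ 2 ≤ (C * (1 / s)) ^ 2 := by gcongr
        _ = C ^ 2 * (1 / s) * (1 / s) := by ring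
        _ ≤ C ^ 2 * (1 / s) * 1 := by gcongr
        _ = _ := mul_one _
    calc _ ≤ 64 * (C ^ 2 * (1 / s)) * ((1 + q) * E) := by gcongr; linarith
      _ = _ := by ring
  have w2 : 2 * (C / R) * ((2 * n + 12 * a) * tot (vsq U) t + n * q) ≤ 30 * C * (1 / s) * ((1 + q) * E) := by
    rw [n2]
    calc _ ≤ 2 * (C * (1 / s)) * (15 * ((1 + q) * E)) := by
          gcongr; linarith
      _ = _ := by ring
  have w3 : 16 * (C / R) * (n * √(8 * R * q)) ≤ 48 * C * (1 / s) * ((1 + q) * E) := by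
    calc _ ≤ 16 * (C / R) * (3 * s * (1 + q) * E) := by gcongr
      _ = 48 * (C * (s / R)) * ((1 + q) * E) := by ring
      _ = 48 * (C * (1 / s)) * ((1 + q) * E) := by
        congr 3; rw [sR]; field_simp
      _ = _ := by ring
  have w4 : 2 * (C' / R * (pressSize U H t * n)) ≤ 84 * C' * (1 / s) * ((1 + q) * E) := by
    calc _ ≤ 2 * (C' * (1 / s) * (42 * ((1 + q) * E))) := by gcongr
      _ = _ := by ring
  have fin : (64 * C ^ 2 + 78 * C + 84 * C') * (1 + q) / s * E = 64 * C ^ 2 * (1 / s) * ((1 + q) * E) +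
      30 * C * (1 / s) * ((1 + q) * E) + 48 * C * (1 / s) * ((1 + q) * E) + 84 * C' * (1 / s) * ((1 + q) * E) := by
    ring
  rw [fin]
  change -(C' / R * (pressSize U H t * n)) ≤ _ at p'
  linarith

/-- The basic energy inequality. -/
theorem energy_le (h : VFlow T U H P) {N : ℝ → ℝ} (hN : ∀ t ∈ Set.Ioc 0 T, 1 ≤ N t ∧ √(tot (vsq U) t) ≤ N t)
    (iN : IntegrableOn (fun t => N t ^ 3 + quartG U t * N t ^ 2) (Set.Ioc 0 T)) :
    (∀ t ∈ Set.Icc 0 T, tot (vsq U) t + tot (msq H) t ≤ tot (vsq U) 0 + tot (msq H) 0) ∧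
      ∀ t ∈ Set.Icc 0 T, IntegrableOn (tot (msq (grad U))) (Set.Ioc 0 t) ∧
        ∫ s in Set.Ioc 0 t, tot (msq (grad U)) s ≤ tot (vsq U) 0 + tot (msq H) 0 := by
  rcases lt_or_ge T 0 with hT | hT
  · rw [Set.Icc_eq_empty (not_le.2 hT)]
    exact ⟨fun t ht => ht.elim, fun t ht => ht.elim⟩
  obtain ⟨C, hC, hb⟩ := exists_energy_dt_bound
  obtain ⟨K, hK, hQ⟩ := h.exists_totSq_strain_le hT iN fun t ht => by
    obtain ⟨n1, n2⟩ := hN t ht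
    have q0 := quartG_nonneg U t
    have a1 : N t ≤ N t ^ 3 := le_self_pow₀ n1 (by norm_num)
    have a2 := le_mul_of_one_le_right q0 (one_le_pow₀ n1 (n := 2))
    exact ⟨by linarith, by nlinarith⟩
  have E0 : ∀ t ∈ Set.Ioc 0 T, 0 ≤ N t ^ 3 + quartG U t * N t ^ 2 := fun t ht => by
    have := (hN t ht).1
    have := quartG_nonneg U t
    positivity
  set I := ∫ t in Set.Ioc 0 T, (N t ^ 3 + quartG U t * N t ^ 2) with hI
  have h0 : (0:ℝ) ∈ Set.Icc 0 T := ⟨le_rfl, hT⟩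
  have js : JS fun t x => vsq U t x + msq H t x := h.jU.add h.jH
  have iS : ∀ t ∈ Set.Icc 0 T, Integrable fun x => vsq U t x + msq H t x := fun t ht => (h.iU t ht).add (h.iH t ht)
  have tS : ∀ t ∈ Set.Icc 0 T, ∫ x, (vsq U t x + msq H t x) = tot (vsq U) t + tot (msq H) t := fun t ht =>
    integral_add (h.iU t ht) (h.iH t ht)
  have s0 : ∀ t x, 0 ≤ vsq U t x + msq H t x := fun t x => add_nonneg (vsq_nonneg _ _ _) (msq_nonneg _ _ _)
  set κ := C * (1 + √K) with hκ
  have key : ∀ t ∈ Set.Icc 0 T, ∀ n : ℕ, (∫ x, cut (rad n) x * (vsq U t x + msq H t x)) +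
      ∫ s in Set.Ioc 0 t, ∫ x, cut (rad n) x * msq (grad U) s x ≤
      tot (vsq U) 0 + tot (msq H) 0 + κ * I / √(rad n) := by
    intro t ht n
    have hR := one_le_rad n
    set R := rad n
    have hR0 : 0 < R := by linarith
    have hsub : Set.Ioc 0 t ⊆ Set.Ioc 0 T := Set.Ioc_subset_Ioc_right ht.2
    have iY : IntegrableOn (fun s => ∫ x, cut R x * msq (grad U) s x) (Set.Ioc 0 t) :=
      (continuous_integral_cut h.jG hR0).integrableOn_Ioc
    have step : (∫ x, cut R x * (vsq U t x + msq H t x)) - (∫ x, cut R x * (vsq U 0 x + msq H 0 x)) ≤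
        ∫ s in Set.Ioc 0 t, (-(∫ x, cut R x * msq (grad U) s x) + κ / √R * (N s ^ 3 + quartG U s * N s ^ 2)) := by
      refine sub_le_setIntegral (y := fun t => ∫ x, cut R x * (vsq U t x + msq H t x)) ht.1
        (continuous_integral_cut js hR0).continuousOn
        (fun r _ => (JS.hasDerivAt_integral_compact js (sm_cut R) (cut_compact hR0) r).hasDerivWithinAt)
        (iY.neg.add ((iN.mono_set hsub).const_mul _)) fun r hr => ?_
      have hr' : r ∈ Set.Ioc 0 T := ⟨hr.1, hr.2.le.trans ht.2⟩
      refine (hb T U H P h r ⟨hr.1, hr.2.trans_le ht.2⟩ R hR (N r) (hN r hr').1 (hN r hr').2).trans ?_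
      have l1 : C * (1 + √(totSq (msq H) r)) ≤ κ :=
        mul_le_mul_of_nonneg_left (by linarith [Real.sqrt_le_sqrt (hQ r ⟨hr.1.le, hr'.2⟩)]) hC
      exact add_le_add_right (mul_le_mul_of_nonneg_right (by gcongr) (E0 r hr')) _
    have iY' : IntegrableOn (fun s => -∫ x, cut R x * msq (grad U) s x) (Set.Ioc 0 t) := iY.neg
    rw [integral_add iY' ((iN.mono_set hsub).const_mul _), integral_neg, integral_const_mul] at step
    have m1 : ∫ s in Set.Ioc 0 t, (N s ^ 3 + quartG U s * N s ^ 2) ≤ I :=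
      setIntegral_mono_set iN ((ae_restrict_iff' measurableSet_Ioc).2 (ae_of_all _ E0)) hsub.eventuallyLE
    have m2 : κ / √R * ∫ s in Set.Ioc 0 t, (N s ^ 3 + quartG U s * N s ^ 2) ≤ κ / √R * I := by gcongr
    have m3 := integral_cut_mul_le (iS 0 h0) (s0 0) R
    rw [tS 0 h0] at m3
    rw [mul_div_right_comm]
    linarith
  have lim : Tendsto (fun n => tot (vsq U) 0 + tot (msq H) 0 + κ * I / √(rad n)) atTop
      (nhds (tot (vsq U) 0 + tot (msq H) 0 + 0)) :=
    tendsto_const_nhds.add (tendsto_const_nhds.div_atTop (Real.tendsto_sqrt_atTop.comp tendsto_rad))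
  rw [add_zero] at lim
  have Y0 : ∀ n s, 0 ≤ ∫ x, cut (rad n) x * msq (grad U) s x := fun n s =>
    integral_cut_nonneg (msq_nonneg (grad U) s) _
  refine ⟨fun t ht => ?_, fun t ht => ?_⟩
  · rw [← tS t ht]
    refine le_of_tendsto_of_tendsto' (tendsto_integral_cut_mul (iS t ht)) lim fun n => ?_
    have : 0 ≤ ∫ s in Set.Ioc 0 t, ∫ x, cut (rad n) x * msq (grad U) s x := integral_nonneg (Y0 n)
    linarith [key t ht n]
  · refine integrable_of_tendsto (F := fun n s => ∫ x, cut (rad n) x * msq (grad U) s x)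
      (fun n => (continuous_integral_cut h.jG (rad_pos n)).integrableOn_Ioc) (fun n => ae_of_all _ (Y0 n))
      h.measurable_totG.aestronglyMeasurable
      ((ae_restrict_iff' measurableSet_Ioc).2 (ae_of_all _ fun s hs =>
        tendsto_integral_cut_mul (h.iG s ⟨hs.1.le, hs.2.trans ht.2⟩))) (fun n => ?_) lim
    have := integral_cut_nonneg (s0 t) (rad n)
    linarith [key t ht n]

end VFlow

namespace VFlow
variable {T : ℝ} {U : Fin 2 → ℝ → V → ℝ} {H : Fin 2 → Fin 2 → ℝ → V → ℝ} {P : ℝ → V → ℝ} {t : ℝ}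

theorem abs_enstrophy_le (h : VFlow T U H P) (ht : t ∈ Set.Icc 0 T) (x : V) :
    |enstrophy U H t x| ≤ 2⁻¹ * msq (grad U) t x + 4 * √(msq (grad U) t x) := by
  have g0 := msq_nonneg (grad U) t x
  have w := h.abs_work_le ht x
  have s := mul_le_mul_of_nonneg_right (h.sqrt_small ht x) (Real.sqrt_nonneg (msq (grad U) t x))
  rw [enstrophy]
  refine (abs_add_le _ _).trans ?_
  rw [abs_of_nonneg (by positivity : 0 ≤ 2⁻¹ * msq (grad U) t x)]
  linarith

theorem exists_enstrophy_flux_bound : ∃ C : ℝ, 0 ≤ C ∧ ∀ (T : ℝ) (U : Fin 2 → ℝ → V → ℝ)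
    (H : Fin 2 → Fin 2 → ℝ → V → ℝ) (P : ℝ → V → ℝ), VFlow T U H P → ∀ t ∈ Set.Icc 0 T, ∀ R : ℝ, 0 < R →
    ∫ x, (cut R x * (remainder U H t x - vsq (acc U) t x) + ∑ j, pd j (cut R) x *
      (U j t x * enstrophy U H t x - ∑ i, tens U H i j t x * acc U i t x)) ≤
    -(∫ x, cut R x * vsq (acc U) t x) + (32 * tot (msq (grad U)) t + C / R *
      (√(tot (vsq U) t) * √(totSq (msq (grad U)) t) + (4 * tot (vsq U) t + 6 * tot (msq (grad U)) t +
        4 * tot (msq H) t + 6 * tot (vsq (acc U)) t))) := by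
  obtain ⟨C, hC, hb⟩ := exists_cut_bound
  refine ⟨C, hC, fun T U H P h t ht R hR => ?_⟩
  have k1 : Integrable (fun x => √(vsq U t x) * msq (grad U) t x) ∧
      |∫ x, √(vsq U t x) * msq (grad U) t x| ≤ 1 * (√(∫ x, vsq U t x) * √(∫ x, msq (grad U) t x ^ 2)) :=
    abs_integral_le_sqrt zero_le_one ((h.contU t).sqrt.mul (h.contG t)) (h.contU t) ((h.contG t).pow 2)
      (vsq_nonneg U t) (fun x => sq_nonneg _) (h.iU t ht) (h.iD t ht) fun x => by
        rw [Real.sqrt_sq (msq_nonneg (grad U) t x), one_mul, abs_of_nonneg]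
        exact mul_nonneg (Real.sqrt_nonneg _) (msq_nonneg (grad U) t x)
  have iφA : Integrable fun x => cut R x * vsq (acc U) t x := integrable_cut_mul (h.contA t) hR
  have iφA' : Integrable fun x => -(cut R x * vsq (acc U) t x) := iφA.neg
  have j1 : Integrable fun x => 4 * vsq U t x + 6 * msq (grad U) t x := ((h.iU t ht).const_mul _).add
    ((h.iG t ht).const_mul _)
  have j2 : Integrable fun x => 4 * vsq U t x + 6 * msq (grad U) t x + 4 * msq H t x :=
    j1.add ((h.iH t ht).const_mul _)
  have j3 : Integrable fun x => 4 * vsq U t x + 6 * msq (grad U) t x + 4 * msq H t x + 6 * vsq (acc U) t x :=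
    j2.add ((h.iA t ht).const_mul _)
  have j4 : Integrable fun x => √(vsq U t x) * msq (grad U) t x +
      (4 * vsq U t x + 6 * msq (grad U) t x + 4 * msq H t x + 6 * vsq (acc U) t x) := k1.1.add j3
  have iB : Integrable fun x => 32 * msq (grad U) t x + C / R * (√(vsq U t x) * msq (grad U) t x +
      (4 * vsq U t x + 6 * msq (grad U) t x + 4 * msq H t x + 6 * vsq (acc U) t x)) :=
    ((h.iG t ht).const_mul _).add (j4.const_mul _)
  have cR : Continuous (remainder U H t) := continuous_finsetSum _ fun i _ => continuous_finsetSum _ fun j _ =>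
    (((JS.matd h.sU (JS.stress h.sH i j)).sm t).continuous.mul ((h.smU i t).pd j).continuous).sub
      ((h.smB i j t).continuous.mul (continuous_finsetSum _ fun k _ =>
        ((h.smU k t).pd j).continuous.mul ((h.smU i t).pd k).continuous))
  have mono : ∫ x, (cut R x * (remainder U H t x - vsq (acc U) t x) + ∑ j, pd j (cut R) x *
      (U j t x * enstrophy U H t x - ∑ i, tens U H i j t x * acc U i t x)) ≤
      ∫ x, (-(cut R x * vsq (acc U) t x) + (32 * msq (grad U) t x + C / R * (√(vsq U t x) * msq (grad U) t x +
      (4 * vsq U t x + 6 * msq (grad U) t x + 4 * msq H t x + 6 * vsq (acc U) t x)))) := by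
    refine integral_mono ((integrable_cut_mul (cR.sub (h.contA t)) hR).add
      (integrable_sum_pd_cut_mul (fun j => ?_) hR)) (iφA'.add iB) fun x => ?_
    · exact ((h.smU j t).continuous.mul (h.jens.sm t).continuous).sub
        (continuous_finsetSum _ fun i _ => (h.smT i j t).continuous.mul (h.smA i t).continuous)
    have u0 := vsq_nonneg U t x
    have h0 := msq_nonneg H t x
    have g0 := msq_nonneg (grad U) t x
    have a0 := vsq_nonneg (acc U) t x
    have su := Real.sqrt_nonneg (vsq U t x)
    have sg := Real.sqrt_nonneg (msq (grad U) t x)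
    have su2 := Real.sq_sqrt u0
    have sg2 := Real.sq_sqrt g0
    have sh2 := Real.sq_sqrt h0
    have sa2 := Real.sq_sqrt a0
    have d0 : 0 ≤ C / R := by positivity
    have c3 : ∀ j, |pd j (cut R) x| ≤ C / R := fun j =>
      (hb R hR j x).2.1.trans (mul_le_of_le_one_right d0 (eta_le_one _ x))
    have t1 : |∑ j, pd j (cut R) x * (U j t x * enstrophy U H t x - ∑ i, tens U H i j t x * acc U i t x)| ≤
        2 * (C / R * (√(vsq U t x) * (2⁻¹ * msq (grad U) t x + 4 * √(msq (grad U) t x)) +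
          2 * ((√(msq (grad U) t x) + 2 * √(msq H t x)) * √(vsq (acc U) t x)))) :=
      abs_sum_two_le fun j => abs_mul_le (c3 j) ((abs_sub _ _).trans (add_le_add
        (abs_mul_le (abs_le_vsq U j t x) (h.abs_enstrophy_le ht x))
        (abs_sum_two_le fun i => abs_mul_le (h.abs_tens_le ht i j x) (abs_le_vsq (acc U) i t x))))
    have t2 : 2 * (√(vsq U t x) * (2⁻¹ * msq (grad U) t x + 4 * √(msq (grad U) t x)) +
          2 * ((√(msq (grad U) t x) + 2 * √(msq H t x)) * √(vsq (acc U) t x))) ≤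
        √(vsq U t x) * msq (grad U) t x +
        (4 * vsq U t x + 6 * msq (grad U) t x + 4 * msq H t x + 6 * vsq (acc U) t x) := by
      nlinarith [sq_nonneg (√(vsq U t x) - √(msq (grad U) t x)),
        sq_nonneg (√(msq (grad U) t x) - √(vsq (acc U) t x)), sq_nonneg (√(msq H t x) - √(vsq (acc U) t x))]
    have t2' := mul_le_mul_of_nonneg_left t2 d0
    have t3 : cut R x * remainder U H t x ≤ 32 * msq (grad U) t x := by
      have := (le_abs_self _).trans (h.abs_remainder_le ht x)
      have c0 := cut_nonneg R x
      calc _ ≤ cut R x * (32 * msq (grad U) t x) := by gcongr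
        _ ≤ _ := mul_le_of_le_one_left (by positivity) (cut_le_one R x)
    have q1 := le_abs_self (∑ j, pd j (cut R) x *
      (U j t x * enstrophy U H t x - ∑ i, tens U H i j t x * acc U i t x))
    change cut R x * (remainder U H t x - vsq (acc U) t x) + ∑ j, pd j (cut R) x *
      (U j t x * enstrophy U H t x - ∑ i, tens U H i j t x * acc U i t x) ≤ _
    linear_combination t1 + t2' + t3 + q1
  refine mono.trans ?_
  rw [integral_add iφA' iB, integral_neg, integral_add ((h.iG t ht).const_mul _) (j4.const_mul _),
    integral_const_mul, integral_const_mul, integral_add k1.1 j3, integral_add j2 ((h.iA t ht).const_mul _),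
    integral_add j1 ((h.iH t ht).const_mul _), integral_add ((h.iU t ht).const_mul _) ((h.iG t ht).const_mul _),
    integral_const_mul, integral_const_mul, integral_const_mul, integral_const_mul]
  have d0 : 0 ≤ C / R := by positivity
  have l1 := (le_abs_self _).trans k1.2
  rw [one_mul] at l1
  exact add_le_add_right (add_le_add_right (mul_le_mul_of_nonneg_left (add_le_add_left l1 _) d0) _) _

theorem exists_enstrophy_dt_bound : ∃ C : ℝ, 0 ≤ C ∧ ∀ (T : ℝ) (U : Fin 2 → ℝ → V → ℝ)
    (H : Fin 2 → Fin 2 → ℝ → V → ℝ) (P : ℝ → V → ℝ), VFlow T U H P → ∀ t ∈ Set.Ioo 0 T,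
    tot (vsq U) t + tot (msq H) t ≤ 1 → ∀ R : ℝ, 1 ≤ R →
    ∫ x, cut R x * dt (enstrophy U H) t x ≤ -(∫ x, cut R x * vsq (acc U) t x) +
      C * (tot (msq (grad U)) t + √(tot (msq (grad U)) t) * √(totSq (msq (grad U)) t)) +
      C / R * (1 + tot (msq (grad U)) t + tot (vsq (acc U)) t + √(totSq (msq (grad U)) t) +
        √(tot (msq (grad U)) t) * √(totSq (msq (grad U)) t)) := by
  obtain ⟨C, hC, hb⟩ := exists_enstrophy_flux_bound
  obtain ⟨C', hC', hp⟩ := exists_pressure_div_free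
  obtain ⟨C'', hC'', hq⟩ := exists_pressure_convection
  refine ⟨32 + 6 * C + 512 * C' + 64 * C'', by positivity, fun T U H P h t ht h1 R hR => ?_⟩
  have hR0 : 0 < R := by linarith
  have ht' : t ∈ Set.Icc 0 T := ⟨ht.1.le, ht.2.le⟩
  rw [h.integral_cutoff_enstrophy_dt (sm_cut R) (cut_compact hR0) ht']
  have f := hb T U H P h t ht' R hR0
  have smD : ∀ i, Sm (tder U i t) := fun i => (h.sU i).dt.sm t
  have p := hp T U H P h t ht (tder U) smD (h.div_tder ht) (h.int_tder ht').1 R hR0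
  have q := hq T U H P h t ht R hR
  have cK : ∀ i, Continuous fun x => ∑ k, U k t x * pd k (U i t) x := fun i =>
    continuous_finsetSum _ fun k _ => (h.smU k t).continuous.mul ((h.smU i t).pd k).continuous
  have cP : ∀ i, Continuous (pd i (P t)) := fun i => ((h.smP t).pd i).continuous
  rw [← integral_cut_sum (h.smP t) (fun i => (smD i).continuous) hR0] at p
  rw [← integral_cut_sum (h.smP t) cK hR0] at q
  have cR : Continuous (remainder U H t) := continuous_finsetSum _ fun i _ => continuous_finsetSum _ fun j _ =>
    (((JS.matd h.sU (JS.stress h.sH i j)).sm t).continuous.mul ((h.smU i t).pd j).continuous).sub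
      ((h.smB i j t).continuous.mul (continuous_finsetSum _ fun k _ =>
        ((h.smU k t).pd j).continuous.mul ((h.smU i t).pd k).continuous))
  have i1 : Integrable fun x => cut R x * (remainder U H t x - vsq (acc U) t x) + ∑ j, pd j (cut R) x *
      (U j t x * enstrophy U H t x - ∑ i, tens U H i j t x * acc U i t x) := by
    refine (integrable_cut_mul (cR.sub (h.contA t)) hR0).add (integrable_sum_pd_cut_mul (fun j => ?_) hR0)
    exact ((h.smU j t).continuous.mul (h.jens.sm t).continuous).sub
        (continuous_finsetSum _ fun i _ => (h.smT i j t).continuous.mul (h.smA i t).continuous)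
  have i2 : Integrable fun x => cut R x * ∑ i, pd i (P t) x * tder U i t x :=
    integrable_cut_mul (continuous_finsetSum _ fun i _ => (cP i).mul (smD i).continuous) hR0
  have i3 : Integrable fun x => cut R x * ∑ i, pd i (P t) x * ∑ k, U k t x * pd k (U i t) x :=
    integrable_cut_mul (continuous_finsetSum _ fun i _ => (cP i).mul (cK i)) hR0
  have e : ∫ x, (cut R x * (remainder U H t x - vsq (acc U) t x - ∑ i, pd i (P t) x * acc U i t x) +
        ∑ j, pd j (cut R) x * (U j t x * enstrophy U H t x - ∑ i, tens U H i j t x * acc U i t x)) =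
      (∫ x, (cut R x * (remainder U H t x - vsq (acc U) t x) + ∑ j, pd j (cut R) x *
      (U j t x * enstrophy U H t x - ∑ i, tens U H i j t x * acc U i t x))) -
      (∫ x, cut R x * ∑ i, pd i (P t) x * tder U i t x) -
      ∫ x, cut R x * ∑ i, pd i (P t) x * ∑ k, U k t x * pd k (U i t) x := by
    have i12 : Integrable fun x => (cut R x * (remainder U H t x - vsq (acc U) t x) + ∑ j, pd j (cut R) x *
      (U j t x * enstrophy U H t x - ∑ i, tens U H i j t x * acc U i t x)) -
      cut R x * ∑ i, pd i (P t) x * tder U i t x := i1.sub i2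
    rw [← integral_sub i1 i2, ← integral_sub i12 i3]
    refine integral_congr_ae (ae_of_all _ fun x => ?_)
    simp only [tder_eq, Fin.sum_univ_two]; ring
  rw [e]
  have p' := (neg_abs_le _).trans' (neg_le_neg p)
  have q' := (neg_abs_le _).trans' (neg_le_neg q)
  have X := (h.int_tder ht').2
  have W := (h.int_vsq_sq ht').2
  have Q := (h.int_msq_sq ht').2
  have n0 := tot_vsq_nonneg U t
  have s0 := tot_msq_nonneg H t
  have G0 := tot_msq_nonneg (grad U) t
  have A0 := tot_vsq_nonneg (acc U) t
  have D0 := totSq_nonneg (msq (grad U)) t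
  have W0 := totSq_nonneg (vsq U) t
  have Q0 := totSq_nonneg (msq H) t
  have X0 := tot_vsq_nonneg (tder U) t
  change totSq (vsq U) t ≤ 64 * (tot (vsq U) t * tot (msq (grad U)) t) at W
  change totSq (msq H) t ≤ tot (msq H) t at Q
  change tot (vsq (tder U)) t ≤ 2 * tot (vsq (acc U)) t + 128 * (√(tot (vsq U) t * tot (msq (grad U)) t) *
    √(totSq (msq (grad U)) t)) at X
  have ps : pressSize U H t ^ 2 = 32 * totSq (msq H) t + 8 * totSq (vsq U) t := Real.sq_sqrt (by positivity)
  have ps0 := pressSize_nonneg U H t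
  have sX := Real.sq_sqrt X0
  set n := tot (vsq U) t
  set G := tot (msq (grad U)) t
  set A := tot (vsq (acc U)) t
  set d := √(totSq (msq (grad U)) t)
  have d0 : 0 ≤ d := Real.sqrt_nonneg _
  have nG : n * G ≤ G := mul_le_of_le_one_left G0 (by linarith)
  have sn : √n ≤ 1 := Real.sqrt_le_one.2 (by linarith)
  have sG : √(n * G) ≤ √G := Real.sqrt_le_sqrt nG
  have sG0 := Real.sqrt_nonneg G
  have sW : √(totSq (vsq U) t) ≤ 8 * √G := by
    rw [Real.sqrt_le_left (by positivity), mul_pow, Real.sq_sqrt G0]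
    linarith
  have b1 : pressSize U H t * √(tot (vsq (tder U)) t) ≤ 512 * (1 + G + A + d + √G * d) := by
    have : √(n * G) * d ≤ √G * d := mul_le_mul_of_nonneg_right sG d0
    have : 0 ≤ √G * d := by positivity
    nlinarith [sq_nonneg (pressSize U H t - √(tot (vsq (tder U)) t))]
  have b2 : √(totSq (vsq U) t) * d ≤ 8 * (√G * d) := by
    rw [← mul_assoc]; exact mul_le_mul_of_nonneg_right sW d0
  have gd : 0 ≤ √G * d := by positivity
  have b3 : √n * d + (4 * n + 6 * G + 4 * tot (msq H) t + 6 * A) ≤ 6 * (1 + G + A + d + √G * d) := by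
    have := mul_le_mul_of_nonneg_right sn d0
    linarith
  have b4 : n + totSq (vsq U) t ≤ 64 * (1 + G + A + d + √G * d) := by linarith
  have b5 : G + √(totSq (vsq U) t) * d ≤ 8 * (G + √G * d) := by linarith
  have r0 : 0 ≤ C / R := by positivity
  have r1 : 0 ≤ C' / R := by positivity
  have r2 : 0 ≤ C'' / R := by positivity
  have c1 := mul_le_mul_of_nonneg_left b3 r0
  have c2 := mul_le_mul_of_nonneg_left b1 r1
  have c3 := mul_le_mul_of_nonneg_left b4 r2
  have c4 := mul_le_mul_of_nonneg_left b5 hC''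
  have c5 : 32 * G + 8 * C'' * (G + √G * d) ≤ (32 + 6 * C + 512 * C' + 64 * C'') * (G + √G * d) := by
    have z1 : 0 ≤ (6 * C + 512 * C' + 56 * C'') * (G + √G * d) := by positivity
    linarith
  have c6 : 0 ≤ 32 / R * (1 + G + A + d + √G * d) := by positivity
  have c7 : (32 + 6 * C + 512 * C' + 64 * C'') / R = 32 / R + 6 * (C / R) + 512 * (C' / R) + 64 * (C'' / R) := by
    ring
  rw [c7]
  linarith

theorem integral_cut_enstrophy_le (h : VFlow T U H P) (ht : t ∈ Set.Icc 0 T) {R : ℝ} (hR : 0 < R) :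
    ∫ x, cut R x * enstrophy U H t x ≤ tot (msq (grad U)) t + 32 * tot (msq H) t := by
  have j : Integrable fun x => msq (grad U) t x + 32 * msq H t x := (h.iG t ht).add ((h.iH t ht).const_mul _)
  calc _ ≤ ∫ x, (msq (grad U) t x + 32 * msq H t x) := by
        refine integral_mono (integrable_cut_mul (h.jens.sm t).continuous hR) j fun x => ?_
        have w := (le_abs_self _).trans (h.abs_work_le ht x)
        have g0 := msq_nonneg (grad U) t x
        have h0 := msq_nonneg H t x
        have g1 := Real.sq_sqrt g0
        have h1 := Real.sq_sqrt h0
        have : enstrophy U H t x ≤ msq (grad U) t x + 32 * msq H t x := by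
          rw [enstrophy]
          nlinarith [sq_nonneg (√(msq (grad U) t x) - 8 * √(msq H t x))]
        exact (mul_le_mul_of_nonneg_left this (cut_nonneg R x)).trans
          (mul_le_of_le_one_left (by positivity) (cut_le_one R x))
    _ = _ := by rw [integral_add (h.iG t ht) ((h.iH t ht).const_mul _), integral_const_mul]; rfl

theorem le_integral_cut_enstrophy (h : VFlow T U H P) (ht : t ∈ Set.Icc 0 T) {R : ℝ} (hR : 0 < R) :
    4⁻¹ * (∫ x, cut R x * msq (grad U) t x) - 64 * tot (msq H) t ≤ ∫ x, cut R x * enstrophy U H t x := by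
  have i1 : Integrable fun x => cut R x * msq (grad U) t x := integrable_cut_mul (h.contG t) hR
  rw [tot, ← integral_const_mul, ← integral_const_mul,
    ← integral_sub (i1.const_mul _) ((h.iH t ht).const_mul _)]
  refine integral_mono ((i1.const_mul _).sub ((h.iH t ht).const_mul _))
    (integrable_cut_mul (h.jens.sm t).continuous hR) fun x => ?_
  have w := (neg_abs_le _).trans' (neg_le_neg (h.abs_work_le ht x))
  have g0 := msq_nonneg (grad U) t x
  have h0 := msq_nonneg H t x
  have g1 := Real.sq_sqrt g0
  have h1 := Real.sq_sqrt h0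
  have c0 := cut_nonneg R x
  have b : 4⁻¹ * msq (grad U) t x - 64 * msq H t x ≤ enstrophy U H t x := by
    rw [enstrophy]
    nlinarith [sq_nonneg (√(msq (grad U) t x) - 16 * √(msq H t x))]
  have b' := mul_le_mul_of_nonneg_left b c0
  have b'' := mul_le_of_le_one_left (by positivity : 0 ≤ 64 * msq H t x) (cut_le_one R x)
  change 4⁻¹ * (cut R x * msq (grad U) t x) - 64 * msq H t x ≤ cut R x * enstrophy U H t x
  linarith

end VFlow

theorem sg_nonneg {t : ℝ} (ht : 0 ≤ t) : 0 ≤ sg t := le_min zero_le_one ht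

theorem sg_le_one (t : ℝ) : sg t ≤ 1 := min_le_left _ _

theorem continuous_sg : Continuous sg := continuous_const.min continuous_id

theorem le_mul_sg {t T : ℝ} (ht : t ∈ Set.Ioc 0 T) : t ≤ (1 + T) * sg t := by
  rcases le_total t 1 with h | h
  · rw [sg, min_eq_right h]; nlinarith [ht.1, ht.2]
  · rw [sg, min_eq_left h]; linarith [ht.2]

theorem exists_hasDerivWithinAt_sg (t : ℝ) :
    ∃ s ∈ Set.Icc (0:ℝ) 1, HasDerivWithinAt sg s (Set.Ioi t) t := by
  rcases lt_or_ge t 1 with h | h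
  · refine ⟨1, by simp, HasDerivAt.hasDerivWithinAt ((hasDerivAt_id t).congr_of_eventuallyEq ?_)⟩
    filter_upwards [Iio_mem_nhds h] with s hs
    exact min_eq_right (le_of_lt hs)
  · refine ⟨0, by simp, (hasDerivWithinAt_const t _ (1:ℝ)).congr (fun s hs => ?_) (min_eq_left h)⟩
    exact min_eq_left (h.trans (le_of_lt hs))

namespace VFlow

variable {T : ℝ} {U : Fin 2 → ℝ → V → ℝ} {H : Fin 2 → Fin 2 → ℝ → V → ℝ} {P : ℝ → V → ℝ}

theorem energy_le_of_weighted (h : VFlow T U H P) (hT : 0 < T)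
    (iA : IntegrableOn (fun t => sg t * tot (vsq (acc U)) t) (Set.Ioc 0 T))
    (iD : IntegrableOn (fun t => sg t ^ 2 * totSq (msq (grad U)) t) (Set.Ioc 0 T)) :
    (∀ t ∈ Set.Icc 0 T, tot (vsq U) t + tot (msq H) t ≤ tot (vsq U) 0 + tot (msq H) 0) ∧
      ∀ t ∈ Set.Icc 0 T, IntegrableOn (tot (msq (grad U))) (Set.Ioc 0 t) ∧
        ∫ s in Set.Ioc 0 t, tot (msq (grad U)) s ≤ tot (vsq U) 0 + tot (msq H) 0 := by
  have h1 : IntegrableOn (fun t => t * tot (vsq (acc U)) t) (Set.Ioc 0 T) := by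
    refine (iA.const_mul (1 + T)).mono' (measurable_id.mul h.measurable_totA).aestronglyMeasurable
      ((ae_restrict_iff' measurableSet_Ioc).2 (ae_of_all _ fun t ht => ?_))
    have a0 := tot_vsq_nonneg (acc U) t
    rw [Real.norm_eq_abs, abs_of_nonneg (mul_nonneg ht.1.le a0), ← mul_assoc]
    exact mul_le_mul_of_nonneg_right (le_mul_sg ht) a0
  have h2 : IntegrableOn (fun t => t ^ 2 * totSq (msq (grad U)) t) (Set.Ioc 0 T) := by
    refine (iD.const_mul ((1 + T) ^ 2)).mono'
      ((measurable_id.pow_const 2).mul h.measurable_totSqG).aestronglyMeasurable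
      ((ae_restrict_iff' measurableSet_Ioc).2 (ae_of_all _ fun t ht => ?_))
    have a0 := totSq_nonneg (msq (grad U)) t
    rw [Real.norm_eq_abs, abs_of_nonneg (mul_nonneg (sq_nonneg t) a0), ← mul_assoc, ← mul_pow]
    exact mul_le_mul_of_nonneg_right (pow_le_pow_left₀ ht.1.le (le_mul_sg ht) 2) a0
  obtain ⟨N, hN, iN⟩ := h.exists_rate hT h1 h2
  exact h.energy_le hN iN

/-- The time-weighted estimate for the velocity gradient and the material acceleration. -/
theorem exists_weighted_bound : ∃ C : ℝ, 0 ≤ C ∧ ∀ (T : ℝ) (U : Fin 2 → ℝ → V → ℝ)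
    (H : Fin 2 → Fin 2 → ℝ → V → ℝ) (P : ℝ → V → ℝ), VFlow T U H P → 0 < T →
    tot (vsq U) 0 + tot (msq H) 0 ≤ 1 →
    IntegrableOn (fun t => sg t * tot (vsq (acc U)) t) (Set.Ioc 0 T) →
    IntegrableOn (fun t => sg t ^ 2 * totSq (msq (grad U)) t) (Set.Ioc 0 T) →
    (∀ t ∈ Set.Icc 0 T, sg t * tot (msq (grad U)) t ≤ C * (tot (vsq U) 0 + tot (msq H) 0 +
      ∫ s in Set.Ioc 0 T, sg s ^ 2 * totSq (msq (grad U)) s)) ∧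
    ∫ t in Set.Ioc 0 T, sg t * tot (vsq (acc U)) t ≤ C * (tot (vsq U) 0 + tot (msq H) 0 +
      ∫ s in Set.Ioc 0 T, sg s ^ 2 * totSq (msq (grad U)) s) := by
  obtain ⟨C, hC, hb⟩ := exists_enstrophy_dt_bound
  refine ⟨4 * (97 + 2 * C), by positivity, fun T U H P h hT he iA iD => ?_⟩
  obtain ⟨hE, hG⟩ := h.energy_le_of_weighted hT iA iD
  set e := tot (vsq U) 0 + tot (msq H) 0 with hedef
  have e0 : 0 ≤ e := add_nonneg (tot_vsq_nonneg _ _) (tot_msq_nonneg _ _)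
  set I := ∫ s in Set.Ioc 0 T, sg s ^ 2 * totSq (msq (grad U)) s with hI
  have D0 : ∀ s, 0 ≤ sg s ^ 2 * totSq (msq (grad U)) s := fun s =>
    mul_nonneg (sq_nonneg _) (totSq_nonneg _ _)
  have I0 : 0 ≤ I := integral_nonneg D0
  have H0 : ∀ t ∈ Set.Icc 0 T, tot (msq H) t ≤ e := fun t ht => by
    linarith [hE t ht, tot_vsq_nonneg U t]
  have iG : IntegrableOn (tot (msq (grad U))) (Set.Ioc 0 T) := (hG T ⟨hT.le, le_rfl⟩).1
  set k : ℝ → ℝ := fun s => 2 + 2 * tot (msq (grad U)) s + sg s * tot (vsq (acc U)) s +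
    2 * (sg s ^ 2 * totSq (msq (grad U)) s) with hk
  have ik : IntegrableOn k (Set.Ioc 0 T) :=
    (((integrableOn_const (by simp) (by simp)).add (iG.const_mul _)).add iA).add (iD.const_mul _)
  have k0 : ∀ s ∈ Set.Ioc 0 T, 0 ≤ k s := fun s hs => by
    have := tot_msq_nonneg (grad U) s
    have := mul_nonneg (sg_nonneg hs.1.le) (tot_vsq_nonneg (acc U) s)
    have := D0 s
    simp only [hk]; linarith
  set K := ∫ s in Set.Ioc 0 T, k s with hK
  have key : ∀ t ∈ Set.Icc 0 T, ∀ n : ℕ, 4⁻¹ * (sg t * ∫ x, cut (rad n) x * msq (grad U) t x) +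
      ∫ s in Set.Ioc 0 t, sg s * ∫ x, cut (rad n) x * vsq (acc U) s x ≤
      (97 + 2 * C) * (e + I) + C * K / rad n := by
    intro t ht n
    have hR := one_le_rad n
    set R := rad n
    have hR0 : 0 < R := by linarith
    have hsub : Set.Ioc 0 t ⊆ Set.Ioc 0 T := Set.Ioc_subset_Ioc_right ht.2
    have cA : Continuous fun s => sg s * ∫ x, cut R x * vsq (acc U) s x :=
      continuous_sg.mul (continuous_integral_cut h.jA hR0)
    have nA : IntegrableOn (fun s => -(sg s * ∫ x, cut R x * vsq (acc U) s x)) (Set.Ioc 0 t) :=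
      cA.neg.integrableOn_Ioc
    have nG : IntegrableOn (fun s => (1 + 2 * C) * tot (msq (grad U)) s) (Set.Ioc 0 t) :=
      (iG.mono_set hsub).const_mul _
    have nD : IntegrableOn (fun s => C * (sg s ^ 2 * totSq (msq (grad U)) s)) (Set.Ioc 0 t) :=
      (iD.mono_set hsub).const_mul _
    have nk : IntegrableOn (fun s => C / R * k s) (Set.Ioc 0 t) := (ik.mono_set hsub).const_mul _
    have n2 : IntegrableOn (fun s => -(sg s * ∫ x, cut R x * vsq (acc U) s x) +
      (1 + 2 * C) * tot (msq (grad U)) s) (Set.Ioc 0 t) := nA.add nG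
    have n3 : IntegrableOn (fun s => -(sg s * ∫ x, cut R x * vsq (acc U) s x) +
      (1 + 2 * C) * tot (msq (grad U)) s + C * (sg s ^ 2 * totSq (msq (grad U)) s)) (Set.Ioc 0 t) := n2.add nD
    have n4 : IntegrableOn (fun s => -(sg s * ∫ x, cut R x * vsq (acc U) s x) +
      (1 + 2 * C) * tot (msq (grad U)) s + C * (sg s ^ 2 * totSq (msq (grad U)) s) + C / R * k s)
      (Set.Ioc 0 t) := n3.add nk
    choose s' hs' hd using exists_hasDerivWithinAt_sg
    have step : sg t * ((∫ x, cut R x * enstrophy U H t x) - 32 * e) -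
        sg 0 * ((∫ x, cut R x * enstrophy U H 0 x) - 32 * e) ≤
        ∫ s in Set.Ioc 0 t, (-(sg s * ∫ x, cut R x * vsq (acc U) s x) +
      (1 + 2 * C) * tot (msq (grad U)) s + C * (sg s ^ 2 * totSq (msq (grad U)) s) + C / R * k s) := by
      refine sub_le_setIntegral (y := fun t => sg t * ((∫ x, cut R x * enstrophy U H t x) - 32 * e)) ht.1
        (continuous_sg.mul ((continuous_integral_cut h.jens hR0).sub continuous_const)).continuousOn
        (fun r _ => (hd r).mul ((JS.hasDerivAt_integral_compact h.jens (sm_cut R) (cut_compact hR0)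
          r).hasDerivWithinAt.sub_const _)) n4 fun r hr => ?_
      have hr' : r ∈ Set.Ioo 0 T := ⟨hr.1, hr.2.trans_le ht.2⟩
      have hr'' : r ∈ Set.Icc 0 T := ⟨hr'.1.le, hr'.2.le⟩
      have b1 := hb T U H P h r hr' ((hE r hr'').trans he) R hR
      have b2 := h.integral_cut_enstrophy_le hr'' hR0
      have b3 := H0 r hr''
      have G0 := tot_msq_nonneg (grad U) r
      have Dn := totSq_nonneg (msq (grad U)) r
      have σ0 := sg_nonneg hr.1.le
      have σ1 := sg_le_one r
      obtain ⟨p0, p1⟩ := hs' r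
      have c1 : s' r * ((∫ x, cut R x * enstrophy U H r x) - 32 * e) ≤ tot (msq (grad U)) r := by
        have : s' r * ((∫ x, cut R x * enstrophy U H r x) - 32 * e) ≤ s' r * tot (msq (grad U)) r :=
          mul_le_mul_of_nonneg_left (by linarith) p0
        exact this.trans (mul_le_of_le_one_left G0 p1)
      have c2 := mul_le_mul_of_nonneg_left b1 σ0
      have q1 := Real.sq_sqrt G0
      have q2 := Real.sq_sqrt Dn
      simp only [hk]
      set g := √(tot (msq (grad U)) r)
      set d := √(totSq (msq (grad U)) r)
      set A := tot (vsq (acc U)) r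
      set Y := ∫ x, cut R x * dt (enstrophy U H) r x
      set Z := ∫ x, cut R x * vsq (acc U) r x
      rw [← q1] at c1 c2 ⊢
      rw [← q2]
      have c3 : sg r * (g * d) ≤ g ^ 2 + sg r ^ 2 * d ^ 2 := by
        nlinarith [sq_nonneg (g - sg r * d), sq_nonneg g, sq_nonneg (sg r * d)]
      have c4 : sg r * d ≤ 1 + sg r ^ 2 * d ^ 2 := by
        nlinarith [sq_nonneg (1 - sg r * d), sq_nonneg (sg r * d)]
      have c5 : sg r * g ^ 2 ≤ g ^ 2 := mul_le_of_le_one_left (sq_nonneg g) σ1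
      have c6 : C * (sg r * (g ^ 2 + g * d)) ≤ C * (2 * g ^ 2 + sg r ^ 2 * d ^ 2) :=
        mul_le_mul_of_nonneg_left (by linarith) hC
      have c7 : C / R * (sg r * (1 + g ^ 2 + A + d + g * d)) ≤
          C / R * (2 + 2 * g ^ 2 + sg r * A + 2 * (sg r ^ 2 * d ^ 2)) :=
        mul_le_mul_of_nonneg_left (by linarith) (by positivity)
      linear_combination c1 + c2 + c6 + c7
    rw [integral_add n3 nk, integral_add n2 nD, integral_add nA nG, integral_neg, integral_const_mul,
      integral_const_mul, integral_const_mul] at step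
    have z0 : sg 0 = 0 := by simp [sg]
    rw [z0, zero_mul, sub_zero] at step
    have m1 : ∫ s in Set.Ioc 0 t, sg s ^ 2 * totSq (msq (grad U)) s ≤ I :=
      setIntegral_mono_set iD (ae_of_all _ D0) hsub.eventuallyLE
    have m2 : ∫ s in Set.Ioc 0 t, k s ≤ K :=
      setIntegral_mono_set ik ((ae_restrict_iff' measurableSet_Ioc).2 (ae_of_all _ k0)) hsub.eventuallyLE
    have m3 := mul_le_mul_of_nonneg_left m1 hC
    have m4 := mul_le_mul_of_nonneg_left m2 (by positivity : 0 ≤ C / R)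
    have m5 := mul_le_mul_of_nonneg_left (hG t ht).2 (by positivity : 0 ≤ 1 + 2 * C)
    have m6 := mul_le_mul_of_nonneg_left (h.le_integral_cut_enstrophy ht hR0) (sg_nonneg ht.1)
    have m7 : sg t * (tot (msq H) t) ≤ e :=
      (mul_le_of_le_one_left (tot_msq_nonneg _ _) (sg_le_one t)).trans (H0 t ht)
    have m8 : sg t * e ≤ e := mul_le_of_le_one_left e0 (sg_le_one t)
    have m9 := mul_nonneg hC I0
    rw [mul_div_right_comm]
    linarith
  have lim : Tendsto (fun n => (97 + 2 * C) * (e + I) + C * K / rad n) atTop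
      (nhds ((97 + 2 * C) * (e + I) + 0)) := tendsto_const_nhds.add (tendsto_const_div_rad _)
  rw [add_zero] at lim
  have Y0 : ∀ n, ∀ s ∈ Set.Ici (0:ℝ), 0 ≤ sg s * ∫ x, cut (rad n) x * vsq (acc U) s x := fun n s hs =>
    mul_nonneg (sg_nonneg hs) (integral_cut_nonneg (vsq_nonneg (acc U) s) _)
  refine ⟨fun t ht => ?_, ?_⟩
  · have := le_of_tendsto_of_tendsto' (((tendsto_integral_cut_mul (h.iG t ht)).const_mul (sg t)).const_mul 4⁻¹)
      lim fun n => by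
        have : 0 ≤ ∫ s in Set.Ioc 0 t, sg s * ∫ x, cut (rad n) x * vsq (acc U) s x :=
          setIntegral_nonneg measurableSet_Ioc fun s hs => Y0 n s hs.1.le
        linarith [key t ht n]
    change 4⁻¹ * (sg t * tot (msq (grad U)) t) ≤ _ at this
    linarith
  · have := (integrable_of_tendsto (μ := volume.restrict (Set.Ioc 0 T))
      (F := fun n s => sg s * ∫ x, cut (rad n) x * vsq (acc U) s x)
      (fun n => (continuous_sg.mul (continuous_integral_cut h.jA (rad_pos n))).integrableOn_Ioc)
      (fun n => (ae_restrict_iff' measurableSet_Ioc).2 (ae_of_all _ fun s hs => Y0 n s hs.1.le))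
      (continuous_sg.measurable.mul h.measurable_totA).aestronglyMeasurable
      ((ae_restrict_iff' measurableSet_Ioc).2 (ae_of_all _ fun s hs =>
        (tendsto_integral_cut_mul (h.iA s ⟨hs.1.le, hs.2⟩)).const_mul (sg s))) (fun n => by
        have := mul_nonneg (sg_nonneg hT.le) (integral_cut_nonneg (msq_nonneg (grad U) T) (rad n))
        linarith [key T ⟨hT.le, le_rfl⟩ n]) lim).2
    change ∫ s in Set.Ioc 0 T, sg s * tot (vsq (acc U)) s ≤ _ at this
    have := mul_nonneg (by positivity : 0 ≤ 97 + 2 * C) (add_nonneg e0 I0)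
    linarith

end VFlow

theorem IsSolution.vflow {u : ℝ → V → V} {F : ℝ → V → M2} {P : ℝ → V → ℝ} {T : ℝ}
    (su : ContDiff ℝ (⊤ : ℕ∞) (Function.uncurry u)) (sF : ContDiff ℝ (⊤ : ℕ∞) (Function.uncurry F))
    (sP : ContDiff ℝ (⊤ : ℕ∞) (Function.uncurry P)) (h : IsSolution u F P T)
    (hdiv : ∀ t ∈ Set.Icc (0:ℝ) T, ∀ (x : V) (j : Fin 2), ∑ i, pd i (fun y => F t y i j) x = 0)
    (hs : ∀ t ∈ Set.Icc (0:ℝ) T, ∀ x : V, nsq (F t x - idM) ≤ 1/4)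
    (hi : ∀ t ∈ Set.Icc (0:ℝ) T,
      Integrable (fun x : V => vnsq (u t x)) ∧
      Integrable (fun x : V => nsq (F t x - idM)) ∧
      Integrable (fun x : V => nsq (gradU (u t) x)) ∧
      Integrable (fun x : V => vnsq (mdot u t x)) ∧
      Integrable (fun x : V => (nsq (gradU (u t) x)) ^ 2)) :
    VFlow T (fun i t x => u t x i) (fun i j t x => F t x i j - idM i j) P := by
  have jU : ∀ i, JS fun t x => u t x i := fun i => contDiff_pi.1 su i
  have jF : ∀ i j, JS fun t x => F t x i j := fun i j => contDiff_pi.1 (contDiff_pi.1 sF i) j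
  have dF : ∀ i j t, Differentiable ℝ fun y => F t y i j := fun i j t => ((jF i j).sm t).diff
  have pdH : ∀ k i j t, pd k (fun y => F t y i j - idM i j) = pd k fun y => F t y i j := fun k i j t => by
    funext x
    rw [pd, fderiv_sub_const, pd]
  have jH : ∀ i j, JS fun t x => F t x i j - idM i j := fun i j => (jF i j).sub (JS.const _)
  refine ⟨jU, jH, sP, fun t ht x i => ?_, fun t ht x i j => ?_,
    h.2.2, fun t ht x j => ?_, hs, fun t ht => (hi t ht).1, fun t ht => (hi t ht).2.1,
    fun t ht => (hi t ht).2.2.1, fun t ht => (hi t ht).2.2.2.1, fun t ht => (hi t ht).2.2.2.2⟩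
  · have e := h.1 t ht x i
    have d := hdiv t ht x i
    have q : ∀ j, tens (fun i t x => u t x i) (fun i j t x => F t x i j - idM i j) i j t = fun x =>
        (pd j (fun y => u t y i) x + ∑ k, F t x i k * F t x j k) - F t x j i := fun j => by
      funext y
      fin_cases i <;> fin_cases j <;> simp [tens, stress, idM] <;> ring
    have sp : ∀ j, pd j (tens (fun i t x => u t x i) (fun i j t x => F t x i j - idM i j) i j t) x =
        pd j (pd j fun y => u t y i) x + pd j (fun y => ∑ k, F t y i k * F t y j k) x -
          pd j (fun y => F t y j i) x := fun j => by
      have s1 : Differentiable ℝ (pd j fun y => u t y i) := (((jU i).sm t).pd j).diff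
      have s2 : Differentiable ℝ fun y => ∑ k, F t y i k * F t y j k :=
        Differentiable.fun_sum fun k _ => (dF i k t).mul (dF j k t)
      have s3 : Differentiable ℝ fun x => pd j (fun y => u t y i) x + ∑ k, F t x i k * F t x j k := s1.add s2
      rw [q, pd_sub j s3 (dF j i t), pd_add j s1 s2]
    change _ + _ + _ = _
    simp only [sp, Finset.sum_sub_distrib, Finset.sum_add_distrib, d]
    rw [← e, lap]
    simp only [dt]
    ring
  · have e := h.2.1 t ht x i j
    have q : dt (fun t x => F t x i j - idM i j) t x = deriv (fun s => F s x i j) t := by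
      rw [dt, deriv_sub_const]
    rw [matd, q]
    change _ + ∑ k, u t x k * pd k (fun y => F t y i j - idM i j) x = _
    simp only [pdH, e]
    simp only [mul_sub, Finset.sum_sub_distrib, idM]
    simp
  · simp only [pdH]
    exact hdiv t ht x j

theorem vnsq_nonneg (v : V) : 0 ≤ vnsq v := Finset.sum_nonneg fun _ _ => sq_nonneg _

theorem nsq_nonneg (A : M2) : 0 ≤ nsq A :=
  Finset.sum_nonneg fun _ _ => Finset.sum_nonneg fun _ _ => sq_nonneg _

theorem integral_add_integral_le_eps0 {u0 : V → V} {F0 : V → M2} (hu : Integrable fun x => vnsq (u0 x))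
    (hF : Integrable fun x => nsq (F0 x - idM))
    (hw : Integrable fun x => (nsq (F0 x - idM) + vnsq (u0 x)) * (1 + vnsq x)) :
    (∫ x, vnsq (u0 x)) + ∫ x, nsq (F0 x - idM) ≤ eps0 u0 F0 := by
  have s : 0 ≤ ⨆ x, nsq (F0 x - idM) := Real.iSup_nonneg fun x => nsq_nonneg _
  rw [← integral_add hu hF, eps0]
  have : ∫ x, (vnsq (u0 x) + nsq (F0 x - idM)) ≤ ∫ x, (nsq (F0 x - idM) + vnsq (u0 x)) * (1 + vnsq x) :=
    integral_mono (hu.add hF) hw fun x => by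
      have a := add_nonneg (nsq_nonneg (F0 x - idM)) (vnsq_nonneg (u0 x))
      have b := mul_nonneg a (vnsq_nonneg x)
      simp only
      linarith
  linarith

/-- Step Two of Lemma 2.1: there is a universal constant `M` with
`sup_{0≤t≤T} σ(t)∫|∇u|²dx + ∫₀ᵀ∫σ(t)|u̇|²dxdt ≤ M(ε₀ + ∫₀ᵀ∫σ(t)²|∇u|⁴dxdt)`. -/
theorem statement_3 :
    ∃ M : ℝ, 0 < M ∧
      ∀ (u : ℝ → V → V) (F : ℝ → V → M2) (P : ℝ → V → ℝ) (T : ℝ),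
        0 ≤ T →
        ContDiff ℝ (⊤ : ℕ∞) (Function.uncurry u) →
        ContDiff ℝ (⊤ : ℕ∞) (Function.uncurry F) →
        ContDiff ℝ (⊤ : ℕ∞) (Function.uncurry P) →
        IsSolution u F P T →
        (∀ t ∈ Set.Icc (0:ℝ) T, ∀ (x : V) (j : Fin 2),
          ∑ i, pd i (fun y => F t y i j) x = 0) →
        (∀ t ∈ Set.Icc (0:ℝ) T, ∀ x : V, Matrix.det (Matrix.of (F t x)) = 1) →
        (∀ t ∈ Set.Icc (0:ℝ) T, ∀ x : V, nsq (F t x - idM) ≤ 1/4) →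
        (∀ t ∈ Set.Icc (0:ℝ) T,
          Integrable (fun x : V => vnsq (u t x)) ∧
          Integrable (fun x : V => nsq (F t x - idM)) ∧
          Integrable (fun x : V => nsq (gradU (u t) x)) ∧
          Integrable (fun x : V => vnsq (mdot u t x)) ∧
          Integrable (fun x : V => (nsq (gradU (u t) x)) ^ 2)) →
        IntegrableOn (fun t => ∫ x : V, sg t * vnsq (mdot u t x)) (Set.Ioc (0:ℝ) T) →
        IntegrableOn (fun t => ∫ x : V, (sg t) ^ 2 * (nsq (gradU (u t) x)) ^ 2)
          (Set.Ioc (0:ℝ) T) →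
        Integrable (fun x : V =>
          (nsq (F 0 x - idM) + vnsq (u 0 x)) * (1 + vnsq x)) →
        eps0 (u 0) (F 0) ≤ 1 →
        (⨆ t ∈ Set.Icc (0:ℝ) T, sg t * ∫ x : V, nsq (gradU (u t) x))
            + (∫ t in Set.Ioc (0:ℝ) T, ∫ x : V, sg t * vnsq (mdot u t x))
          ≤ M * (eps0 (u 0) (F 0) +
              ∫ t in Set.Ioc (0:ℝ) T, ∫ x : V,
                (sg t) ^ 2 * (nsq (gradU (u t) x)) ^ 2) := by
  obtain ⟨C, hC, hb⟩ := VFlow.exists_weighted_bound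
  refine ⟨2 * C + 1, by linarith, fun u F P T hT su sF sP h hdiv _ hs hi iA iD hw he => ?_⟩
  have hV := h.vflow su sF sP hdiv hs hi
  have h0 : (0:ℝ) ∈ Set.Icc 0 T := ⟨le_rfl, hT⟩
  have e1 := integral_add_integral_le_eps0 (hi 0 h0).1 (hi 0 h0).2.1 hw
  have e0 : 0 ≤ eps0 (u 0) (F 0) :=
    (add_nonneg (integral_nonneg fun x => vnsq_nonneg _) (integral_nonneg fun x => nsq_nonneg _)).trans e1
  simp only [integral_const_mul] at iA iD ⊢
  set I := ∫ t in Set.Ioc (0:ℝ) T, sg t ^ 2 * ∫ x, nsq (gradU (u t) x) ^ 2 with hI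
  have I0 : 0 ≤ I := integral_nonneg fun t => mul_nonneg (sq_nonneg _) (integral_nonneg fun x => sq_nonneg _)
  have eI : 0 ≤ C * (eps0 (u 0) (F 0) + I) := mul_nonneg hC (add_nonneg e0 I0)
  have key : (∀ t ∈ Set.Icc 0 T, sg t * ∫ x, nsq (gradU (u t) x) ≤ C * (eps0 (u 0) (F 0) + I)) ∧
      ∫ t in Set.Ioc 0 T, sg t * ∫ x, vnsq (mdot u t x) ≤ C * (eps0 (u 0) (F 0) + I) := by
    rcases hT.eq_or_lt with rfl | hT
    · refine ⟨fun t ht => ?_, by simpa using eI⟩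
      obtain rfl : t = 0 := le_antisymm ht.2 ht.1
      simpa [sg] using eI
    · obtain ⟨k1, k2⟩ := hb T _ _ P hV hT (e1.trans he) iA iD
      have m := mul_le_mul_of_nonneg_left (add_le_add_left e1 I) hC
      exact ⟨fun t ht => (k1 t ht).trans m, k2.trans m⟩
  have := Real.iSup_le (fun t => Real.iSup_le (key.1 t) eI) eI
  linarith [key.2]
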